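/- For every d ≥ 2, the set of Ω-stable rational maps of the Riemann sphere of degree d is open and dense in the space of all rational maps of degree d. -/

import Mathlib

open Filter Topology Polynomial Set OnePoint
open scoped Classical

noncomputable section

/-- The Riemann sphere, as the one-point compactification of `ℂ`. -/
abbrev Sphere := OnePoint ℂ

/-- The finite part of a point of the sphere (junk value `0` at `∞`). -/
def toC : Sphere → ℂ := Function.extend (fun z : ℂ => (z : Sphere)) id fun _ => 0

/-- The rational map on the Riemann sphere induced by a pair of polynomials `p/q`. -/
def ratEval (p q : ℂ[X]) : Sphere → Sphere := fun x =>
  if x = ∞ then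
    (if q.degree < p.degree then ∞
     else if p.degree < q.degree then ((0 : ℂ) : Sphere)
     else ((p.leadingCoeff / q.leadingCoeff : ℂ) : Sphere))
  else
    (if q.eval (toC x) = 0 then ∞
     else ((p.eval (toC x) / q.eval (toC x) : ℂ) : Sphere))

/-- The polynomial with coefficients `a 0, …, a d`. -/
def polyOf {d : ℕ} (a : Fin (d + 1) → ℂ) : ℂ[X] :=
  ∑ i : Fin (d + 1), C (a i) * X ^ (i : ℕ)

/-- The space of rational maps of degree `d`, parametrized by the pairs of coefficient
vectors of two coprime polynomials whose maximal degree is `d`, with the topology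
induced by the (finite-dimensional) coefficient space. -/
def RatSpace (d : ℕ) : Type :=
  {c : (Fin (d + 1) → ℂ) × (Fin (d + 1) → ℂ) //
    IsCoprime (polyOf c.1) (polyOf c.2) ∧
    max (polyOf c.1).natDegree (polyOf c.2).natDegree = d}

instance (d : ℕ) : TopologicalSpace (RatSpace d) :=
  instTopologicalSpaceSubtype

/-- The self-map of the Riemann sphere induced by an element of `RatSpace d`. -/
def RatSpace.toFun {d : ℕ} (F : RatSpace d) : Sphere → Sphere :=
  ratEval (polyOf F.1.1) (polyOf F.1.2)

/-- The non-wandering set of a self-map of the sphere. -/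
def nonWandering (f : Sphere → Sphere) : Set Sphere :=
  {x | ∀ U ∈ 𝓝 x, ∃ n : ℕ, 1 ≤ n ∧ (f^[n] '' U ∩ U).Nonempty}

/-- A rational map `F` of degree `d` is Ω-stable if every sufficiently close rational
map `G` of degree `d` has its restriction to its non-wandering set topologically
conjugate to that of `F`. -/
def OmegaStable {d : ℕ} (F : RatSpace d) : Prop :=
  ∃ U ∈ 𝓝 F, ∀ G ∈ U,
    ∃ h hinv : Sphere → Sphere,
      ContinuousOn h (nonWandering F.toFun) ∧
      h '' nonWandering F.toFun = nonWandering (RatSpace.toFun G) ∧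
      ContinuousOn hinv (nonWandering (RatSpace.toFun G)) ∧
      (∀ x ∈ nonWandering F.toFun, hinv (h x) = x) ∧
      (∀ y ∈ nonWandering (RatSpace.toFun G), h (hinv y) = y) ∧
      (∀ x ∈ nonWandering F.toFun, h (F.toFun x) = (RatSpace.toFun G) (h x))

instance (priority := 3000) prodNormedSpaceComplex {E F : Type*} [NormedAddCommGroup E]
    [NormedAddCommGroup F] [NormedSpace ℂ E] [NormedSpace ℂ F] : NormedSpace ℂ (E × F) :=
  Prod.normedSpace

instance (priority := 3000) normedSpaceComplexSelf : NormedSpace ℂ ℂ :=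
  NormedField.toNormedSpace

/-! ### Bloch's and Schottky's theorems -/

lemma exists_log_on_ball {c : ℂ} {R : ℝ} {φ : ℂ → ℂ}
    (hφ : DifferentiableOn ℂ φ (Metric.ball c R)) (h0 : ∀ z ∈ Metric.ball c R, φ z ≠ 0)
    {z₀ : ℂ} (hz₀ : z₀ ∈ Metric.ball c R) :
    ∃ L : ℂ → ℂ, DifferentiableOn ℂ L (Metric.ball c R) ∧
      (∀ z ∈ Metric.ball c R, Complex.exp (L z) = φ z) ∧ L z₀ = Complex.log (φ z₀) := by
  have hd : DifferentiableOn ℂ (deriv φ) (Metric.ball c R) := hφ.deriv Metric.isOpen_ball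
  obtain ⟨P, hP⟩ := (hd.div hφ h0).isExactOn_ball
  set L : ℂ → ℂ := fun z => P z - P z₀ + Complex.log (φ z₀)
  have hL : ∀ z ∈ Metric.ball c R, HasDerivAt L (deriv φ z / φ z) z := fun z hz =>
    ((hP z hz).sub_const _).add_const _
  refine ⟨L, fun z hz => (hL z hz).differentiableAt.differentiableWithinAt, ?_, by simp [L]⟩
  have hder : ∀ z ∈ Metric.ball c R,
      HasDerivAt (fun z => φ z * Complex.exp (-L z)) 0 z := by
    intro z hz
    have h1 := (hφ.differentiableAt (Metric.isOpen_ball.mem_nhds hz)).hasDerivAt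
    have h2 := h1.mul ((hL z hz).neg.cexp)
    refine h2.congr_deriv ?_
    have h3 : φ z * (deriv φ z / φ z) = deriv φ z := mul_div_cancel₀ _ (h0 z hz)
    linear_combination -Complex.exp (-L z) * h3
  intro z hz
  have hconst : φ z * Complex.exp (-L z) = φ z₀ * Complex.exp (-L z₀) := by
    have := (convex_ball c R).norm_image_sub_le_of_norm_hasDerivWithin_le (C := 0)
      (fun w hw => (hder w hw).hasDerivWithinAt) (by simp) hz₀ hz
    simpa [sub_eq_zero] using this
  have h1 : φ z₀ * Complex.exp (-L z₀) = 1 := by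
    simp only [L, sub_self, zero_add, Complex.exp_neg, Complex.exp_log (h0 z₀ hz₀)]
    exact mul_inv_cancel₀ (h0 z₀ hz₀)
  rw [h1, Complex.exp_neg] at hconst
  field_simp at hconst
  exact hconst.symm

lemma ball_subset_image_of_norm_deriv_le {g : ℂ → ℂ} {z₀ : ℂ} {ρ : ℝ} (hρ : 0 < ρ)
    (hg : DifferentiableOn ℂ g (Metric.ball z₀ ρ)) (hm : deriv g z₀ ≠ 0)
    (hb : ∀ z ∈ Metric.ball z₀ ρ, ‖deriv g z‖ ≤ 2 * ‖deriv g z₀‖) :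
    Metric.ball (g z₀) (‖deriv g z₀‖ * ρ / 24) ⊆ g '' Metric.ball z₀ ρ := by
  set m := ‖deriv g z₀‖ with hmdef
  have hmpos : 0 < m := norm_pos_iff.2 hm
  have hdd : DifferentiableOn ℂ (deriv g) (Metric.ball z₀ ρ) := hg.deriv Metric.isOpen_ball
  have hsub : Metric.closedBall z₀ (ρ / 6) ⊆ Metric.ball z₀ ρ :=
    Metric.closedBall_subset_ball (by linarith)
  have hS : ∀ z ∈ Metric.closedBall z₀ (ρ / 6), ‖deriv g z - deriv g z₀‖ ≤ m / 2 := by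
    intro z hz
    have := Complex.dist_le_div_mul_dist_of_mapsTo_ball (R₂ := 3 * m) hdd (by
      intro w hw
      rw [Metric.mem_closedBall, dist_eq_norm]
      calc _ ≤ ‖deriv g w‖ + ‖deriv g z₀‖ := norm_sub_le _ _
        _ ≤ 3 * m := by linarith [hb w hw]) (hsub hz)
    rw [dist_eq_norm] at this
    refine this.trans ?_
    calc 3 * m / ρ * dist z z₀ ≤ 3 * m / ρ * (ρ / 6) := by
          gcongr; exact hz
      _ = m / 2 := by field_simp; norm_num
  have hC : DiffContOnCl ℂ g (Metric.ball z₀ (ρ / 6)) := by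
    apply DifferentiableOn.diffContOnCl
    rw [closure_ball _ (by positivity)]
    exact hg.mono hsub
  have key : ∀ z ∈ Metric.sphere z₀ (ρ / 6), m * ρ / 12 ≤ ‖g z - g z₀‖ := by
    intro z hz
    have hz' := Metric.sphere_subset_closedBall hz
    have := (convex_closedBall z₀ (ρ / 6)).norm_image_sub_le_of_norm_hasDerivWithin_le
      (f := fun z => g z - deriv g z₀ * z) (C := m / 2)
      (fun w hw => (((hg.differentiableAt (Metric.isOpen_ball.mem_nhds (hsub hw))).hasDerivAt.sub
        ((hasDerivAt_id w).const_mul (deriv g z₀)))).hasDerivWithinAt)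
      (fun w hw => by simpa using hS w hw) (Metric.mem_closedBall_self (by positivity)) hz'
    have e : ‖z - z₀‖ = ρ / 6 := by rw [← dist_eq_norm]; exact hz
    rw [e] at this
    have h3 : ‖deriv g z₀ * (z - z₀)‖ = m * (ρ / 6) := by rw [norm_mul, e]
    have h4 := norm_sub_norm_le (deriv g z₀ * (z - z₀)) (g z₀ - g z)
    have h5 : ‖g z - deriv g z₀ * z - (g z₀ - deriv g z₀ * z₀)‖
      = ‖deriv g z₀ * (z - z₀) - (g z - g z₀)‖ := by rw [← norm_neg]; congr 1; ring
    rw [h5] at this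
    have h6 := norm_sub_norm_le (deriv g z₀ * (z - z₀)) (g z - g z₀)
    rw [h3] at h6
    nlinarith
  have hne : ∃ᶠ z in 𝓝 z₀, g z ≠ g z₀ := by
    have h1 := (hg.differentiableAt (Metric.ball_mem_nhds z₀ hρ)).hasDerivAt
    exact ((h1.eventually_ne hm (c := g z₀)).frequently).filter_mono nhdsWithin_le_nhds
  have := hC.ball_subset_image_closedBall (by positivity) key hne
  rw [show m * ρ / 12 / 2 = m * ρ / 24 by ring] at this
  exact this.trans (image_mono hsub)

lemma bloch_deriv_bound {g : ℂ → ℂ} (hg : DifferentiableOn ℂ g (Metric.ball 0 1)) {b : ℝ}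
    (hb : ∀ w : ℂ, ¬ Metric.ball w b ⊆ g '' Metric.ball 0 1) {z : ℂ}
    (hz : z ∈ Metric.ball (0 : ℂ) 1) : ‖deriv g z‖ * (1 - ‖z‖) ≤ 48 * b := by
  have hdd : DifferentiableOn ℂ (deriv g) (Metric.ball 0 1) := hg.deriv Metric.isOpen_ball
  have hb0 : 0 < b := by
    by_contra h
    exact hb 0 (by rw [Metric.ball_eq_empty.2 (not_lt.1 h)]; exact empty_subset _)
  have hz1 : ‖z‖ < 1 := by simpa using hz
  have main : ∀ r : ℝ, ‖z‖ < r → r < 1 → ‖deriv g z‖ * (r - ‖z‖) ≤ 48 * b := by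
    intro r hr hr1
    have hr0 : 0 < r := (norm_nonneg z).trans_lt hr
    have hsub : Metric.closedBall (0 : ℂ) r ⊆ Metric.ball 0 1 := Metric.closedBall_subset_ball hr1
    obtain ⟨w, hw, hmax⟩ := (isCompact_closedBall (0 : ℂ) r).exists_isMaxOn
      ⟨0, by simp [hr0.le]⟩ (f := fun w => ‖deriv g w‖ * (r - ‖w‖))
      (((hdd.continuousOn.mono hsub).norm).mul (by fun_prop))
    have hzm := hmax (show z ∈ Metric.closedBall 0 r by simpa using hr.le)
    simp only [mem_ofPred_eq] at hzm
    refine hzm.trans ?_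
    by_contra! hcon
    have hw' : ‖w‖ ≤ r := by simpa using hw
    have hpos : 0 < ‖deriv g w‖ * (r - ‖w‖) := lt_trans (by positivity) hcon
    have hd0 : deriv g w ≠ 0 := by
      intro h; simp [h] at hpos
    have hρ : 0 < r - ‖w‖ := by
      rcases hw'.lt_or_eq with h | h
      · linarith
      · simp [h] at hpos
    have hsub2 : Metric.ball w ((r - ‖w‖) / 2) ⊆ Metric.closedBall 0 r := by
      intro u hu
      rw [Metric.mem_ball, dist_eq_norm] at hu
      have := norm_le_norm_add_norm_sub' u w
      simp only [Metric.mem_closedBall, dist_zero_right]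
      linarith
    have := ball_subset_image_of_norm_deriv_le (g := g) (z₀ := w) (half_pos hρ)
      (hg.mono (hsub2.trans hsub)) hd0 (by
        intro u hu
        have h1 := hmax (hsub2 hu)
        simp only [mem_ofPred_eq] at h1
        rw [Metric.mem_ball, dist_eq_norm] at hu
        have h2 := norm_le_norm_add_norm_sub' u w
        have h3 : (r - ‖w‖) / 2 ≤ r - ‖u‖ := by linarith
        have h4 : ‖deriv g u‖ * ((r - ‖w‖) / 2) ≤ ‖deriv g w‖ * (r - ‖w‖) :=
          (mul_le_mul_of_nonneg_left h3 (norm_nonneg _)).trans h1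
        nlinarith)
    refine hb (g w) ((Metric.ball_subset_ball ?_).trans
      (this.trans (image_mono (hsub2.trans hsub))))
    nlinarith
  have hlim : Tendsto (fun r : ℝ => ‖deriv g z‖ * (r - ‖z‖)) (𝓝[<] 1)
      (𝓝 (‖deriv g z‖ * (1 - ‖z‖))) := by
    apply Tendsto.mono_left _ nhdsWithin_le_nhds
    exact Continuous.tendsto (by fun_prop) 1
  refine le_of_tendsto hlim ?_
  filter_upwards [self_mem_nhdsWithin, nhdsWithin_le_nhds (lt_mem_nhds hz1)] with r h1 h2
  exact main r h2 h1

lemma exists_cosh_sq_eq_natCast (x : ℝ) : ∃ y : ℝ, |y - x| ≤ 1 ∧ ∃ n : ℕ, Real.cosh y ^ 2 = n := by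
  wlog hx : 0 ≤ x with H
  · obtain ⟨y, hy, n, hn⟩ := H (-x) (by linarith)
    exact ⟨-y, by rw [← abs_neg]; convert hy using 2; ring, n, by rwa [Real.cosh_neg]⟩
  have hcont : ContinuousOn (fun y => Real.cosh y ^ 2) (Icc x (x + 1)) := by fun_prop
  have h1 : Real.cosh x ^ 2 + 1 ≤ Real.cosh (x + 1) ^ 2 := by
    rw [Real.cosh_add]
    have hs : 1 ≤ Real.sinh 1 := Real.self_le_sinh_iff.2 zero_le_one
    have hc : 1 ≤ Real.cosh 1 := Real.one_le_cosh 1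
    have hsx : 0 ≤ Real.sinh x := Real.sinh_nonneg_iff.2 hx
    have hcx : 1 ≤ Real.cosh x := Real.one_le_cosh x
    have e := Real.cosh_sq 1
    have h2 : 0 ≤ Real.sinh x * Real.sinh 1 := by positivity
    have h3 : Real.cosh x ^ 2 + 1 ≤ (Real.cosh x * Real.cosh 1) ^ 2 := by
      have := one_le_mul_of_one_le_of_one_le (one_le_pow₀ hcx (n := 2)) (one_le_pow₀ hs (n := 2))
      rw [mul_pow, e]; linarith
    nlinarith [mul_pos (lt_of_lt_of_le one_pos hcx) (lt_of_lt_of_le one_pos hc)]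
  obtain ⟨y, hy, hn⟩ := intermediate_value_Icc (by linarith) hcont
    (show ((⌈Real.cosh x ^ 2⌉₊ : ℕ) : ℝ) ∈ _ from
      ⟨Nat.le_ceil _, (Nat.ceil_lt_add_one (by positivity)).le.trans h1⟩)
  exact ⟨y, by rw [abs_le]; constructor <;> linarith [hy.1, hy.2], _, hn⟩

lemma exists_mem_ball_cosh_sq_eq_natCast (w : ℂ) :
    ∃ u ∈ Metric.ball w 3, ∃ n : ℕ, Complex.cosh u ^ 2 = n := by
  obtain ⟨y, hy, n, hn⟩ := exists_cosh_sq_eq_natCast w.re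
  set k : ℤ := round (w.im / Real.pi)
  have hk : |w.im / Real.pi - k| ≤ 1 / 2 := abs_sub_round _
  have hk' : |k * Real.pi - w.im| ≤ Real.pi / 2 := by
    have : k * Real.pi - w.im = -(w.im / Real.pi - k) * Real.pi := by
      field_simp [Real.pi_ne_zero]; ring
    rw [this, abs_mul, abs_neg, abs_of_pos Real.pi_pos]
    nlinarith [Real.pi_pos]
  refine ⟨⟨y, k * Real.pi⟩, ?_, n, ?_⟩
  · rw [Metric.mem_ball, dist_eq_norm]
    refine (Complex.norm_le_abs_re_add_abs_im _).trans_lt ?_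
    simp only [Complex.sub_re, Complex.sub_im]
    have := Real.pi_lt_d2
    linarith
  · have : (⟨y, k * Real.pi⟩ : ℂ) = y + (k * Real.pi : ℝ) * Complex.I := by
      apply Complex.ext <;> simp
    rw [this, Complex.cosh_add, Complex.cosh_mul_I, Complex.sinh_mul_I, ← Complex.ofReal_sin,
      Real.sin_int_mul_pi, ← Complex.ofReal_cos]
    have hc : Real.cos (k * Real.pi) ^ 2 = 1 := by
      have := Real.sin_sq_add_cos_sq (k * Real.pi)
      rw [Real.sin_int_mul_pi] at this
      simpa using this
    simp only [Complex.ofReal_zero, zero_mul, mul_zero, add_zero, mul_pow, ← Complex.ofReal_cosh]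
    norm_cast
    rw [hc, mul_one, hn]

lemma schottky_aux (r M : ℝ) (hr : r < 1) : ∃ K : ℝ, ∀ φ : ℂ → ℂ,
    DifferentiableOn ℂ φ (Metric.ball 0 1) → (∀ z ∈ Metric.ball (0 : ℂ) 1, φ z ≠ 0 ∧ φ z ≠ 1) →
    ∀ z w : ℂ, ‖z‖ ≤ r → ‖w‖ ≤ r → 1 / 2 ≤ ‖φ z‖ → ‖φ z‖ ≤ M → ‖φ w‖ ≤ K := by
  set B := (Real.log 2 + |Real.log M| + Real.pi)
  set G := (Real.log (2 * (B + 2)) + Real.pi + 2 * (144 / (1 - r)))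
  refine ⟨Real.exp (2 * Real.pi * Real.exp G ^ 2), ?_⟩
  intro φ hφ h01 z w hz hw hzl hzM
  have hsub : Metric.closedBall (0 : ℂ) r ⊆ Metric.ball 0 1 := Metric.closedBall_subset_ball hr
  have hzc : z ∈ Metric.closedBall (0 : ℂ) r := by simpa using hz
  have hwc : w ∈ Metric.closedBall (0 : ℂ) r := by simpa using hw
  obtain ⟨L, hLd, hL, hLz⟩ := exists_log_on_ball hφ (fun z hz => (h01 z hz).1) (hsub hzc)
  have hpi : (2 * Real.pi * Complex.I : ℂ) ≠ 0 := Complex.two_pi_I_ne_zero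
  set F : ℂ → ℂ := fun u => L u / (2 * Real.pi * Complex.I) with hF
  have hFd : DifferentiableOn ℂ F (Metric.ball 0 1) := hLd.div_const _
  have hFL : ∀ u, L u = F u * (2 * Real.pi * Complex.I) := fun u => by
    simp only [hF]; rw [div_mul_cancel₀ _ hpi]
  have hFint : ∀ u ∈ Metric.ball (0 : ℂ) 1, ∀ n : ℕ, F u ≠ n := by
    intro u hu n hn
    apply (h01 u hu).2
    rw [← hL u hu, hFL, hn]
    exact Complex.exp_nat_mul_two_pi_mul_I n
  obtain ⟨LA, hAd, hA, -⟩ := exists_log_on_ball hFd (fun u hu => by simpa using hFint u hu 0)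
    (hsub hzc)
  obtain ⟨LC, hCd, hC, -⟩ := exists_log_on_ball (φ := fun u => F u - 1) (hFd.sub_const 1)
    (fun u hu => sub_ne_zero.2 (by simpa using hFint u hu 1)) (hsub hzc)
  set A : ℂ → ℂ := fun u => Complex.exp (LA u / 2) with hAdef
  set D : ℂ → ℂ := fun u => Complex.exp (LC u / 2) with hDdef
  have hA2 : ∀ u ∈ Metric.ball (0 : ℂ) 1, A u ^ 2 = F u := fun u hu => by
    rw [← hA u hu, ← Complex.exp_nat_mul]; congr 1; push_cast; ring
  have hD2 : ∀ u ∈ Metric.ball (0 : ℂ) 1, D u ^ 2 = F u - 1 := fun u hu => by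
    rw [← hC u hu, ← Complex.exp_nat_mul]; congr 1; push_cast; ring
  have hAD : ∀ u ∈ Metric.ball (0 : ℂ) 1, (A u - D u) * (A u + D u) = 1 := fun u hu => by
    linear_combination hA2 u hu - hD2 u hu
  obtain ⟨g, hgd, hg, hgz⟩ := exists_log_on_ball (φ := fun u => A u - D u)
    ((hAd.div_const 2).cexp.sub (hCd.div_const 2).cexp)
    (fun u hu => left_ne_zero_of_mul_eq_one (hAD u hu)) (hsub hzc)
  have hcosh : ∀ u ∈ Metric.ball (0 : ℂ) 1, Complex.cosh (g u) ^ 2 = F u := by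
    intro u hu
    have h1 : Complex.exp (-g u) = A u + D u := by
      rw [Complex.exp_neg, hg u hu]
      exact inv_eq_of_mul_eq_one_right (hAD u hu)
    rw [Complex.cosh, hg u hu, h1, ← hA2 u hu]
    ring
  have hnb : ∀ v : ℂ, ¬ Metric.ball v 3 ⊆ g '' Metric.ball 0 1 := by
    intro v hv
    obtain ⟨u, hu, n, hn⟩ := exists_mem_ball_cosh_sq_eq_natCast v
    obtain ⟨t, ht, rfl⟩ := hv hu
    exact hFint t ht n (by rw [← hcosh t ht, hn])
  have hder : ∀ u ∈ Metric.closedBall (0 : ℂ) r, ‖deriv g u‖ ≤ 144 / (1 - r) := by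
    intro u hu
    have h1 := bloch_deriv_bound hgd hnb (hsub hu)
    have h2 : ‖u‖ ≤ r := by simpa using hu
    rw [le_div_iff₀ (by linarith)]
    nlinarith [norm_nonneg (deriv g u)]
  have hlip := (convex_closedBall (0 : ℂ) r).norm_image_sub_le_of_norm_hasDerivWithin_le
    (fun u hu => (hgd.differentiableAt (Metric.isOpen_ball.mem_nhds
      (hsub hu))).hasDerivAt.hasDerivWithinAt) hder hzc hwc
  have hFz : ‖F z‖ ≤ B := by
    have hn : ‖(2 * Real.pi * Complex.I : ℂ)‖ = 2 * Real.pi := by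
      simp [Real.pi_pos.le]
    simp only [hF, norm_div, hn]
    have h1 : 1 ≤ 2 * Real.pi := by linarith [Real.pi_gt_three]
    refine (div_le_self (norm_nonneg _) h1).trans ?_
    rw [hLz]
    refine (Complex.norm_le_abs_re_add_abs_im _).trans (add_le_add ?_ ?_)
    · rw [Complex.log_re, abs_le]
      have h2 : Real.log (1 / 2) ≤ Real.log ‖φ z‖ := Real.log_le_log (by norm_num) hzl
      have h3 : Real.log ‖φ z‖ ≤ Real.log M := Real.log_le_log (by linarith) hzM
      rw [one_div, Real.log_inv] at h2
      have := le_abs_self (Real.log M)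
      have := abs_nonneg (Real.log M)
      have : 0 < Real.log 2 := Real.log_pos (by norm_num)
      constructor <;> linarith
    · rw [Complex.log_im]; exact Complex.abs_arg_le_pi _
  have hB : 0 ≤ B := (norm_nonneg _).trans hFz
  have hAz : ‖A z‖ ≤ B + 2 := by
    have : ‖A z‖ ^ 2 ≤ B := by rw [← norm_pow, hA2 z (hsub hzc)]; exact hFz
    nlinarith [norm_nonneg (A z)]
  have hDz : ‖D z‖ ≤ B + 2 := by
    have : ‖D z‖ ^ 2 ≤ B + 1 := by
      rw [← norm_pow, hD2 z (hsub hzc)]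
      refine (norm_sub_le _ _).trans ?_
      rw [norm_one]; linarith
    nlinarith [norm_nonneg (D z)]
  have hgz' : ‖g z‖ ≤ Real.log (2 * (B + 2)) + Real.pi := by
    rw [hgz]
    refine (Complex.norm_le_abs_re_add_abs_im _).trans (add_le_add ?_ ?_)
    · have h1 : ‖A z - D z‖ ≤ 2 * (B + 2) := (norm_sub_le _ _).trans (by linarith)
      have h2 : ‖A z + D z‖ ≤ 2 * (B + 2) := (norm_add_le _ _).trans (by linarith)
      have h3 : ‖A z - D z‖ * ‖A z + D z‖ = 1 := by
        rw [← norm_mul, hAD z (hsub hzc), norm_one]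
      have h4 : 0 < ‖A z - D z‖ := by
        rw [norm_pos_iff]; exact left_ne_zero_of_mul_eq_one (hAD z (hsub hzc))
      have h5 : (2 * (B + 2))⁻¹ ≤ ‖A z - D z‖ := by
        rw [inv_le_iff_one_le_mul₀ (by positivity), ← h3]; gcongr
      rw [Complex.log_re, abs_le]
      refine ⟨?_, Real.log_le_log h4 h1⟩
      rw [← Real.log_inv]
      exact Real.log_le_log (by positivity) h5
    · rw [Complex.log_im]; exact Complex.abs_arg_le_pi _
  have hgw : ‖g w‖ ≤ G := by
    have h1 : ‖w - z‖ ≤ 2 := (norm_sub_le _ _).trans (by linarith)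
    have h2 := norm_le_norm_add_norm_sub' (g w) (g z)
    have h3 : 0 < 1 - r := by linarith
    have h4 : 144 / (1 - r) * ‖w - z‖ ≤ 2 * (144 / (1 - r)) := by
      rw [mul_comm]; gcongr
    linarith
  have hFw : ‖F w‖ ≤ Real.exp G ^ 2 := by
    rw [← hcosh w (hsub hwc), norm_pow]
    gcongr
    rw [Complex.cosh, norm_div]
    have h1 : ‖Complex.exp (g w)‖ ≤ Real.exp G :=
      (Complex.norm_exp_le_exp_norm _).trans (Real.exp_le_exp.2 hgw)
    have h2 : ‖Complex.exp (-g w)‖ ≤ Real.exp G :=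
      (Complex.norm_exp_le_exp_norm _).trans (Real.exp_le_exp.2 (by rwa [norm_neg]))
    have h3 := norm_add_le (Complex.exp (g w)) (Complex.exp (-g w))
    simp only [Complex.norm_ofNat]
    linarith
  rw [← hL w (hsub hwc)]
  refine (Complex.norm_exp_le_exp_norm _).trans (Real.exp_le_exp.2 ?_)
  rw [hFL, norm_mul]
  have hn : ‖(2 * Real.pi * Complex.I : ℂ)‖ = 2 * Real.pi := by
    simp [Real.pi_pos.le]
  rw [hn, mul_comm]
  gcongr

/-- Schottky's theorem, with a free pair of base points. -/
theorem schottky_unit (r M : ℝ) (hr : r < 1) : ∃ K : ℝ, ∀ φ : ℂ → ℂ,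
    DifferentiableOn ℂ φ (Metric.ball 0 1) → (∀ z ∈ Metric.ball (0 : ℂ) 1, φ z ≠ 0 ∧ φ z ≠ 1) →
    ∀ z w : ℂ, ‖z‖ ≤ r → ‖w‖ ≤ r → ‖φ z‖ ≤ M → ‖φ w‖ ≤ K := by
  obtain ⟨K₁, hK₁⟩ := schottky_aux r M hr
  obtain ⟨K₂, hK₂⟩ := schottky_aux r 2 hr
  refine ⟨max K₁ (K₂ + 1), fun φ hφ h01 z w hz hw hM => ?_⟩
  by_cases h : 1 / 2 ≤ ‖φ z‖
  · exact (hK₁ φ hφ h01 z w hz hw h hM).trans (le_max_left _ _)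
  · push Not at h
    have h1 := norm_sub_norm_le 1 (φ z)
    have h2 := norm_sub_le 1 (φ z)
    rw [norm_one] at h1 h2
    have := hK₂ (fun u => 1 - φ u) (hφ.const_sub 1)
      (fun u hu => ⟨sub_ne_zero.2 (h01 u hu).2.symm, by simpa using (h01 u hu).1⟩) z w hz hw
      (by linarith) (by linarith)
    have h3 := norm_sub_le 1 (1 - φ w)
    rw [sub_sub_cancel, norm_one] at h3
    exact (by linarith : ‖φ w‖ ≤ K₂ + 1).trans (le_max_right _ _)

theorem schottky {R : ℝ} (r M : ℝ) (hr : r < R) : ∃ K : ℝ, 0 < K ∧ ∀ (c : ℂ) (φ : ℂ → ℂ),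
    DifferentiableOn ℂ φ (Metric.ball c R) → (∀ z ∈ Metric.ball c R, φ z ≠ 0 ∧ φ z ≠ 1) →
    ∀ z ∈ Metric.closedBall c r, ∀ w ∈ Metric.closedBall c r, ‖φ z‖ ≤ M → ‖φ w‖ ≤ K := by
  rcases lt_or_ge r 0 with h | h
  · exact ⟨1, one_pos, fun c φ _ _ z hz => by rw [Metric.closedBall_eq_empty.2 h] at hz; exact hz.elim⟩
  have hR : 0 < R := h.trans_lt hr
  obtain ⟨K, hK⟩ := schottky_unit (r / R) M ((div_lt_one hR).2 hr)
  refine ⟨max K 1, by positivity, fun c φ hφ h01 z hz w hw hM => le_max_of_le_left ?_⟩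
  have hmaps : ∀ u ∈ Metric.ball (0 : ℂ) 1, c + R * u ∈ Metric.ball c R := by
    intro u hu
    rw [Metric.mem_ball, dist_eq_norm, add_sub_cancel_left, norm_mul, Complex.norm_real,
      Real.norm_of_nonneg hR.le]
    have : ‖u‖ < 1 := by simpa using hu
    nlinarith
  have hRc : (R : ℂ) ≠ 0 := by exact_mod_cast hR.ne'
  have key : ∀ u ∈ Metric.closedBall c r, ‖(u - c) / R‖ ≤ r / R ∧ c + R * ((u - c) / R) = u := by
    intro u hu
    rw [Metric.mem_closedBall, dist_eq_norm] at hu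
    refine ⟨?_, by field_simp; ring⟩
    rw [norm_div, Complex.norm_real, Real.norm_of_nonneg hR.le]
    gcongr
  have := hK (fun u => φ (c + R * u)) (hφ.comp (by fun_prop) hmaps)
    (fun u hu => h01 _ (hmaps u hu)) _ _ (key z hz).1 (key w hw).1
  simp only [(key z hz).2, (key w hw).2] at this
  exact this hM

/-- A holomorphic function omitting `0` and `1` which is small at one point is small nearby. -/
theorem schottky_small {R : ℝ} (r ε : ℝ) (hr : r < R) (hε : 0 < ε) :
    ∃ δ : ℝ, 0 < δ ∧ ∀ (c : ℂ) (φ : ℂ → ℂ),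
    DifferentiableOn ℂ φ (Metric.ball c R) → (∀ z ∈ Metric.ball c R, φ z ≠ 0 ∧ φ z ≠ 1) →
    ∀ z ∈ Metric.closedBall c r, ∀ w ∈ Metric.closedBall c r, ‖φ z‖ < δ → ‖φ w‖ < ε := by
  obtain ⟨K, hK0, hK⟩ := schottky r ε⁻¹ hr
  refine ⟨K⁻¹, by positivity, fun c φ hφ h01 z hz w hw hz1 => ?_⟩
  by_contra! hcon
  have hz0 := (h01 z (Metric.closedBall_subset_ball hr hz)).1
  have := hK c (fun u => (φ u)⁻¹) (hφ.inv fun u hu => (h01 u hu).1)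
    (fun u hu => ⟨inv_ne_zero (h01 u hu).1, by simpa using (h01 u hu).2⟩) w hw z hz (by
      rw [norm_inv]; exact inv_anti₀ hε hcon)
  rw [norm_inv] at this
  have h2 := inv_le_of_inv_le₀ (norm_pos_iff.2 hz0) this
  linarith

lemma koebe_unit : ∃ κ : ℝ, 0 < κ ∧ κ < 1 ∧ ∀ g : ℂ → ℂ, DifferentiableOn ℂ g (Metric.ball 0 1) →
    InjOn g (Metric.ball 0 1) → deriv g 0 ≠ 0 → ∀ z : ℂ, ‖z‖ ≤ κ →
    ‖g z - g 0 - deriv g 0 * z‖ ≤ 1 / 2 * (‖deriv g 0‖ * ‖z‖) := by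
  obtain ⟨K, hK0, hK⟩ := schottky (R := 1) (1 / 2) 2 (by norm_num)
  set κ : ℝ := (8 * (K + 2))⁻¹
  have hκ0 : 0 < κ := by positivity
  have hκ1 : κ ≤ 1 / 16 := by
    rw [one_div]; exact inv_anti₀ (by norm_num) (by linarith)
  have hKκ : (K + 2) * κ = 1 / 8 := by simp only [κ]; field_simp
  refine ⟨κ, hκ0, by linarith, fun g hg hinj hd z hz => ?_⟩
  have h0mem : (0 : ℂ) ∈ Metric.ball (0 : ℂ) 1 := by simp
  set h := dslope g 0
  have hh : DifferentiableOn ℂ h (Metric.ball 0 1) :=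
    (Complex.differentiableOn_dslope (Metric.ball_mem_nhds 0 one_pos)).2 hg
  have hh0 : h 0 = deriv g 0 := dslope_same g 0
  have hgh : ∀ u, g u - g 0 = u * h u := fun u => by
    simpa using (sub_smul_dslope g 0 u).symm
  have hne : ∀ u ∈ Metric.ball (0 : ℂ) 1, h u ≠ 0 := by
    intro u hu hu0
    by_cases h' : u = 0
    · rw [h', hh0] at hu0; exact hd hu0
    · have := hgh u
      rw [hu0, mul_zero, sub_eq_zero] at this
      exact h' (hinj hu h0mem this)
  have hhalf : ∀ u ∈ Metric.ball (0 : ℂ) 1, u / 2 ∈ Metric.ball (0 : ℂ) 1 := by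
    intro u hu
    simp only [Metric.mem_ball, dist_zero_right, norm_div, Complex.norm_ofNat] at hu ⊢
    linarith [norm_nonneg u]
  have hhh : DifferentiableOn ℂ (fun u => h (u / 2)) (Metric.ball 0 1) :=
    hh.comp (by fun_prop) hhalf
  set k : ℂ → ℂ := fun u => 2 * (h u / h (u / 2)) with hkdef
  have hk : DifferentiableOn ℂ k (Metric.ball 0 1) :=
    (hh.div hhh fun u hu => hne _ (hhalf u hu)).const_mul 2
  have hk0 : k 0 = 2 := by simp [hkdef, hne 0 h0mem]
  have hk01 : ∀ u ∈ Metric.ball (0 : ℂ) 1, k u ≠ 0 ∧ k u ≠ 1 := by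
    intro u hu
    refine ⟨mul_ne_zero two_ne_zero (div_ne_zero (hne u hu) (hne _ (hhalf u hu))), fun h1 => ?_⟩
    have h2 := hne _ (hhalf u hu)
    have h3 : 2 * h u = h (u / 2) := by
      simp only [hkdef] at h1; field_simp at h1; exact h1
    by_cases hu0 : u = 0
    · rw [hu0, hk0] at h1; norm_num at h1
    · have h4 := hgh u
      have h5 := hgh (u / 2)
      have : g u = g (u / 2) := by linear_combination h4 - h5 + (u / 2) * h3
      have := hinj hu (hhalf u hu) this
      apply hu0
      linear_combination 2 * this
  have hkb : ∀ u ∈ Metric.ball (0 : ℂ) (1 / 2), ‖k u‖ ≤ K := fun u hu =>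
    hK 0 k hk hk01 0 (by simp) u (Metric.ball_subset_closedBall hu) (by simp [hk0])
  have hks : ∀ u : ℂ, ‖u‖ ≤ κ → ‖h u - h (u / 2)‖ ≤ 1 / 8 * ‖h (u / 2)‖ := by
    intro u hu
    have hu' : u ∈ Metric.ball (0 : ℂ) (1 / 2) := by simp; linarith
    have hu1 : u ∈ Metric.ball (0 : ℂ) 1 := by simp; linarith
    have := Complex.dist_le_div_mul_dist_of_mapsTo_ball (f := k) (R₂ := K + 2)
      (hk.mono (Metric.ball_subset_ball (by norm_num))) (by
        intro w hw
        rw [Metric.mem_closedBall, dist_eq_norm]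
        refine (norm_sub_le _ _).trans ?_
        rw [hk0, Complex.norm_ofNat]
        linarith [hkb w hw]) hu'
    rw [dist_eq_norm, hk0, dist_zero_right] at this
    have h2 := hne _ (hhalf u hu1)
    have e : h u - h (u / 2) = (k u - 2) * h (u / 2) / 2 := by
      simp only [hkdef]; field_simp
    rw [e, norm_div, norm_mul, Complex.norm_ofNat]
    have : ‖k u - 2‖ ≤ 1 / 4 := this.trans (by
      calc (K + 2) / (1 / 2) * ‖u‖ ≤ (K + 2) / (1 / 2) * κ := by gcongr
        _ = 2 * ((K + 2) * κ) := by ring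
        _ = 1 / 4 := by rw [hKκ]; norm_num)
    nlinarith [norm_nonneg (h (u / 2))]
  have hsubκ : Metric.closedBall (0 : ℂ) κ ⊆ Metric.ball 0 1 :=
    Metric.closedBall_subset_ball (by linarith)
  obtain ⟨v, hv, hmax⟩ := (isCompact_closedBall (0 : ℂ) κ).exists_isMaxOn
      ⟨0, by simp [hκ0.le]⟩ (f := fun w => ‖h w - h 0‖)
      (((hh.continuousOn.mono hsubκ).sub continuousOn_const).norm)
  set m := ‖h v - h 0‖ with hm
  have hhalf2 : ∀ u : ℂ, ‖u‖ ≤ κ → ‖h (u / 2) - h 0‖ ≤ m / 2 := by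
    intro u hu
    have hu2 : ‖u / 2‖ ≤ κ / 2 := by rw [norm_div, Complex.norm_ofNat]; linarith
    have := Complex.dist_le_div_mul_dist_of_mapsTo_ball (f := h) (R₂ := m) (c := 0) (R₁ := κ)
      (z := u / 2) (hh.mono (Metric.ball_subset_closedBall.trans hsubκ)) (by
        intro w hw
        rw [Metric.mem_closedBall, dist_eq_norm]
        exact hmax (Metric.ball_subset_closedBall hw)) (by simp only [Metric.mem_ball, dist_zero_right]; linarith)
    rw [dist_eq_norm, dist_zero_right] at this
    refine this.trans ?_
    calc m / κ * ‖u / 2‖ ≤ m / κ * (κ / 2) := by gcongr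
      _ = m / 2 := by field_simp
  have hv' : ‖v‖ ≤ κ := by simpa using hv
  have hm2 : m ≤ 1 / 8 * (‖h 0‖ + m / 2) + m / 2 := by
    have h1 := hks v hv'
    have h2 := hhalf2 v hv'
    have h3 := norm_le_norm_add_norm_sub' (h (v / 2)) (h 0)
    have h4 := norm_sub_le_norm_sub_add_norm_sub (h v) (h (v / 2)) (h 0)
    linarith
  have hz' : z ∈ Metric.closedBall (0 : ℂ) κ := by simpa using hz
  have hfin : ‖h z - h 0‖ ≤ 1 / 2 * ‖h 0‖ := by
    have h1 : ‖h z - h 0‖ ≤ m := hmax hz'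
    linarith [norm_nonneg (h 0)]
  rw [hgh z, ← hh0, show z * h z - h 0 * z = (h z - h 0) * z by ring, norm_mul]
  nlinarith [norm_nonneg z]

/-- A weak form of Koebe's distortion theorem. -/
theorem koebe_distortion : ∃ κ : ℝ, 0 < κ ∧ κ < 1 ∧ ∀ (c : ℂ) (R : ℝ) (g : ℂ → ℂ), 0 < R →
    DifferentiableOn ℂ g (Metric.ball c R) → InjOn g (Metric.ball c R) → deriv g c ≠ 0 →
    ∀ z : ℂ, ‖z - c‖ ≤ κ * R →
    ‖g z - g c - deriv g c * (z - c)‖ ≤ 1 / 2 * (‖deriv g c‖ * ‖z - c‖) := by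
  obtain ⟨κ, hκ0, hκ1, hκ⟩ := koebe_unit
  refine ⟨κ, hκ0, hκ1, fun c R g hR hg hinj hd z hz => ?_⟩
  have hRc : (R : ℂ) ≠ 0 := by exact_mod_cast hR.ne'
  have hmaps : ∀ u ∈ Metric.ball (0 : ℂ) 1, c + R * u ∈ Metric.ball c R := by
    intro u hu
    rw [Metric.mem_ball, dist_eq_norm, add_sub_cancel_left, norm_mul, Complex.norm_real,
      Real.norm_of_nonneg hR.le]
    have : ‖u‖ < 1 := by simpa using hu
    nlinarith
  have hder : deriv (fun u => g (c + R * u)) 0 = deriv g c * R := by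
    have h1 : HasDerivAt g (deriv g c) (c + R * 0) := by
      simpa using (hg.differentiableAt (Metric.ball_mem_nhds c hR)).hasDerivAt
    have h2 : HasDerivAt (fun u : ℂ => c + R * u) R 0 := by
      simpa using ((hasDerivAt_id (0 : ℂ)).const_mul (R : ℂ)).const_add c
    exact (h1.comp (0 : ℂ) h2).deriv
  have hzR : ‖(z - c) / R‖ = ‖z - c‖ / R := by
    rw [norm_div, Complex.norm_real, Real.norm_of_nonneg hR.le]
  have hzz : c + R * ((z - c) / R) = z := by field_simp; ring
  have := hκ (fun u => g (c + R * u)) (hg.comp (by fun_prop) hmaps)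
    (fun u hu v hv huv => by
      simpa [hRc] using hinj (hmaps u hu) (hmaps v hv) huv)
    (by rw [hder]; exact mul_ne_zero hd hRc) ((z - c) / R)
    (by rw [hzR, div_le_iff₀ hR]; exact hz)
  rw [hder] at this
  simp only [hzz, mul_zero, add_zero] at this
  rw [show deriv g c * R * ((z - c) / R) = deriv g c * (z - c) by field_simp, hzR, norm_mul,
    Complex.norm_real, Real.norm_of_nonneg hR.le] at this
  rwa [show ‖deriv g c‖ * R * (‖z - c‖ / R) = ‖deriv g c‖ * ‖z - c‖ by field_simp] at this

/-! ### Holomorphic root sections -/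

lemma exists_implicit_of_deriv_ne_zero {E : Type*} [NormedAddCommGroup E] [NormedSpace ℂ E]
    [CompleteSpace E] {Ψ : E × ℂ → ℂ} {u : E × ℂ} (hΨ : ContDiffAt ℂ 1 Ψ u) (h0 : Ψ u = 0)
    (hd : deriv (fun w => Ψ (u.1, w)) u.2 ≠ 0) :
    ∃ s : E → ℂ, s u.1 = u.2 ∧ DifferentiableAt ℂ s u.1 ∧ (∀ᶠ x in 𝓝 u.1, Ψ (x, s x) = 0) ∧
      ∀ᶠ v in 𝓝 u, Ψ v = 0 ↔ s v.1 = v.2 := by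
  have hs : HasStrictFDerivAt Ψ (fderiv ℂ Ψ u) u := hΨ.hasStrictFDerivAt one_ne_zero
  have hcomp : HasFDerivAt (fun w => Ψ (u.1, w)) (fderiv ℂ Ψ u ∘L .inr ℂ E ℂ) u.2 := by
    have h1 : HasFDerivAt Ψ (fderiv ℂ Ψ u) (u.1, u.2) := hs.hasFDerivAt
    exact h1.comp u.2 (hasFDerivAt_prodMk_right u.1 u.2)
  have hinv : (fderiv ℂ Ψ u ∘L .inr ℂ E ℂ).IsInvertible := by
    have hv : deriv (fun w => Ψ (u.1, w)) u.2 = (fderiv ℂ Ψ u ∘L .inr ℂ E ℂ) 1 :=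
      hcomp.hasDerivAt.deriv
    refine ⟨ContinuousLinearEquiv.unitsEquivAut ℂ (Units.mk0 _ hd), ?_⟩
    ext
    simp [hv]
  refine ⟨hs.implicitFunctionOfProdDomain hinv, ?_,
    (hs.hasStrictFDerivAt_implicitFunctionOfProdDomain hinv).hasFDerivAt.differentiableAt, ?_, ?_⟩
  · exact (hs.eventually_apply_eq_iff_implicitFunctionOfProdDomain hinv).self_of_nhds.mp rfl
  · simpa [h0] using hs.eventually_apply_implicitFunctionOfProdDomain hinv
  · simpa [h0] using hs.eventually_apply_eq_iff_implicitFunctionOfProdDomain hinv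

/-- Simple, locally bounded zeros of a holomorphic family over a disc extend to global
holomorphic sections. -/
theorem exists_root_section {c : ℂ} {R : ℝ} {Ψ : ℂ × ℂ → ℂ}
    (hΨ : ∀ u : ℂ × ℂ, u.1 ∈ Metric.ball c R → ContDiffAt ℂ 1 Ψ u)
    (hsimple : ∀ t ∈ Metric.ball c R, ∀ w, Ψ (t, w) = 0 → deriv (fun w => Ψ (t, w)) w ≠ 0)
    (hbdd : ∀ t ∈ Metric.ball c R, ∃ M : ℝ, ∀ᶠ s in 𝓝 t, ∀ w, Ψ (s, w) = 0 → ‖w‖ ≤ M)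
    {t₀ w₀ : ℂ} (ht₀ : t₀ ∈ Metric.ball c R) (hw₀ : Ψ (t₀, w₀) = 0) :
    ∃ φ : ℂ → ℂ, DifferentiableOn ℂ φ (Metric.ball c R) ∧ φ t₀ = w₀ ∧
      ∀ t ∈ Metric.ball c R, Ψ (t, φ t) = 0 := by
  set D := Metric.ball c R with hD
  have hDo : IsOpen D := Metric.isOpen_ball
  have hDne : D.Nonempty := ⟨t₀, ht₀⟩
  let Z : Type := {p : D × ℂ // Ψ (p.1, p.2) = 0}
  let π : Z → D := fun p => p.1.1
  have hπc : Continuous π := continuous_fst.comp continuous_subtype_val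
  have hloc : ∀ z : Z, ∃ s : ℂ → ℂ, s z.1.1 = z.1.2 ∧ DifferentiableAt ℂ s z.1.1 ∧
      (∀ᶠ x in 𝓝 (z.1.1 : ℂ), Ψ (x, s x) = 0) ∧
      ∀ᶠ v in 𝓝 ((z.1.1 : ℂ), z.1.2), Ψ v = 0 ↔ s v.1 = v.2 := fun z =>
    exists_implicit_of_deriv_ne_zero (u := ((z.1.1 : ℂ), z.1.2)) (hΨ _ z.1.1.2) z.2
      (hsimple _ z.1.1.2 _ z.2)
  have hemb : Continuous (fun z : Z => ((z.1.1 : ℂ), z.1.2)) := by fun_prop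
  have hopen : IsOpenMap π := by
    rw [isOpenMap_iff_nhds_le]
    intro z
    obtain ⟨s, hs0, hsd, hs1, -⟩ := hloc z
    intro V hV
    rw [mem_map] at hV
    obtain ⟨V', hV', hVV'⟩ := mem_nhds_subtype _ _ _ |>.1 hV
    have hc : Tendsto (fun t : D => ((t, s t) : D × ℂ)) (𝓝 z.1.1) (𝓝 z.1) := by
      rw [show z.1 = (z.1.1, s z.1.1) by rw [hs0]]
      exact Tendsto.prodMk_nhds tendsto_id
        (hsd.continuousAt.tendsto.comp continuous_subtype_val.continuousAt)
    have h1 := hc.eventually hV'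
    have h2 : ∀ᶠ t : D in 𝓝 z.1.1, Ψ (t, s t) = 0 :=
      continuous_subtype_val.continuousAt.eventually hs1
    filter_upwards [h1, h2] with t ht1 ht2
    exact hVV' (show (⟨(t, s t), ht2⟩ : Z) ∈ Subtype.val ⁻¹' V' from ht1)
  have hinj : ∀ z : Z, ∃ U ∈ 𝓝 z, InjOn π U := by
    intro z
    obtain ⟨s, hs0, hsd, -, hs2⟩ := hloc z
    refine ⟨_, hemb.continuousAt.eventually hs2, ?_⟩
    intro a ha b hb hab
    have ha' := (ha : _ ↔ _).1 a.2
    have hb' := (hb : _ ↔ _).1 b.2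
    have h1 : a.1.1 = b.1.1 := hab
    apply Subtype.ext
    apply Prod.ext h1
    simp only at ha' hb'
    rw [← ha', ← hb', h1]
  have hlh : IsLocalHomeomorph π := by
    rw [isLocalHomeomorph_iff_isOpenEmbedding_restrict]
    intro z
    obtain ⟨U, hU, hUi⟩ := hinj z
    refine ⟨interior U, interior_mem_nhds.2 hU, ?_⟩
    refine IsOpenEmbedding.of_continuous_injective_isOpenMap (hπc.comp continuous_subtype_val)
      (injOn_iff_injective.1 (hUi.mono interior_subset)) ?_
    exact hopen.domRestrict isOpen_interior
  have hbd : ∀ t : D, ∃ M : ℝ, ∀ᶠ s in 𝓝 t, ∀ z : Z, z.1.1 = s → ‖z.1.2‖ ≤ M := by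
    intro t
    obtain ⟨M, hM⟩ := hbdd t t.2
    refine ⟨M, (continuous_subtype_val.continuousAt.eventually hM).mono fun s hs z hz => ?_⟩
    exact hs _ (by rw [← hz]; exact z.2)
  have hΨc : Continuous (fun p : D × ℂ => Ψ (p.1, p.2)) := by
    rw [continuous_iff_continuousAt]
    intro p
    have h1 : ContinuousAt Ψ ((p.1 : ℂ), p.2) := (hΨ ((p.1 : ℂ), p.2) p.1.2).continuousAt
    exact ContinuousAt.comp (f := fun p : D × ℂ => ((p.1 : ℂ), p.2)) h1 (by fun_prop)
  -- a sequential compactness principle for `π`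
  have hseq : ∀ (z : ℕ → Z) (t : D), Tendsto (fun n => π (z n)) atTop (𝓝 t) →
      ∃ (a : Z) (k : ℕ → ℕ), StrictMono k ∧ Tendsto (z ∘ k) atTop (𝓝 a) ∧ π a = t := by
    intro z t hz
    obtain ⟨M, hM⟩ := hbd t
    have hev : ∀ᶠ n in atTop, (z n).1.2 ∈ Metric.closedBall (0 : ℂ) M := by
      filter_upwards [hz.eventually hM] with n hn
      simpa using hn (z n) rfl
    obtain ⟨w, -, k, hk, hkw⟩ := (isCompact_closedBall (0 : ℂ) M).tendsto_subseq'
      hev.frequently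
    have hlim : Tendsto (fun n => (z (k n)).1) atTop (𝓝 (t, w)) :=
      (hz.comp hk.tendsto_atTop).prodMk_nhds hkw
    have hzero : Ψ ((t : ℂ), w) = 0 := by
      have h1 := (hΨc.tendsto (t, w)).comp hlim
      have h2 : ((fun p : D × ℂ => Ψ (p.1, p.2)) ∘ fun n => (z (k n)).1) = fun _ => 0 := by
        funext n; exact (z (k n)).2
      rw [h2] at h1
      exact (tendsto_nhds_unique h1 tendsto_const_nhds)
    exact ⟨⟨(t, w), hzero⟩, k, hk, tendsto_subtype_rng.2 hlim, rfl⟩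
  have hclosed : IsClosedMap π := by
    intro S hS
    apply IsSeqClosed.isClosed
    intro x t hx hxt
    choose z hzS hzx using hx
    obtain ⟨a, k, hk, hka, hat⟩ := hseq z t (by simpa [hzx] using hxt)
    exact ⟨a, hS.mem_of_tendsto hka (Eventually.of_forall fun n => hzS (k n)), hat⟩
  have hfin : ∀ t : D, (π ⁻¹' {t}).Finite := by
    intro t
    by_contra hinf
    have hinf' : (π ⁻¹' {t}).Infinite := hinf
    set z : ℕ → Z := fun n => hinf'.natEmbedding _ n with hzdef
    have hz : Function.Injective z := fun a b hab =>
      (hinf'.natEmbedding _).injective (Subtype.ext hab)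
    have hzt : ∀ n, π (z n) = t := fun n => (hinf'.natEmbedding _ n).2
    obtain ⟨a, k, hk, hka, hat⟩ := hseq z t (by simp [hzt])
    obtain ⟨U, hU, hUi⟩ := hinj a
    obtain ⟨n, hn⟩ := (hka.eventually hU).exists_forall_of_atTop
    have := hUi (hn n le_rfl) (hn (n + 1) (by lia)) (by simp [hzt])
    have := hk.injective (hz this)
    lia
  have hcov : IsCoveringMapOn π univ :=
    hclosed.isCoveringMapOn_of_isLocalHomeomorphOn (fun t _ => hfin t) hlh.isLocalHomeomorphOn
  have : ContractibleSpace D := (convex_ball c R).contractibleSpace hDne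
  have : LocallyPathConnectedSpace D := hDo.locallyPathConnectedSpace
  obtain ⟨F, ⟨hF0, hF⟩, -⟩ := hcov.existsUnique_continuousMap_lifts (ContinuousMap.id D)
    (a₀ := ⟨t₀, ht₀⟩) (e₀ := (⟨(⟨t₀, ht₀⟩, w₀), hw₀⟩ : Z)) rfl (fun _ => mem_univ _)
  have hF1 : ∀ t : D, (F t).1.1 = t := fun t => congrFun hF t
  refine ⟨fun t => if h : t ∈ D then (F ⟨t, h⟩).1.2 else 0, ?_, ?_, ?_⟩
  · intro t ht
    obtain ⟨s, hs0, hsd, -, hs2⟩ := hloc (F ⟨t, ht⟩)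
    rw [hF1] at hs0 hsd
    apply DifferentiableAt.differentiableWithinAt
    refine hsd.congr_of_eventuallyEq ?_
    have h1 : ∀ᶠ x : D in 𝓝 ⟨t, ht⟩, s x = (F x).1.2 := by
      have := (hemb.comp F.continuous).continuousAt (x := ⟨t, ht⟩) |>.eventually hs2
      filter_upwards [this] with x hx
      have := hx.1 (F x).2
      simpa [hF1] using this
    rw [nhds_subtype_eq_comap, eventually_comap] at h1
    filter_upwards [h1, hDo.mem_nhds ht] with x hx hxD
    rw [dif_pos hxD, hx ⟨x, hxD⟩ rfl]
  · simp [ht₀, hF0]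
  · intro t ht
    have := (F ⟨t, ht⟩).2
    rw [hF1] at this
    simpa [ht] using this

/-- Pairs of coefficient vectors. -/
abbrev Par (d : ℕ) := (Fin (d + 1) → ℂ) × (Fin (d + 1) → ℂ)

/-- The homogeneous form of degree `d` with coefficients `a`. -/
def hom {R : Type*} [CommRing R] {d : ℕ} (a : Fin (d + 1) → R) (Z : R × R) : R :=
  ∑ i : Fin (d + 1), a i * Z.1 ^ (i : ℕ) * Z.2 ^ (d - i)

/-- The homogeneous lift of a rational map to `ℂ²` (over any ring of coefficients). -/
def hlift {R : Type*} [CommRing R] {d : ℕ} (c : (Fin (d + 1) → R) × (Fin (d + 1) → R))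
    (Z : R × R) : R × R :=
  (hom c.1 Z, hom c.2 Z)

/-- The determinant of two vectors of the plane. -/
def br {R : Type*} [CommRing R] (Z W : R × R) : R := Z.1 * W.2 - Z.2 * W.1

/-- The projection from `ℂ² ∖ 0` to the Riemann sphere. -/
def prj (Z : ℂ × ℂ) : Sphere := if Z.2 = 0 then ∞ else ((Z.1 / Z.2 : ℂ) : Sphere)

/-- Nondegenerate parameters: those whose lift has no nontrivial zero. -/
def ND {d : ℕ} (c : Par d) : Prop := ∀ Z : ℂ × ℂ, Z ≠ 0 → hlift c Z ≠ 0

/-- The self-map of the sphere with given coefficients. -/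
def sphereMap {d : ℕ} (c : Par d) : Sphere → Sphere := ratEval (polyOf c.1) (polyOf c.2)

variable {d : ℕ}

@[simp] lemma toC_coe (z : ℂ) : toC (z : Sphere) = z :=
  OnePoint.coe_injective.extend_apply id (fun _ => 0) z

lemma polyOf_eval (a : Fin (d + 1) → ℂ) (z : ℂ) : (polyOf a).eval z = ∑ i, a i * z ^ (i : ℕ) := by
  simp [polyOf, eval_finsetSum]

lemma polyOf_coeff (a : Fin (d + 1) → ℂ) (i : Fin (d + 1)) : (polyOf a).coeff i = a i := by
  simp only [polyOf, finsetSum_coeff, coeff_C_mul, coeff_X_pow]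
  rw [Finset.sum_eq_single i]
  · simp
  · intro j _ hj
    rw [if_neg (fun h => hj (Fin.ext h.symm)), mul_zero]
  · simp

lemma polyOf_natDegree_le (a : Fin (d + 1) → ℂ) : (polyOf a).natDegree ≤ d := by
  refine natDegree_sum_le_of_forall_le _ _ fun i _ => ?_
  exact (natDegree_C_mul_X_pow_le _ _).trans (by have := i.2; lia)

lemma hom_one (a : Fin (d + 1) → ℂ) (z : ℂ) : hom a (z, 1) = (polyOf a).eval z := by
  simp [hom, polyOf_eval]

lemma hom_smul (a : Fin (d + 1) → ℂ) (s : ℂ) (Z : ℂ × ℂ) : hom a (s • Z) = s ^ d * hom a Z := by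
  simp only [hom, Finset.mul_sum, Prod.smul_fst, Prod.smul_snd, smul_eq_mul, mul_pow]
  refine Finset.sum_congr rfl fun i _ => ?_
  have : s ^ d = s ^ (i : ℕ) * s ^ (d - i) := by
    rw [← pow_add]; congr 1; have := i.2; lia
  rw [this]; ring

lemma hom_zero_right (a : Fin (d + 1) → ℂ) (z : ℂ) : hom a (z, 0) = (polyOf a).coeff d * z ^ d := by
  have := polyOf_coeff a (Fin.last d)
  rw [Fin.val_last] at this
  rw [this, hom, Finset.sum_eq_single (Fin.last d)]
  · simp
  · intro j _ hj
    have : d - (j : ℕ) ≠ 0 := by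
      have h1 := j.2
      have h2 : (j : ℕ) ≠ d := fun h => hj (Fin.ext h)
      lia
    simp [this]
  · simp

lemma hlift_smul (c : Par d) (s : ℂ) (Z : ℂ × ℂ) : hlift c (s • Z) = s ^ d • hlift c Z := by
  simp [hlift, hom_smul]

lemma iter_smul (c : Par d) (n : ℕ) (s : ℂ) (Z : ℂ × ℂ) :
    (hlift c)^[n] (s • Z) = s ^ (d ^ n) • (hlift c)^[n] Z := by
  induction n generalizing s Z with
  | zero => simp
  | succ n ih =>
    rw [Function.iterate_succ_apply, hlift_smul, ih, Function.iterate_succ_apply, ← pow_mul,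
      pow_succ, mul_comm]

lemma contDiff_hlift : ContDiff ℂ ⊤ fun p : Par d × (ℂ × ℂ) => hlift p.1 p.2 := by
  unfold hlift hom
  fun_prop

lemma contDiff_iter (n : ℕ) : ContDiff ℂ ⊤ fun p : Par d × (ℂ × ℂ) => (hlift p.1)^[n] p.2 := by
  induction n with
  | zero => simpa using contDiff_snd
  | succ n ih =>
    simp only [Function.iterate_succ_apply']
    exact contDiff_hlift.comp (contDiff_fst.prodMk ih)

lemma continuous_iter (n : ℕ) : Continuous fun p : Par d × (ℂ × ℂ) => (hlift p.1)^[n] p.2 :=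
  (contDiff_iter n).continuous

lemma ND.iter_ne_zero {c : Par d} (hc : ND c) (n : ℕ) {Z : ℂ × ℂ} (hZ : Z ≠ 0) :
    (hlift c)^[n] Z ≠ 0 := by
  induction n with
  | zero => simpa
  | succ n ih => rw [Function.iterate_succ_apply']; exact hc _ ih

/-! #### The projection -/

@[simp] lemma prj_one (z : ℂ) : prj (z, 1) = z := by simp [prj]

@[simp] lemma prj_zero_right (z : ℂ) : prj (z, 0) = ∞ := by simp [prj]

lemma prj_smul {s : ℂ} (hs : s ≠ 0) (Z : ℂ × ℂ) : prj (s • Z) = prj Z := by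
  simp [prj, hs, mul_div_mul_left]

lemma exists_prj_eq (x : Sphere) : ∃ Z : ℂ × ℂ, Z ≠ 0 ∧ prj Z = x := by
  induction x using OnePoint.rec with
  | infty => exact ⟨(1, 0), by simp, by simp⟩
  | coe z => exact ⟨(z, 1), by simp, by simp⟩

lemma prj_eq_prj_iff {Z W : ℂ × ℂ} (hZ : Z ≠ 0) (hW : W ≠ 0) : prj Z = prj W ↔ br Z W = 0 := by
  obtain ⟨x, y⟩ := Z
  obtain ⟨u, v⟩ := W
  simp only [ne_eq, Prod.mk_eq_zero, not_and] at hZ hW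
  simp only [prj, br]
  by_cases hy : y = 0 <;> by_cases hv : v = 0
  · simp [hy, hv]
  · have hx : x ≠ 0 := fun h => hZ h hy
    simp [hy, hv, hx]
  · have hu : u ≠ 0 := fun h => hW h hv
    simp [hy, hv, hu]
  · simp only [hy, hv, if_false, OnePoint.coe_eq_coe]
    rw [div_eq_div_iff hy hv, sub_eq_zero, mul_comm u y]

lemma exists_smul_of_br_eq_zero {Z W : ℂ × ℂ} (hZ : Z ≠ 0) (h : br Z W = 0) :
    ∃ s : ℂ, W = s • Z := by
  obtain ⟨x, y⟩ := Z
  obtain ⟨u, v⟩ := W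
  simp only [br] at h
  by_cases hy : y = 0
  · have hx : x ≠ 0 := fun hx => hZ (by simp [hx, hy])
    refine ⟨u / x, ?_⟩
    simp only [hy, zero_mul, sub_zero, mul_eq_zero, hx, false_or] at h
    simp [hy, h, hx]
  · refine ⟨v / y, ?_⟩
    apply Prod.ext
    · simp only [Prod.smul_mk, smul_eq_mul]; field_simp; linear_combination -h
    · simp [hy]

lemma continuous_br : Continuous fun p : (ℂ × ℂ) × (ℂ × ℂ) => br p.1 p.2 := by
  unfold br; fun_prop

lemma continuousAt_prj {Z : ℂ × ℂ} (hZ : Z ≠ 0) : ContinuousAt prj Z := by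
  by_cases h : Z.2 = 0
  · have hx : Z.1 ≠ 0 := fun hx => hZ (Prod.ext hx h)
    have e : prj Z = ∞ := by simp [prj, h]
    rw [ContinuousAt, e, OnePoint.hasBasis_nhds_infty.tendsto_right_iff]
    rintro K ⟨-, hK⟩
    obtain ⟨M, hM⟩ := hK.isBounded.exists_norm_le
    have h1 : ∀ᶠ W : ℂ × ℂ in 𝓝 Z, M * ‖W.2‖ < ‖W.1‖ := by
      have hc : ContinuousAt (fun W : ℂ × ℂ => ‖W.1‖ - M * ‖W.2‖) Z := by fun_prop
      have := hc.eventually (lt_mem_nhds (a := 0) (by simpa [h] using hx))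
      filter_upwards [this] with W hW
      linarith
    filter_upwards [h1] with W hW
    by_cases h2 : W.2 = 0
    · simp [prj, h2]
    · left
      refine ⟨W.1 / W.2, fun hmem => ?_, by simp [prj, h2]⟩
      have := hM _ hmem
      rw [norm_div, div_le_iff₀ (norm_pos_iff.2 h2)] at this
      linarith
  · have : ContinuousAt (fun W : ℂ × ℂ => ((W.1 / W.2 : ℂ) : Sphere)) Z :=
      OnePoint.continuous_coe.continuousAt.comp
        (continuousAt_fst.div continuousAt_snd h)
    refine this.congr ?_
    filter_upwards [continuousAt_snd.eventually_ne h] with W hW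
    simp [prj, hW]

lemma sphereMap_prj {c : Par d} (hc : ND c) {Z : ℂ × ℂ} (hZ : Z ≠ 0) :
    sphereMap c (prj Z) = prj (hlift c Z) := by
  have key : ∀ z : ℂ, sphereMap c (prj (z, 1)) = prj (hlift c (z, 1)) := by
    intro z
    rw [prj_one]
    simp [sphereMap, ratEval, hlift, hom_one, prj]
  by_cases h : Z.2 = 0
  · have hx : Z.1 ≠ 0 := fun hx => hZ (Prod.ext hx h)
    have e : Z = Z.1 • ((1 : ℂ), (0 : ℂ)) := by apply Prod.ext <;> simp [h]
    rw [e, prj_smul hx, hlift_smul, prj_smul (pow_ne_zero _ hx), prj_zero_right]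
    have h0 := hc (1, 0) (by simp)
    have dl : ∀ a : Fin (d + 1) → ℂ, (polyOf a).coeff d ≠ 0 → (polyOf a).degree = d := by
      intro a ha
      refine le_antisymm ?_ (le_degree_of_ne_zero ha)
      exact degree_le_of_natDegree_le (polyOf_natDegree_le a)
    have dl' : ∀ a : Fin (d + 1) → ℂ, (polyOf a).coeff d = 0 → (polyOf a).degree < d := by
      intro a ha
      refine lt_of_le_of_ne (degree_le_of_natDegree_le (polyOf_natDegree_le a)) fun h => ?_
      exact coeff_ne_zero_of_eq_degree h ha
    have lc : ∀ a : Fin (d + 1) → ℂ, (polyOf a).coeff d ≠ 0 →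
        (polyOf a).leadingCoeff = (polyOf a).coeff d := by
      intro a ha
      rw [leadingCoeff, natDegree_eq_of_degree_eq_some (dl a ha)]
    simp only [hlift, hom_zero_right, one_pow, mul_one, ne_eq, Prod.mk_eq_zero, not_and] at h0 ⊢
    simp only [sphereMap, ratEval, if_true, prj]
    by_cases h1 : (polyOf c.1).coeff d = 0 <;> by_cases h2 : (polyOf c.2).coeff d = 0
    · exact absurd h2 (h0 h1)
    · have := dl' _ h1
      have h3 := dl _ h2
      rw [h3, if_neg this.not_gt, if_pos this, if_neg h2, h1, zero_div]
    · have := dl' _ h2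
      have h3 := dl _ h1
      rw [h3, if_pos this, if_pos h2]
    · rw [dl _ h1, dl _ h2, if_neg (lt_irrefl _), if_neg (lt_irrefl _), lc _ h1, lc _ h2,
        if_neg h2]
  · have e : Z = Z.2 • (Z.1 / Z.2, (1 : ℂ)) := by
      apply Prod.ext
      · simp only [Prod.smul_mk, smul_eq_mul]; field_simp
      · simp
    rw [e, prj_smul h, hlift_smul, prj_smul (pow_ne_zero _ h), key]

lemma iterate_sphereMap_prj {c : Par d} (hc : ND c) (n : ℕ) {Z : ℂ × ℂ} (hZ : Z ≠ 0) :
    (sphereMap c)^[n] (prj Z) = prj ((hlift c)^[n] Z) := by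
  induction n with
  | zero => rfl
  | succ n ih =>
    rw [Function.iterate_succ_apply', Function.iterate_succ_apply', ih,
      sphereMap_prj hc (hc.iter_ne_zero n hZ)]

lemma nd_iff (hd : 2 ≤ d) (c : Par d) :
    ND c ↔ IsCoprime (polyOf c.1) (polyOf c.2) ∧
      max (polyOf c.1).natDegree (polyOf c.2).natDegree = d := by
  constructor
  · intro h
    have h0 := h (1, 0) (by simp)
    simp only [hlift, hom_zero_right, one_pow, mul_one, ne_eq, Prod.mk_eq_zero, not_and] at h0
    refine ⟨?_, ?_⟩
    · rw [isCoprime_iff_aeval_ne_zero_of_isAlgClosed ℂ ℂ]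
      intro z
      have := h (z, 1) (by simp)
      simp only [hlift, hom_one, ne_eq, Prod.mk_eq_zero, not_and_or] at this
      simpa using this
    · refine le_antisymm (max_le (polyOf_natDegree_le _) (polyOf_natDegree_le _)) ?_
      by_cases h1 : (polyOf c.1).coeff d = 0
      · exact le_max_of_le_right (le_natDegree_of_ne_zero (h0 h1))
      · exact le_max_of_le_left (le_natDegree_of_ne_zero h1)
  · rintro ⟨h1, h2⟩ Z hZ h0
    simp only [hlift, Prod.mk_eq_zero] at h0
    by_cases h : Z.2 = 0
    · have hx : Z.1 ≠ 0 := fun hx => hZ (Prod.ext hx h)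
      have e : Z = (Z.1, 0) := Prod.ext rfl h
      rw [e, hom_zero_right, hom_zero_right] at h0
      simp only [mul_eq_zero, pow_eq_zero_iff', hx, false_and, or_false] at h0
      have hn : ∀ a : Fin (d + 1) → ℂ, (polyOf a).coeff d = 0 → (polyOf a).natDegree ≠ d := by
        intro a ha h
        have : (polyOf a).leadingCoeff = 0 := by rw [leadingCoeff, h, ha]
        rw [leadingCoeff_eq_zero] at this
        rw [this, natDegree_zero] at h
        lia
      rcases max_choice (polyOf c.1).natDegree (polyOf c.2).natDegree with h3 | h3
      · exact hn _ h0.1 (h3.symm.trans h2)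
      · exact hn _ h0.2 (h3.symm.trans h2)
    · have e : Z = Z.2 • (Z.1 / Z.2, (1 : ℂ)) := by
        apply Prod.ext
        · simp only [Prod.smul_mk, smul_eq_mul]; field_simp
        · simp
      rw [e, hom_smul, hom_smul, hom_one, hom_one] at h0
      simp only [mul_eq_zero, pow_eq_zero_iff', h, false_and, false_or] at h0
      obtain ⟨u, v, huv⟩ := h1
      have := congrArg (eval (Z.1 / Z.2)) huv
      simp [h0.1, h0.2] at this

/-! #### Nondegeneracy is open; continuity -/

lemma isOpen_nd : IsOpen {c : Par d | ND c} := by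
  rw [isOpen_iff_mem_nhds]
  intro c hc
  have h := (isCompact_sphere (0 : ℂ × ℂ) 1).eventually_forall_of_forall_eventually (x₀ := c)
    (P := fun c Z => hlift c Z ≠ 0) fun Z hZ =>
      (contDiff_hlift.continuous.continuousAt (x := (c, Z))).eventually_ne
        (hc Z (fun h0 => by simp [h0] at hZ))
  filter_upwards [h] with c' h Z hZ h0
  have hn : (‖Z‖ : ℂ) ≠ 0 := by simpa using hZ
  refine h ((‖Z‖ : ℂ)⁻¹ • Z) ?_ ?_
  · simp [norm_smul, hZ]
  · rw [hlift_smul, h0, smul_zero]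

lemma exists_section (x : Sphere) : ∃ σ : Sphere → ℂ × ℂ, ContinuousAt σ x ∧
    ∀ y, σ y ≠ 0 ∧ (y = x → prj (σ y) = y) ∧ ∀ᶠ y in 𝓝 x, prj (σ y) = y := by
  induction x using OnePoint.rec with
  | infty =>
    refine ⟨fun y => if y = ∞ then (1, 0) else (1, (toC y)⁻¹), ?_, fun y => ⟨?_, ?_, ?_⟩⟩
    · rw [ContinuousAt, OnePoint.nhds_infty_eq, tendsto_sup]
      refine ⟨?_, ?_⟩
      · rw [tendsto_map'_iff]
        simp only [if_true]
        refine Tendsto.congr (f₁ := fun z : ℂ => ((1 : ℂ), z⁻¹)) (fun z => by simp) ?_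
        rw [coclosedCompact_eq_cocompact, ← Metric.cobounded_eq_cocompact]
        exact (tendsto_const_nhds.prodMk_nhds tendsto_inv₀_cobounded)
      · rw [tendsto_pure_left]
        intro s hs
        exact mem_of_mem_nhds hs
    · dsimp only
      split_ifs <;> simp
    · rintro rfl; simp
    · have h1 : ∀ᶠ y : Sphere in 𝓝 ∞, y ≠ ((0 : ℂ) : Sphere) :=
        isOpen_ne.mem_nhds (OnePoint.infty_ne_coe _)
      filter_upwards [h1] with y hy
      induction y using OnePoint.rec with
      | infty => simp
      | coe z =>
        have : z ≠ 0 := fun h => hy (by rw [h])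
        simp [prj, this]
  | coe z =>
    refine ⟨fun y => (toC y, 1), ?_, fun y => ⟨by simp, ?_, ?_⟩⟩
    · rw [ContinuousAt, OnePoint.nhds_coe_eq, tendsto_map'_iff]
      simp only [toC_coe]
      have : ((fun y : Sphere => (toC y, (1 : ℂ))) ∘ ((↑) : ℂ → Sphere)) = fun z => (z, 1) := by
        ext z <;> simp
      rw [this]
      exact (continuous_id.prodMk continuous_const).continuousAt
    · rintro rfl; simp
    · rw [OnePoint.nhds_coe_eq, eventually_map]
      exact Eventually.of_forall fun w => by simp

lemma continuousAt_iterate {c : Par d} (hc : ND c) (n : ℕ) (x : Sphere) :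
    ContinuousAt (fun p : Par d × Sphere => (sphereMap p.1)^[n] p.2) (c, x) := by
  obtain ⟨σ, hσ, h⟩ := exists_section x
  have e : (fun p : Par d × Sphere => (sphereMap p.1)^[n] p.2) =ᶠ[𝓝 (c, x)]
      fun p => prj ((hlift p.1)^[n] (σ p.2)) := by
    have h1 : ∀ᶠ p : Par d × Sphere in 𝓝 (c, x), ND p.1 :=
      (continuous_fst.tendsto (c, x)).eventually (isOpen_nd.mem_nhds hc)
    have h2 : ∀ᶠ p : Par d × Sphere in 𝓝 (c, x), prj (σ p.2) = p.2 :=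
      (continuous_snd.tendsto (c, x)).eventually (h x).2.2
    filter_upwards [h1, h2] with p hp hp'
    rw [← iterate_sphereMap_prj hp n (h _).1, hp']
  have e0 : (sphereMap c)^[n] x = prj ((hlift c)^[n] (σ x)) := e.self_of_nhds
  rw [ContinuousAt, e0]
  refine Tendsto.congr' e.symm ?_
  have h1 : Tendsto (fun p : Par d × Sphere => (p.1, σ p.2)) (𝓝 (c, x)) (𝓝 (c, σ x)) :=
    (continuous_fst.tendsto (c, x)).prodMk_nhds (hσ.tendsto.comp (continuous_snd.tendsto (c, x)))
  have h2 : Tendsto (fun p : Par d × Sphere => (hlift p.1)^[n] (σ p.2)) (𝓝 (c, x))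
      (𝓝 ((hlift c)^[n] (σ x))) := by
    have := ((continuous_iter n).tendsto (c, σ x)).comp h1
    simpa only [Function.comp_def] using this
  exact (continuousAt_prj (hc.iter_ne_zero n (h x).1)).tendsto.comp h2

lemma ND.continuous_iterate {c : Par d} (hc : ND c) (n : ℕ) :
    Continuous (sphereMap c)^[n] :=
  continuous_iff_continuousAt.2 fun x =>
    (continuousAt_iterate hc n x).comp (f := fun x => (c, x))
      (continuousAt_const.prodMk continuousAt_id)

lemma ND.continuous {c : Par d} (hc : ND c) : Continuous (sphereMap c) :=
  hc.continuous_iterate 1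

section

variable {d : ℕ}

/-! ### Periodic points in homogeneous coordinates -/

/-- The form whose zeros are the fixed points of the `n`-th iterate. -/
def Phi {R : Type*} [CommRing R] (n : ℕ) (c : (Fin (d + 1) → R) × (Fin (d + 1) → R))
    (Z : R × R) : R :=
  br ((hlift c)^[n] Z) Z

lemma br_smul_left (s : ℂ) (Z W : ℂ × ℂ) : br (s • Z) W = s * br Z W := by
  simp [br]; ring

lemma br_smul_right (s : ℂ) (Z W : ℂ × ℂ) : br Z (s • W) = s * br Z W := by
  simp [br]; ring

lemma br_add_right (Z W W' : ℂ × ℂ) : br Z (W + W') = br Z W + br Z W' := by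
  simp [br]; ring

lemma br_add_left (Z Z' W : ℂ × ℂ) : br (Z + Z') W = br Z W + br Z' W := by
  simp [br]; ring

@[simp] lemma br_self (Z : ℂ × ℂ) : br Z Z = 0 := by simp [br]; ring

lemma br_swap (Z W : ℂ × ℂ) : br Z W = - br W Z := by simp [br]; ring

/-- Expansion of a vector in a basis. -/
lemma br_expand (A B Z : ℂ × ℂ) : br A B • Z = br Z B • A + br A Z • B := by
  apply Prod.ext <;> simp [br] <;> ring

lemma contDiff_br : ContDiff ℂ ⊤ fun p : (ℂ × ℂ) × (ℂ × ℂ) => br p.1 p.2 := by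
  unfold br; fun_prop

lemma contDiff_phi (n : ℕ) : ContDiff ℂ ⊤ fun p : Par d × (ℂ × ℂ) => Phi n p.1 p.2 := by
  have := contDiff_br.comp ((contDiff_iter (d := d) n).prodMk contDiff_snd)
  simpa only [Function.comp_def, Phi] using this

lemma contDiff_phi_right (n : ℕ) (c : Par d) : ContDiff ℂ ⊤ (Phi n c) := by
  have := (contDiff_phi (d := d) n).comp (contDiff_prodMk_right c)
  simpa only [Function.comp_def] using this

lemma contDiff_iter_right (n : ℕ) (c : Par d) : ContDiff ℂ ⊤ (hlift c)^[n] := by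
  have := (contDiff_iter (d := d) n).comp (contDiff_prodMk_right c)
  simpa only [Function.comp_def] using this

lemma phi_smul (n : ℕ) (c : Par d) (s : ℂ) (Z : ℂ × ℂ) :
    Phi n c (s • Z) = s ^ (d ^ n + 1) * Phi n c Z := by
  rw [Phi, iter_smul, br_smul_left, br_smul_right, Phi]; ring

lemma phi_eq_zero_iff {c : Par d} (hc : ND c) (n : ℕ) {Z : ℂ × ℂ} (hZ : Z ≠ 0) :
    Phi n c Z = 0 ↔ (sphereMap c)^[n] (prj Z) = prj Z := by
  rw [iterate_sphereMap_prj hc n hZ, prj_eq_prj_iff (hc.iter_ne_zero n hZ) hZ, Phi]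

/-- A homogeneous function of degree `e` is an eigenvector of its derivative along the radius. -/
lemma fderiv_radial {E : Type*} [NormedAddCommGroup E] [NormedSpace ℂ E] {L : ℂ × ℂ → E}
    {e : ℕ} (hL : Differentiable ℂ L) (h : ∀ (s : ℂ) Z, L (s • Z) = s ^ e • L Z) (Z : ℂ × ℂ) :
    fderiv ℂ L Z Z = (e : ℂ) • L Z := by
  have h1 : HasDerivAt (fun s : ℂ => s • Z) Z 1 := by
    simpa using (hasDerivAt_id (1 : ℂ)).smul_const Z
  have h2 : HasDerivAt (fun s : ℂ => L (s • Z)) (fderiv ℂ L Z Z) 1 := by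
    have h3 : HasFDerivAt L (fderiv ℂ L Z) ((1 : ℂ) • Z) := by
      rw [one_smul]; exact (hL Z).hasFDerivAt
    exact h3.comp_hasDerivAt (1 : ℂ) h1
  have h3 : HasDerivAt (fun s : ℂ => s ^ e • L Z) ((e : ℂ) • L Z) 1 := by
    simpa using (hasDerivAt_pow e (1 : ℂ)).smul_const (L Z)
  simp only [h] at h2
  exact h2.unique h3

lemma fderiv_phi_radial (n : ℕ) (c : Par d) (Z : ℂ × ℂ) :
    fderiv ℂ (Phi n c) Z Z = (d ^ n + 1 : ℕ) * Phi n c Z :=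
  fderiv_radial ((contDiff_phi_right n c).differentiable (by simp)) (phi_smul n c) Z

/-- All fixed points of the `n`-th iterate are simple. -/
def NP (n : ℕ) (c : Par d) : Prop :=
  ∀ Z : ℂ × ℂ, Z ≠ 0 → Phi n c Z = 0 → ∀ B, br Z B ≠ 0 → fderiv ℂ (Phi n c) Z B ≠ 0

/-- The derivative of `Phi` along an affine line. -/
lemma hasDerivAt_phi_line (n : ℕ) (c : Par d) (A B : ℂ × ℂ) (w : ℂ) :
    HasDerivAt (fun w : ℂ => Phi n c (A + w • B)) (fderiv ℂ (Phi n c) (A + w • B) B) w := by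
  have h1 : HasDerivAt (fun w : ℂ => A + w • B) B w := by
    simpa using ((hasDerivAt_id w).smul_const B).const_add A
  exact (((contDiff_phi_right n c).differentiable (by simp)) _).hasFDerivAt.comp_hasDerivAt w h1

lemma fderiv_ne_zero_of_exists {n : ℕ} {c : Par d} {Z B B' : ℂ × ℂ} (h0 : Phi n c Z = 0)
    (hB : br Z B ≠ 0) (h : fderiv ℂ (Phi n c) Z B' ≠ 0) : fderiv ℂ (Phi n c) Z B ≠ 0 := by
  intro h1
  have := congrArg (fderiv ℂ (Phi n c) Z) (br_expand Z B B')
  rw [map_add, _root_.map_smul, _root_.map_smul, _root_.map_smul, h1, fderiv_phi_radial, h0] at this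
  simp [hB] at this
  exact h this

/-! #### Polynomials -/

/-- `P` has degree at most `N`, with coefficient `r` in degree `N`. -/
def HasLead {R : Type*} [CommRing R] (N : ℕ) (P : R[X]) (r : R) : Prop :=
  P.natDegree ≤ N ∧ P.coeff N = r

namespace HasLead

variable {R : Type*} [CommRing R] {N M : ℕ} {P Q : R[X]} {r s : R}

lemma mul (h : HasLead N P r) (h' : HasLead M Q s) : HasLead (N + M) (P * Q) (r * s) :=
  ⟨natDegree_mul_le_of_le h.1 h'.1, by
    rw [coeff_mul_add_eq_of_natDegree_le h.1 h'.1, h.2, h'.2]⟩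

lemma pow (h : HasLead N P r) (k : ℕ) : HasLead (k * N) (P ^ k) (r ^ k) := by
  refine ⟨natDegree_pow_le_of_le k h.1, ?_⟩
  rw [coeff_pow_of_natDegree_le h.1, h.2]

lemma sub (h : HasLead N P r) (h' : HasLead N Q s) : HasLead N (P - Q) (r - s) :=
  ⟨natDegree_sub_le_of_le h.1 h'.1 |>.trans (by simp), by rw [coeff_sub, h.2, h'.2]⟩

lemma sum {ι : Type*} {t : Finset ι} {P : ι → R[X]} {r : ι → R}
    (h : ∀ i ∈ t, HasLead N (P i) (r i)) : HasLead N (∑ i ∈ t, P i) (∑ i ∈ t, r i) :=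
  ⟨natDegree_sum_le_of_forall_le _ _ fun i hi => (h i hi).1, by
    rw [finsetSum_coeff]; exact Finset.sum_congr rfl fun i hi => (h i hi).2⟩

lemma C_mul (h : HasLead N P r) (a : R) : HasLead N (C a * P) (a * r) :=
  ⟨(natDegree_C_mul_le _ _).trans h.1, by rw [coeff_C_mul, h.2]⟩

end HasLead

lemma map_hom {R S : Type*} [CommRing R] [CommRing S] (φ : R →+* S) (a : Fin (d + 1) → R)
    (Z : R × R) : φ (hom a Z) = hom (fun i => φ (a i)) (Prod.map φ φ Z) := by
  simp [hom]

lemma map_iter {R S : Type*} [CommRing R] [CommRing S] (φ : R →+* S)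
    (c : (Fin (d + 1) → R) × (Fin (d + 1) → R)) (n : ℕ) (Z : R × R) :
    Prod.map φ φ ((hlift c)^[n] Z) =
      (hlift ((fun i => φ (c.1 i)), (fun i => φ (c.2 i))))^[n] (Prod.map φ φ Z) := by
  induction n with
  | zero => rfl
  | succ n ih =>
    rw [Function.iterate_succ_apply', Function.iterate_succ_apply', ← ih]
    simp [hlift, map_hom]

lemma map_phi {R S : Type*} [CommRing R] [CommRing S] (φ : R →+* S)
    (c : (Fin (d + 1) → R) × (Fin (d + 1) → R)) (n : ℕ) (Z : R × R) :
    φ (Phi n c Z) = Phi n ((fun i => φ (c.1 i)), (fun i => φ (c.2 i))) (Prod.map φ φ Z) := by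
  rw [Phi, Phi, ← map_iter]
  simp [br]

/-- The restriction of `Phi` to the affine line `A + X B`, as a polynomial. -/
def phiLine {R : Type*} [CommRing R] (n : ℕ) (c : (Fin (d + 1) → R) × (Fin (d + 1) → R))
    (A B : R × R) : R[X] :=
  Phi n ((fun i => C (c.1 i)), (fun i => C (c.2 i))) (C A.1 + C B.1 * X, C A.2 + C B.2 * X)

lemma hasLead_line {R : Type*} [CommRing R] (a b : R) : HasLead 1 (C a + C b * X) b := by
  refine ⟨?_, by simp [coeff_C]⟩
  exact natDegree_add_le_of_degree_le (by simp) (natDegree_C_mul_le _ _ |>.trans natDegree_X_le)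

lemma hasLead_hom {R : Type*} [CommRing R] {N : ℕ} {P Q : R[X]} {r s : R} (a : Fin (d + 1) → R)
    (h : HasLead N P r) (h' : HasLead N Q s) :
    HasLead (N * d) (hom (fun i => C (a i)) (P, Q)) (hom a (r, s)) := by
  refine HasLead.sum fun i _ => ?_
  have := ((h.pow (i : ℕ)).mul (h'.pow (d - i))).C_mul (a i)
  have e : (i : ℕ) * N + (d - i) * N = N * d := by
    rw [← add_mul, mul_comm]; congr 1; have := i.2; lia
  rw [e] at this
  simpa [mul_assoc] using this

lemma hasLead_iter {R : Type*} [CommRing R] (n : ℕ) (c : (Fin (d + 1) → R) × (Fin (d + 1) → R))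
    (A B : R × R) :
    HasLead (d ^ n) ((hlift ((fun i => C (c.1 i)), (fun i => C (c.2 i))))^[n]
      (C A.1 + C B.1 * X, C A.2 + C B.2 * X)).1 ((hlift c)^[n] B).1 ∧
    HasLead (d ^ n) ((hlift ((fun i => C (c.1 i)), (fun i => C (c.2 i))))^[n]
      (C A.1 + C B.1 * X, C A.2 + C B.2 * X)).2 ((hlift c)^[n] B).2 := by
  induction n with
  | zero => exact ⟨by simpa using hasLead_line _ _, by simpa using hasLead_line _ _⟩
  | succ n ih =>
    rw [Function.iterate_succ_apply', Function.iterate_succ_apply', pow_succ]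
    exact ⟨hasLead_hom _ ih.1 ih.2, hasLead_hom _ ih.1 ih.2⟩

lemma hasLead_phiLine {R : Type*} [CommRing R] (n : ℕ)
    (c : (Fin (d + 1) → R) × (Fin (d + 1) → R)) (A B : R × R) :
    HasLead (d ^ n + 1) (phiLine n c A B) (Phi n c B) :=
  ((hasLead_iter n c A B).1.mul (hasLead_line _ _)).sub
    ((hasLead_iter n c A B).2.mul (hasLead_line _ _))

lemma eval_phiLine (n : ℕ) (c : Par d) (A B : ℂ × ℂ) (w : ℂ) :
    (phiLine n c A B).eval w = Phi n c (A + w • B) := by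
  have := map_phi (evalRingHom w) ((fun i => C (c.1 i)), (fun i => C (c.2 i))) n
    (C A.1 + C B.1 * X, C A.2 + C B.2 * X)
  simp only [coe_evalRingHom, Prod.map] at this
  rw [phiLine, this]
  congr 1
  · simp only [eval_C]
  · apply Prod.ext <;>
    simp only [eval_add, eval_mul, eval_C, eval_X, Prod.fst_add, Prod.snd_add, Prod.smul_fst,
      Prod.smul_snd, smul_eq_mul, mul_comm]

lemma eval_derivative_phiLine (n : ℕ) (c : Par d) (A B : ℂ × ℂ) (w : ℂ) :
    (derivative (phiLine n c A B)).eval w = fderiv ℂ (Phi n c) (A + w • B) B := by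
  have h1 := (phiLine n c A B).hasDerivAt w
  simp only [eval_phiLine] at h1
  exact h1.unique (hasDerivAt_phi_line n c A B w)

lemma map_phiLine {R S : Type*} [CommRing R] [CommRing S] (φ : R →+* S) (n : ℕ)
    (c : (Fin (d + 1) → R) × (Fin (d + 1) → R)) (A B : R × R) :
    (phiLine n c A B).map φ =
      phiLine n ((fun i => φ (c.1 i)), (fun i => φ (c.2 i))) (Prod.map φ φ A) (Prod.map φ φ B) := by
  have := map_phi (mapRingHom φ) ((fun i => C (c.1 i)), (fun i => C (c.2 i))) n
    (C A.1 + C B.1 * X, C A.2 + C B.2 * X)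
  rw [coe_mapRingHom] at this
  rw [phiLine, this, phiLine]
  simp

/-! ### Finiteness of degenerate parameters -/

/-- If one specialization of a polynomial family has full degree and simple roots, then only
finitely many specializations have a multiple root. -/
lemma finite_multiple_root (P : ℂ[X][X]) (N : ℕ) (hP : P.natDegree ≤ N + 1)
    (hlead : (P.map (evalRingHom 1)).natDegree = N + 1)
    (hsimple : ∀ w, (P.map (evalRingHom 1)).eval w = 0 →
      (derivative (P.map (evalRingHom 1))).eval w ≠ 0) :
    {t : ℂ | ∃ w, (P.map (evalRingHom t)).eval w = 0 ∧
      (derivative (P.map (evalRingHom t))).eval w = 0}.Finite := by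
  set Δ : ℂ[X] := resultant P (derivative P) (N + 1) N with hΔ
  have hd : (derivative P).natDegree ≤ N := (natDegree_derivative_le P).trans (by lia)
  have hmap : ∀ t : ℂ, Δ.eval t =
      resultant (P.map (evalRingHom t)) (derivative (P.map (evalRingHom t))) (N + 1) N := by
    intro t
    rw [derivative_map, resultant_map_map]; rfl
  have h1 : Δ.eval 1 ≠ 0 := by
    rw [hmap]
    have h2 : (derivative (P.map (evalRingHom (1 : ℂ)))).natDegree = N := by
      rw [natDegree_derivative, hlead]; rfl
    have := resultant_ne_zero (P.map (evalRingHom (1 : ℂ)))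
      (derivative (P.map (evalRingHom (1 : ℂ)))) ?_
    · rwa [hlead, h2] at this
    · rw [isCoprime_iff_aeval_ne_zero_of_isAlgClosed ℂ ℂ]
      intro w
      simp only [coe_aeval_eq_eval]
      by_cases h : (P.map (evalRingHom (1 : ℂ))).eval w = 0
      · exact Or.inr (hsimple w h)
      · exact Or.inl h
  have hΔ0 : Δ ≠ 0 := fun h => h1 (by rw [h, eval_zero])
  refine (Δ.roots.toFinset.finite_toSet).subset ?_
  rintro t ⟨w, hw1, hw2⟩
  simp only [Finset.mem_coe, Multiset.mem_toFinset, mem_roots hΔ0, IsRoot.def]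
  rw [hmap]
  obtain ⟨p, q, -, -, h⟩ := exists_mul_add_mul_eq_C_resultant (P.map (evalRingHom t))
    (derivative (P.map (evalRingHom t))) (m := N + 1) (n := N)
    ((natDegree_map_le).trans hP) (by rw [derivative_map]; exact natDegree_map_le.trans hd) (by lia)
  have := congrArg (eval w) h
  rw [eval_add, eval_mul, eval_mul, hw1, hw2, eval_C] at this
  simpa using this.symm

/-- The coefficients of the map `z ↦ z ^ d`. -/
def powPar (d : ℕ) : Par d := (Pi.single (Fin.last d) 1, Pi.single 0 1)

lemma hlift_powPar (Z : ℂ × ℂ) : hlift (powPar d) Z = (Z.1 ^ d, Z.2 ^ d) := by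
  simp only [hlift, hom, powPar]
  congr 1
  · rw [Finset.sum_eq_single (Fin.last d)]
    · simp
    · intro i _ hi; simp [hi]
    · simp
  · rw [Finset.sum_eq_single 0]
    · simp
    · intro i _ hi; simp [hi]
    · simp

lemma phi_powPar (n : ℕ) (Z : ℂ × ℂ) :
    Phi n (powPar d) Z = Z.1 ^ d ^ n * Z.2 - Z.2 ^ d ^ n * Z.1 := by
  have : ∀ n, (hlift (powPar d))^[n] Z = (Z.1 ^ d ^ n, Z.2 ^ d ^ n) := by
    intro n
    induction n with
    | zero => simp
    | succ n ih => rw [Function.iterate_succ_apply', ih, hlift_powPar, pow_succ, pow_mul, pow_mul]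
  rw [Phi, this, br]

lemma np_powPar (hd : 2 ≤ d) {n : ℕ} (hn : 1 ≤ n) : NP n (powPar d) := by
  intro Z hZ h0 B hB h1
  have hN : 2 ≤ d ^ n := hd.trans (Nat.le_self_pow (by lia) d)
  obtain ⟨N, hN'⟩ : ∃ N, d ^ n = N + 1 := ⟨d ^ n - 1, by lia⟩
  have hN0 : N ≠ 0 := by lia
  have hall : ∀ B', fderiv ℂ (Phi n (powPar d)) Z B' = 0 := by
    intro B'
    by_contra h
    exact fderiv_ne_zero_of_exists h0 hB h h1
  have hx : HasDerivAt (fun w : ℂ => Phi n (powPar d) (Z + w • (1, 0)))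
      ((N + 1) * Z.1 ^ N * Z.2 - Z.2 ^ (N + 1)) 0 := by
    simp only [phi_powPar, hN', Prod.fst_add, Prod.snd_add, Prod.smul_fst, Prod.smul_snd,
      smul_eq_mul, mul_one, mul_zero, add_zero]
    have h := ((((hasDerivAt_id (0 : ℂ)).const_add Z.1).pow (N + 1)).mul_const Z.2).sub
      ((((hasDerivAt_id (0 : ℂ)).const_add Z.1)).const_mul (Z.2 ^ (N + 1)))
    refine h.congr_deriv ?_
    simp
  have hy : HasDerivAt (fun w : ℂ => Phi n (powPar d) (Z + w • (0, 1)))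
      (Z.1 ^ (N + 1) - (N + 1) * Z.2 ^ N * Z.1) 0 := by
    simp only [phi_powPar, hN', Prod.fst_add, Prod.snd_add, Prod.smul_fst, Prod.smul_snd,
      smul_eq_mul, mul_one, mul_zero, add_zero]
    have h := ((((hasDerivAt_id (0 : ℂ)).const_add Z.2)).const_mul (Z.1 ^ (N + 1))).sub
      ((((hasDerivAt_id (0 : ℂ)).const_add Z.2).pow (N + 1)).mul_const Z.1)
    refine h.congr_deriv ?_
    simp
  have ex := hx.unique (hasDerivAt_phi_line n (powPar d) Z (1, 0) 0)
  have ey := hy.unique (hasDerivAt_phi_line n (powPar d) Z (0, 1) 0)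
  rw [zero_smul, add_zero, hall] at ex ey
  obtain ⟨x, y⟩ := Z
  simp only at ex ey
  have hNc : ((N : ℂ) + 1) ^ 2 - 1 ≠ 0 := by
    have : ((N : ℂ) + 1) ^ 2 - 1 = N * (N + 2) := by ring
    rw [this]
    have h2 : ((N : ℂ) + 2) ≠ 0 := by exact_mod_cast (by lia : N + 2 ≠ 0)
    exact mul_ne_zero (by exact_mod_cast hN0) h2
  have key : ∀ x y : ℂ, (N + 1) * x ^ N * y - y ^ (N + 1) = 0 →
      x ^ (N + 1) - (N + 1) * y ^ N * x = 0 → x = 0 := by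
    intro x y h1 h2
    by_contra hx
    have e1 : x ^ N = (N + 1) * y ^ N := by
      apply mul_right_cancel₀ hx; rw [← pow_succ]; linear_combination h2
    by_cases hy : y = 0
    · rw [hy, zero_pow hN0, mul_zero] at e1
      exact hx (by simpa [hN0] using e1)
    · have e2 : y ^ N = (N + 1) * x ^ N := by
        apply mul_right_cancel₀ hy; rw [← pow_succ]; linear_combination -h1
      have : (((N : ℂ) + 1) ^ 2 - 1) * x ^ N = 0 := by
        linear_combination -e1 - (N + 1) * e2
      rcases mul_eq_zero.1 this with h | h
      · exact hNc h
      · exact hx (pow_eq_zero_iff hN0 |>.1 h)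
  have hx0 := key x y ex ey
  have hy0 : y = 0 := by
    rw [hx0] at ex
    simpa [hN0] using ex
  exact hZ (by rw [hx0, hy0]; rfl)

lemma exists_transverse (hd : 2 ≤ d) {n : ℕ} (hn : 1 ≤ n) {A : ℂ × ℂ} (hA : A ≠ 0) :
    ∃ B : ℂ × ℂ, br A B ≠ 0 ∧ Phi n (powPar d) B ≠ 0 := by
  have hN : 2 ≤ d ^ n := hd.trans (Nat.le_self_pow (by lia) d)
  have h1 : (X ^ d ^ n - X : ℂ[X]) ≠ 0 := by
    intro h
    have := congrArg (fun p => coeff p (d ^ n)) h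
    simp [coeff_X, show ¬ (1 = d ^ n) by lia] at this
  have h2 : (C A.1 - C A.2 * X : ℂ[X]) ≠ 0 := by
    intro h
    apply hA
    have h0 := congrArg (fun p => coeff p 0) h
    have h1 := congrArg (fun p => coeff p 1) h
    simp [coeff_C] at h0 h1
    exact Prod.ext h0 h1
  obtain ⟨s, hs⟩ : ∃ s, ((X ^ d ^ n - X) * (C A.1 - C A.2 * X) : ℂ[X]).eval s ≠ 0 := by
    by_contra! h
    exact mul_ne_zero h1 h2 (Polynomial.funext fun r => by rw [h, eval_zero])
  simp only [eval_mul, eval_sub, eval_pow, eval_X, eval_C, ne_eq, mul_eq_zero, not_or] at hs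
  refine ⟨(s, 1), ?_, ?_⟩
  · simpa [br] using hs.2
  · simpa [phi_powPar] using hs.1

/-- Along a segment towards `z ↦ z ^ d`, multiple fixed points are exceptional. -/
lemma finite_multiple_phi (hd : 2 ≤ d) {n : ℕ} (hn : 1 ≤ n) (c : Par d) {A B : ℂ × ℂ}
    (hAB : br A B ≠ 0) (hB : Phi n (powPar d) B ≠ 0) :
    {t : ℂ | ∃ w : ℂ, Phi n (c + t • (powPar d - c)) (A + w • B) = 0 ∧
      fderiv ℂ (Phi n (c + t • (powPar d - c))) (A + w • B) B = 0}.Finite := by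
  set P : ℂ[X][X] := phiLine n (R := ℂ[X])
    ((fun i => C (c.1 i) + X * C ((powPar d - c).1 i)),
      (fun i => C (c.2 i) + X * C ((powPar d - c).2 i))) (C A.1, C A.2) (C B.1, C B.2) with hP
  have hmap : ∀ t : ℂ, P.map (evalRingHom t) = phiLine n (c + t • (powPar d - c)) A B := by
    intro t
    rw [hP, map_phiLine]
    congr 1
    · apply Prod.ext <;> funext i <;> simp
    · simp
    · simp
  have hl := hasLead_phiLine n (powPar d) A B
  have e1 : c + (1 : ℂ) • (powPar d - c) = powPar d := by simp
  have := finite_multiple_root P (d ^ n) (hasLead_phiLine n _ _ _).1 ?_ ?_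
  · refine this.subset ?_
    rintro t ⟨w, h1, h2⟩
    refine ⟨w, ?_, ?_⟩
    · rw [hmap, eval_phiLine, h1]
    · rw [hmap, eval_derivative_phiLine, h2]
  · rw [hmap, e1]
    refine le_antisymm hl.1 (le_natDegree_of_ne_zero ?_)
    rw [hl.2]; exact hB
  · intro w hw
    rw [hmap, e1] at hw ⊢
    rw [eval_phiLine] at hw
    rw [eval_derivative_phiLine]
    have hbr : br (A + w • B) B ≠ 0 := by
      rw [br_add_left, br_smul_left, br_self]; simpa using hAB
    refine np_powPar hd hn _ (fun h => hbr ?_) hw B hbr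
    rw [h]; simp [br]

end

section

open Metric

/-! ### Sums over the roots of a polynomial family -/

/-- Holomorphic dependence of a circle integral on a parameter. -/
lemma differentiableOn_circleIntegral {G : ℂ × ℂ → ℂ} {r ε : ℝ} (hε : 0 ≤ ε)
    (hG : ∀ t ∈ ball (0 : ℂ) r, ∀ w ∈ sphere (0 : ℂ) ε, ContDiffAt ℂ 1 G (t, w)) :
    DifferentiableOn ℂ (fun t => ∮ w in C(0, ε), G (t, w)) (ball 0 r) := by
  intro t₀ ht₀
  obtain ⟨ρ, hρ, hsub⟩ := nhds_basis_closedBall.mem_iff.1 (isOpen_ball.mem_nhds ht₀)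
  have hcm : ∀ θ, circleMap (0 : ℂ) ε θ ∈ sphere (0 : ℂ) ε := circleMap_mem_sphere 0 hε
  have hD : ContinuousOn (fun u : ℂ × ℂ => fderiv ℂ G u (1, 0))
      (closedBall t₀ ρ ×ˢ sphere (0 : ℂ) ε) := by
    intro u hu
    have : ContinuousAt (fderiv ℂ G) u :=
      ((hG u.1 (hsub hu.1) u.2 hu.2).fderiv_right (m := 0) (by simp)).continuousAt
    exact (this.clm_apply continuousAt_const).continuousWithinAt
  obtain ⟨M, hM⟩ := ((isCompact_closedBall t₀ ρ).prod
    (isCompact_sphere (0 : ℂ) ε)).exists_bound_of_continuousOn hD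
  have hcont : ∀ t ∈ ball (0 : ℂ) r,
      Continuous fun θ => deriv (circleMap (0 : ℂ) ε) θ • G (t, circleMap 0 ε θ) := by
    intro t ht
    simp only [deriv_circleMap]
    refine ((continuous_circleMap 0 ε).mul continuous_const).smul
      (continuous_iff_continuousAt.2 fun θ => ?_)
    exact ContinuousAt.comp (f := fun θ => (t, circleMap 0 ε θ)) (hG t ht _ (hcm θ)).continuousAt
      (by fun_prop)
  have key := (intervalIntegral.hasDerivAt_integral_of_dominated_loc_of_deriv_le
    (μ := MeasureTheory.volume) (a := 0) (b := 2 * Real.pi) (x₀ := t₀) (s := ball t₀ ρ)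
    (F := fun t θ => deriv (circleMap (0 : ℂ) ε) θ • G (t, circleMap 0 ε θ))
    (F' := fun t θ => deriv (circleMap (0 : ℂ) ε) θ • fderiv ℂ G (t, circleMap 0 ε θ) (1, 0))
    (bound := fun _ => ε * M) (ball_mem_nhds t₀ hρ) ?_ ?_ ?_ ?_ ?_ ?_).2
  · exact key.differentiableAt.differentiableWithinAt
  · filter_upwards [isOpen_ball.mem_nhds ht₀] with t ht
    exact (hcont t ht).aestronglyMeasurable
  · exact (hcont t₀ ht₀).intervalIntegrable _ _
  · refine Continuous.aestronglyMeasurable ?_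
    simp only [deriv_circleMap]
    refine ((continuous_circleMap 0 ε).mul continuous_const).smul ?_
    exact hD.comp_continuous (f := fun θ => (t₀, circleMap 0 ε θ)) (by fun_prop)
      fun θ => ⟨mem_closedBall_self hρ.le, hcm θ⟩
  · refine .of_forall fun θ _ t ht => ?_
    rw [norm_smul, deriv_circleMap]
    have h1 := hM (t, circleMap 0 ε θ) ⟨ball_subset_closedBall ht, hcm θ⟩
    have h2 : ‖circleMap (0 : ℂ) ε θ * Complex.I‖ = ε := by simp [abs_of_nonneg hε]
    rw [h2]
    gcongr
  · exact intervalIntegrable_const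
  · refine .of_forall fun θ _ t ht => ?_
    have h1 : HasDerivAt (fun t : ℂ => (t, circleMap (0 : ℂ) ε θ)) (1, 0) t :=
      (hasDerivAt_id t).prodMk (hasDerivAt_const t _)
    have h2 := ((hG t (hsub (ball_subset_closedBall ht)) _ (hcm θ)).differentiableAt
      (by simp)).hasFDerivAt.comp_hasDerivAt t h1
    exact h2.const_smul (deriv (circleMap (0 : ℂ) ε) θ)

/-- The sum of `h` over the roots of `P` in a disc, as a contour integral. -/
lemma circleIntegral_derivative_div (P : ℂ[X]) {ε : ℝ} (hε : 0 ≤ ε)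
    (hP : ∀ w ∈ sphere (0 : ℂ) ε, P.eval w ≠ 0) {h : ℂ → ℂ} (hh : DiffContOnCl ℂ h (ball 0 ε)) :
    ∮ w in C(0, ε), (derivative P).eval w / P.eval w * h w =
      2 * Real.pi * Complex.I * ((P.roots.filter fun a => ‖a‖ < ε).map h).sum := by
  have h1 : ∮ w in C(0, ε), (derivative P).eval w / P.eval w * h w =
      ∮ w in C(0, ε), (P.roots.map fun a => (w - a)⁻¹ * h w).sum := by
    refine circleIntegral.integral_congr hε fun w hw => ?_
    have := (IsAlgClosed.splits P).eval_derivative_div_eval_of_ne_zero (hP w hw)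
    simp only [this, one_div, Multiset.sum_map_mul_right]
  rw [h1]
  have hroots : ∀ a ∈ P.roots, a ∉ sphere (0 : ℂ) ε := fun a ha hs =>
    hP a hs (isRoot_of_mem_roots ha)
  have hint : ∀ a ∉ sphere (0 : ℂ) ε, ContinuousOn (fun w => (w - a)⁻¹ * h w) (sphere 0 ε) := by
    intro a ha
    refine ContinuousOn.mul (ContinuousOn.inv₀ (by fun_prop) fun w hw h0 => ha ?_)
      (hh.continuousOn_ball.mono sphere_subset_closedBall)
    rwa [← sub_eq_zero.1 h0]
  have hone : ∀ a ∉ sphere (0 : ℂ) ε, ∮ w in C(0, ε), (w - a)⁻¹ * h w =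
      if ‖a‖ < ε then 2 * Real.pi * Complex.I * h a else 0 := by
    intro a ha
    split_ifs with hlt
    · have := hh.circleIntegral_sub_inv_smul (w := a) (by simpa using hlt)
      simpa using this
    · refine DiffContOnCl.circleIntegral_eq_zero hε ?_
      have : ε < ‖a‖ := lt_of_le_of_ne (not_lt.1 hlt) fun h => ha (by simp [h])
      have h2 : DiffContOnCl ℂ (fun w : ℂ => (w - a)⁻¹) (ball 0 ε) := by
        refine DiffContOnCl.inv (Differentiable.diffContOnCl (by fun_prop)) fun w hw h0 => ?_
        have hw' := closure_ball_subset_closedBall hw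
        rw [mem_closedBall_zero_iff, sub_eq_zero.1 h0] at hw'
        linarith
      simpa using h2.smul hh
  generalize P.roots = s at hroots
  induction s using Multiset.induction_on with
  | empty => simp [circleIntegral]
  | cons a s ih =>
    have ha := hroots a (Multiset.mem_cons_self a s)
    have hs : ∀ b ∈ s, b ∉ sphere (0 : ℂ) ε := fun b hb => hroots b (Multiset.mem_cons_of_mem hb)
    have hci : ∀ s : Multiset ℂ, (∀ b ∈ s, b ∉ sphere (0 : ℂ) ε) →
        ContinuousOn (fun w => (s.map fun a => (w - a)⁻¹ * h w).sum) (sphere 0 ε) := by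
      intro s
      induction s using Multiset.induction_on with
      | empty => intro _; simpa using continuousOn_const
      | cons b s ih =>
        intro hb
        simp only [Multiset.map_cons, Multiset.sum_cons]
        exact (hint b (hb b (Multiset.mem_cons_self b s))).add
          (ih fun b' hb' => hb b' (Multiset.mem_cons_of_mem hb'))
    simp only [Multiset.map_cons, Multiset.sum_cons]
    rw [circleIntegral.integral_add ((hint a ha).circleIntegrable hε)
      ((hci s hs).circleIntegrable hε), ih hs, hone a ha, Multiset.filter_cons]
    split_ifs with hlt <;> simp [mul_add]

/-- If a holomorphic function vanishing at a root of a polynomial family has nonnegative real part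
at all nearby roots, then its real part vanishes at nearby roots, which do exist. -/
lemma eventually_exists_root_re_eq_zero {P : ℂ → ℂ[X]}
    (hP : ContDiff ℂ 2 fun u : ℂ × ℂ => (P u.1).eval u.2) (hP0 : P 0 ≠ 0)
    (h00 : (P 0).eval 0 = 0) {h : ℂ × ℂ → ℂ} (hh : ContDiffAt ℂ 1 h 0) (h0 : h 0 = 0)
    (hpos : ∀ᶠ u in 𝓝 (0 : ℂ × ℂ), (P u.1).eval u.2 = 0 → 0 ≤ (h u).re)
    {U : Set (ℂ × ℂ)} (hU : U ∈ 𝓝 (0 : ℂ × ℂ)) :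
    ∀ᶠ t in 𝓝 (0 : ℂ), ∃ w, (t, w) ∈ U ∧ (P t).eval w = 0 ∧ (h (t, w)).re = 0 := by
  obtain ⟨r, hr, hS⟩ := Metric.eventually_nhds_iff_ball.1
    ((hh.eventually (by simp)).and (hpos.and hU))
  have hS' : ∀ t w : ℂ, ‖t‖ < r → ‖w‖ < r → (t, w) ∈ ball (0 : ℂ × ℂ) r := by
    intro t w ht hw
    rw [mem_ball_zero_iff, Prod.norm_def]
    exact max_lt ht hw
  obtain ⟨ε, hε, hεr, hroot⟩ : ∃ ε, 0 < ε ∧ ε < r ∧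
      ∀ w : ℂ, ‖w‖ ≤ ε → (P 0).eval w = 0 → w = 0 := by
    have h1 : ∀ᶠ w in 𝓝 (0 : ℂ), (P 0).eval w = 0 → w = 0 := by
      have : ((P 0).roots.toFinset.erase 0 : Set ℂ)ᶜ ∈ 𝓝 (0 : ℂ) :=
        ((P 0).roots.toFinset.erase 0).finite_toSet.isClosed.isOpen_compl.mem_nhds (by simp)
      filter_upwards [this] with w hw h2
      by_contra h3
      exact hw (by simp [hP0, h2, h3])
    obtain ⟨ε, hε, h2⟩ := nhds_basis_closedBall.eventually_iff.1 h1
    exact ⟨min ε (r / 2), by positivity, (min_le_right _ _).trans_lt (by linarith),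
      fun w hw => h2 (by simpa using hw.trans (min_le_left _ _))⟩
  have hsph : ∀ᶠ t in 𝓝 (0 : ℂ), ∀ w ∈ sphere (0 : ℂ) ε, (P t).eval w ≠ 0 := by
    refine (isCompact_sphere (0 : ℂ) ε).eventually_forall_of_forall_eventually fun w hw => ?_
    refine hP.continuous.continuousAt.eventually_ne ?_
    intro h1
    have := hroot w (by simpa using (mem_sphere_zero_iff_norm.1 hw).le) h1
    rw [this] at hw
    simp at hw
    exact hε.ne hw
  obtain ⟨δ₀, hδ₀, hδ₀'⟩ := Metric.eventually_nhds_iff_ball.1 hsph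
  set δ := min δ₀ r with hδdef
  have hδ : 0 < δ := lt_min hδ₀ hr
  have hδ' : ∀ t ∈ ball (0 : ℂ) δ, ∀ w ∈ sphere (0 : ℂ) ε, (P t).eval w ≠ 0 := fun t ht =>
    hδ₀' t (ball_subset_ball (min_le_left _ _) ht)
  have hδr : ∀ t ∈ ball (0 : ℂ) δ, ‖t‖ < r := fun t ht => by
    simpa using ball_subset_ball (min_le_right _ _) ht
  have hder : (fun u : ℂ × ℂ => (derivative (P u.1)).eval u.2) =
      fun u => fderiv ℂ (fun u : ℂ × ℂ => (P u.1).eval u.2) u (0, 1) := by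
    funext u
    have h1 : HasDerivAt (fun w : ℂ => (u.1, w)) (0, 1) u.2 :=
      (hasDerivAt_const u.2 u.1).prodMk (hasDerivAt_id u.2)
    have h2 := (hP.differentiable (by simp) u).hasFDerivAt.comp_hasDerivAt u.2 h1
    exact ((P u.1).hasDerivAt u.2).unique h2
  have hderc : ContDiff ℂ 1 fun u : ℂ × ℂ => (derivative (P u.1)).eval u.2 := by
    rw [hder]
    exact (hP.fderiv_right (m := 1) (by norm_num)).clm_apply contDiff_const
  -- sums over roots
  have hsum : ∀ g : ℂ × ℂ → ℂ, (∀ u ∈ ball (0 : ℂ × ℂ) r, ContDiffAt ℂ 1 g u) →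
      ∃ q : ℂ → ℂ, DifferentiableOn ℂ q (ball 0 δ) ∧ ∀ t ∈ ball (0 : ℂ) δ,
        q t = (((P t).roots.filter fun a => ‖a‖ < ε).map fun w => g (t, w)).sum := by
    intro g hg
    refine ⟨fun t => (2 * Real.pi * Complex.I)⁻¹ *
      ∮ w in C(0, ε), (derivative (P t)).eval w / (P t).eval w * g (t, w), ?_, ?_⟩
    · refine DifferentiableOn.const_mul (differentiableOn_circleIntegral
        (G := fun u => (derivative (P u.1)).eval u.2 / (P u.1).eval u.2 * g u) hε.le
        fun t ht w hw => ?_) _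
      exact (hderc.contDiffAt.div (hP.contDiffAt.of_le (by norm_num)) (hδ' t ht w hw)).mul
        (hg _ (hS' t w (hδr t ht) (by simpa [mem_sphere_zero_iff_norm.1 hw] using hεr)))
    · intro t ht
      have hd : DifferentiableOn ℂ (fun w => g (t, w)) (closure (ball 0 ε)) := by
        intro w hw
        have h1 := hg _ (hS' t w (hδr t ht) ((mem_closedBall_zero_iff.1
          (closure_ball_subset_closedBall hw)).trans_lt hεr))
        exact ((h1.differentiableAt (by simp)).comp w (f := fun w => (t, w))
          (by fun_prop)).differentiableWithinAt
      simp only []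
      rw [circleIntegral_derivative_div (P t) hε.le (hδ' t ht) hd.diffContOnCl,
        inv_mul_cancel_left₀ Complex.two_pi_I_ne_zero]
  obtain ⟨q, hq, hqs⟩ := hsum h fun u hu => (hS u hu).1
  obtain ⟨q₁, hq₁, hqs₁⟩ := hsum (fun _ => 1) fun u hu => contDiffAt_const
  have hmem : ∀ t ∈ ball (0 : ℂ) δ, ∀ a ∈ (P t).roots.filter (fun a => ‖a‖ < ε),
      (P t).eval a = 0 ∧ (t, a) ∈ U ∧ 0 ≤ (h (t, a)).re := by
    intro t ht a ha
    rw [Multiset.mem_filter] at ha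
    have h1 : (P t).eval a = 0 := isRoot_of_mem_roots ha.1
    have h2 := hS _ (hS' t a (hδr t ht) (ha.2.trans hεr))
    exact ⟨h1, h2.2.2, h2.2.1 h1⟩
  have hre : ∀ t ∈ ball (0 : ℂ) δ, (q t).re =
      (((P t).roots.filter fun a => ‖a‖ < ε).map fun w => (h (t, w)).re).sum := by
    intro t ht
    rw [hqs t ht]
    exact (map_multiset_sum Complex.reLm _).trans (by rw [Multiset.map_map]; rfl)
  have hre0 : ∀ t ∈ ball (0 : ℂ) δ, 0 ≤ (q t).re := by
    intro t ht
    rw [hre t ht]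
    refine Multiset.sum_nonneg fun x hx => ?_
    obtain ⟨a, ha, rfl⟩ := Multiset.mem_map.1 hx
    exact (hmem t ht a ha).2.2
  have h0mem : (0 : ℂ) ∈ ball (0 : ℂ) δ := mem_ball_self hδ
  have hq0 : q 0 = 0 := by
    rw [hqs 0 h0mem]
    refine Multiset.sum_eq_zero fun x hx => ?_
    obtain ⟨a, ha, rfl⟩ := Multiset.mem_map.1 hx
    have h1 := hroot a (Multiset.mem_filter.1 ha).2.le (hmem 0 h0mem a ha).1
    rw [h1]
    exact h0
  have hmax : IsMaxOn (norm ∘ fun t => Complex.exp (-q t)) (ball 0 δ) 0 := by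
    intro t ht
    simp only [mem_ofPred_eq, Function.comp, Complex.norm_exp, Complex.neg_re, hq0]
    simpa using hre0 t ht
  have hconst := Complex.eqOn_of_isPreconnected_of_isMaxOn_norm
    (convex_ball (0 : ℂ) δ).isPreconnected isOpen_ball (hq.neg.cexp) h0mem hmax
  have hq1 : q₁ 0 ≠ 0 := by
    rw [hqs₁ 0 h0mem]
    simp only [Multiset.map_const', Multiset.sum_replicate, nsmul_eq_mul, mul_one, ne_eq,
      Nat.cast_eq_zero, Multiset.card_eq_zero]
    intro h1
    have h2 : (0 : ℂ) ∈ (P 0).roots.filter fun a => ‖a‖ < ε := by simp [hε, hP0, h00]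
    simp [h1] at h2
  filter_upwards [ball_mem_nhds (0 : ℂ) hδ,
    ((hq₁.continuousOn.continuousAt (ball_mem_nhds (0 : ℂ) hδ)).eventually_ne hq1)] with t ht ht1
  have hne : (P t).roots.filter (fun a => ‖a‖ < ε) ≠ 0 := by
    intro h1
    rw [hqs₁ t ht, h1] at ht1
    simp at ht1
  obtain ⟨a, ha⟩ := Multiset.exists_mem_of_ne_zero hne
  refine ⟨a, (hmem t ht a ha).2.1, (hmem t ht a ha).1, ?_⟩
  have h1 : (q t).re = 0 := by
    have := congrArg norm (hconst ht)
    simp only [Function.const, Complex.norm_exp] at this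
    simpa [hq0] using this
  rw [hre t ht] at h1
  refine (Multiset.all_zero_of_le_zero_le_of_sum_eq_zero ?_ h1) _ (Multiset.mem_map_of_mem _ ha)
  intro x hx
  obtain ⟨b, hb, rfl⟩ := Multiset.mem_map.1 hx
  exact (hmem t ht b hb).2.2

end

section

open Metric

variable {d : ℕ}

/-! ### Jacobians and attracting cycles -/

lemma br_map (M : ℂ × ℂ →L[ℂ] ℂ × ℂ) (X Y : ℂ × ℂ) :
    br (M X) (M Y) = br (M (1, 0)) (M (0, 1)) * br X Y := by
  have h : ∀ X : ℂ × ℂ, M X = X.1 • M (1, 0) + X.2 • M (0, 1) := by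
    intro X
    rw [← _root_.map_smul, ← _root_.map_smul, ← map_add]
    simp
  rw [h X, h Y]
  simp [br]
  ring

/-- The Jacobian determinant of an iterate of the lift. -/
def jac (c : Par d) (n : ℕ) (Z : ℂ × ℂ) : ℂ :=
  br (fderiv ℂ (hlift c)^[n] Z (1, 0)) (fderiv ℂ (hlift c)^[n] Z (0, 1))

lemma differentiable_iter (c : Par d) (n : ℕ) : Differentiable ℂ (hlift c)^[n] :=
  (contDiff_iter_right n c).differentiable (by simp)

lemma br_fderiv (c : Par d) (n : ℕ) (Z X Y : ℂ × ℂ) :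
    br (fderiv ℂ (hlift c)^[n] Z X) (fderiv ℂ (hlift c)^[n] Z Y) = jac c n Z * br X Y :=
  br_map _ X Y

lemma fderiv_iter_add (c : Par d) (m n : ℕ) (Z X : ℂ × ℂ) :
    fderiv ℂ (hlift c)^[m + n] Z X =
      fderiv ℂ (hlift c)^[m] ((hlift c)^[n] Z) (fderiv ℂ (hlift c)^[n] Z X) := by
  rw [Function.iterate_add, fderiv_comp Z (differentiable_iter c m _) (differentiable_iter c n _)]
  rfl

lemma jac_add (c : Par d) (m n : ℕ) (Z : ℂ × ℂ) :
    jac c (m + n) Z = jac c m ((hlift c)^[n] Z) * jac c n Z := by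
  conv_lhs => rw [jac, fderiv_iter_add, fderiv_iter_add, br_fderiv]
  rfl

lemma fderiv_iter_radial (c : Par d) (n : ℕ) (Z : ℂ × ℂ) :
    fderiv ℂ (hlift c)^[n] Z Z = ((d ^ n : ℕ) : ℂ) • (hlift c)^[n] Z :=
  fderiv_radial (differentiable_iter c n) (iter_smul c n) Z

/-- Euler's relation. -/
lemma br_iter_fderiv (c : Par d) (n : ℕ) (Z B : ℂ × ℂ) :
    (d : ℂ) ^ n * br ((hlift c)^[n] Z) (fderiv ℂ (hlift c)^[n] Z B) = jac c n Z * br Z B := by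
  rw [← br_fderiv, fderiv_iter_radial, br_smul_left]
  push_cast
  rfl

lemma smul_fderiv_iter_smul (c : Par d) (n : ℕ) (s : ℂ) (Z B : ℂ × ℂ) :
    s • fderiv ℂ (hlift c)^[n] (s • Z) B = s ^ d ^ n • fderiv ℂ (hlift c)^[n] Z B := by
  have h1 : HasFDerivAt (fun Z : ℂ × ℂ => s • Z) (s • ContinuousLinearMap.id ℂ (ℂ × ℂ)) Z :=
    (hasFDerivAt_id Z).const_smul s
  have h2 := (differentiable_iter c n (s • Z)).hasFDerivAt.comp Z h1
  have h3 := (differentiable_iter c n Z).hasFDerivAt.const_smul (s ^ d ^ n)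
  have h4 : ((hlift c)^[n] ∘ fun Z : ℂ × ℂ => s • Z) = s ^ d ^ n • (hlift c)^[n] := by
    funext Z
    exact iter_smul c n s Z
  rw [h4] at h2
  have := congrArg (fun M : ℂ × ℂ →L[ℂ] ℂ × ℂ => M B) (h2.unique h3)
  simpa using this

lemma jac_smul (c : Par d) (n : ℕ) (s : ℂ) (Z : ℂ × ℂ) :
    s ^ 2 * jac c n (s • Z) = (s ^ d ^ n) ^ 2 * jac c n Z := by
  have := congrArg₂ br (smul_fderiv_iter_smul c n s Z (1, 0)) (smul_fderiv_iter_smul c n s Z (0, 1))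
  rw [br_smul_left, br_smul_right, br_smul_left, br_smul_right] at this
  rw [jac, jac]
  linear_combination this

lemma contDiff_jac (n : ℕ) : ContDiff ℂ 1 fun p : Par d × (ℂ × ℂ) => jac p.1 n p.2 := by
  have h : ∀ X : ℂ × ℂ, ContDiff ℂ 1 fun p : Par d × (ℂ × ℂ) => fderiv ℂ (hlift p.1)^[n] p.2 X := by
    intro X
    have h2 : ContDiff ℂ 2 (Function.uncurry fun (p : Par d × (ℂ × ℂ)) Z => (hlift p.1)^[n] Z) := by
      have := ((contDiff_iter (d := d) n).of_le (m := 2) le_top).comp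
        ((contDiff_fst.fst).prodMk contDiff_snd :
          ContDiff ℂ 2 fun q : (Par d × (ℂ × ℂ)) × (ℂ × ℂ) => (q.1.1, q.2))
      simpa only [Function.comp_def, Function.uncurry_def] using this
    exact (ContDiff.fderiv h2 contDiff_snd (by norm_num)).clm_apply contDiff_const
  have := (contDiff_br.of_le (m := 1) le_top).comp ((h (1, 0)).prodMk (h (0, 1)))
  simpa only [Function.comp_def, jac] using this

/-- Derivative of `Phi` in terms of the multiplier. -/
lemma fderiv_phi_eq (c : Par d) (n : ℕ) (Z B : ℂ × ℂ) :
    fderiv ℂ (Phi n c) Z B = br (fderiv ℂ (hlift c)^[n] Z B) Z + br ((hlift c)^[n] Z) B := by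
  have hL := (differentiable_iter c n Z).hasFDerivAt
  have h1 := hL.fst
  have h2 := hL.snd
  have h3 := (h1.mul (hasFDerivAt_snd (𝕜 := ℂ) (p := Z))).sub
    (h2.mul (hasFDerivAt_fst (𝕜 := ℂ) (p := Z)))
  have h4 : HasFDerivAt (Phi n c) _ Z := h3
  rw [h4.fderiv]
  simp [br]
  ring

lemma fderiv_phi_of_fixed {c : Par d} {n : ℕ} {Z : ℂ × ℂ} {α : ℂ} (h : (hlift c)^[n] Z = α • Z)
    (B : ℂ × ℂ) : (d : ℂ) ^ n * α * fderiv ℂ (Phi n c) Z B =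
      ((d : ℂ) ^ n * α ^ 2 - jac c n Z) * br Z B := by
  have h1 := br_iter_fderiv c n Z B
  rw [h, br_smul_left] at h1
  rw [fderiv_phi_eq, h, br_smul_left, br_swap _ Z]
  linear_combination -h1

/-- The point `Z` represents an attracting fixed point of the `n`-th iterate. -/
def AttAt (c : Par d) (n : ℕ) (Z : ℂ × ℂ) : Prop :=
  Z ≠ 0 ∧ ∃ α : ℂ, (hlift c)^[n] Z = α • Z ∧ ‖jac c n Z‖ < (d : ℝ) ^ n * ‖α‖ ^ 2

/-- The map has `m` attracting cycles. -/
def HasAtt (c : Par d) (m : ℕ) : Prop :=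
  ∃ N, 1 ≤ N ∧ ∃ A : Fin m → ℂ × ℂ, (∀ i, AttAt c N (A i)) ∧
    ∀ i j, i ≠ j → ∀ k, br ((hlift c)^[k] (A i)) (A j) ≠ 0

lemma eq_of_smul_eq_smul_vec {Z : ℂ × ℂ} (hZ : Z ≠ 0) {α β : ℂ} (h : α • Z = β • Z) : α = β :=
  smul_left_injective ℂ hZ h

lemma jac_mul_of_fixed {c : Par d} {n : ℕ} {Z : ℂ × ℂ} {α : ℂ} (hα : α ≠ 0)
    (h : (hlift c)^[n] Z = α • Z) (j : ℕ) :
    ∃ β : ℂ, β ≠ 0 ∧ (hlift c)^[j * n] Z = β • Z ∧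
      jac c (j * n) Z * ((d : ℂ) ^ n * α ^ 2) ^ j =
        ((d : ℂ) ^ (j * n) * β ^ 2) * jac c n Z ^ j := by
  induction j with
  | zero =>
    refine ⟨1, one_ne_zero, by simp, ?_⟩
    simp [jac, br]
  | succ j ih =>
    obtain ⟨β, hβ, h1, h2⟩ := ih
    refine ⟨α ^ d ^ (j * n) * β, by positivity, ?_, ?_⟩
    · rw [Nat.succ_mul, Function.iterate_add_apply, h, iter_smul, h1, smul_smul]
    · rw [Nat.succ_mul, jac_add, h]
      have h3 := jac_smul c (j * n) α Z
      rw [pow_succ, pow_add]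
      linear_combination ((d : ℂ) ^ n * ((d : ℂ) ^ n * α ^ 2) ^ j * jac c n Z) * h3
        + jac c n Z * (α ^ d ^ (j * n)) ^ 2 * (d : ℂ) ^ n * h2

/-- The multiplier of an attracting fixed point of an iterate is not one anywhere on its cycle. -/
lemma AttAt.br_ne_zero {c : Par d} (hc : ND c) (hd : 2 ≤ d) {N n : ℕ} (hN : 1 ≤ N) (hn : 1 ≤ n)
    {A Z : ℂ × ℂ} {α : ℂ} (hA : AttAt c N A) (hZ : Z ≠ 0) (hα : α ≠ 0)
    (h : (hlift c)^[n] Z = α • Z) (hJ : jac c n Z = (d : ℂ) ^ n * α ^ 2) (k : ℕ) :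
    br ((hlift c)^[k] A) Z ≠ 0 := by
  intro h0
  obtain ⟨hA0, γ, hγ, hJA⟩ := hA
  have hd0 : (d : ℂ) ≠ 0 := by simp; lia
  have hd0' : (0 : ℝ) < d := by simp; lia
  have hγ0 : γ ≠ 0 := by
    rintro rfl
    simp at hJA
    linarith [norm_nonneg (jac c N A)]
  -- all multiples of the period, at `Z`
  have hZj : ∀ j, ∃ β : ℂ, β ≠ 0 ∧ (hlift c)^[j * n] Z = β • Z ∧
      jac c (j * n) Z = (d : ℂ) ^ (j * n) * β ^ 2 := by
    intro j
    obtain ⟨β, hβ, h1, h2⟩ := jac_mul_of_fixed hα h j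
    refine ⟨β, hβ, h1, ?_⟩
    rw [← hJ] at h2
    refine mul_right_cancel₀ (pow_ne_zero j ?_) h2
    rw [hJ]
    positivity
  -- come back from `Z` to `A`
  obtain ⟨s, hs⟩ := exists_smul_of_br_eq_zero (hc.iter_ne_zero k hA0) h0
  have hs0 : s ≠ 0 := by rintro rfl; simp at hs; exact hZ hs
  obtain ⟨k', hk'⟩ : ∃ k', k' + k = k * N := ⟨k * N - k, by
    have : k ≤ k * N := Nat.le_mul_of_pos_right k hN
    lia⟩
  obtain ⟨s', hs'⟩ : ∃ s' : ℂ, (hlift c)^[k'] Z = s' • A := by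
    obtain ⟨β, -, h1, -⟩ := jac_mul_of_fixed hγ0 hγ k
    rw [← hk', Function.iterate_add_apply] at h1
    refine ⟨s ^ d ^ k' * β, ?_⟩
    rw [hs, iter_smul, h1, smul_smul]
  have hs'0 : s' ≠ 0 := by
    rintro rfl
    exact hc.iter_ne_zero k' hZ (by rw [hs']; simp)
  have hjk : jac c k' Z ≠ 0 := by
    obtain ⟨β, hβ, -, h1⟩ := hZj k'
    have h2 : k' * n - k' + k' = k' * n := Nat.sub_add_cancel (Nat.le_mul_of_pos_right k' hn)
    intro h3
    have h4 := jac_add c (k' * n - k') k' Z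
    rw [h2, h1, h3, mul_zero] at h4
    exact (by positivity : (d : ℂ) ^ (k' * n) * β ^ 2 ≠ 0) h4
  obtain ⟨β, hβ, hβZ, hβJ⟩ := hZj N
  obtain ⟨δ, hδ, hδA, hδJ⟩ := jac_mul_of_fixed hγ0 hγ n
  rw [mul_comm N n] at hβZ hβJ
  set M := n * N with hM
  have h5 : jac c M A = (d : ℂ) ^ M * δ ^ 2 := by
    have e1 := jac_add c M k' Z
    rw [add_comm, jac_add c k' M Z, hs', hβZ, hβJ] at e1
    have e2 := jac_smul c M s' A
    have e3 := jac_smul c k' β Z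
    have e4 : s' ^ d ^ M * δ = β ^ d ^ k' * s' := by
      have : (hlift c)^[M] ((hlift c)^[k'] Z) = (hlift c)^[k'] ((hlift c)^[M] Z) := by
        rw [← Function.iterate_add_apply, add_comm, Function.iterate_add_apply]
      rw [hs', hβZ, iter_smul, iter_smul, hδA, hs', smul_smul, smul_smul] at this
      exact eq_of_smul_eq_smul_vec hA0 this
    have e5 : jac c M (s' • A) = (d : ℂ) ^ M * (β ^ d ^ k') ^ 2 := by
      apply mul_right_cancel₀ hjk
      linear_combination -e1 + (d : ℂ) ^ M * e3
    rw [e5] at e2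
    have e6 : (s' ^ d ^ M) ^ 2 ≠ 0 := by positivity
    apply mul_left_cancel₀ e6
    linear_combination -e2 - (d : ℂ) ^ M * (s' ^ d ^ M * δ + β ^ d ^ k' * s') * e4
  rw [h5] at hδJ
  have h6 : ((d : ℂ) ^ N * γ ^ 2) ^ n = jac c N A ^ n :=
    mul_left_cancel₀ (by positivity : (d : ℂ) ^ M * δ ^ 2 ≠ 0) hδJ
  have h7 := congrArg norm h6
  rw [norm_pow, norm_pow, norm_mul, norm_pow, norm_pow, Complex.norm_natCast] at h7
  exact (pow_lt_pow_left₀ hJA (norm_nonneg _) (by lia)).ne' h7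

/-! ### Persistence of attracting cycles -/

/-- The multiplicative factor at a fixed point, read in a transverse direction. -/
lemma factor_eq {c : Par d} {n : ℕ} {Z B : ℂ × ℂ} {α : ℂ} (hB : br Z B ≠ 0)
    (h : (hlift c)^[n] Z = α • Z) : br ((hlift c)^[n] Z) B / br Z B = α := by
  rw [h, br_smul_left, mul_div_cancel_right₀ _ hB]

lemma ne_zero_of_br {Z B : ℂ × ℂ} (h : br Z B ≠ 0) : Z ≠ 0 := by
  rintro rfl; simp [br] at h

lemma exists_factor {c : Par d} {n : ℕ} {Z : ℂ × ℂ} (hZ : Z ≠ 0) (h : Phi n c Z = 0) :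
    ∃ α : ℂ, (hlift c)^[n] Z = α • Z :=
  exists_smul_of_br_eq_zero hZ (by rw [br_swap]; simpa [Phi] using h)

lemma attAt_iff {c : Par d} {n : ℕ} {Z B : ℂ × ℂ} (hB : br Z B ≠ 0) (h : Phi n c Z = 0) :
    AttAt c n Z ↔ ‖jac c n Z‖ < (d : ℝ) ^ n * ‖br ((hlift c)^[n] Z) B / br Z B‖ ^ 2 := by
  obtain ⟨α, hα⟩ := exists_factor (ne_zero_of_br hB) h
  rw [factor_eq hB hα]
  refine ⟨fun ⟨_, β, hβ, hJ⟩ => ?_, fun hJ => ⟨ne_zero_of_br hB, α, hα, hJ⟩⟩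
  rwa [eq_of_smul_eq_smul_vec (ne_zero_of_br hB) (hα.symm.trans hβ)]

lemma exists_br_ne_zero {Z : ℂ × ℂ} (hZ : Z ≠ 0) : ∃ B, br Z B ≠ 0 := by
  by_contra! h
  have h1 := h (0, 1)
  have h2 := h (1, 0)
  simp [br] at h1 h2
  exact hZ (Prod.ext h1 h2)

lemma AttAt.phi_eq_zero {c : Par d} {n : ℕ} {Z : ℂ × ℂ} (h : AttAt c n Z) : Phi n c Z = 0 := by
  obtain ⟨-, α, hα, -⟩ := h
  rw [Phi, hα, br_smul_left, br_self, mul_zero]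

lemma contDiff_phi_chart (n : ℕ) (A B : ℂ × ℂ) :
    ContDiff ℂ ⊤ fun p : Par d × ℂ => Phi n p.1 (A + p.2 • B) := by
  have := (contDiff_phi (d := d) n).comp (contDiff_fst.prodMk
    (contDiff_const.add (contDiff_snd.smul contDiff_const)) :
      ContDiff ℂ ⊤ fun p : Par d × ℂ => (p.1, A + p.2 • B))
  simpa only [Function.comp_def] using this

/-- Simple fixed points of iterates persist. -/
lemma exists_continuation {c : Par d} {n : ℕ} {A B : ℂ × ℂ} (h0 : Phi n c A = 0)
    (h1 : fderiv ℂ (Phi n c) A B ≠ 0) :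
    ∃ s : Par d → ℂ, s c = 0 ∧ DifferentiableAt ℂ s c ∧ (∀ᶠ x in 𝓝 c, Phi n x (A + s x • B) = 0) ∧
      ∀ᶠ v in 𝓝 (c, (0 : ℂ)), Phi n v.1 (A + v.2 • B) = 0 ↔ s v.1 = v.2 := by
  refine exists_implicit_of_deriv_ne_zero (Ψ := fun p : Par d × ℂ => Phi n p.1 (A + p.2 • B))
    (u := (c, 0)) ((contDiff_phi_chart n A B).contDiffAt.of_le le_top) (by simpa using h0) ?_
  simp only
  rw [(hasDerivAt_phi_line n c A B 0).deriv]
  simpa using h1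

lemma AttAt.ne_zero_factor {c : Par d} {n : ℕ} {Z : ℂ × ℂ} {α : ℂ}
    (h : ‖jac c n Z‖ < (d : ℝ) ^ n * ‖α‖ ^ 2) : α ≠ 0 := by
  rintro rfl
  simp at h
  linarith [norm_nonneg (jac c n Z)]

lemma AttAt.eventually {c : Par d} {n : ℕ} {A : ℂ × ℂ} (h : AttAt c n A)
    {W : Set (ℂ × ℂ)} (hW : W ∈ 𝓝 A) : ∀ᶠ c' in 𝓝 c, ∃ A' ∈ W, AttAt c' n A' := by
  have hphi := h.phi_eq_zero
  obtain ⟨hA, α, hα, hJ⟩ := id h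
  obtain ⟨B, hB⟩ := exists_br_ne_zero hA
  have hα0 : α ≠ 0 := AttAt.ne_zero_factor hJ
  have hd1 : fderiv ℂ (Phi n c) A B ≠ 0 := by
    intro h0
    have h2 := fderiv_phi_of_fixed hα B
    rw [h0, mul_zero] at h2
    have h3 := (mul_eq_zero.1 h2.symm).resolve_right hB
    rw [← sub_eq_zero.1 h3] at hJ
    simp at hJ
  obtain ⟨s, hs0, hsd, hs, -⟩ := exists_continuation hphi hd1
  have hAc : ContinuousAt (fun x => (x, A + s x • B)) c :=
    continuousAt_id.prodMk (continuousAt_const.add (hsd.continuousAt.smul continuousAt_const))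
  have e0 : (c, A + s c • B) = (c, A) := by simp [hs0]
  have hAW : ∀ᶠ x in 𝓝 c, A + s x • B ∈ W := by
    have := (hAc.snd)
    refine this ?_
    simpa [hs0] using hW
  have hbr : ∀ w : ℂ, br (A + w • B) B = br A B := by intro w; simp [br]; ring
  have hopen : ∀ᶠ x in 𝓝 c, ‖jac x n (A + s x • B)‖ <
      (d : ℝ) ^ n * ‖br ((hlift x)^[n] (A + s x • B)) B / br A B‖ ^ 2 := by
    have c1 : ContinuousAt (fun x => ‖jac x n (A + s x • B)‖) c := by
      have := ((contDiff_jac (d := d) n).continuous.continuousAt (x := (c, A + s c • B))).comp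
        (f := fun x => (x, A + s x • B)) hAc
      simpa only [Function.comp_def] using this.norm
    have c2 : ContinuousAt (fun x => (hlift x)^[n] (A + s x • B)) c := by
      have := ((continuous_iter (d := d) n).continuousAt (x := (c, A + s c • B))).comp
        (f := fun x => (x, A + s x • B)) hAc
      simpa only [Function.comp_def] using this
    have c3 : ContinuousAt (fun x => br ((hlift x)^[n] (A + s x • B)) B) c := by
      have := continuous_br.continuousAt.comp (c2.prodMk (continuousAt_const (y := B)))
      simpa only [Function.comp_def] using this
    refine c1.eventually_lt (((c3.div_const _).norm.pow 2).const_mul _) ?_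
    simp only [hs0, zero_smul, add_zero]
    rwa [factor_eq hB hα]
  filter_upwards [hs, hAW, hopen] with x h1 h2 h3
  refine ⟨_, h2, (attAt_iff (B := B) (by rwa [hbr]) h1).2 ?_⟩
  rwa [hbr]

lemma iter_of_fixed {c : Par d} {N : ℕ} {A : ℂ × ℂ} {α : ℂ} (hα : α ≠ 0)
    (h : (hlift c)^[N] A = α • A) (k : ℕ) :
    ∃ s : ℂ, s ≠ 0 ∧ (hlift c)^[k] A = s • (hlift c)^[k % N] A := by
  obtain ⟨β, hβ, h1, -⟩ := jac_mul_of_fixed hα h (k / N)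
  refine ⟨β ^ d ^ (k % N), by positivity, ?_⟩
  conv_lhs => rw [← Nat.mod_add_div k N, mul_comm N, Function.iterate_add_apply, h1, iter_smul]

lemma continuous_br_iter (k : ℕ) : Continuous fun q : Par d × ((ℂ × ℂ) × (ℂ × ℂ)) =>
    br ((hlift q.1)^[k] q.2.1) q.2.2 := by
  have := continuous_br.comp (((continuous_iter (d := d) k).comp
    (continuous_fst.prodMk continuous_snd.fst)).prodMk
      (continuous_snd.snd : Continuous fun q : Par d × ((ℂ × ℂ) × (ℂ × ℂ)) => q.2.2))
  simpa only [Function.comp_def] using this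

/-- Attracting points near points with disjoint orbits belong to different cycles. -/
lemma exists_nhds_hasAtt {c : Par d} {N m : ℕ} (hN : 1 ≤ N) {A : Fin m → ℂ × ℂ}
    (hdis : ∀ i j, i ≠ j → ∀ k, br ((hlift c)^[k] (A i)) (A j) ≠ 0) :
    ∃ W : Fin m → Set (ℂ × ℂ), (∀ i, W i ∈ 𝓝 (A i)) ∧ ∀ᶠ c' in 𝓝 c, ∀ A' : Fin m → ℂ × ℂ,
      (∀ i, A' i ∈ W i) → (∀ i, AttAt c' N (A' i)) → HasAtt c' m := by
  have h1 : ∀ᶠ q : Par d × (Fin m → ℂ × ℂ) in 𝓝 c ×ˢ 𝓝 A, ∀ i j, i ≠ j → ∀ k ∈ Finset.range N,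
      br ((hlift q.1)^[k] (q.2 i)) (q.2 j) ≠ 0 := by
    refine eventually_all.2 fun i => eventually_all.2 fun j => ?_
    by_cases hij : i = j
    · simp [hij]
    · simp only [ne_eq, hij, not_false_eq_true, forall_true_left]
      refine (Finset.eventually_all _).2 fun k _ => ?_
      have h2 : Continuous fun q : Par d × (Fin m → ℂ × ℂ) => (q.1, (q.2 i, q.2 j)) := by fun_prop
      have h3 := (continuous_br_iter (d := d) k).comp h2
      simp only [Function.comp_def] at h3
      rw [← nhds_prod_eq]
      exact h3.continuousAt.eventually_ne (hdis i j hij k)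
  obtain ⟨V, hV, S, hS, h2⟩ := mem_prod_iff.1 h1
  rw [nhds_pi, Filter.mem_pi'] at hS
  obtain ⟨I, W, hW, hS⟩ := hS
  refine ⟨W, hW, ?_⟩
  filter_upwards [hV] with c' hc' A' hA'W hA'
  refine ⟨N, hN, A', hA', fun i j hij k => ?_⟩
  obtain ⟨-, α, hα, hJ⟩ := hA' i
  obtain ⟨s, hs, h3⟩ := iter_of_fixed (AttAt.ne_zero_factor hJ) hα k
  rw [h3, br_smul_left]
  have h4 : (c', A') ∈ V ×ˢ S := ⟨hc', hS fun i _ => hA'W i⟩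
  exact mul_ne_zero hs (h2 h4 i j hij _ (Finset.mem_range.2 (Nat.mod_lt _ hN)))

lemma HasAtt.eventually {c : Par d} {m : ℕ} (h : HasAtt c m) : ∀ᶠ c' in 𝓝 c, HasAtt c' m := by
  obtain ⟨N, hN, A, hA, hdis⟩ := h
  obtain ⟨W, hW, h1⟩ := exists_nhds_hasAtt hN hdis
  filter_upwards [h1, eventually_all.2 fun i => (hA i).eventually (hW i)] with c' h1 h2
  choose A' hA'W hA' using h2
  exact h1 A' hA'W hA'

lemma AttAt.mul {c : Par d} {n : ℕ} {A : ℂ × ℂ} (h : AttAt c n A) {j : ℕ} (hj : 1 ≤ j)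
    (hd : 2 ≤ d) : AttAt c (j * n) A := by
  obtain ⟨hA, α, hα, hJ⟩ := h
  have hα0 := AttAt.ne_zero_factor hJ
  obtain ⟨β, hβ, h1, h2⟩ := jac_mul_of_fixed hα0 hα j
  refine ⟨hA, β, h1, ?_⟩
  have hd' : (0 : ℝ) < d := by simp; lia
  have h3 := congrArg norm h2
  simp only [norm_mul, norm_pow, Complex.norm_natCast] at h3
  have h4 : 0 < ((d : ℝ) ^ n * ‖α‖ ^ 2) ^ j := by positivity
  have h5 := pow_lt_pow_left₀ hJ (norm_nonneg _) (by lia : j ≠ 0)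
  have h6 : 0 < (d : ℝ) ^ (j * n) * ‖β‖ ^ 2 := by positivity
  refine lt_of_mul_lt_mul_right ?_ h4.le
  rw [h3]
  exact mul_lt_mul_of_pos_left h5 h6

/-- The restriction of `Phi` to an affine line is not identically zero. -/
lemma phiLine_ne_zero (hd : 2 ≤ d) {n : ℕ} (hn : 1 ≤ n) {c : Par d} (hc : ND c) {A B : ℂ × ℂ}
    (hAB : br A B ≠ 0) : phiLine n c A B ≠ 0 := by
  intro h0
  have hN : 2 ≤ d ^ n := hd.trans (Nat.le_self_pow (by lia) d)
  obtain ⟨hL1, hL2⟩ := hasLead_iter n c A B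
  set L := (hlift ((fun i => (C (c.1 i) : ℂ[X])), (fun i => C (c.2 i))))^[n]
      (C A.1 + C B.1 * X, C A.2 + C B.2 * X) with hL
  have heval : ∀ w : ℂ, (L.1.eval w, L.2.eval w) = (hlift c)^[n] (A + w • B) := by
    intro w
    have := map_iter (evalRingHom w) ((fun i => (C (c.1 i) : ℂ[X])), (fun i => C (c.2 i))) n
      (C A.1 + C B.1 * X, C A.2 + C B.2 * X)
    rw [← hL] at this
    change (eval w L.1, eval w L.2) = _ at this
    rw [this]
    simp only [coe_evalRingHom, Prod.map, eval_C]
    congr 1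
    apply Prod.ext <;>
    simp only [eval_add, eval_mul, eval_C, eval_X, Prod.fst_add, Prod.snd_add, Prod.smul_fst,
      Prod.smul_snd, smul_eq_mul, mul_comm]
  have hzero : ∀ w : ℂ, br ((hlift c)^[n] (A + w • B)) (A + w • B) = 0 := by
    intro w
    have := eval_phiLine n c A B w
    rw [h0, eval_zero] at this
    exact this.symm
  set Q : ℂ[X] := L.1 * C B.2 - L.2 * C B.1 with hQ
  set S : ℂ[X] := C A.1 * L.2 - C A.2 * L.1 with hS
  have hQe : ∀ w, Q.eval w = br ((hlift c)^[n] (A + w • B)) B := by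
    intro w; rw [← heval]; simp [hQ, br]
  have hSe : ∀ w, S.eval w = br A ((hlift c)^[n] (A + w • B)) := by
    intro w; rw [← heval]; simp [hS, br]
  have hSQ : S = X * Q := by
    refine Polynomial.funext fun w => ?_
    rw [eval_mul, eval_X, hSe, hQe]
    have := hzero w
    rw [br_add_right, br_smul_right] at this
    rw [br_swap]
    linear_combination -this
  have hAline : ∀ w : ℂ, A + w • B ≠ 0 := by
    intro w h
    have : br (A + w • B) B = br A B := by simp [br]; ring
    rw [h] at this
    exact hAB (by rw [← this]; simp [br])
  have hBB : Phi n c B = 0 := by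
    have := (hasLead_phiLine n c A B).2
    rw [h0] at this
    simpa using this.symm
  have hB0 : B ≠ 0 := by rintro rfl; simp [br] at hAB
  have hdeg : d ^ n ≤ S.natDegree := by
    refine le_natDegree_of_ne_zero ?_
    rw [hS, coeff_sub, coeff_C_mul, coeff_C_mul, hL1.2, hL2.2]
    obtain ⟨β, hβ⟩ := exists_factor hB0 hBB
    have hβ0 : β ≠ 0 := by
      rintro rfl
      exact hc.iter_ne_zero n hB0 (by rw [hβ]; simp)
    rw [hβ]
    have : A.1 * (β • B).2 - A.2 * (β • B).1 = β * br A B := by simp [br]; ring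
    rw [this]
    exact mul_ne_zero hβ0 hAB
  have hQdeg : Q.degree ≠ 0 := by
    intro h
    have h1 : Q.natDegree = 0 := natDegree_eq_zero_iff_degree_le_zero.2 h.le
    have h2 : S.natDegree ≤ 1 := by
      rw [hSQ]
      exact natDegree_mul_le.trans (by rw [h1]; simp)
    lia
  obtain ⟨w, hw⟩ := IsAlgClosed.exists_root Q hQdeg
  refine hc.iter_ne_zero n (hAline w) ?_
  have h1 := br_expand A B ((hlift c)^[n] (A + w • B))
  rw [← hQe, ← hSe, hSQ, eval_mul, IsRoot.def.1 hw] at h1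
  simp at h1
  exact h1.resolve_left hAB

/-- Near a degenerate fixed point of an iterate there are parameters with an attracting one. -/
lemma exists_attAt_near (hd : 2 ≤ d) {n : ℕ} (hn : 1 ≤ n) {c : Par d} (hc : ND c) {Z B₀ : ℂ × ℂ}
    (hZ : Z ≠ 0) (h0 : Phi n c Z = 0) (hB₀ : br Z B₀ ≠ 0) (h1 : fderiv ℂ (Phi n c) Z B₀ = 0)
    {V : Set (Par d)} (hV : V ∈ 𝓝 c) {W : Set (ℂ × ℂ)} (hW : W ∈ 𝓝 Z) :
    ∃ c' ∈ V, ∃ Z' ∈ W, AttAt c' n Z' := by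
  by_contra! hno
  obtain ⟨B, hB, hBpow⟩ := exists_transverse hd hn hZ
  obtain ⟨α, hα⟩ := exists_factor hZ h0
  have hα0 : α ≠ 0 := by
    rintro rfl
    exact hc.iter_ne_zero n hZ (by rw [hα]; simp)
  have hd0 : (d : ℂ) ≠ 0 := by simp; lia
  have hJ : jac c n Z = (d : ℂ) ^ n * α ^ 2 := by
    have h2 := fderiv_phi_of_fixed hα B₀
    rw [h1, mul_zero] at h2
    exact (sub_eq_zero.1 ((mul_eq_zero.1 h2.symm).resolve_right hB₀)).symm
  set γ : ℂ → Par d := fun t => c + t • (powPar d - c) with hγ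
  have hbr : ∀ w : ℂ, br (Z + w • B) B = br Z B := by intro w; simp [br]; ring
  have hcurve : ContDiff ℂ ⊤ fun u : ℂ × ℂ => (γ u.1, Z + u.2 • B) :=
    (contDiff_const.add (contDiff_fst.smul contDiff_const)).prodMk
      (contDiff_const.add (contDiff_snd.smul contDiff_const))
  have hcurve0 : (γ 0, Z + (0 : ℂ) • B) = (c, Z) := by simp [hγ]
  have hP : ContDiff ℂ 2 fun u : ℂ × ℂ => (phiLine n (γ u.1) Z B).eval u.2 := by
    simp only [eval_phiLine]
    have := ((contDiff_phi (d := d) n).comp hcurve).of_le (m := 2) le_top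
    simpa only [Function.comp_def] using this
  have hjac : ContDiff ℂ 1 fun u : ℂ × ℂ => jac (γ u.1) n (Z + u.2 • B) := by
    have := (contDiff_jac (d := d) n).comp (hcurve.of_le le_top)
    simpa only [Function.comp_def] using this
  have hfac : ContDiff ℂ 1 fun u : ℂ × ℂ => br ((hlift (γ u.1))^[n] (Z + u.2 • B)) B / br Z B := by
    have h2 := (contDiff_iter (d := d) n).comp hcurve
    have h3 := ((contDiff_br.comp (h2.prodMk (contDiff_const (c := B)))).div_const (br Z B)).of_le
      (m := 1) le_top
    simpa only [Function.comp_def] using h3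
  have hjac0 : jac (γ 0) n (Z + (0 : ℂ) • B) = (d : ℂ) ^ n * α ^ 2 := by simp [hγ, hJ]
  have hjne : jac (γ 0) n (Z + (0 : ℂ) • B) ≠ 0 := by rw [hjac0]; positivity
  have hjev : ∀ᶠ u : ℂ × ℂ in 𝓝 0, jac (γ u.1) n (Z + u.2 • B) ≠ 0 :=
    hjac.continuous.continuousAt.eventually_ne hjne
  have hfac0 : br ((hlift (γ 0))^[n] (Z + (0 : ℂ) • B)) B / br Z B = α := by
    simp only [hγ, zero_smul, add_zero]
    exact factor_eq hB hα
  set h : ℂ × ℂ → ℂ := fun u => 1 - (d : ℂ) ^ n *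
    (br ((hlift (γ u.1))^[n] (Z + u.2 • B)) B / br Z B) ^ 2 / jac (γ u.1) n (Z + u.2 • B) with hh
  have hnear : ∀ᶠ u : ℂ × ℂ in 𝓝 0, γ u.1 ∈ V ∧ Z + u.2 • B ∈ W := by
    have hc1 := hcurve.continuous.continuousAt (x := 0)
    have h2 : V ×ˢ W ∈ 𝓝 (γ (0 : ℂ × ℂ).1, Z + (0 : ℂ × ℂ).2 • B) := by
      rw [show (γ (0 : ℂ × ℂ).1, Z + (0 : ℂ × ℂ).2 • B) = (c, Z) from hcurve0]
      exact prod_mem_nhds hV hW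
    exact hc1 h2
  have hle : ∀ᶠ u : ℂ × ℂ in 𝓝 0, (phiLine n (γ u.1) Z B).eval u.2 = 0 → ‖1 - h u‖ ≤ 1 := by
    filter_upwards [hjev, hnear] with u hu1 hu2 hroot
    rw [eval_phiLine] at hroot
    have h2 := hno _ hu2.1 _ hu2.2
    rw [attAt_iff (B := B) (by rwa [hbr]) hroot, hbr, not_lt] at h2
    simp only [hh, sub_sub_cancel]
    rw [norm_div, div_le_one (norm_pos_iff.2 hu1), norm_mul, norm_pow, norm_pow,
      Complex.norm_natCast]
    exact h2
  have hev := eventually_exists_root_re_eq_zero (P := fun t => phiLine n (γ t) Z B) hP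
    (by simpa [hγ] using phiLine_ne_zero hd hn hc hB) (by rw [eval_phiLine]; simpa [hγ] using h0)
    (h := h) (contDiffAt_const.sub (ContDiffAt.div (contDiffAt_const.mul
      (hfac.contDiffAt.pow 2)) hjac.contDiffAt hjne))
    (by
      simp only [hh, Prod.fst_zero, Prod.snd_zero]
      rw [hfac0, hjac0, div_self (by positivity), sub_self])
    (hle.mono fun u hu hroot => by
      have h2 := (Complex.re_le_norm (1 - h u)).trans (hu hroot)
      simp at h2
      exact h2) (hle.and hjev)
  have hfin := finite_multiple_phi hd hn c hB hBpow
  refine (infinite_of_mem_nhds (0 : ℂ) hev) (hfin.subset ?_)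
  rintro t ⟨w, ⟨hw1, hw2⟩, hw3, hw4⟩
  refine ⟨w, by rwa [eval_phiLine] at hw3, ?_⟩
  have h2 : h (t, w) = 0 := by
    have h3 := hw1 hw3
    have h4 : (1 - h (t, w)).re = 1 := by simp [hw4]
    have h5 : ‖1 - h (t, w)‖ ^ 2 = 1 + (h (t, w)).im ^ 2 := by
      rw [Complex.sq_norm, Complex.normSq_apply, h4]
      simp
      ring
    have h6 : (h (t, w)).im = 0 := by
      have : ‖1 - h (t, w)‖ ^ 2 ≤ 1 := pow_le_one₀ (norm_nonneg _) h3
      have : (h (t, w)).im ^ 2 ≤ 0 := by linarith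
      exact pow_eq_zero_iff two_ne_zero |>.1 (le_antisymm this (sq_nonneg _))
    exact Complex.ext hw4 h6
  rw [eval_phiLine] at hw3
  have hZw : br (Z + w • B) B ≠ 0 := by rwa [hbr]
  obtain ⟨β, hβ⟩ := exists_factor (ne_zero_of_br hZw) hw3
  have hβ' := factor_eq hZw hβ
  rw [hbr] at hβ'
  simp only [hh] at h2 hw2
  rw [hβ', sub_eq_zero, eq_div_iff hw2, one_mul] at h2
  have h3 := fderiv_phi_of_fixed hβ B
  rw [h2, sub_self, zero_mul] at h3
  have hβ0 : β ≠ 0 := by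
    rintro rfl
    simp at h2
    exact hw2 h2
  exact (mul_eq_zero.1 h3).resolve_left (by positivity)

/-! ### Every attracting cycle attracts a critical point -/

/-- The points attracted to `x` by the `N`-th iterate. -/
def basin (f : Sphere → Sphere) (N : ℕ) (x : Sphere) : Set Sphere :=
  {y | Tendsto (fun k => f^[N * k] y) atTop (𝓝 x)}

lemma basin_of_iterate {f : Sphere → Sphere} {N : ℕ} {x y : Sphere} (h : f^[N] y ∈ basin f N x) :
    y ∈ basin f N x := by
  have h1 : Tendsto (fun k => f^[N * (k + 1)] y) atTop (𝓝 x) := by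
    refine Tendsto.congr (fun k => ?_) h
    rw [Nat.mul_succ, Function.iterate_add_apply]
  exact (tendsto_add_atTop_iff_nat (f := fun k => f^[N * k] y) 1).1 h1

lemma basin_iterate {f : Sphere → Sphere} (hf : Continuous f) {N : ℕ} {x y : Sphere} (l : ℕ)
    (h : y ∈ basin f N x) : f^[l] y ∈ basin f N (f^[l] x) := by
  have h1 := ((hf.iterate l).tendsto x).comp h
  refine Tendsto.congr (fun k => ?_) h1
  simp only [Function.comp]
  rw [← Function.iterate_add_apply, add_comm, Function.iterate_add_apply]

lemma br_line (A B : ℂ × ℂ) (w : ℂ) : br (A + w • B) B = br A B := by simp [br]; ring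

lemma line_ne_zero {A B : ℂ × ℂ} (h : br A B ≠ 0) (w : ℂ) : A + w • B ≠ 0 :=
  ne_zero_of_br (B := B) (by rwa [br_line])

/-- Reading a vector in an affine chart. -/
lemma smul_chart {A B Z : ℂ × ℂ} (hAB : br A B ≠ 0) (hZ : br Z B ≠ 0) :
    Z = (br Z B / br A B) • (A + (br A Z / br Z B) • B) := by
  have h := br_expand A B Z
  rw [smul_add, smul_smul, div_mul_div_comm, mul_comm (br A B), mul_div_mul_left _ _ hZ,
    div_eq_inv_mul, div_eq_inv_mul, mul_smul, mul_smul, ← smul_add, ← h, inv_smul_smul₀ hAB]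

lemma prj_chart {A B Z : ℂ × ℂ} (hAB : br A B ≠ 0) (hZ : br Z B ≠ 0) :
    prj Z = prj (A + (br A Z / br Z B) • B) := by
  conv_lhs => rw [smul_chart hAB hZ]
  exact prj_smul (div_ne_zero hZ hAB) _

lemma hasDerivAt_iter_line (c : Par d) (n : ℕ) (A B : ℂ × ℂ) (w : ℂ) :
    HasDerivAt (fun w : ℂ => (hlift c)^[n] (A + w • B))
      (fderiv ℂ (hlift c)^[n] (A + w • B) B) w := by
  have h1 : HasDerivAt (fun w : ℂ => A + w • B) B w := by
    simpa using ((hasDerivAt_id w).smul_const B).const_add A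
  exact (differentiable_iter c n _).hasFDerivAt.comp_hasDerivAt w h1

lemma HasDerivAt.br {Z W : ℂ → ℂ × ℂ} {Z' W' : ℂ × ℂ} {t : ℂ} (hZ : HasDerivAt Z Z' t)
    (hW : HasDerivAt W W' t) :
    HasDerivAt (fun t => _root_.br (Z t) (W t)) (_root_.br Z' (W t) + _root_.br (Z t) W') t := by
  have hZ₁ : HasDerivAt (fun t => (Z t).1) Z'.1 t :=
    (ContinuousLinearMap.fst ℂ ℂ ℂ).hasFDerivAt.comp_hasDerivAt t hZ
  have hZ₂ : HasDerivAt (fun t => (Z t).2) Z'.2 t :=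
    (ContinuousLinearMap.snd ℂ ℂ ℂ).hasFDerivAt.comp_hasDerivAt t hZ
  have hW₁ : HasDerivAt (fun t => (W t).1) W'.1 t :=
    (ContinuousLinearMap.fst ℂ ℂ ℂ).hasFDerivAt.comp_hasDerivAt t hW
  have hW₂ : HasDerivAt (fun t => (W t).2) W'.2 t :=
    (ContinuousLinearMap.snd ℂ ℂ ℂ).hasFDerivAt.comp_hasDerivAt t hW
  have := (hZ₁.mul hW₂).sub (hZ₂.mul hW₁)
  refine (this : HasDerivAt (fun t => _root_.br (Z t) (W t)) _ t).congr_deriv ?_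
  simp [_root_.br]
  ring

/-- Points near an attracting point are attracted to it. -/
lemma AttAt.exists_mem_basin {c : Par d} (hc : ND c) (hd : 2 ≤ d) {N : ℕ} {A B : ℂ × ℂ}
    (h : AttAt c N A) (hAB : _root_.br A B ≠ 0) :
    ∃ r, 0 < r ∧ ∀ w : ℂ, ‖w‖ < r → prj (A + w • B) ∈ basin (sphereMap c) N (prj A) := by
  obtain ⟨hA, α, hα, hJ⟩ := h
  have hα0 := AttAt.ne_zero_factor hJ
  have hd0 : (d : ℂ) ≠ 0 := by simp; lia
  have hd0' : (0 : ℝ) < d := by simp; lia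
  set u : ℂ → ℂ := fun w => br ((hlift c)^[N] (A + w • B)) B with hu
  set v : ℂ → ℂ := fun w => br A ((hlift c)^[N] (A + w • B)) with hv
  have hL := hasDerivAt_iter_line c N A B 0
  have hu' := hL.br (hasDerivAt_const (0 : ℂ) B)
  have hv' := (hasDerivAt_const (0 : ℂ) A).br hL
  have hu0 : u 0 = α * br A B := by simp only [hu, zero_smul, add_zero, hα, br_smul_left]
  have hv0 : v 0 = 0 := by simp only [hv, zero_smul, add_zero, hα, br_smul_right, br_self, mul_zero]
  have hu0' : u 0 ≠ 0 := by rw [hu0]; positivity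
  have hF := hv'.div hu' hu0'
  set ρ : ℂ := jac c N A / ((d : ℂ) ^ N * α ^ 2) with hρ
  have hF' : HasDerivAt (fun w => v w / u w) ρ 0 := by
    refine hF.congr_deriv ?_
    have h1 := br_iter_fderiv c N A B
    rw [hα, br_smul_left] at h1
    change (_ * u 0 - v 0 * _) / u 0 ^ 2 = ρ
    rw [hv0, zero_mul, sub_zero, hu0, hρ]
    simp only [zero_smul, add_zero]
    have h2 : br 0 ((hlift c)^[N] A) = 0 := by simp [_root_.br]
    rw [h2, zero_add, div_eq_div_iff (by positivity) (by positivity)]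
    linear_combination (α ^ 2 * br A B) * h1
  have hρ1 : ‖ρ‖ < 1 := by
    rw [hρ, norm_div, div_lt_one (norm_pos_iff.2 (by positivity)), norm_mul, norm_pow, norm_pow,
      Complex.norm_natCast]
    exact hJ
  obtain ⟨q, hq1, hq2⟩ := exists_between hρ1
  have hq0 : 0 < q := (norm_nonneg ρ).trans_lt hq1
  have hev : ∀ᶠ w in 𝓝 (0 : ℂ), u w ≠ 0 ∧ ‖v w / u w‖ ≤ q * ‖w‖ := by
    refine (hu'.continuousAt.eventually_ne hu0').and ?_
    have h1 := (hasDerivAt_iff_tendsto_slope.1 hF').norm.eventually_lt_const hq1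
    rw [eventually_nhdsWithin_iff] at h1
    filter_upwards [h1] with w hw
    by_cases hw0 : w = 0
    · simp [hw0, hv0]
    · have h2 := hw hw0
      rw [slope_def_field, hv0, zero_div, sub_zero, sub_zero, norm_div,
        div_lt_iff₀ (norm_pos_iff.2 hw0)] at h2
      exact h2.le
  obtain ⟨r, hr, hball⟩ := Metric.eventually_nhds_iff_ball.1 hev
  refine ⟨r, hr, fun w hw => ?_⟩
  have hseq : ∀ k, ∃ z : ℂ, ‖z‖ ≤ q ^ k * ‖w‖ ∧
      (sphereMap c)^[N * k] (prj (A + w • B)) = prj (A + z • B) := by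
    intro k
    induction k with
    | zero => exact ⟨w, by simp, by simp⟩
    | succ k ih =>
      obtain ⟨z, hz, h1⟩ := ih
      have hzr : z ∈ ball (0 : ℂ) r := by
        rw [mem_ball_zero_iff]
        refine (hz.trans ?_).trans_lt hw
        exact mul_le_of_le_one_left (norm_nonneg _) (pow_le_one₀ hq0.le hq2.le)
      refine ⟨v z / u z, (hball z hzr).2.trans ?_, ?_⟩
      · rw [pow_succ', mul_assoc]
        gcongr
      · rw [Nat.mul_succ, add_comm, Function.iterate_add_apply, h1,
          iterate_sphereMap_prj hc N (line_ne_zero hAB z)]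
        exact prj_chart hAB (hball z hzr).1
  choose z hz hz' using hseq
  have hz0 : Tendsto z atTop (𝓝 0) := by
    refine squeeze_zero_norm hz ?_
    simpa using (tendsto_pow_atTop_nhds_zero_of_lt_one hq0.le hq2).mul_const ‖w‖
  have h2 : Tendsto (fun k => A + z k • B) atTop (𝓝 A) := by
    simpa using (hz0.smul_const B).const_add A
  exact ((continuousAt_prj hA).tendsto.comp h2).congr fun k => (hz' k).symm

lemma deriv_br_iter_line {c : Par d} {N : ℕ} {A B V : ℂ × ℂ} {w β : ℂ}
    (h : (hlift c)^[N] (A + w • B) = β • V) :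
    HasDerivAt (fun w : ℂ => br ((hlift c)^[N] (A + w • B)) V)
      (br (fderiv ℂ (hlift c)^[N] (A + w • B) B) V) w ∧
    (d : ℂ) ^ N * β * br (fderiv ℂ (hlift c)^[N] (A + w • B) B) V
      = -(jac c N (A + w • B) * br A B) := by
  constructor
  · refine ((hasDerivAt_iter_line c N A B w).br (hasDerivAt_const w V)).congr_deriv ?_
    simp [br]
  · have h1 := br_iter_fderiv c N (A + w • B) B
    rw [h, br_smul_left, br_line, br_swap] at h1
    linear_combination -h1

lemma jac_eq_zero_of_iterate {c : Par d} {N : ℕ} {Z : ℂ × ℂ} (h : jac c N Z = 0) :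
    ∃ l, jac c 1 ((hlift c)^[l] Z) = 0 := by
  by_contra! h'
  induction N with
  | zero => simp [jac, br] at h
  | succ N ih =>
    rw [add_comm, jac_add, mul_eq_zero] at h
    exact h.elim (h' N) ih

lemma mem_basin_self {c : Par d} (hc : ND c) {N : ℕ} {A : ℂ × ℂ} (h : AttAt c N A) :
    prj A ∈ basin (sphereMap c) N (prj A) := by
  obtain ⟨hA, α, hα, hJ⟩ := h
  have h1 : Function.IsFixedPt ((sphereMap c)^[N]) (prj A) := by
    rw [Function.IsFixedPt, iterate_sphereMap_prj hc N hA, hα, prj_smul (AttAt.ne_zero_factor hJ)]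
  have h2 : ∀ k, (sphereMap c)^[N * k] (prj A) = prj A := fun k => by
    rw [Function.iterate_mul]
    exact h1.iterate k
  simp only [basin, mem_ofPred_eq, h2]
  exact tendsto_const_nhds

/-- **Fatou.** An attracting cycle attracts a critical point. -/
theorem AttAt.exists_critical {c : Par d} (hc : ND c) (hd : 2 ≤ d) {N : ℕ} {A B : ℂ × ℂ}
    (h : AttAt c N A) (hB : AttAt c N B) (hAB : br A B ≠ 0) :
    ∃ Z, Z ≠ 0 ∧ jac c 1 Z = 0 ∧
      ∃ l, prj Z ∈ basin (sphereMap c) N ((sphereMap c)^[l] (prj A)) := by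
  by_contra! hcr
  have hnc : ∀ Z, Z ≠ 0 → prj Z ∈ basin (sphereMap c) N (prj A) → jac c N Z ≠ 0 := by
    intro Z hZ hZb hJ
    obtain ⟨l, hl⟩ := jac_eq_zero_of_iterate hJ
    refine hcr _ (hc.iter_ne_zero l hZ) hl l ?_
    rw [← iterate_sphereMap_prj hc l hZ]
    exact basin_iterate hc.continuous l hZb
  have hmem := mem_basin_self hc h
  obtain ⟨r, hr, hrb⟩ := h.exists_mem_basin hc hd hAB
  obtain ⟨r', hr', hrb'⟩ := hB.exists_mem_basin hc hd (B := A) (by rwa [br_swap, neg_ne_zero])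
  have hM : ∀ w : ℂ, prj (A + w • B) ∈ basin (sphereMap c) N (prj A) → ‖w‖ ≤ r'⁻¹ := by
    intro w hw
    by_contra! hlt
    have hw0 : w ≠ 0 := by
      rintro rfl
      rw [norm_zero] at hlt
      exact hlt.not_ge (by positivity)
    have h1 : prj (A + w • B) = prj (B + w⁻¹ • A) := by
      rw [← prj_smul (inv_ne_zero hw0) (A + w • B), smul_add, inv_smul_smul₀ hw0, add_comm]
    rw [h1] at hw
    have h2 := hrb' w⁻¹ (by rw [norm_inv]; exact inv_lt_of_inv_lt₀ hr' hlt)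
    exact hAB ((prj_eq_prj_iff h.1 hB.1).1 (tendsto_nhds_unique hw h2))
  obtain ⟨hA, α, hα, hJ⟩ := h
  have hα0 := AttAt.ne_zero_factor hJ
  have hd0 : (d : ℂ) ≠ 0 := by simp; lia
  have hJ0 := hnc A hA hmem
  have step : ∀ g : ℂ → ℂ, DifferentiableOn ℂ g (ball 0 r) → g 0 = 0 →
      (∀ s ∈ ball (0 : ℂ) r, prj (A + g s • B) ∈ basin (sphereMap c) N (prj A)) →
      ∃ g₁ : ℂ → ℂ, DifferentiableOn ℂ g₁ (ball 0 r) ∧ g₁ 0 = 0 ∧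
      (∀ s ∈ ball (0 : ℂ) r, prj (A + g₁ s • B) ∈ basin (sphereMap c) N (prj A)) ∧
      jac c N A * deriv g₁ 0 = (d : ℂ) ^ N * α ^ 2 * deriv g 0 := by
    intro g hg hg0 hgb
    have hmem' : ∀ s ∈ ball (0 : ℂ) r, ∀ w : ℂ, br ((hlift c)^[N] (A + w • B)) (A + g s • B) = 0 →
        prj (A + w • B) ∈ basin (sphereMap c) N (prj A) := by
      intro s hs w hw
      apply basin_of_iterate
      rw [iterate_sphereMap_prj hc N (line_ne_zero hAB w),
        (prj_eq_prj_iff (hc.iter_ne_zero N (line_ne_zero hAB w)) (line_ne_zero hAB _)).2 hw]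
      exact hgb s hs
    obtain ⟨g₁, h1, h2, h3⟩ := exists_root_section (c := 0) (R := r)
      (Ψ := fun u => br ((hlift c)^[N] (A + u.2 • B)) (A + g u.1 • B)) (t₀ := 0) (w₀ := 0)
      (by
        intro u hu
        have e1 : ContDiffAt ℂ 1 (fun u : ℂ × ℂ => (hlift c)^[N] (A + u.2 • B)) u := by
          have e0 : ContDiff ℂ 1 (fun u : ℂ × ℂ => A + u.2 • B) := by fun_prop
          have := ((contDiff_iter_right N c).of_le le_top).comp e0
          simpa only [Function.comp_def] using this.contDiffAt
        have e2 : ContDiffAt ℂ 1 (fun u : ℂ × ℂ => A + g u.1 • B) u := by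
          have e0 : ContDiffAt ℂ 1 g u.1 :=
            (hg.analyticAt (isOpen_ball.mem_nhds hu)).contDiffAt
          have e3 : ContDiffAt ℂ 1 (fun u : ℂ × ℂ => g u.1) u := e0.comp u contDiffAt_fst
          exact contDiffAt_const.add (e3.smul contDiffAt_const)
        exact (e1.fst.mul e2.snd).sub (e1.snd.mul e2.fst))
      (by
        intro s hs w hw
        obtain ⟨β, hβ⟩ := exists_smul_of_br_eq_zero (line_ne_zero hAB (g s))
          (by rw [br_swap, neg_eq_zero]; exact hw)
        obtain ⟨k1, k2⟩ := deriv_br_iter_line hβ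
        rw [k1.deriv]
        intro h0
        rw [h0, mul_zero, eq_comm, neg_eq_zero] at k2
        exact mul_ne_zero (hnc _ (line_ne_zero hAB w) (hmem' s hs w hw)) hAB k2)
      (by
        intro s hs
        refine ⟨r'⁻¹, ?_⟩
        filter_upwards [isOpen_ball.mem_nhds hs] with s' hs' w hw
        exact hM w (hmem' s' hs' w hw))
      (mem_ball_self hr)
      (by simp [hg0, hα, br_smul_left, br_self])
    refine ⟨g₁, h1, h2, fun s hs => hmem' s hs _ (h3 s hs), ?_⟩
    have hb0 : ball (0 : ℂ) r ∈ 𝓝 0 := ball_mem_nhds _ hr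
    have d1 := (h1.differentiableAt hb0).hasDerivAt
    have d2 := (hg.differentiableAt hb0).hasDerivAt
    have d3 : HasDerivAt (fun s => A + (g s : ℂ) • B) (deriv g 0 • B) 0 :=
      (d2.smul_const B).const_add A
    have d4 : HasDerivAt (fun s => (hlift c)^[N] (A + g₁ s • B))
        (deriv g₁ 0 • fderiv ℂ (hlift c)^[N] (A + g₁ 0 • B) B) 0 :=
      (hasDerivAt_iter_line c N A B (g₁ 0)).scomp 0 d1
    have d5 := d4.br d3
    have d6 : HasDerivAt (fun s => br ((hlift c)^[N] (A + g₁ s • B)) (A + g s • B)) 0 0 := by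
      refine (hasDerivAt_const (0 : ℂ) (0 : ℂ)).congr_of_eventuallyEq ?_
      filter_upwards [hb0] with s hs
      exact h3 s hs
    have d7 := d5.unique d6
    rw [h2, hg0] at d7
    simp only [zero_smul, add_zero, hα, br_smul_left, br_smul_right] at d7
    have d8 := br_iter_fderiv c N A B
    rw [hα, br_smul_left, br_swap] at d8
    apply mul_right_cancel₀ hAB
    linear_combination (-deriv g₁ 0) * d8 - ((d : ℂ) ^ N * α) * d7
  set ρ : ℝ := ((d : ℝ) ^ N * ‖α‖ ^ 2) / ‖jac c N A‖ with hρ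
  have hρ1 : 1 < ρ := (one_lt_div (norm_pos_iff.2 hJ0)).2 hJ
  have key : ∀ k : ℕ, ∃ g : ℂ → ℂ, DifferentiableOn ℂ g (ball 0 r) ∧ g 0 = 0 ∧
      (∀ s ∈ ball (0 : ℂ) r, prj (A + g s • B) ∈ basin (sphereMap c) N (prj A)) ∧
      ‖deriv g 0‖ = ρ ^ k := by
    intro k
    induction k with
    | zero => exact ⟨id, differentiableOn_id, rfl,
        fun s hs => hrb s (by simpa using hs), by simp⟩
    | succ k ih =>
      obtain ⟨g, h1, h2, h3, h4⟩ := ih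
      obtain ⟨g₁, k1, k2, k3, k4⟩ := step g h1 h2 h3
      refine ⟨g₁, k1, k2, k3, ?_⟩
      have k5 := congrArg norm k4
      simp only [norm_mul, norm_pow, Complex.norm_natCast, h4] at k5
      rw [pow_succ', hρ, div_mul_eq_mul_div, eq_div_iff (norm_ne_zero_iff.2 hJ0), ← hρ, ← k5,
        mul_comm]
  obtain ⟨k, hk⟩ := pow_unbounded_of_one_lt (r'⁻¹ / (r / 2)) hρ1
  obtain ⟨g, h1, h2, h3, h4⟩ := key k
  have h5 : ‖deriv g 0‖ ≤ r'⁻¹ / (r / 2) := by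
    refine Complex.norm_deriv_le_of_forall_mem_sphere_norm_le (by positivity) ?_ ?_
    · refine (h1.mono ?_).diffContOnCl
      rw [closure_ball _ (by positivity)]
      exact closedBall_subset_ball (by linarith)
    · intro z hz
      exact hM _ (h3 z (sphere_subset_closedBall.trans (closedBall_subset_ball (by linarith)) hz))
  linarith

/-! ### Generic critical points -/

/-- The Wronskian polynomial, whose roots are the finite critical points. -/
def wr (c : Par d) : ℂ[X] :=
  derivative (polyOf c.1) * polyOf c.2 - polyOf c.1 * derivative (polyOf c.2)

lemma jac_one (c : Par d) (z : ℂ) : jac c 1 (z, 1) = d * (wr c).eval z := by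
  have h1 := br_iter_fderiv c 1 (z, 1) (1, 0)
  have h2 := hasDerivAt_iter_line c 1 (0, 1) (1, 0) z
  have e : ∀ w : ℂ, ((0, 1) : ℂ × ℂ) + w • ((1, 0) : ℂ × ℂ) = (w, 1) := fun w => by simp
  simp only [e, Function.iterate_one, hlift, hom_one] at h2
  have h3 := ((polyOf c.1).hasDerivAt z).prodMk ((polyOf c.2).hasDerivAt z)
  have h4 := h2.unique h3
  simp only [Function.iterate_one, hlift, hom_one] at h1
  rw [h4] at h1
  simp only [br, wr, eval_sub, eval_mul, pow_one] at h1 ⊢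
  linear_combination h1

lemma natDegree_wr_le (hd : 2 ≤ d) (c : Par d) : (wr c).natDegree ≤ 2 * d - 2 := by
  have hp := polyOf_natDegree_le c.1
  have hq := polyOf_natDegree_le c.2
  have hp' : (derivative (polyOf c.1)).natDegree ≤ d - 1 :=
    (natDegree_derivative_le _).trans (by lia)
  have hq' : (derivative (polyOf c.2)).natDegree ≤ d - 1 :=
    (natDegree_derivative_le _).trans (by lia)
  rw [natDegree_le_iff_coeff_eq_zero]
  intro n hn
  rw [wr, coeff_sub]
  rcases eq_or_ne n (d - 1 + d) with rfl | hne
  · rw [coeff_mul_add_eq_of_natDegree_le hp' hq, show d - 1 + d = d + (d - 1) by lia,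
      coeff_mul_add_eq_of_natDegree_le hp hq', coeff_derivative, coeff_derivative,
      show d - 1 + 1 = d by lia]
    ring
  · rw [coeff_eq_zero_of_natDegree_lt, coeff_eq_zero_of_natDegree_lt, sub_zero]
    · exact natDegree_mul_le.trans_lt (by lia)
    · exact natDegree_mul_le.trans_lt (by lia)

/-- All critical points are finite and simple. -/
def Gen (c : Par d) : Prop :=
  (wr c).natDegree = 2 * d - 2 ∧ ∀ w, (wr c).eval w = 0 → (derivative (wr c)).eval w ≠ 0

lemma continuous_coeff_wr (k : ℕ) : Continuous fun c : Par d => (wr c).coeff k := by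
  have h1 : ∀ n, Continuous fun c : Par d => (polyOf c.1).coeff n := fun n => by
    simp only [polyOf, finsetSum_coeff, coeff_C_mul, coeff_X_pow]
    fun_prop
  have h2 : ∀ n, Continuous fun c : Par d => (polyOf c.2).coeff n := fun n => by
    simp only [polyOf, finsetSum_coeff, coeff_C_mul, coeff_X_pow]
    fun_prop
  simp only [wr, coeff_sub, coeff_mul, coeff_derivative]
  fun_prop

lemma continuous_resultant_wr (m n : ℕ) :
    Continuous fun c : Par d => resultant (wr c) (derivative (wr c)) m n := by
  refine Continuous.matrix_det (continuous_matrix fun i j => ?_)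
  simp only [sylvester, Matrix.of_apply]
  refine j.addCases (fun j => ?_) (fun j => ?_)
  · simp only [Fin.addCases_left]
    split_ifs
    · simp only [coeff_derivative]
      exact (continuous_coeff_wr _).mul continuous_const
    · exact continuous_const
  · simp only [Fin.addCases_right]
    split_ifs
    · exact continuous_coeff_wr _
    · exact continuous_const

lemma gen_iff (hd : 2 ≤ d) (c : Par d) : Gen c ↔ (wr c).coeff (2 * d - 2) ≠ 0 ∧
    resultant (wr c) (derivative (wr c)) (2 * d - 2) (2 * d - 3) ≠ 0 := by
  have hle := natDegree_wr_le hd c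
  have hdeg : (wr c).natDegree = 2 * d - 2 ↔ (wr c).coeff (2 * d - 2) ≠ 0 := by
    constructor
    · intro h h0
      rw [← h, coeff_natDegree, leadingCoeff_eq_zero] at h0
      rw [h0, natDegree_zero] at h
      lia
    · exact fun h => le_antisymm hle (le_natDegree_of_ne_zero h)
  rw [Gen, ← hdeg]
  refine and_congr_right fun h => ?_
  have h2 : (derivative (wr c)).natDegree = 2 * d - 3 := by rw [natDegree_derivative, h]; lia
  rw [← h, ← h2, Ne, resultant_eq_zero_iff]
  have h0 : wr c ≠ 0 := by
    intro h0
    rw [h0, natDegree_zero] at h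
    lia
  have hcop : IsCoprime (wr c) (derivative (wr c)) ↔
      ∀ w, (wr c).eval w = 0 → (derivative (wr c)).eval w ≠ 0 := by
    rw [isCoprime_iff_aeval_ne_zero_of_isAlgClosed ℂ ℂ]
    simp only [coe_aeval_eq_eval]
    exact forall_congr' fun w => by tauto
  rw [← hcop]
  tauto

lemma isOpen_gen (hd : 2 ≤ d) : IsOpen {c : Par d | Gen c} := by
  simp only [gen_iff hd]
  exact ((continuous_coeff_wr _).isOpen_preimage _ isOpen_compl_singleton).inter
    ((continuous_resultant_wr _ _).isOpen_preimage _ isOpen_compl_singleton)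

/-- A map with generic critical points: `z ↦ (2 z ^ d + z) / (z ^ (d - 1) + 2)`. -/
lemma exists_gen (hd : 2 ≤ d) : ∃ c : Par d, Gen c := by
  obtain ⟨k, rfl⟩ : ∃ k, d = k + 2 := ⟨d - 2, by lia⟩
  have hsum : ∀ a : ℂ[X], a.natDegree ≤ k + 2 →
      polyOf (fun i : Fin (k + 2 + 1) => a.coeff i) = a := by
    intro a ha
    rw [polyOf, Fin.sum_univ_eq_sum_range (fun i => C (a.coeff i) * X ^ i) (k + 2 + 1)]
    exact (a.as_sum_range_C_mul_X_pow' (by lia)).symm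
  set p : ℂ[X] := C 2 * X ^ (k + 2) + X with hp
  set q : ℂ[X] := X ^ (k + 1) + C 2 with hq
  have hwr : wr ((fun i => p.coeff i, fun i => q.coeff i) : Par (k + 2)) =
      C 2 * X ^ (2 * k + 2) + C (3 * (k : ℂ) + 8) * X ^ (k + 1) + C 2 := by
    simp only [wr]
    rw [hsum p (by rw [hp]; compute_degree!), hsum q (by rw [hq]; compute_degree!), hp, hq]
    simp only [derivative_mul, derivative_C, derivative_X_pow, derivative_X, map_add,
      map_mul, map_natCast]
    simp only [Nat.cast_add, map_ofNat, Nat.cast_ofNat, Nat.cast_one,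
      show k + 2 - 1 = k + 1 by lia, show k + 1 - 1 = k by lia]
    ring
  refine ⟨(fun i => p.coeff i, fun i => q.coeff i), ?_⟩
  rw [Gen, hwr]
  constructor
  · compute_degree!
    all_goals lia
  · intro w hw hw'
    simp only [derivative_add, derivative_mul, derivative_C, derivative_X_pow, eval_add, eval_mul,
      eval_C, eval_pow, eval_X, zero_mul, zero_add, add_zero,
      show 2 * k + 2 - 1 = 2 * k + 1 by lia, show k + 1 - 1 = k by lia] at hw hw'
    push_cast at hw'
    set b : ℂ := 3 * k + 8 with hb
    set u : ℂ := w ^ (k + 1) with hu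
    have h1 : 2 * u ^ 2 + b * u + 2 = 0 := by rw [← hw, hu]; ring
    have hk : (k : ℂ) + 1 ≠ 0 := by exact_mod_cast Nat.succ_ne_zero k
    have h2 : 4 * u ^ 2 + b * u = 0 := by
      apply mul_left_cancel₀ hk
      rw [mul_zero, ← mul_zero w, ← hw', hu]
      ring
    have hu0 : u ≠ 0 := by
      rintro h0
      rw [h0] at h1
      norm_num at h1
    have h3 : 4 * u + b = 0 := by
      apply mul_left_cancel₀ hu0
      linear_combination h2
    have h4 : b ^ 2 = 16 := by linear_combination (-8) * h1 + (4 * u + b) * h3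
    have h5 : (3 * k + 8) ^ 2 = 16 := by rw [hb] at h4; exact_mod_cast h4
    nlinarith

lemma exists_mem_gen (hd : 2 ≤ d) {c : Par d} {V : Set (Par d)} (hV : V ∈ 𝓝 c) :
    ∃ c' ∈ V, Gen c' := by
  obtain ⟨e, he⟩ := exists_gen hd
  set v : Par d := e - c with hv
  have hpoly : ∀ (a b : Fin (d + 1) → ℂ) (t : ℂ), polyOf (a + t • b) = polyOf a + C t * polyOf b := by
    intro a b t
    simp only [polyOf, Pi.add_apply, Pi.smul_apply, smul_eq_mul, C_add, C_mul, add_mul,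
      Finset.sum_add_distrib, Finset.mul_sum, mul_assoc]
  set Q : ℂ[X] := derivative (polyOf c.1) * polyOf v.2 + derivative (polyOf v.1) * polyOf c.2
    - polyOf c.1 * derivative (polyOf v.2) - polyOf v.1 * derivative (polyOf c.2) with hQ
  have hexp : ∀ t : ℂ, wr (c + t • v) = wr c + C t * Q + C (t ^ 2) * wr v := by
    intro t
    simp only [wr, Prod.fst_add, Prod.snd_add, Prod.smul_fst, Prod.smul_snd, hpoly, derivative_add,
      derivative_C_mul, hQ, C_pow]
    ring
  set P : ℂ[X][X] := (wr c).map C + C X * Q.map C + C (X ^ 2) * (wr v).map C with hP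
  have hmap : ∀ t : ℂ, P.map (evalRingHom t) = wr (c + t • v) := by
    intro t
    have hC : (evalRingHom t).comp C = RingHom.id ℂ := by ext x; simp
    rw [hexp, hP]
    simp only [Polynomial.map_add, Polynomial.map_mul, Polynomial.map_map, hC, Polynomial.map_id,
      Polynomial.map_C, coe_evalRingHom, eval_X, eval_pow]
  have h1 : P.map (evalRingHom 1) = wr e := by rw [hmap, one_smul, hv, add_sub_cancel]
  have hQdeg : Q.natDegree ≤ 2 * d - 2 := by
    have : Q = wr (c + (1 : ℂ) • v) - wr c - wr v := by rw [hexp]; simp; ring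
    rw [this]
    exact (natDegree_sub_le_of_le (natDegree_sub_le_of_le (natDegree_wr_le hd _)
      (natDegree_wr_le hd _)) (natDegree_wr_le hd _)).trans (by simp)
  have hPdeg : P.natDegree ≤ 2 * d - 3 + 1 := by
    rw [show 2 * d - 3 + 1 = 2 * d - 2 by lia]
    refine natDegree_add_le_of_degree_le (natDegree_add_le_of_degree_le ?_ ?_) ?_
    · exact natDegree_map_le.trans (natDegree_wr_le hd _)
    · exact (natDegree_C_mul_le _ _).trans (natDegree_map_le.trans hQdeg)
    · exact (natDegree_C_mul_le _ _).trans (natDegree_map_le.trans (natDegree_wr_le hd _))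
  have hfin := finite_multiple_root P (2 * d - 3) hPdeg (by rw [h1, he.1]; lia)
    (by rw [h1]; exact he.2)
  have hlead : (P.coeff (2 * d - 2)) ≠ 0 := by
    intro h0
    have h2 := congrArg (fun p => p.coeff (2 * d - 2)) h1
    simp only [coeff_map, h0, map_zero] at h2
    exact ((gen_iff hd e).1 he).1 h2.symm
  have hfin2 : {t : ℂ | (P.coeff (2 * d - 2)).eval t = 0}.Finite := by
    refine ((P.coeff (2 * d - 2)).roots.toFinset.finite_toSet).subset fun t ht => ?_
    simpa [hlead] using ht
  have hline : Tendsto (fun t : ℂ => c + t • v) (𝓝 0) (𝓝 c) := by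
    have : Continuous fun t : ℂ => c + t • v := by fun_prop
    simpa using this.tendsto 0
  have hV' : (fun t : ℂ => c + t • v) ⁻¹' V ∈ 𝓝 (0 : ℂ) := hline hV
  obtain ⟨t, htV, ht⟩ := ((infinite_of_mem_nhds _ hV').sdiff (hfin.union hfin2)).nonempty
  refine ⟨_, htV, ?_⟩
  simp only [mem_union, not_or, mem_ofPred_eq, not_exists, not_and, hmap] at ht
  refine ⟨le_antisymm (natDegree_wr_le hd _) (le_natDegree_of_ne_zero ?_), ht.1⟩
  rw [← hmap, coeff_map]
  exact ht.2

lemma HasAtt.le {c : Par d} (hd : 2 ≤ d) (hc : ND c) (hg : Gen c) {m : ℕ} (h : HasAtt c m) :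
    m ≤ 2 * d := by
  rcases Nat.lt_or_ge m 2 with hm | hm
  · lia
  obtain ⟨N, hN, A, hA, hdis⟩ := h
  have hex : ∀ i, ∃ Z, Z ≠ 0 ∧ jac c 1 Z = 0 ∧
      ∃ l, prj Z ∈ basin (sphereMap c) N ((sphereMap c)^[l] (prj (A i))) := by
    intro i
    obtain ⟨j, hj⟩ : ∃ j, i ≠ j := by
      by_contra! h0
      have := h0 ⟨0, by lia⟩
      have := h0 ⟨1, by lia⟩
      simp_all
    exact (hA i).exists_critical hc hd (hA j) (hdis i j hj 0)
  choose Z hZ0 hZJ l hl using hex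
  have hfix : ∀ j k, (sphereMap c)^[N * k] (prj (A j)) = prj (A j) := by
    intro j k
    obtain ⟨hA0, α, hα, hJ⟩ := hA j
    rw [Function.iterate_mul]
    refine Function.IsFixedPt.iterate ?_ k
    rw [Function.IsFixedPt, iterate_sphereMap_prj hc N hA0, hα,
      prj_smul (AttAt.ne_zero_factor hJ)]
  have hinj : Function.Injective fun i => prj (Z i) := by
    intro i j hij
    by_contra hne
    have h1 := hl i
    simp only at hij
    rw [hij] at h1
    have h2 := congrArg (sphereMap c)^[(N - 1) * l j] (tendsto_nhds_unique h1 (hl j))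
    rw [← Function.iterate_add_apply, ← Function.iterate_add_apply,
      show (N - 1) * l j + l j = N * l j by
        rw [← Nat.succ_mul, Nat.succ_eq_add_one, Nat.sub_add_cancel hN], hfix,
      iterate_sphereMap_prj hc _ (hA i).1,
      prj_eq_prj_iff (hc.iter_ne_zero _ (hA i).1) (hA j).1] at h2
    exact hdis i j hne _ h2
  have hw0 : wr c ≠ 0 := by
    intro h0
    have := hg.1
    rw [h0, natDegree_zero] at this
    lia
  set S : Finset Sphere := insert ∞ ((wr c).roots.toFinset.image fun z : ℂ => (z : Sphere)) with hS
  have hmem : ∀ i, prj (Z i) ∈ S := by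
    intro i
    by_cases h2 : (Z i).2 = 0
    · rw [prj, if_pos h2]
      exact Finset.mem_insert_self _ _
    · rw [prj, if_neg h2]
      refine Finset.mem_insert_of_mem (Finset.mem_image_of_mem _ ?_)
      rw [Multiset.mem_toFinset, mem_roots hw0, IsRoot.def]
      have h3 := jac_smul c 1 (Z i).2 ((Z i).1 / (Z i).2, 1)
      have h4 : (Z i).2 • (((Z i).1 / (Z i).2, 1) : ℂ × ℂ) = Z i := by
        apply Prod.ext <;> simp [mul_div_cancel₀, h2]
      rw [h4, hZJ, mul_zero, jac_one] at h3
      have hd0 : (d : ℂ) ≠ 0 := by simp; lia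
      have h5 : ((Z i).2 ^ d ^ 1) ^ 2 * (d : ℂ) ≠ 0 := by positivity
      rw [← mul_assoc, eq_comm, mul_eq_zero] at h3
      exact h3.resolve_left h5
  have hcard : Fintype.card (Fin m) ≤ S.card := by
    rw [← Finset.card_univ]
    exact Finset.card_le_card_of_injOn _ (fun i _ => hmem i) hinj.injOn
  have h6 : S.card ≤ (2 * d - 2) + 1 := by
    refine (Finset.card_insert_le _ _).trans ?_
    gcongr
    refine Finset.card_image_le.trans ((Multiset.toFinset_card_le _).trans ?_)
    exact (card_roots' _).trans (natDegree_wr_le hd c)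
  rw [Fintype.card_fin] at hcard
  lia

/-- Every open set of maps contains an open set of maps all of whose periodic points have
multiplier different from one. -/
theorem exists_open_np (hd : 2 ≤ d) {W : Set (Par d)} (hW : IsOpen W) {c₀ : Par d} (hc₀ : c₀ ∈ W)
    (hnd : ND c₀) :
    ∃ V ⊆ W, IsOpen V ∧ V.Nonempty ∧ ∀ c ∈ V, ND c ∧ Gen c ∧ ∀ n, 1 ≤ n → NP n c := by
  set W' : Set (Par d) := W ∩ {c | ND c} ∩ {c | Gen c} with hW'
  have hW'o : IsOpen W' := (hW.inter isOpen_nd).inter (isOpen_gen hd)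
  have hne : W'.Nonempty := by
    obtain ⟨c, hc, hg⟩ := exists_mem_gen hd ((hW.inter isOpen_nd).mem_nhds ⟨hc₀, hnd⟩)
    exact ⟨c, hc, hg⟩
  set S : Set ℕ := {m | ∃ c ∈ W', HasAtt c m} with hS
  have hS0 : S.Nonempty := by
    obtain ⟨c, hc⟩ := hne
    exact ⟨0, c, hc, 1, le_rfl, Fin.elim0, fun i => i.elim0, fun i => i.elim0⟩
  have hSb : BddAbove S := ⟨2 * d, fun m ⟨c, hc, h⟩ => h.le hd hc.1.2 hc.2⟩
  obtain ⟨c₁, hc₁, hm⟩ := Nat.sSup_mem hS0 hSb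
  set m := sSup S with hmdef
  refine ⟨W' ∩ interior {c | HasAtt c m}, fun c hc => hc.1.1.1, hW'o.inter isOpen_interior,
    ⟨c₁, hc₁, mem_interior_iff_mem_nhds.2 hm.eventually⟩, ?_⟩
  rintro c ⟨hcW, hcm⟩
  have hc : ND c := hcW.1.2
  refine ⟨hc, hcW.2, fun n hn Z hZ h0 B hB h1 => ?_⟩
  obtain ⟨N, hN, A, hA, hdis⟩ := interior_subset hcm
  obtain ⟨α, hα⟩ := exists_factor hZ h0
  have hα0 : α ≠ 0 := by
    rintro rfl
    exact hc.iter_ne_zero n hZ (by rw [hα, zero_smul])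
  have hJ : jac c n Z = (d : ℂ) ^ n * α ^ 2 := by
    have := fderiv_phi_of_fixed hα B
    rw [h1, mul_zero, eq_comm, mul_eq_zero] at this
    exact (sub_eq_zero.1 (this.resolve_right hB)).symm
  have hbr := fun i => (hA i).br_ne_zero hc hd hN hn hZ hα0 hα hJ
  let A₁ : Fin (m + 1) → ℂ × ℂ := Fin.cons Z A
  have hA₁ : A₁ 0 = Z := rfl
  have hA₁s : ∀ i : Fin m, A₁ i.succ = A i := fun _ => rfl
  have hdis' : ∀ i j, i ≠ j → ∀ k, br ((hlift c)^[k] (A₁ i)) (A₁ j) ≠ 0 := by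
    intro i j hij k
    refine Fin.cases (motive := fun i => i ≠ j → br ((hlift c)^[k] (A₁ i)) (A₁ j) ≠ 0) ?_ ?_ i hij
    · refine Fin.cases ?_ ?_ j
      · intro h; exact absurd rfl h
      · intro j _
        simp only [hA₁, hA₁s]
        intro h2
        rw [← prj_eq_prj_iff (hc.iter_ne_zero k hZ) (hA j).1, ← iterate_sphereMap_prj hc k hZ] at h2
        have h3 := congrArg (sphereMap c)^[(n - 1) * k] h2
        have hfix : (sphereMap c)^[n * k] (prj Z) = prj Z := by
          rw [Function.iterate_mul]
          refine Function.IsFixedPt.iterate ?_ k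
          rw [Function.IsFixedPt, iterate_sphereMap_prj hc n hZ, hα, prj_smul hα0]
        rw [← Function.iterate_add_apply, show (n - 1) * k + k = n * k by
          rw [← Nat.succ_mul, Nat.succ_eq_add_one, Nat.sub_add_cancel hn], hfix,
          iterate_sphereMap_prj hc _ (hA j).1, eq_comm,
          prj_eq_prj_iff (hc.iter_ne_zero _ (hA j).1) hZ] at h3
        exact hbr j _ h3
    · intro i
      refine Fin.cases ?_ ?_ j
      · intro _
        simp only [hA₁, hA₁s]
        exact hbr i k
      · intro j h
        simp only [hA₁s]
        exact hdis i j (fun h' => h (by rw [h'])) k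
  obtain ⟨V, hV, hev⟩ := exists_nhds_hasAtt (N := n * N) (Nat.mul_pos hn hN) hdis'
  have hev2 := eventually_all.2 fun i => ((hA i).mul hn hd).eventually (hV i.succ)
  obtain ⟨c', hc', Z', hZ', hatt⟩ := exists_attAt_near hd hn hc hZ h0 hB h1
    ((hev.and hev2).and (hW'o.mem_nhds hcW)) (hV 0)
  obtain ⟨⟨e1, e2⟩, e3⟩ := hc'
  choose A' hA'V hA' using e2
  have hbig : HasAtt c' (m + 1) := by
    refine e1 (Fin.cons Z' A') ?_ ?_
    · exact fun i => Fin.cases hZ' (fun i => hA'V i) i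
    · refine fun i => Fin.cases ?_ (fun i => hA' i) i
      have := hatt.mul hN hd
      rwa [mul_comm] at this
  have := le_csSup hSb (show m + 1 ∈ S from ⟨c', e3, hbig⟩)
  lia

/-! ### Holomorphic motion of the periodic points -/

/-- The implicit function is differentiable near the base point. -/
lemma exists_implicit_differentiable {E : Type*} [NormedAddCommGroup E] [NormedSpace ℂ E]
    [CompleteSpace E] {Ψ : E × ℂ → ℂ} {u : E × ℂ} (hΨ : ContDiff ℂ 1 Ψ) (h0 : Ψ u = 0)
    (hd : deriv (fun w => Ψ (u.1, w)) u.2 ≠ 0) :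
    ∃ s : E → ℂ, s u.1 = u.2 ∧ ∀ᶠ x in 𝓝 u.1, DifferentiableAt ℂ s x ∧ Ψ (x, s x) = 0 := by
  obtain ⟨s, hs, hsd, hs0, hs1⟩ := exists_implicit_of_deriv_ne_zero hΨ.contDiffAt h0 hd
  refine ⟨s, hs, ?_⟩
  have hder : ∀ x w, deriv (fun w => Ψ (x, w)) w = fderiv ℂ Ψ (x, w) (0, 1) := by
    intro x w
    have h1 : HasFDerivAt Ψ (fderiv ℂ Ψ (x, w)) (x, w) :=
      (hΨ.differentiable one_ne_zero _).hasFDerivAt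
    have h2 := h1.comp w (hasFDerivAt_prodMk_right x w)
    have h3 := h2.hasDerivAt.deriv
    simpa [Function.comp_def] using h3
  have hcont : Continuous fun v : E × ℂ => fderiv ℂ Ψ v ((0, 1) : E × ℂ) :=
    (hΨ.continuous_fderiv one_ne_zero).clm_apply continuous_const
  have hlim : Tendsto (fun x => (x, s x)) (𝓝 u.1) (𝓝 u) := by
    have := (tendsto_id (α := E) (x := 𝓝 u.1)).prodMk_nhds hsd.continuousAt.tendsto
    rwa [hs] at this
  have hne : ∀ᶠ x in 𝓝 u.1, fderiv ℂ Ψ (x, s x) ((0, 1) : E × ℂ) ≠ 0 := by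
    refine hlim.eventually (hcont.continuousAt.eventually_ne ?_)
    rw [← hder u.1 u.2]
    exact hd
  filter_upwards [hs0, hne, hlim.eventually (eventually_eventually_nhds.2 hs1)] with x h1 h2 h3
  refine ⟨?_, h1⟩
  obtain ⟨s', k1, k2, k3, -⟩ := exists_implicit_of_deriv_ne_zero (u := (x, s x))
    hΨ.contDiffAt h1 (by rw [hder]; exact h2)
  have hlim' : Tendsto (fun y => (y, s' y)) (𝓝 x) (𝓝 (x, s x)) := by
    have := (tendsto_id (α := E) (x := 𝓝 x)).prodMk_nhds k2.continuousAt.tendsto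
    simp only at k1
    rwa [k1] at this
  refine k2.congr_of_eventuallyEq ?_
  filter_upwards [k3, hlim'.eventually h3] with y h4 h5
  exact h5.1 h4

/-- A holomorphically moving frame of fixed points along a holomorphic family of maps without
periodic points of multiplier one. -/
structure Frame (γ : ℂ → Par d) (A C : ℂ → ℂ × ℂ) : Prop where
  nd : ∀ t ∈ ball (0 : ℂ) 2, ND (γ t)
  np : ∀ t ∈ ball (0 : ℂ) 2, ∀ n, 1 ≤ n → NP n (γ t)
  diff_par : DifferentiableOn ℂ γ (ball 0 2)
  diff_fst : DifferentiableOn ℂ A (ball 0 2)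
  diff_snd : DifferentiableOn ℂ C (ball 0 2)
  br_ne : ∀ t ∈ ball (0 : ℂ) 2, br (A t) (C t) ≠ 0
  fix_zero : ∀ t ∈ ball (0 : ℂ) 2, Phi 1 (γ t) (A t) = 0
  fix_one : ∀ t ∈ ball (0 : ℂ) 2, Phi 1 (γ t) (A t + C t) = 0
  fix_infty : ∀ t ∈ ball (0 : ℂ) 2, Phi 1 (γ t) (C t) = 0

/-- The holomorphic sections of periodic points in a moving frame. -/
def perSec (γ : ℂ → Par d) (A C : ℂ → ℂ × ℂ) : Set (ℂ → ℂ) :=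
  {φ | DifferentiableOn ℂ φ (ball 0 2) ∧
    ∃ n, 1 ≤ n ∧ ∀ t ∈ ball (0 : ℂ) 2, Phi n (γ t) (A t + φ t • C t) = 0}

lemma phi_mul {c : Par d} (hc : ND c) {n : ℕ} {Z : ℂ × ℂ} (hZ : Z ≠ 0) (h : Phi n c Z = 0)
    (j : ℕ) : Phi (n * j) c Z = 0 := by
  rw [phi_eq_zero_iff hc _ hZ] at h ⊢
  rw [Function.iterate_mul]
  exact Function.IsFixedPt.iterate h j

lemma contDiffAt_phi_frame {γ : ℂ → Par d} {A C : ℂ → ℂ × ℂ} {s : Set ℂ}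
    (hγ : DifferentiableOn ℂ γ s) (hA : DifferentiableOn ℂ A s) (hC : DifferentiableOn ℂ C s)
    (n : ℕ) {u : ℂ × ℂ} (hb : s ∈ 𝓝 u.1) :
    ContDiffAt ℂ 1 (fun u : ℂ × ℂ => Phi n (γ u.1) (A u.1 + u.2 • C u.1)) u := by
  have e1 : ContDiffAt ℂ 1 (fun u : ℂ × ℂ => γ u.1) u :=
    (hγ.analyticAt hb).contDiffAt.comp u contDiffAt_fst
  have e2 : ContDiffAt ℂ 1 (fun u : ℂ × ℂ => A u.1) u :=
    (hA.analyticAt hb).contDiffAt.comp u contDiffAt_fst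
  have e3 : ContDiffAt ℂ 1 (fun u : ℂ × ℂ => C u.1) u :=
    (hC.analyticAt hb).contDiffAt.comp u contDiffAt_fst
  have e5 : ContDiffAt ℂ 1 (fun u : ℂ × ℂ => A u.1 + u.2 • C u.1) u :=
    e2.add (contDiffAt_snd.smul e3)
  have := ((contDiff_phi (d := d) n).contDiffAt.of_le le_top).comp u (e1.prodMk e5)
  simpa only [Function.comp_def] using this

namespace Frame

variable {γ : ℂ → Par d} {A C : ℂ → ℂ × ℂ}

lemma deriv_phi_ne_zero (hF : Frame γ A C) {n : ℕ} (hn : 1 ≤ n) {t : ℂ}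
    (ht : t ∈ ball (0 : ℂ) 2) {w : ℂ} (h : Phi n (γ t) (A t + w • C t) = 0) :
    deriv (fun w => Phi n (γ t) (A t + w • C t)) w ≠ 0 := by
  rw [(hasDerivAt_phi_line n (γ t) (A t) (C t) w).deriv]
  exact hF.np t ht n hn _ (line_ne_zero (hF.br_ne t ht) w) h _ (by
    rw [br_line]; exact hF.br_ne t ht)

lemma phi_bounded (hF : Frame γ A C) {n : ℕ} (hn : 1 ≤ n) {t : ℂ} (ht : t ∈ ball (0 : ℂ) 2) :
    ∃ M : ℝ, ∀ᶠ s in 𝓝 t, ∀ w : ℂ, Phi n (γ s) (A s + w • C s) = 0 → ‖w‖ ≤ M := by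
  have hCA : ∀ s ∈ ball (0 : ℂ) 2, br (C s) (A s) ≠ 0 := fun s hs => by
    rw [br_swap, neg_ne_zero]; exact hF.br_ne s hs
  have hC : ∀ s ∈ ball (0 : ℂ) 2, Phi n (γ s) (C s) = 0 := by
    intro s hs
    have := phi_mul (hF.nd s hs) (ne_zero_of_br (hCA s hs)) (hF.fix_infty s hs) n
    rwa [one_mul] at this
  obtain ⟨s₀, h1, -, h3, h4⟩ := exists_implicit_of_deriv_ne_zero
    (u := ((t, 0) : ℂ × ℂ)) (contDiffAt_phi_frame hF.diff_par hF.diff_snd hF.diff_fst n (isOpen_ball.mem_nhds ht)) (by simpa using hC t ht) (by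
      simp only
      rw [(hasDerivAt_phi_line n (γ t) (C t) (A t) 0).deriv]
      refine hF.np t ht n hn _ (line_ne_zero (hCA t ht) 0) (by simpa using hC t ht) _ ?_
      rw [br_line]; exact hCA t ht)
  rw [nhds_prod_eq] at h4
  obtain ⟨P, hP, Q, hQ, h5⟩ := eventually_prod_iff.1 h4
  obtain ⟨ε, hε, h6⟩ := Metric.eventually_nhds_iff_ball.1 hQ
  refine ⟨ε⁻¹, ?_⟩
  filter_upwards [hP, isOpen_ball.mem_nhds ht] with s hs hsb w hw
  by_contra! hlt
  have hw0 : w ≠ 0 := by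
    rintro rfl
    rw [norm_zero] at hlt
    exact hlt.not_ge (by positivity)
  have e1 : s₀ s = 0 := (h5 hs (h6 0 (mem_ball_self hε))).1 (by simpa using hC s hsb)
  have e2 : s₀ s = w⁻¹ := by
    refine (h5 hs (h6 w⁻¹ ?_)).1 ?_
    · rw [mem_ball_zero_iff, norm_inv]
      exact inv_lt_of_inv_lt₀ hε hlt
    · have h7 := phi_smul n (γ s) w⁻¹ (A s + w • C s)
      rw [hw, mul_zero, smul_add, inv_smul_smul₀ hw0, add_comm] at h7
      exact h7
  exact inv_ne_zero hw0 (e2.symm.trans e1)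

lemma exists_perSec (hF : Frame γ A C) {n : ℕ} (hn : 1 ≤ n) {t₀ w₀ : ℂ}
    (ht₀ : t₀ ∈ ball (0 : ℂ) 2) (h : Phi n (γ t₀) (A t₀ + w₀ • C t₀) = 0) :
    ∃ φ ∈ perSec γ A C, φ t₀ = w₀ := by
  obtain ⟨φ, h1, h2, h3⟩ := exists_root_section
    (Ψ := fun u : ℂ × ℂ => Phi n (γ u.1) (A u.1 + u.2 • C u.1)) (fun u hu => contDiffAt_phi_frame hF.diff_par hF.diff_fst hF.diff_snd n
      (isOpen_ball.mem_nhds hu))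
    (fun t ht w hw => hF.deriv_phi_ne_zero hn ht hw) (fun t ht => hF.phi_bounded hn ht) ht₀ h
  exact ⟨φ, ⟨h1, n, hn, h3⟩, h2⟩

lemma perSec_eq_or_ne (hF : Frame γ A C) {φ ψ : ℂ → ℂ} (hφ : φ ∈ perSec γ A C)
    (hψ : ψ ∈ perSec γ A C) :
    (∀ t ∈ ball (0 : ℂ) 2, φ t = ψ t) ∨ ∀ t ∈ ball (0 : ℂ) 2, φ t ≠ ψ t := by
  obtain ⟨dφ, m, hm, hφ⟩ := hφ
  obtain ⟨dψ, n, hn, hψ⟩ := hψ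
  by_contra! hcon
  obtain ⟨⟨t₁, ht₁, hne⟩, t₂, ht₂, heq⟩ := hcon
  have hφ' : ∀ t ∈ ball (0 : ℂ) 2, Phi (m * n) (γ t) (A t + φ t • C t) = 0 := fun t ht =>
    phi_mul (hF.nd t ht) (line_ne_zero (hF.br_ne t ht) _) (hφ t ht) n
  have hψ' : ∀ t ∈ ball (0 : ℂ) 2, Phi (m * n) (γ t) (A t + ψ t • C t) = 0 := fun t ht => by
    rw [mul_comm]
    exact phi_mul (hF.nd t ht) (line_ne_zero (hF.br_ne t ht) _) (hψ t ht) m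
  have hloc : ∀ t ∈ ball (0 : ℂ) 2, φ t = ψ t → φ =ᶠ[𝓝 t] ψ := by
    intro t ht h
    obtain ⟨s, -, -, -, h4⟩ := exists_implicit_of_deriv_ne_zero
      (u := ((t, φ t) : ℂ × ℂ)) (contDiffAt_phi_frame hF.diff_par hF.diff_fst hF.diff_snd (m * n)
        (isOpen_ball.mem_nhds ht)) (hφ' t ht)
      (hF.deriv_phi_ne_zero (Nat.mul_pos hm hn) ht (hφ' t ht))
    have hb := isOpen_ball.mem_nhds ht
    have l1 : Tendsto (fun x => (x, φ x)) (𝓝 t) (𝓝 (t, φ t)) :=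
      tendsto_id.prodMk_nhds (dφ.differentiableAt hb).continuousAt.tendsto
    have l2 : Tendsto (fun x => (x, ψ x)) (𝓝 t) (𝓝 (t, φ t)) := by
      rw [h]
      exact tendsto_id.prodMk_nhds (dψ.differentiableAt hb).continuousAt.tendsto
    filter_upwards [l1.eventually h4, l2.eventually h4, hb] with x h5 h6 hx
    exact (h5.1 (hφ' x hx)).symm.trans (h6.1 (hψ' x hx))
  have := (dφ.analyticOnNhd isOpen_ball).eqOn_of_preconnected_of_eventuallyEq
    (dψ.analyticOnNhd isOpen_ball) (convex_ball _ _).isPreconnected ht₂ (hloc t₂ ht₂ heq)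
  exact hne (this ht₁)

lemma zero_mem_perSec (hF : Frame γ A C) : (fun _ => 0) ∈ perSec γ A C :=
  ⟨differentiableOn_const _, 1, le_rfl, fun t ht => by simpa using hF.fix_zero t ht⟩

lemma one_mem_perSec (hF : Frame γ A C) : (fun _ => 1) ∈ perSec γ A C :=
  ⟨differentiableOn_const _, 1, le_rfl, fun t ht => by simpa using hF.fix_one t ht⟩

end Frame

/-- A holomorphic motion of a subset of the plane over the disc of radius two, normalised to contain
the constants `0` and `1`. -/
structure Motion (S : Set (ℂ → ℂ)) : Prop where
  diff : ∀ φ ∈ S, DifferentiableOn ℂ φ (ball 0 2)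
  eq_or_ne : ∀ φ ∈ S, ∀ ψ ∈ S,
    (∀ t ∈ ball (0 : ℂ) 2, φ t = ψ t) ∨ ∀ t ∈ ball (0 : ℂ) 2, φ t ≠ ψ t
  zero_mem : (fun _ => 0) ∈ S
  one_mem : (fun _ => 1) ∈ S

lemma Frame.motion {γ : ℂ → Par d} {A C : ℂ → ℂ × ℂ} (hF : Frame γ A C) :
    Motion (perSec γ A C) :=
  ⟨fun _ h => h.1, fun _ h _ h' => hF.perSec_eq_or_ne h h', hF.zero_mem_perSec, hF.one_mem_perSec⟩

lemma closedBall_one_subset : closedBall (0 : ℂ) 1 ⊆ ball 0 2 :=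
  closedBall_subset_ball one_lt_two

namespace Motion

variable {S : Set (ℂ → ℂ)}

lemma bounded (hS : Motion S) (M : ℝ) : ∃ K, 0 < K ∧ ∀ φ ∈ S, ∀ s ∈ closedBall (0 : ℂ) 1,
    ∀ t ∈ closedBall (0 : ℂ) 1, ‖φ s‖ ≤ M → ‖φ t‖ ≤ K := by
  obtain ⟨K, hK, h⟩ := schottky (R := 2) 1 M one_lt_two
  refine ⟨K + 1, by positivity, fun φ hφ s hs t ht hM => ?_⟩
  rcases hS.eq_or_ne φ hφ _ hS.zero_mem with h0 | h0
  · rw [h0 t (closedBall_one_subset ht), norm_zero]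
    positivity
  rcases hS.eq_or_ne φ hφ _ hS.one_mem with h1 | h1
  · rw [h1 t (closedBall_one_subset ht), norm_one]
    linarith
  have := h 0 φ (hS.diff φ hφ) (fun z hz => ⟨h0 z hz, h1 z hz⟩) s hs t ht hM
  linarith

lemma equicontinuous (hS : Motion S) (M : ℝ) {ε : ℝ} (hε : 0 < ε) :
    ∃ δ > 0, ∀ φ ∈ S, ∀ ψ ∈ S, ∀ s ∈ closedBall (0 : ℂ) 1, ∀ t ∈ closedBall (0 : ℂ) 1,
      ‖φ s‖ ≤ M → ‖φ s - ψ s‖ < δ → ‖φ t - ψ t‖ < ε := by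
  obtain ⟨K, hK, hb⟩ := hS.bounded M
  obtain ⟨δ, hδ, h⟩ := schottky_small (R := 2) 1 (ε / (K + 1)) one_lt_two (by positivity)
  refine ⟨min (1 / 2) (δ / 2), by positivity, fun φ hφ ψ hψ s hs t ht hM hsub => ?_⟩
  have hs2 := closedBall_one_subset hs
  have ht2 := closedBall_one_subset ht
  rcases hS.eq_or_ne φ hφ ψ hψ with h1 | h1
  · rwa [h1 t ht2, sub_self, norm_zero]
  have key : ∀ e : ℂ, (fun _ => e) ∈ S → ‖e‖ ≤ 1 → 1 / 2 ≤ ‖φ s - e‖ → ‖φ t - ψ t‖ < ε := by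
    intro e he he1 hse
    have k1 : ∀ t ∈ ball (0 : ℂ) 2, φ t ≠ e := by
      refine (hS.eq_or_ne φ hφ _ he).resolve_left fun h2 => ?_
      rw [h2 s hs2, sub_self, norm_zero] at hse
      norm_num at hse
    have k2 : ∀ t ∈ ball (0 : ℂ) 2, ψ t ≠ e := by
      refine (hS.eq_or_ne ψ hψ _ he).resolve_left fun h2 => ?_
      rw [h2 s hs2] at hsub
      exact (hsub.trans_le (min_le_left _ _)).not_ge hse
    have k3 : ∀ t ∈ ball (0 : ℂ) 2, φ t - e ≠ 0 := fun t ht => sub_ne_zero.2 (k1 t ht)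
    have hlt := h 0 (fun t => (φ t - ψ t) / (φ t - e))
      (((hS.diff φ hφ).sub (hS.diff ψ hψ)).div ((hS.diff φ hφ).sub (differentiableOn_const e)) k3)
      (fun z hz => ⟨div_ne_zero (sub_ne_zero.2 (h1 z hz)) (k3 z hz), fun h2 => ?_⟩) s hs t ht ?_
    · rw [norm_div, div_lt_iff₀ (norm_pos_iff.2 (k3 t ht2))] at hlt
      refine hlt.trans_le ?_
      have h4 : ‖φ t - e‖ ≤ K + 1 :=
        (norm_sub_le _ _).trans (add_le_add (hb φ hφ s hs t ht hM) he1)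
      calc ε / (K + 1) * ‖φ t - e‖ ≤ ε / (K + 1) * (K + 1) := by gcongr
        _ = ε := div_mul_cancel₀ _ (by positivity)
    · rw [div_eq_one_iff_eq (k3 z hz)] at h2
      exact k2 z hz (by linear_combination -h2)
    · rw [norm_div, div_lt_iff₀ (norm_pos_iff.2 (k3 s hs2))]
      have := hsub.trans_le (min_le_right _ _)
      nlinarith
  by_cases h2 : 1 / 2 ≤ ‖φ s‖
  · exact key 0 hS.zero_mem (by simp) (by simpa using h2)
  · refine key 1 hS.one_mem (by simp) ?_
    push Not at h2
    have := norm_sub_norm_le (1 : ℂ) (φ s)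
    rw [norm_one, norm_sub_rev] at this
    linarith

lemma lipschitz (hS : Motion S) (M : ℝ) : ∃ L, 0 < L ∧ ∀ φ ∈ S, ∀ t ∈ ball (0 : ℂ) 1,
    ‖φ t‖ ≤ M → ‖φ t - φ 0‖ ≤ L * ‖t‖ := by
  obtain ⟨K, hK, hb⟩ := hS.bounded M
  refine ⟨2 * (K + 1), by positivity, fun φ hφ t ht hM => ?_⟩
  have h0 : (0 : ℂ) ∈ closedBall (0 : ℂ) 1 := by simp
  have hle : ∀ s ∈ ball (0 : ℂ) 1, ‖φ s‖ ≤ K := fun s hs =>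
    hb φ hφ t (ball_subset_closedBall ht) s (ball_subset_closedBall hs) hM
  have h0' : ‖φ 0‖ ≤ K := hb φ hφ t (ball_subset_closedBall ht) 0 h0 hM
  have := Complex.dist_le_div_mul_dist_of_mapsTo_ball (f := φ) (c := 0) (R₁ := 1)
    (R₂ := 2 * (K + 1)) ((hS.diff φ hφ).mono (ball_subset_ball one_le_two)) (fun s hs => by
      rw [mem_closedBall, dist_eq_norm]
      have := norm_sub_le (φ s) (φ 0)
      linarith [hle s hs]) ht
  simpa [dist_eq_norm] using this

end Motion

lemma coe_image_ball_mem_nhds (z : ℂ) {ε : ℝ} (hε : 0 < ε) :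
    ((fun w : ℂ => (w : Sphere)) '' ball z ε) ∈ 𝓝 (z : Sphere) := by
  rw [OnePoint.nhds_coe_eq]
  exact image_mem_map (ball_mem_nhds z hε)

lemma compl_image_closedBall_mem_nhds (K : ℝ) :
    ((fun w : ℂ => (w : Sphere)) '' closedBall 0 K)ᶜ ∈ 𝓝 (∞ : Sphere) :=
  (OnePoint.isOpen_compl_image_coe.2
    ⟨isClosed_closedBall, isCompact_closedBall _ _⟩).mem_nhds (by simp)

/-- The correspondence between two fibres of a holomorphic motion. -/
def motionGraph (S : Set (ℂ → ℂ)) (s t : ℂ) : Set (Sphere × Sphere) :=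
  insert (∞, ∞) ((fun φ : ℂ → ℂ => ((φ s : Sphere), (φ t : Sphere))) '' S)

namespace Motion

variable {S : Set (ℂ → ℂ)} {s t : ℂ}

lemma graph_infty (hS : Motion S) (hs : s ∈ closedBall (0 : ℂ) 1) (ht : t ∈ closedBall (0 : ℂ) 1)
    {z : ℂ} {y : Sphere} (h : ((z : Sphere), y) ∈ closure (motionGraph S s t)) : y ≠ ∞ := by
  rintro rfl
  obtain ⟨K, -, hK⟩ := hS.bounded (‖z‖ + 1)
  obtain ⟨p, ⟨⟨w, hw, h1⟩, h2⟩, h3⟩ := mem_closure_iff_nhds.1 h _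
    (prod_mem_nhds (coe_image_ball_mem_nhds z one_pos) (compl_image_closedBall_mem_nhds K))
  rcases h3 with rfl | ⟨φ, hφ, rfl⟩
  · simp at h1
  · simp only [OnePoint.coe_eq_coe] at h1
    subst h1
    refine h2 ⟨φ t, ?_, rfl⟩
    rw [mem_closedBall_zero_iff]
    refine hK φ hφ s hs t ht ?_
    have := norm_sub_norm_le (φ s) z
    rw [mem_ball, dist_eq_norm] at hw
    linarith

lemma graph_swap {x y : Sphere} (h : (x, y) ∈ closure (motionGraph S s t)) :
    (y, x) ∈ closure (motionGraph S t s) := by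
  have : MapsTo Prod.swap (motionGraph S s t) (motionGraph S t s) := by
    rintro p (rfl | ⟨φ, hφ, rfl⟩)
    · exact Or.inl rfl
    · exact Or.inr ⟨φ, hφ, rfl⟩
  exact this.closure continuous_swap h

lemma graph_functional (hS : Motion S) (hs : s ∈ closedBall (0 : ℂ) 1)
    (ht : t ∈ closedBall (0 : ℂ) 1) {x y y' : Sphere} (h : (x, y) ∈ closure (motionGraph S s t))
    (h' : (x, y') ∈ closure (motionGraph S s t)) : y = y' := by
  induction x using OnePoint.rec with
  | infty =>
    have : ∀ y : Sphere, ((∞ : Sphere), y) ∈ closure (motionGraph S s t) → y = ∞ := by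
      intro y hy
      by_contra hne
      obtain ⟨z, rfl⟩ := OnePoint.ne_infty_iff_exists.1 hne
      exact hS.graph_infty ht hs (graph_swap hy) rfl
    rw [this y h, this y' h']
  | coe w =>
    obtain ⟨z₀, rfl⟩ := OnePoint.ne_infty_iff_exists.1 (hS.graph_infty hs ht h)
    obtain ⟨z', rfl⟩ := OnePoint.ne_infty_iff_exists.1 (hS.graph_infty hs ht h')
    by_contra hne
    have hpos : 0 < dist z₀ z' / 3 := by
      have : z₀ ≠ z' := fun h => hne (by rw [h])
      have := dist_pos.2 this
      positivity
    obtain ⟨δ, hδ, hK⟩ := hS.equicontinuous (‖w‖ + 1) hpos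
    have near : ∀ z : ℂ, ((w : Sphere), (z : Sphere)) ∈ closure (motionGraph S s t) →
        ∃ φ ∈ S, dist (φ s) w < min 1 (δ / 2) ∧ dist (φ t) z < dist z₀ z' / 3 := by
      intro z h
      obtain ⟨p, ⟨⟨u, hu, h1⟩, v, hv, h2⟩, h3⟩ := mem_closure_iff_nhds.1 h _
        (prod_mem_nhds (coe_image_ball_mem_nhds w (ε := min 1 (δ / 2)) (by positivity))
          (coe_image_ball_mem_nhds z hpos))
      rcases h3 with rfl | ⟨φ, hφ, rfl⟩
      · simp at h1
      · simp only [OnePoint.coe_eq_coe] at h1 h2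
        subst h1 h2
        exact ⟨φ, hφ, hu, hv⟩
    obtain ⟨φ, hφ, a1, a2⟩ := near z₀ h
    obtain ⟨ψ, hψ, b1, b2⟩ := near z' h'
    have c1 : ‖φ s‖ ≤ ‖w‖ + 1 := by
      have := norm_sub_norm_le (φ s) w
      rw [dist_eq_norm] at a1
      linarith [a1.trans_le (min_le_left _ _)]
    have c2 : ‖φ s - ψ s‖ < δ := by
      rw [← dist_eq_norm]
      linarith [dist_triangle_right (φ s) (ψ s) w, a1.trans_le (min_le_right _ _),
        b1.trans_le (min_le_right _ _)]
    have c3 := hK φ hφ ψ hψ s hs t ht c1 c2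
    rw [← dist_eq_norm] at c3
    linarith [dist_triangle4 z₀ (φ t) (ψ t) z', dist_comm z₀ (φ t)]

end Motion

lemma exists_conj_of_closed {X Y : Type*} [TopologicalSpace X] [CompactSpace X] [T2Space X]
    [TopologicalSpace Y] [CompactSpace Y] [T2Space Y] [Nonempty X] [Nonempty Y]
    {Γ : Set (X × Y)} (hΓ : IsClosed Γ)
    (h1 : ∀ x y y', (x, y) ∈ Γ → (x, y') ∈ Γ → y = y')
    (h2 : ∀ x x' y, (x, y) ∈ Γ → (x', y) ∈ Γ → x = x') {f : X → X} {g : Y → Y}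
    (hfg : ∀ x y, (x, y) ∈ Γ → (f x, g y) ∈ Γ) :
    ∃ (h : X → Y) (hinv : Y → X), ContinuousOn h (Prod.fst '' Γ) ∧
      h '' (Prod.fst '' Γ) = Prod.snd '' Γ ∧ ContinuousOn hinv (Prod.snd '' Γ) ∧
      (∀ x ∈ Prod.fst '' Γ, hinv (h x) = x) ∧ (∀ y ∈ Prod.snd '' Γ, h (hinv y) = y) ∧
      ∀ x ∈ Prod.fst '' Γ, h (f x) = g (h x) := by
  have e1 : ∀ x : X, ∃ y : Y, x ∈ Prod.fst '' Γ → (x, y) ∈ Γ := by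
    intro x
    by_cases hx : x ∈ Prod.fst '' Γ
    · obtain ⟨⟨x, y⟩, hp, rfl⟩ := hx
      exact ⟨y, fun _ => hp⟩
    · exact ⟨Classical.arbitrary Y, fun h => absurd h hx⟩
  have e2 : ∀ y : Y, ∃ x : X, y ∈ Prod.snd '' Γ → (x, y) ∈ Γ := by
    intro y
    by_cases hy : y ∈ Prod.snd '' Γ
    · obtain ⟨⟨x, y⟩, hp, rfl⟩ := hy
      exact ⟨x, fun _ => hp⟩
    · exact ⟨Classical.arbitrary X, fun h => absurd h hy⟩
  choose h hh using e1
  choose k hk using e2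
  have m1 : ∀ {x}, x ∈ Prod.fst '' Γ → h x ∈ Prod.snd '' Γ := fun hx => ⟨_, hh _ hx, rfl⟩
  have m2 : ∀ {y}, y ∈ Prod.snd '' Γ → k y ∈ Prod.fst '' Γ := fun hy => ⟨_, hk _ hy, rfl⟩
  have i1 : ∀ x ∈ Prod.fst '' Γ, k (h x) = x := fun x hx => h2 _ _ _ (hk _ (m1 hx)) (hh _ hx)
  have i2 : ∀ y ∈ Prod.snd '' Γ, h (k y) = y := fun y hy => h1 _ _ _ (hh _ (m2 hy)) (hk _ hy)
  refine ⟨h, k, ?_, ?_, ?_, i1, i2, ?_⟩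
  · rw [continuousOn_iff_isClosed]
    intro B hB
    refine ⟨Prod.fst '' (Γ ∩ Prod.snd ⁻¹' B),
      ((hΓ.inter (hB.preimage continuous_snd)).isCompact.image continuous_fst).isClosed, ?_⟩
    ext x
    constructor
    · rintro ⟨hx, hx'⟩
      exact ⟨⟨(x, h x), ⟨hh _ hx', hx⟩, rfl⟩, hx'⟩
    · rintro ⟨⟨⟨x, y⟩, ⟨hp, hy⟩, rfl⟩, hx'⟩
      refine ⟨?_, hx'⟩
      rw [mem_preimage, h1 _ _ _ (hh _ hx') hp]
      exact hy
  · refine subset_antisymm ?_ fun y hy => ⟨k y, m2 hy, i2 y hy⟩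
    rintro _ ⟨x, hx, rfl⟩
    exact m1 hx
  · rw [continuousOn_iff_isClosed]
    intro B hB
    refine ⟨Prod.snd '' (Γ ∩ Prod.fst ⁻¹' B),
      ((hΓ.inter (hB.preimage continuous_fst)).isCompact.image continuous_snd).isClosed, ?_⟩
    ext y
    constructor
    · rintro ⟨hy, hy'⟩
      exact ⟨⟨(k y, y), ⟨hk _ hy', hy⟩, rfl⟩, hy'⟩
    · rintro ⟨⟨⟨x, y⟩, ⟨hp, hx⟩, rfl⟩, hy'⟩
      refine ⟨?_, hy'⟩
      rw [mem_preimage, h2 _ _ _ (hk _ hy') hp]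
      exact hx
  · intro x hx
    have := hfg _ _ (hh _ hx)
    exact h1 _ _ _ (hh _ ⟨_, this, rfl⟩) this

/-- The coefficients of the Möbius map sending `0`, `∞` to the points with coordinates `A`, `C`. -/
def mob (A C : ℂ × ℂ) : Par 1 := (![A.1, C.1], ![A.2, C.2])

lemma hlift_mob (A C Z : ℂ × ℂ) : hlift (mob A C) Z = Z.2 • A + Z.1 • C := by
  apply Prod.ext <;> simp [hlift, hom, mob, Fin.sum_univ_two, mul_comm]

lemma nd_mob {A C : ℂ × ℂ} (h : br A C ≠ 0) : ND (mob A C) := by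
  intro Z hZ h0
  rw [hlift_mob] at h0
  have h1 : Z.2 * br A C = 0 := by
    have := congrArg (fun W => br W C) h0
    simp only [br_add_left, br_smul_left, br_self] at this
    simpa [br] using this
  have h2 : Z.1 * br A C = 0 := by
    have := congrArg (fun W => br A W) h0
    simp only [br_add_right, br_smul_right, br_self] at this
    simpa [br] using this
  exact hZ (Prod.ext ((mul_eq_zero.1 h2).resolve_right h) ((mul_eq_zero.1 h1).resolve_right h))

lemma mob_coe {A C : ℂ × ℂ} (h : br A C ≠ 0) (w : ℂ) : sphereMap (mob A C) (w : Sphere) = prj (A + w • C) := by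
  rw [← prj_one, sphereMap_prj (nd_mob h) (by simp), hlift_mob, one_smul]

lemma mob_infty {A C : ℂ × ℂ} (h : br A C ≠ 0) : sphereMap (mob A C) ∞ = prj C := by
  rw [← prj_zero_right 1, sphereMap_prj (nd_mob h) (by simp), hlift_mob, one_smul, zero_smul,
    zero_add]

lemma mob_bijective {A C : ℂ × ℂ} (h : br A C ≠ 0) : Function.Bijective (sphereMap (mob A C)) := by
  have hC : C ≠ 0 := ne_zero_of_br (B := A) (by rwa [br_swap, neg_ne_zero])
  have key : ∀ w : ℂ, prj (A + w • C) ≠ prj C := fun w hw => by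
    rw [prj_eq_prj_iff (line_ne_zero h w) hC, br_line] at hw
    exact h hw
  constructor
  · intro x y hxy
    induction x using OnePoint.rec with
    | infty =>
      induction y using OnePoint.rec with
      | infty => rfl
      | coe w =>
        rw [mob_infty h, mob_coe h] at hxy
        exact absurd hxy.symm (key w)
    | coe z =>
      induction y using OnePoint.rec with
      | infty =>
        rw [mob_infty h, mob_coe h] at hxy
        exact absurd hxy (key z)
      | coe w =>
        rw [mob_coe h, mob_coe h, prj_eq_prj_iff (line_ne_zero h z) (line_ne_zero h w)] at hxy
        have : br (A + z • C) (A + w • C) = (w - z) * br A C := by simp [br]; ring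
        rw [this] at hxy
        rw [sub_eq_zero.1 ((mul_eq_zero.1 hxy).resolve_right h)]
  · intro x
    obtain ⟨Z, hZ, rfl⟩ := exists_prj_eq x
    by_cases hZC : br Z C = 0
    · exact ⟨∞, by rw [mob_infty h]; exact ((prj_eq_prj_iff hZ hC).2 hZC).symm⟩
    · exact ⟨_, by rw [mob_coe h]; exact (prj_chart h hZC).symm⟩

namespace Frame

variable {γ : ℂ → Par d} {A C : ℂ → ℂ × ℂ}

lemma snd_ne_zero (hF : Frame γ A C) {t : ℂ} (ht : t ∈ ball (0 : ℂ) 2) : C t ≠ 0 :=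
  ne_zero_of_br (B := A t) (by rw [br_swap, neg_ne_zero]; exact hF.br_ne t ht)

lemma fixed_infty (hF : Frame γ A C) {t : ℂ} (ht : t ∈ ball (0 : ℂ) 2) :
    sphereMap (γ t) (prj (C t)) = prj (C t) :=
  (phi_eq_zero_iff (hF.nd t ht) 1 (hF.snd_ne_zero ht)).1 (hF.fix_infty t ht)

lemma exists_image_perSec (hF : Frame γ A C) {φ : ℂ → ℂ} (hφ : φ ∈ perSec γ A C) :
    ∃ ψ ∈ perSec γ A C, ∀ t ∈ ball (0 : ℂ) 2,
      sphereMap (γ t) (prj (A t + φ t • C t)) = prj (A t + ψ t • C t) := by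
  obtain ⟨hd, n, hn, hφ⟩ := hφ
  set Z : ℂ → ℂ × ℂ := fun t => A t + φ t • C t with hZ
  have hZ0 : ∀ t ∈ ball (0 : ℂ) 2, Z t ≠ 0 := fun t ht => line_ne_zero (hF.br_ne t ht) _
  have hper : ∀ t ∈ ball (0 : ℂ) 2, (sphereMap (γ t))^[n] (prj (Z t)) = prj (Z t) :=
    fun t ht => (phi_eq_zero_iff (hF.nd t ht) n (hZ0 t ht)).1 (hφ t ht)
  have hne : ∀ t ∈ ball (0 : ℂ) 2, br (hlift (γ t) (Z t)) (C t) ≠ 0 := by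
    intro t ht h0
    rw [← prj_eq_prj_iff (hF.nd t ht _ (hZ0 t ht)) (hF.snd_ne_zero ht),
      ← sphereMap_prj (hF.nd t ht) (hZ0 t ht)] at h0
    have h1 := hper t ht
    obtain ⟨m, rfl⟩ := Nat.exists_eq_add_of_le' hn
    rw [Function.iterate_succ_apply, h0, Function.iterate_fixed (hF.fixed_infty ht)] at h1
    rw [prj_eq_prj_iff (hF.snd_ne_zero ht) (hZ0 t ht), br_swap, hZ, br_line, neg_eq_zero] at h1
    exact hF.br_ne t ht h1
  have himg : ∀ t ∈ ball (0 : ℂ) 2, sphereMap (γ t) (prj (Z t)) =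
      prj (A t + (br (A t) (hlift (γ t) (Z t)) / br (hlift (γ t) (Z t)) (C t)) • C t) := by
    intro t ht
    rw [sphereMap_prj (hF.nd t ht) (hZ0 t ht)]
    exact prj_chart (hF.br_ne t ht) (hne t ht)
  refine ⟨fun t => br (A t) (hlift (γ t) (Z t)) / br (hlift (γ t) (Z t)) (C t),
    ⟨?_, n, hn, ?_⟩, himg⟩
  · have dZ : DifferentiableOn ℂ Z (ball 0 2) := hF.diff_fst.add (hd.smul hF.diff_snd)
    have dT : DifferentiableOn ℂ (fun t => hlift (γ t) (Z t)) (ball 0 2) := by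
      have := (contDiff_hlift.differentiable (by simp)).comp_differentiableOn
        (hF.diff_par.prodMk dZ)
      simpa only [Function.comp_def] using this
    have d1 := (contDiff_br.differentiable (by simp)).comp_differentiableOn (hF.diff_fst.prodMk dT)
    have d2 := (contDiff_br.differentiable (by simp)).comp_differentiableOn (dT.prodMk hF.diff_snd)
    exact d1.div d2 hne
  · intro t ht
    rw [phi_eq_zero_iff (hF.nd t ht) n (line_ne_zero (hF.br_ne t ht) _), ← himg t ht,
      ← Function.iterate_succ_apply, Function.iterate_succ_apply', hper t ht]

lemma periodicPts_eq (hF : Frame γ A C) {t : ℂ} (ht : t ∈ ball (0 : ℂ) 2) :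
    Function.periodicPts (sphereMap (γ t)) = sphereMap (mob (A t) (C t)) ''
      insert ∞ ((fun φ : ℂ → ℂ => (φ t : Sphere)) '' perSec γ A C) := by
  have hbr := hF.br_ne t ht
  rw [image_insert_eq, mob_infty hbr, image_image]
  simp only [mob_coe hbr]
  ext x
  constructor
  · rintro ⟨n, hn, hx⟩
    obtain ⟨Z, hZ, rfl⟩ := exists_prj_eq x
    by_cases hZC : br Z (C t) = 0
    · exact Or.inl ((prj_eq_prj_iff hZ (hF.snd_ne_zero ht)).2 hZC)
    · rw [prj_chart hbr hZC] at hx ⊢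
      obtain ⟨φ, hφ, h⟩ := hF.exists_perSec hn ht
        ((phi_eq_zero_iff (hF.nd t ht) n (line_ne_zero hbr _)).2 hx)
      exact Or.inr ⟨φ, hφ, by simp only [h]⟩
  · rintro (rfl | ⟨φ, ⟨-, n, hn, hφ⟩, rfl⟩)
    · exact ⟨1, one_pos, hF.fixed_infty ht⟩
    · exact ⟨n, hn, (phi_eq_zero_iff (hF.nd t ht) n (line_ne_zero hbr _)).1 (hφ t ht)⟩

lemma exists_conj (hF : Frame γ A C) : ∃ h hinv : Sphere → Sphere,
    ContinuousOn h (closure (Function.periodicPts (sphereMap (γ 0)))) ∧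
    h '' closure (Function.periodicPts (sphereMap (γ 0))) =
      closure (Function.periodicPts (sphereMap (γ 1))) ∧
    ContinuousOn hinv (closure (Function.periodicPts (sphereMap (γ 1)))) ∧
    (∀ x ∈ closure (Function.periodicPts (sphereMap (γ 0))), hinv (h x) = x) ∧
    (∀ y ∈ closure (Function.periodicPts (sphereMap (γ 1))), h (hinv y) = y) ∧
    ∀ x ∈ closure (Function.periodicPts (sphereMap (γ 0))),
      h (sphereMap (γ 0) x) = sphereMap (γ 1) (h x) := by
  have c0 : (0 : ℂ) ∈ closedBall (0 : ℂ) 1 := by simp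
  have c1 : (1 : ℂ) ∈ closedBall (0 : ℂ) 1 := by simp
  have b0 := closedBall_one_subset c0
  have b1 := closedBall_one_subset c1
  set m₀ := sphereMap (mob (A 0) (C 0)) with hm₀
  set m₁ := sphereMap (mob (A 1) (C 1)) with hm₁
  have k₀ : Continuous m₀ := (nd_mob (hF.br_ne 0 b0)).continuous
  have k₁ : Continuous m₁ := (nd_mob (hF.br_ne 1 b1)).continuous
  have i₀ := (mob_bijective (hF.br_ne 0 b0)).1
  have i₁ := (mob_bijective (hF.br_ne 1 b1)).1
  set G := motionGraph (perSec γ A C) 0 1 with hG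
  have km := k₀.prodMap k₁
  have hcl : IsClosed (Prod.map m₀ m₁ '' closure G) :=
    (isClosed_closure.isCompact.image km).isClosed
  have hS := hF.motion
  have key := exists_conj_of_closed hcl (f := sphereMap (γ 0)) (g := sphereMap (γ 1)) ?_ ?_ ?_
  · have f₀ : Prod.fst '' (Prod.map m₀ m₁ '' closure G) =
        closure (Function.periodicPts (sphereMap (γ 0))) := by
      rw [image_image, hF.periodicPts_eq b0, ← hm₀]
      have e : insert ∞ ((fun φ : ℂ → ℂ => (φ 0 : Sphere)) '' perSec γ A C) = Prod.fst '' G := by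
        rw [hG, motionGraph, image_insert_eq, image_image]
      rw [e, image_image]
      exact ((k₀.comp continuous_fst).isClosedMap.closure_image_eq_of_continuous
        (k₀.comp continuous_fst) G).symm
    have f₁ : Prod.snd '' (Prod.map m₀ m₁ '' closure G) =
        closure (Function.periodicPts (sphereMap (γ 1))) := by
      rw [image_image, hF.periodicPts_eq b1, ← hm₁]
      have e : insert ∞ ((fun φ : ℂ → ℂ => (φ 1 : Sphere)) '' perSec γ A C) = Prod.snd '' G := by
        rw [hG, motionGraph, image_insert_eq, image_image]
      rw [e, image_image]
      exact ((k₁.comp continuous_snd).isClosedMap.closure_image_eq_of_continuous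
        (k₁.comp continuous_snd) G).symm
    rwa [f₀, f₁] at key
  · rintro _ _ _ ⟨⟨x, y⟩, hp, h⟩ ⟨⟨x', y'⟩, hp', h'⟩
    obtain ⟨rfl, rfl⟩ := Prod.mk.inj h
    obtain ⟨h1, rfl⟩ := Prod.mk.inj h'
    obtain rfl := i₀ h1
    rw [hS.graph_functional c0 c1 hp hp']
  · rintro _ _ _ ⟨⟨x, y⟩, hp, h⟩ ⟨⟨x', y'⟩, hp', h'⟩
    obtain ⟨rfl, rfl⟩ := Prod.mk.inj h
    obtain ⟨rfl, h1⟩ := Prod.mk.inj h'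
    obtain rfl := i₁ h1
    rw [hS.graph_functional c1 c0 (Motion.graph_swap hp) (Motion.graph_swap hp')]
  · rintro _ _ ⟨⟨x, y⟩, hp, h⟩
    obtain ⟨rfl, rfl⟩ := Prod.mk.inj h
    have hmaps : MapsTo (fun p : Sphere × Sphere =>
        (sphereMap (γ 0) (m₀ p.1), sphereMap (γ 1) (m₁ p.2))) G (Prod.map m₀ m₁ '' closure G) := by
      rintro _ (rfl | ⟨φ, hφ, rfl⟩)
      · refine ⟨(∞, ∞), subset_closure (Or.inl rfl), ?_⟩
        simp only [Prod.map_apply, hm₀, hm₁, mob_infty (hF.br_ne 0 b0), mob_infty (hF.br_ne 1 b1),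
          hF.fixed_infty b0, hF.fixed_infty b1]
      · obtain ⟨ψ, hψ, h⟩ := hF.exists_image_perSec hφ
        refine ⟨(ψ 0, ψ 1), subset_closure (Or.inr ⟨ψ, hψ, rfl⟩), ?_⟩
        simp only [Prod.map_apply, hm₀, hm₁, mob_coe (hF.br_ne 0 b0), mob_coe (hF.br_ne 1 b1),
          h 0 b0, h 1 b1]
    have hc := (hmaps.closure ((((hF.nd 0 b0).continuous.comp k₀).comp continuous_fst).prodMk
      (((hF.nd 1 b1).continuous.comp k₁).comp continuous_snd))) hp
    rwa [hcl.closure_eq] at hc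

end Frame

lemma br_line_line (A B : ℂ × ℂ) (a b : ℂ) : br (A + a • B) (A + b • B) = (b - a) * br A B := by
  simp [br]; ring

/-- Three distinct fixed points in a common affine chart. -/
lemma exists_three_fixed (hd : 2 ≤ d) {c : Par d} (hc : ND c) (hnp : NP 1 c) :
    ∃ A B : ℂ × ℂ, br A B ≠ 0 ∧ ∃ u v w : ℂ, u ≠ v ∧ u ≠ w ∧ v ≠ w ∧
      Phi 1 c (A + u • B) = 0 ∧ Phi 1 c (A + v • B) = 0 ∧ Phi 1 c (A + w • B) = 0 := by
  obtain ⟨w₀, hw₀⟩ : ∃ w, (phiLine 1 c ((1, 0) : ℂ × ℂ) (0, 1)).eval w ≠ 0 := by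
    by_contra! h
    exact phiLine_ne_zero hd le_rfl hc (A := (1, 0)) (B := (0, 1)) (by simp [br])
      (funext fun w => by simpa using h w)
  rw [eval_phiLine] at hw₀
  set B : ℂ × ℂ := (1, 0) + w₀ • (0, 1) with hB
  obtain ⟨A, hA⟩ := exists_br_ne_zero (line_ne_zero (A := (1, 0)) (B := (0, 1)) (by simp [br]) w₀)
  rw [← hB, br_swap, neg_ne_zero] at hA
  refine ⟨A, B, hA, ?_⟩
  have hlead := hasLead_phiLine 1 c A B
  have hP0 : phiLine 1 c A B ≠ 0 := phiLine_ne_zero hd le_rfl hc hA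
  have hdeg : (phiLine 1 c A B).natDegree = d + 1 := by
    refine le_antisymm (by simpa using hlead.1) ?_
    refine le_natDegree_of_ne_zero ?_
    have := hlead.2
    rw [pow_one] at this
    rw [this]
    exact hw₀
  have hnodup : (phiLine 1 c A B).roots.Nodup := by
    refine nodup_roots_iff_of_splits hP0 (IsAlgClosed.splits _) |>.2 ?_
    rw [Separable, isCoprime_iff_aeval_ne_zero_of_isAlgClosed ℂ ℂ]
    intro w
    simp only [coe_aeval_eq_eval]
    by_contra! h
    rw [eval_phiLine] at h
    rw [eval_derivative_phiLine] at h
    refine hnp _ (line_ne_zero hA w) h.1 B ?_ h.2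
    rw [br_line]
    exact hA
  have hcard : 2 < (phiLine 1 c A B).roots.toFinset.card := by
    rw [Multiset.toFinset_card_of_nodup hnodup, IsAlgClosed.card_roots_eq_natDegree, hdeg]
    lia
  obtain ⟨u, hu, v, hv, w, hw, h1, h2, h3⟩ := Finset.two_lt_card.1 hcard
  have key : ∀ u ∈ (phiLine 1 c A B).roots.toFinset, Phi 1 c (A + u • B) = 0 := fun u hu => by
    rw [← eval_phiLine]
    exact isRoot_of_mem_roots (Multiset.mem_toFinset.1 hu)
  exact ⟨u, v, w, h1, h2, h3, key u hu, key v hv, key w hw⟩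

lemma exists_fixed_section {c : Par d} (hnp : NP 1 c) {A B : ℂ × ℂ}
    (hAB : br A B ≠ 0) {u : ℂ} (hu : Phi 1 c (A + u • B) = 0) :
    ∃ s : Par d → ℂ, s c = u ∧
      ∀ᶠ x in 𝓝 c, DifferentiableAt ℂ s x ∧ Phi 1 x (A + s x • B) = 0 := by
  have hcd : ContDiff ℂ 1 fun p : Par d × ℂ => Phi 1 p.1 (A + p.2 • B) := by
    have h1 : ContDiff ℂ 1 fun p : Par d × ℂ => (p.1, A + p.2 • B) :=
      contDiff_fst.prodMk (contDiff_const.add (contDiff_snd.smul contDiff_const))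
    have := ((contDiff_phi (d := d) 1).of_le le_top).comp h1
    simpa only [Function.comp_def] using this
  refine exists_implicit_differentiable (u := (c, u)) hcd hu ?_
  simp only
  rw [(hasDerivAt_phi_line 1 c A B u).deriv]
  exact hnp _ (line_ne_zero hAB u) hu B (by rw [br_line]; exact hAB)

lemma exists_frame (hd : 2 ≤ d) {V : Set (Par d)} (hV : IsOpen V)
    (h : ∀ c ∈ V, ND c ∧ ∀ n, 1 ≤ n → NP n c) {c : Par d} (hc : c ∈ V) :
    ∃ ε > 0, ∀ v : Par d, ‖v‖ < ε → ∃ A C, Frame (fun t : ℂ => c + t • v) A C := by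
  obtain ⟨A, B, hAB, a, b, e, hab, hae, hbe, ha, hb, he⟩ :=
    exists_three_fixed hd (h c hc).1 ((h c hc).2 1 le_rfl)
  have hnp := (h c hc).2 1 le_rfl
  obtain ⟨sa, ka, ha⟩ := exists_fixed_section hnp hAB ha
  obtain ⟨sb, kb, hb⟩ := exists_fixed_section hnp hAB hb
  obtain ⟨se, ke, he⟩ := exists_fixed_section hnp hAB he
  have ca := ha.self_of_nhds.1.continuousAt
  have cb := hb.self_of_nhds.1.continuousAt
  have ce := he.self_of_nhds.1.continuousAt
  have n1 : ∀ᶠ x in 𝓝 c, sb x - sa x ≠ 0 :=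
    (cb.sub ca).eventually_ne (by rw [Pi.sub_apply, ka, kb]; exact sub_ne_zero.2 hab.symm)
  have n2 : ∀ᶠ x in 𝓝 c, se x - sa x ≠ 0 :=
    (ce.sub ca).eventually_ne (by rw [Pi.sub_apply, ka, ke]; exact sub_ne_zero.2 hae.symm)
  have n3 : ∀ᶠ x in 𝓝 c, se x - sb x ≠ 0 :=
    (ce.sub cb).eventually_ne (by rw [Pi.sub_apply, kb, ke]; exact sub_ne_zero.2 hbe.symm)
  obtain ⟨r, hr, hball⟩ := Metric.eventually_nhds_iff_ball.1
    ((ha.and (hb.and he)).and ((n1.and (n2.and n3)).and (hV.mem_nhds hc)))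
  refine ⟨r / 2, by positivity, fun v hv => ?_⟩
  have hmem : ∀ t ∈ ball (0 : ℂ) 2, c + t • v ∈ ball c r := by
    intro t ht
    rw [mem_ball_zero_iff] at ht
    rw [mem_ball, dist_eq_norm, add_sub_cancel_left, norm_smul]
    nlinarith [norm_nonneg v, norm_nonneg t]
  have hγ : Differentiable ℂ fun t : ℂ => c + t • v := by fun_prop
  have hsec : ∀ s : Par d → ℂ, (∀ x ∈ ball c r, DifferentiableAt ℂ s x) →
      DifferentiableOn ℂ (fun t : ℂ => s (c + t • v)) (ball 0 2) := fun s hs t ht =>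
    ((hs _ (hmem t ht)).comp t hγ.differentiableAt).differentiableWithinAt
  have da := hsec sa fun x hx => (hball x hx).1.1.1
  have db := hsec sb fun x hx => (hball x hx).1.2.1.1
  have de := hsec se fun x hx => (hball x hx).1.2.2.1
  have hn1 : ∀ t ∈ ball (0 : ℂ) 2, sb (c + t • v) - sa (c + t • v) ≠ 0 :=
    fun t ht => (hball _ (hmem t ht)).2.1.1
  have hn2 : ∀ t ∈ ball (0 : ℂ) 2, se (c + t • v) - sa (c + t • v) ≠ 0 :=
    fun t ht => (hball _ (hmem t ht)).2.1.2.1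
  have hn3 : ∀ t ∈ ball (0 : ℂ) 2, se (c + t • v) - sb (c + t • v) ≠ 0 :=
    fun t ht => (hball _ (hmem t ht)).2.1.2.2
  have hdl : ∀ s : ℂ → ℂ, DifferentiableOn ℂ s (ball 0 2) →
      DifferentiableOn ℂ (fun t => A + s t • B) (ball 0 2) := fun s hs =>
    (differentiableOn_const A).add (hs.smul (differentiableOn_const B))
  refine ⟨fun t => ((se (c + t • v) - sb (c + t • v)) / (se (c + t • v) - sa (c + t • v))) •
      (A + sa (c + t • v) • B),
    fun t => ((sb (c + t • v) - sa (c + t • v)) / (se (c + t • v) - sa (c + t • v))) •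
      (A + se (c + t • v) • B),
    fun t ht => (h _ (hball _ (hmem t ht)).2.2).1, fun t ht => (h _ (hball _ (hmem t ht)).2.2).2,
    hγ.differentiableOn, ((de.sub db).div (de.sub da) hn2).smul (hdl _ da),
    ((db.sub da).div (de.sub da) hn2).smul (hdl _ de), ?_, ?_, ?_, ?_⟩
  · intro t ht
    rw [br_smul_left, br_smul_right, br_line_line]
    have := hn1 t ht
    have := hn2 t ht
    have := hn3 t ht
    positivity
  · intro t ht
    rw [phi_smul, (hball _ (hmem t ht)).1.1.2, mul_zero]
  · intro t ht
    have := (hball _ (hmem t ht)).1.2.1.2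
    rw [← this]
    congr 1
    have := hn2 t ht
    apply Prod.ext <;> simp only [Prod.fst_add, Prod.snd_add, Prod.smul_fst, Prod.smul_snd,
      smul_eq_mul] <;> field_simp <;> ring
  · intro t ht
    rw [phi_smul, (hball _ (hmem t ht)).1.2.2.2, mul_zero]

/-- A point away from the closure of the periodic points stays away from the periodic points of
nearby maps. -/
lemma Frame.eventually_notMem_periodicPts {γ : ℂ → Par d} {A C : ℂ → ℂ × ℂ} (hF : Frame γ A C)
    {x : Sphere} (hx : x ∉ closure (Function.periodicPts (sphereMap (γ 0)))) :
    ∀ᶠ p in 𝓝 ((0 : ℂ), x), p.2 ∉ Function.periodicPts (sphereMap (γ p.1)) := by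
  have b0 : (0 : ℂ) ∈ ball (0 : ℂ) 2 := by simp
  have hbr := hF.br_ne 0 b0
  obtain ⟨σ, hσ, hσp'⟩ := exists_section x
  have hσp : ∀ᶠ y in 𝓝 x, σ y ≠ 0 ∧ prj (σ y) = y :=
    (hσp' x).2.2.mono fun y hy => ⟨(hσp' y).1, hy⟩
  have hZ : br (σ x) (C 0) ≠ 0 := by
    intro h0
    rw [← prj_eq_prj_iff hσp.self_of_nhds.1 (hF.snd_ne_zero b0), hσp.self_of_nhds.2] at h0
    exact hx (subset_closure ⟨1, one_pos, by rw [h0]; exact hF.fixed_infty b0⟩)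
  set w₀ : ℂ := br (A 0) (σ x) / br (σ x) (C 0) with hw₀
  have hxw : x = sphereMap (mob (A 0) (C 0)) (w₀ : Sphere) := by
    rw [mob_coe hbr, ← prj_chart hbr hZ, hσp.self_of_nhds.2]
  obtain ⟨ε, hε, hfree⟩ : ∃ ε > 0, ∀ w ∈ ball w₀ ε,
      sphereMap (mob (A 0) (C 0)) (w : Sphere) ∉ Function.periodicPts (sphereMap (γ 0)) := by
    have h1 : ContinuousAt (fun w : ℂ => sphereMap (mob (A 0) (C 0)) (w : Sphere)) w₀ :=
      ((nd_mob hbr).continuous.comp OnePoint.continuous_coe).continuousAt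
    rw [hxw] at hx
    obtain ⟨ε, hε, h⟩ := Metric.eventually_nhds_iff_ball.1
      (h1.eventually (isClosed_closure.isOpen_compl.mem_nhds hx))
    exact ⟨ε, hε, fun w hw hper => h w hw (subset_closure hper)⟩
  obtain ⟨L, hL, hlip⟩ := hF.motion.lipschitz (‖w₀‖ + ε)
  have cA := (hF.diff_fst.differentiableAt (isOpen_ball.mem_nhds b0)).continuousAt
  have cC := (hF.diff_snd.differentiableAt (isOpen_ball.mem_nhds b0)).continuousAt
  have kA : ContinuousAt (fun p : ℂ × Sphere => A p.1) (0, x) :=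
    ContinuousAt.comp (f := Prod.fst) cA continuousAt_fst
  have kC : ContinuousAt (fun p : ℂ × Sphere => C p.1) (0, x) :=
    ContinuousAt.comp (f := Prod.fst) cC continuousAt_fst
  have kσ : ContinuousAt (fun p : ℂ × Sphere => σ p.2) (0, x) :=
    ContinuousAt.comp (f := Prod.snd) hσ continuousAt_snd
  have k1 : ContinuousAt (fun p : ℂ × Sphere => br (A p.1) (σ p.2)) (0, x) :=
    continuous_br.continuousAt.comp (kA.prodMk kσ)
  have k2 : ContinuousAt (fun p : ℂ × Sphere => br (σ p.2) (C p.1)) (0, x) :=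
    continuous_br.continuousAt.comp (kσ.prodMk kC)
  have k3 : ∀ᶠ p : ℂ × Sphere in 𝓝 (0, x), ‖p.1‖ < min 1 (ε / (2 * L)) :=
    (continuous_fst.norm.tendsto ((0 : ℂ), x)).eventually (Iio_mem_nhds (by simp; positivity))
  have k4 : ∀ᶠ p : ℂ × Sphere in 𝓝 (0, x),
      br (A p.1) (σ p.2) / br (σ p.2) (C p.1) ∈ ball w₀ (ε / 2) :=
    (k1.div k2 hZ).eventually (ball_mem_nhds _ (by positivity))
  filter_upwards [k3, k4, k2.eventually_ne hZ, (continuous_snd.tendsto ((0 : ℂ), x)).eventually hσp]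
    with ⟨t, y⟩ h3 h4 h5 h6
  simp only at h3 h4 h5 h6 ⊢
  have t1 : t ∈ ball (0 : ℂ) 1 := by
    rw [mem_ball_zero_iff]; exact h3.trans_le (min_le_left _ _)
  have t2 := closedBall_one_subset (ball_subset_closedBall t1)
  rintro ⟨n, hn, hy⟩
  rw [← h6.2, prj_chart (hF.br_ne t t2) h5] at hy
  obtain ⟨φ, hφ, hval⟩ := hF.exists_perSec hn t2
    ((phi_eq_zero_iff (hF.nd t t2) n (line_ne_zero (hF.br_ne t t2) _)).2 hy)
  rw [← hval, mem_ball, dist_eq_norm] at h4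
  have h7 := norm_sub_norm_le (φ t) w₀
  have h8 := hlip φ hφ t t1 (by linarith)
  have h9 : L * ‖t‖ < ε / 2 := by
    have := h3.trans_le (min_le_right _ _)
    rw [lt_div_iff₀ (by positivity)] at this
    linarith
  refine hfree (φ 0) ?_ ?_
  · rw [mem_ball, dist_eq_norm]
    have := norm_sub_le_norm_sub_add_norm_sub (φ 0) (φ t) w₀
    rw [norm_sub_rev (φ 0) (φ t)] at this
    linarith
  · rw [hF.periodicPts_eq b0]
    exact mem_image_of_mem _ (Or.inr ⟨φ, hφ, rfl⟩)

/-! ### Fibres of rational maps -/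

/-- The polynomial whose roots are the finite preimages of the point `prj W`. -/
def fibre (c : Par d) (W : ℂ × ℂ) : ℂ[X] := C W.2 * polyOf c.1 - C W.1 * polyOf c.2

lemma eval_fibre (c : Par d) (W : ℂ × ℂ) (z : ℂ) :
    (fibre c W).eval z = br (hlift c (z, 1)) W := by
  simp [fibre, br, hlift, hom_one, mul_comm]

lemma coeff_fibre (c : Par d) (W : ℂ × ℂ) : (fibre c W).coeff d = br (hlift c (1, 0)) W := by
  simp [fibre, br, hlift, hom_zero_right, mul_comm]

lemma natDegree_fibre_le (c : Par d) (W : ℂ × ℂ) : (fibre c W).natDegree ≤ d :=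
  (natDegree_sub_le _ _).trans (max_le ((natDegree_C_mul_le _ _).trans (polyOf_natDegree_le _))
    ((natDegree_C_mul_le _ _).trans (polyOf_natDegree_le _)))

lemma sphereMap_coe_eq_iff {c : Par d} (hc : ND c) {W : ℂ × ℂ} (hW : W ≠ 0) (z : ℂ) :
    sphereMap c z = prj W ↔ (fibre c W).eval z = 0 := by
  rw [← prj_one, sphereMap_prj hc (by simp), prj_eq_prj_iff (hc _ (by simp)) hW, eval_fibre]

lemma sphereMap_infty_eq_iff {c : Par d} (hc : ND c) {W : ℂ × ℂ} (hW : W ≠ 0) :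
    sphereMap c ∞ = prj W ↔ (fibre c W).coeff d = 0 := by
  rw [← prj_zero_right 1, sphereMap_prj hc (by simp), prj_eq_prj_iff (hc _ (by simp)) hW,
    coeff_fibre]

lemma sphereMap_surjective (hd : 1 ≤ d) {c : Par d} (hc : ND c) :
    Function.Surjective (sphereMap c) := by
  intro x
  obtain ⟨W, hW, rfl⟩ := exists_prj_eq x
  by_cases h : (fibre c W).coeff d = 0
  · exact ⟨∞, (sphereMap_infty_eq_iff hc hW).2 h⟩
  · obtain ⟨z, hz⟩ := IsAlgClosed.exists_root (fibre c W) (fun h0 => by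
      have := le_natDegree_of_ne_zero h
      rw [Nat.le_zero.1 (natDegree_le_iff_degree_le.2 h0.le)] at this
      lia)
    exact ⟨z, (sphereMap_coe_eq_iff hc hW z).2 hz⟩

instance : Infinite Sphere := Infinite.of_injective _ (OnePoint.coe_injective (X := ℂ))

lemma fibre_ne_zero (hd : 1 ≤ d) {c : Par d} (hc : ND c) {W : ℂ × ℂ} (hW : W ≠ 0) :
    fibre c W ≠ 0 := by
  intro h0
  obtain ⟨x, hx⟩ := Infinite.exists_notMem_finset ({prj W} : Finset Sphere)
  have key : ∀ y, sphereMap c y = prj W := by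
    intro y
    induction y using OnePoint.rec with
    | infty => rw [sphereMap_infty_eq_iff hc hW, h0, coeff_zero]
    | coe z => rw [sphereMap_coe_eq_iff hc hW, h0, eval_zero]
  obtain ⟨y, rfl⟩ := sphereMap_surjective hd hc x
  exact hx (by simp [key y])

lemma finite_fibre (hd : 1 ≤ d) {c : Par d} (hc : ND c) (x : Sphere) :
    (sphereMap c ⁻¹' {x}).Finite := by
  obtain ⟨W, hW, rfl⟩ := exists_prj_eq x
  refine ((((fibre c W).roots.toFinset.finite_toSet).image
    (fun z : ℂ => (z : Sphere))).insert ∞).subset fun y hy => ?_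
  induction y using OnePoint.rec with
  | infty => exact Or.inl rfl
  | coe z =>
    refine Or.inr ⟨z, ?_, rfl⟩
    rw [Finset.mem_coe, Multiset.mem_toFinset, mem_roots (fibre_ne_zero hd hc hW)]
    exact (sphereMap_coe_eq_iff hc hW z).1 hy

lemma countable_preimage_iterate (hd : 1 ≤ d) {c : Par d} (hc : ND c) {S : Set Sphere}
    (hS : S.Countable) (n : ℕ) : ((sphereMap c)^[n] ⁻¹' S).Countable := by
  induction n with
  | zero => simpa using hS
  | succ n ih =>
    rw [Function.iterate_succ, preimage_comp, ← biUnion_preimage_singleton]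
    exact ih.biUnion fun x _ => (finite_fibre hd hc x).countable

/-! ### A cross-ratio along orbits -/

/-- The cross-ratio of four vectors of the plane. -/
def crossRatio (A B C D : ℂ × ℂ) : ℂ := br A B * br C D / (br A D * br C B)

lemma one_sub_crossRatio {A B C D : ℂ × ℂ} (h : br A D ≠ 0) (h' : br C B ≠ 0) :
    1 - crossRatio A B C D = br A C * br D B / (br A D * br C B) := by
  rw [crossRatio, eq_div_iff (by positivity), sub_mul, div_mul_cancel₀ _ (by positivity)]
  simp only [br]; ring

/-- The cross-ratio of `f^(n+2)(z), f^2(z), f(z), z`, where `z = prj Z`. -/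
def orbitRatio (c : Par d) (n : ℕ) (Z : ℂ × ℂ) : ℂ :=
  crossRatio ((hlift c)^[n + 2] Z) ((hlift c)^[2] Z) (hlift c Z) Z

lemma br_iter_ne_zero {c : Par d} (hc : ND c) {Z : ℂ × ℂ} (hZ : Z ≠ 0)
    (hp : prj ((hlift c)^[2] Z) ∉ Function.periodicPts (sphereMap c)) {i j : ℕ} (hi : i ≤ 2)
    (hij : i < j) : br ((hlift c)^[j] Z) ((hlift c)^[i] Z) ≠ 0 := by
  intro h
  rw [← prj_eq_prj_iff (hc.iter_ne_zero _ hZ) (hc.iter_ne_zero _ hZ),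
    ← iterate_sphereMap_prj hc _ hZ, ← iterate_sphereMap_prj hc _ hZ] at h
  refine hp ⟨j - i, by lia, ?_⟩
  rw [Function.IsPeriodicPt, Function.IsFixedPt, ← iterate_sphereMap_prj hc _ hZ,
    ← Function.iterate_add_apply, show j - i + 2 = (2 - i) + j by lia,
    Function.iterate_add_apply, h, ← Function.iterate_add_apply, show 2 - i + i = 2 by lia]

lemma orbitRatio_ne {c : Par d} (hc : ND c) {Z : ℂ × ℂ} (hZ : Z ≠ 0)
    (hp : prj ((hlift c)^[2] Z) ∉ Function.periodicPts (sphereMap c)) {n : ℕ} (hn : 1 ≤ n) :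
    orbitRatio c n Z ≠ 0 ∧ orbitRatio c n Z ≠ 1 := by
  have h := fun i j (hi : i ≤ 2) (hij : i < j) => br_iter_ne_zero hc hZ hp hi hij
  have h1 := h 2 (n + 2) le_rfl (by lia)
  have h2 := h 0 1 (by lia) (by lia)
  have h3 := h 0 (n + 2) (by lia) (by lia)
  have h4 := h 1 2 (by lia) (by lia)
  have h5 := h 1 (n + 2) (by lia) (by lia)
  have h6 := h 0 2 (by lia) (by lia)
  rw [br_swap, neg_ne_zero] at h4 h6
  simp only [Function.iterate_zero, Function.iterate_one, id] at h2 h3 h4 h5 h6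
  constructor
  · rw [orbitRatio, crossRatio]; positivity
  · rw [ne_comm, ← sub_ne_zero, orbitRatio, one_sub_crossRatio h3 h4]; positivity

lemma crossRatio_smul_left {s : ℂ} (hs : s ≠ 0) (A B C D : ℂ × ℂ) :
    crossRatio (s • A) B C D = crossRatio A B C D := by
  simp only [crossRatio, br_smul_left, mul_assoc]
  rw [mul_div_mul_left _ _ hs]

lemma orbitRatio_smul (c : Par d) (n : ℕ) {s : ℂ} (hs : s ≠ 0) (Z : ℂ × ℂ) :
    orbitRatio c n (s • Z) = orbitRatio c n Z := by
  rw [orbitRatio, iter_smul, iter_smul, hlift_smul, crossRatio_smul_left (pow_ne_zero _ hs),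
    orbitRatio]
  simp only [crossRatio, br_smul_left, br_smul_right]
  rw [show ∀ a b : ℂ, s ^ d ^ 2 * a * (s * (s ^ d * b)) =
    (s ^ d ^ 2 * (s ^ d * s)) * (a * b) by intros; ring]
  rw [show ∀ x y : ℂ, s * x * (s ^ d ^ 2 * (s ^ d * y)) =
    (s ^ d ^ 2 * (s ^ d * s)) * (x * y) by intros; ring, mul_div_mul_left _ _ (by positivity)]

lemma prj_eq_iff_exists_smul {Z W : ℂ × ℂ} (hZ : Z ≠ 0) (hW : W ≠ 0) :
    prj Z = prj W ↔ ∃ s : ℂ, s ≠ 0 ∧ Z = s • W := by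
  constructor
  · intro h
    obtain ⟨s, rfl⟩ := exists_smul_of_br_eq_zero hW ((prj_eq_prj_iff hW hZ).1 h.symm)
    exact ⟨s, fun h0 => hZ (by simp [h0]), rfl⟩
  · rintro ⟨s, hs, rfl⟩
    exact prj_smul hs W

lemma differentiableOn_orbitRatio {γ : ℂ → Par d} {Z : ℂ → ℂ × ℂ} (hγ : Differentiable ℂ γ)
    (hZ : Differentiable ℂ Z) {U : Set ℂ} (hU : ∀ w ∈ U, ND (γ w) ∧ Z w ≠ 0 ∧
      prj ((hlift (γ w))^[2] (Z w)) ∉ Function.periodicPts (sphereMap (γ w)))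
    (n : ℕ) : DifferentiableOn ℂ (fun w => orbitRatio (γ w) n (Z w)) U := by
  have hi : ∀ k, Differentiable ℂ fun w : ℂ => (hlift (γ w))^[k] (Z w) := fun k => by
    have := ((contDiff_iter k).differentiable (by simp)).comp (hγ.prodMk hZ)
    simpa only [Function.comp_def] using this
  have hb : ∀ j k, Differentiable ℂ fun w : ℂ =>
      br ((hlift (γ w))^[j] (Z w)) ((hlift (γ w))^[k] (Z w)) := fun j k => by
    have := (contDiff_br.differentiable (by simp)).comp ((hi j).prodMk (hi k))
    simpa only [Function.comp_def] using this
  have := ((hb (n + 2) 2).mul (hb 1 0)).differentiableOn.fun_div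
    ((hb (n + 2) 0).mul (hb 1 2)).differentiableOn (s := U) fun w hw => by
      obtain ⟨hc, hZ, hp⟩ := hU w hw
      have h := fun i j (hi : i ≤ 2) (hij : i < j) => br_iter_ne_zero hc hZ hp hi hij
      have h1 := h 0 (n + 2) (by lia) (by lia)
      have h2 := h 1 2 (by lia) (by lia)
      rw [br_swap, neg_ne_zero] at h2
      exact mul_ne_zero h1 h2
  exact this

/-- At a non-wandering point outside of the closure of the periodic points, some iterates
converge to the identity, in the sense that the cross-ratio tends uniformly to zero. -/
theorem exists_recurrence_filter (hd : 1 ≤ d) {c : Par d} (hc : ND c) {x₀ : Sphere}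
    (hx : x₀ ∈ nonWandering (sphereMap c))
    (hper : x₀ ∉ closure (Function.periodicPts (sphereMap c))) :
    ∃ ℱ : Filter ℕ, ℱ.NeBot ∧ ℱ ≤ atTop ∧ ∃ A B : ℂ × ℂ, br A B ≠ 0 ∧ ∃ r > 0,
      (∀ w ∈ ball (0 : ℂ) r,
        prj ((hlift c)^[2] (A + w • B)) ∉ closure (Function.periodicPts (sphereMap c))) ∧
      ∀ ε > 0, ∀ᶠ n in ℱ, ∀ w ∈ closedBall (0 : ℂ) (r / 2), ‖orbitRatio c n (A + w • B)‖ < ε := by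
  set f := sphereMap c with hf
  set 𝓛 : Filter (ℕ × Sphere) :=
    comap (fun p : ℕ × Sphere => (p.2, f^[p.1] p.2)) (𝓝 (x₀, x₀)) ⊓ 𝓟 {p | 1 ≤ p.1} with h𝓛
  have hne : 𝓛.NeBot := by
    rw [h𝓛, inf_principal_neBot_iff]
    rintro U ⟨t, ht, htU⟩
    obtain ⟨V, hV, V', hV', hVV⟩ := mem_nhds_prod_iff.1 ht
    obtain ⟨n, hn, y, ⟨z, hz, rfl⟩, hy⟩ := hx _ (inter_mem hV hV')
    exact ⟨(n, z), htU (hVV ⟨hz.1, hy.2⟩), hn⟩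
  set 𝓤 : Ultrafilter (ℕ × Sphere) := Ultrafilter.of 𝓛 with h𝓤
  have hle : (𝓤 : Filter (ℕ × Sphere)) ≤ 𝓛 := Ultrafilter.of_le 𝓛
  have t12 : Tendsto (fun p : ℕ × Sphere => (p.2, f^[p.1] p.2)) 𝓤 (𝓝 (x₀, x₀)) :=
    tendsto_comap.mono_left (hle.trans inf_le_left)
  have t1 : Tendsto (fun p : ℕ × Sphere => p.2) 𝓤 (𝓝 x₀) := (continuous_fst.tendsto _).comp t12
  have t2 : Tendsto (fun p : ℕ × Sphere => f^[p.1] p.2) 𝓤 (𝓝 x₀) :=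
    (continuous_snd.tendsto _).comp t12
  have hpos : ∀ᶠ p : ℕ × Sphere in 𝓤, 1 ≤ p.1 := hle (mem_inf_of_right (mem_principal_self _))
  have htop : Tendsto (fun p : ℕ × Sphere => p.1) 𝓤 atTop := by
    rcases (𝓤.map Prod.fst).le_cofinite_or_eq_pure with h | ⟨n, h⟩
    · rwa [Ultrafilter.coe_map, Nat.cofinite_eq_atTop] at h
    · exfalso
      have hn : ∀ᶠ p : ℕ × Sphere in 𝓤, p.1 = n := by
        have : {n} ∈ 𝓤.map Prod.fst := by rw [h]; exact mem_singleton n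
        exact this
      obtain ⟨p, hp, hp'⟩ := (hpos.and hn).exists
      have t3 : Tendsto (fun p : ℕ × Sphere => f^[p.1] p.2) 𝓤 (𝓝 (f^[n] x₀)) :=
        (((hc.continuous_iterate n).tendsto x₀).comp t1).congr' (hn.mono fun p hp => by
          simp [hp, hf])
      exact hper (subset_closure ⟨n, by lia, tendsto_nhds_unique t3 t2⟩)
  have hsurj : Function.Surjective f^[2] := (sphereMap_surjective hd hc).iterate 2
  choose s hs using hsurj
  obtain ⟨y₀, hy₀⟩ : ∃ y₀, Tendsto (fun p : ℕ × Sphere => s p.2) 𝓤 (𝓝 y₀) :=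
    ⟨_, (𝓤.map fun p : ℕ × Sphere => s p.2).le_nhds_lim⟩
  have hfy : f^[2] y₀ = x₀ := by
    refine tendsto_nhds_unique (((hc.continuous_iterate 2).tendsto y₀).comp hy₀) (t1.congr fun p => ?_)
    exact (hs p.2).symm
  obtain ⟨σ, hσ, hσp⟩ := exists_section y₀
  obtain ⟨τ, hτ, hτp⟩ := exists_section x₀
  set A := σ y₀ with hA
  have hA0 : A ≠ 0 := (hσp y₀).1
  have hAp : prj A = y₀ := (hσp y₀).2.1 rfl
  obtain ⟨B, hAB⟩ := exists_br_ne_zero hA0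
  have hAx : prj ((hlift c)^[2] A) = x₀ := by rw [← iterate_sphereMap_prj hc _ hA0, hAp, ← hfy]
  have hline : ContinuousAt (fun w : ℂ => prj ((hlift c)^[2] (A + w • B))) 0 := by
    have h0 : (hlift c)^[2] (A + (0 : ℂ) • B) ≠ 0 := hc.iter_ne_zero _ (line_ne_zero hAB 0)
    exact (continuousAt_prj h0).comp (f := fun w : ℂ => (hlift c)^[2] (A + w • B))
      ((contDiff_iter_right 2 c).continuous.comp (by fun_prop)).continuousAt
  obtain ⟨r, hr, hfree⟩ := Metric.eventually_nhds_iff_ball.1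
    (hline.eventually (isClosed_closure.isOpen_compl.mem_nhds
      (show _ ∉ closure (Function.periodicPts f) by beta_reduce; rw [zero_smul, add_zero, hAx]; exact hper)))
  have hfree' : ∀ w ∈ ball (0 : ℂ) r,
      prj ((hlift c)^[2] (A + w • B)) ∉ Function.periodicPts f := fun w hw h =>
    hfree w hw (subset_closure h)
  refine ⟨map Prod.fst (𝓤 : Filter (ℕ × Sphere)), inferInstance, htop, A, B, hAB, r, hr, hfree,
    fun ε hε => ?_⟩
  obtain ⟨δ, hδ, hsch⟩ := schottky_small (R := r) (r / 2) ε (by linarith) hε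
  have tσ : Tendsto (fun p : ℕ × Sphere => σ (s p.2)) 𝓤 (𝓝 A) := hσ.tendsto.comp hy₀
  have tτ : Tendsto (fun p : ℕ × Sphere => τ (f^[p.1] p.2)) 𝓤 (𝓝 (τ x₀)) := hτ.tendsto.comp t2
  have tb : ∀ {g h : ℕ × Sphere → ℂ × ℂ} {a b : ℂ × ℂ}, Tendsto g 𝓤 (𝓝 a) → Tendsto h 𝓤 (𝓝 b) →
      Tendsto (fun p => br (g p) (h p)) 𝓤 (𝓝 (br a b)) := fun hg hh =>
    (continuous_br.tendsto _).comp (hg.prodMk_nhds hh)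
  have ti : ∀ k, Tendsto (fun p : ℕ × Sphere => (hlift c)^[k] (σ (s p.2))) 𝓤
      (𝓝 ((hlift c)^[k] A)) := fun k => ((contDiff_iter_right k c).continuous.tendsto _).comp tσ
  have hper' : prj ((hlift c)^[2] A) ∉ Function.periodicPts f := by
    rw [hAx]; exact fun h => hper (subset_closure h)
  have hτ0 : τ x₀ ≠ 0 := (hτp x₀).1
  obtain ⟨a, ha, hτa⟩ := (prj_eq_iff_exists_smul hτ0 (hc.iter_ne_zero 2 hA0)).1
    (((hτp x₀).2.1 rfl).trans hAx.symm)
  have hcr : Tendsto (fun p : ℕ × Sphere => orbitRatio c p.1 (σ (s p.2))) 𝓤 (𝓝 0) := by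
    have h02 := br_iter_ne_zero hc hA0 hper' (i := 0) (j := 2) (by lia) (by lia)
    have h12 := br_iter_ne_zero hc hA0 hper' (i := 1) (j := 2) (by lia) (by lia)
    rw [br_swap, neg_ne_zero] at h12
    have := ((tb tτ (ti 2)).mul (tb (ti 1) (ti 0))).div ((tb tτ (ti 0)).mul (tb (ti 1) (ti 2)))
      (mul_ne_zero (by rw [hτa, br_smul_left]; exact mul_ne_zero ha h02) h12)
    rw [hτa, br_smul_left, br_self, mul_zero, zero_mul, zero_div] at this
    refine this.congr' ?_
    filter_upwards [hy₀.eventually (hσp y₀).2.2, t2.eventually (hτp x₀).2.2] with p h1 h2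
    have e : prj ((hlift c)^[p.1 + 2] (σ (s p.2))) = prj (τ (f^[p.1] p.2)) := by
      rw [h2, ← iterate_sphereMap_prj hc _ (hσp _).1, h1, Function.iterate_add_apply, ← hf, hs]
    obtain ⟨b, hb, hb'⟩ := (prj_eq_iff_exists_smul (hc.iter_ne_zero _ (hσp _).1) (hτp _).1).1 e
    rw [orbitRatio, hb', crossRatio_smul_left hb]
    rfl
  have hw : Tendsto (fun p : ℕ × Sphere => br A (σ (s p.2)) / br (σ (s p.2)) B) 𝓤 (𝓝 0) := by
    have := (tb (tendsto_const_nhds (x := A)) tσ).div (tb tσ (tendsto_const_nhds (x := B))) hAB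
    rwa [br_self, zero_div] at this
  rw [eventually_map]
  filter_upwards [hpos, hcr.eventually (ball_mem_nhds 0 hδ),
    hw.eventually (closedBall_mem_nhds 0 (half_pos hr)),
    (tb tσ tendsto_const_nhds).eventually_ne hAB] with p hp h1 h2 h3 w hw
  refine hsch 0 (fun w => orbitRatio c p.1 (A + w • B))
    (differentiableOn_orbitRatio (γ := fun _ => c) (Z := fun w => A + w • B) (by fun_prop)
      (by fun_prop) (fun w hw => ⟨hc, line_ne_zero hAB w, hfree' w hw⟩) _)
    (fun z hz => orbitRatio_ne hc (line_ne_zero hAB z) (hfree' z hz) hp) _ h2 _ hw ?_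
  rw [← orbitRatio_smul c p.1 (div_ne_zero h3 hAB), ← smul_chart hAB h3]
  simpa using h1

/-- The affine coordinate of the point `prj Z`. -/
def quot (Z : ℂ × ℂ) : ℂ := Z.1 / Z.2

lemma prj_eq_quot {Z : ℂ × ℂ} (h : Z.2 ≠ 0) : prj Z = (quot Z : Sphere) := by simp [prj, h, quot]

lemma snd_ne_zero_iff (Z : ℂ × ℂ) : Z.2 ≠ 0 ↔ prj Z ≠ ∞ := by
  by_cases h : Z.2 = 0 <;> simp [prj, h]

lemma quot_eq_of_prj {Z : ℂ × ℂ} {z : ℂ} (h : prj Z = z) : Z.2 ≠ 0 ∧ quot Z = z := by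
  have h2 : Z.2 ≠ 0 := (snd_ne_zero_iff Z).2 (by simp [h])
  exact ⟨h2, OnePoint.coe_injective ((prj_eq_quot h2).symm.trans h)⟩

lemma prj_line_injective {A B : ℂ × ℂ} (h : br A B ≠ 0) :
    Function.Injective fun w : ℂ => prj (A + w • B) := by
  intro v w hvw
  have := (prj_eq_prj_iff (line_ne_zero h v) (line_ne_zero h w)).1 hvw
  have e : br (A + v • B) (A + w • B) = (w - v) * br A B := by simp [br]; ring
  rw [e, mul_eq_zero, or_iff_left h, sub_eq_zero] at this
  exact this.symm

/-- The points to be avoided: critical points, `∞` and the points with the same image as `∞`. -/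
def badSet (c : Par d) : Set Sphere :=
  (fun z : ℂ => (z : Sphere)) '' {z | (wr c).eval z = 0} ∪ sphereMap c ⁻¹' {sphereMap c ∞}

lemma countable_badSet (hd : 1 ≤ d) {c : Par d} (hc : ND c) (hwr : wr c ≠ 0) :
    (badSet c).Countable := by
  refine ((Set.Finite.image _ ?_).union (finite_fibre hd hc _)).countable
  refine ((wr c).roots.toFinset.finite_toSet).subset fun z hz => ?_
  simpa [hwr] using hz

/-- At a non-wandering point outside of the closure of the periodic points, some iterates
converge to the identity near a point with a generic orbit. -/
theorem exists_generic_recurrence (hd : 1 ≤ d) {c : Par d} (hc : ND c) (hwr : wr c ≠ 0)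
    {x₀ : Sphere} (hx : x₀ ∈ nonWandering (sphereMap c))
    (hper : x₀ ∉ closure (Function.periodicPts (sphereMap c))) :
    ∃ ℱ : Filter ℕ, ℱ.NeBot ∧ ℱ ≤ atTop ∧ ∃ (y : ℂ) (ρ : ℝ), 0 < ρ ∧
      (∀ j, (sphereMap c)^[j] y ∉ badSet c) ∧
      (∀ z ∈ ball y ρ,
        (sphereMap c)^[2] z ∉ closure (Function.periodicPts (sphereMap c))) ∧
      ∀ ε > 0, ∀ᶠ n in ℱ, ∀ z ∈ ball y ρ, ‖orbitRatio c n (z, 1)‖ < ε := by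
  obtain ⟨ℱ, h1, h2, A, B, hAB, r, hr, hfree, hsmall⟩ := exists_recurrence_filter hd hc hx hper
  have hcount : ((fun w : ℂ => prj (A + w • B)) ⁻¹'
      ⋃ j, (sphereMap c)^[j] ⁻¹' badSet c).Countable :=
    (countable_iUnion fun j => countable_preimage_iterate hd hc
      (countable_badSet hd hc hwr) j).preimage (prj_line_injective hAB)
  obtain ⟨w₀, hw₀, hw₀'⟩ := (hcount.dense_compl ℂ).inter_open_nonempty _
    (isOpen_ball (x := (0 : ℂ)) (ε := r / 2)) ⟨0, by simpa⟩
  have hgen : ∀ j, (sphereMap c)^[j] (prj (A + w₀ • B)) ∉ badSet c := by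
    intro j hj
    exact hw₀' (mem_iUnion.2 ⟨j, hj⟩)
  have hinf : prj (A + w₀ • B) ≠ ∞ := fun h => hgen 0 (Or.inr (by simp [h]))
  obtain ⟨y, hy⟩ := OnePoint.ne_infty_iff_exists.1 hinf
  have hyb : br (y, 1) B ≠ 0 := by
    obtain ⟨s, hs, e⟩ := (prj_eq_iff_exists_smul (W := A + w₀ • B) (Z := (y, 1)) (by simp)
      (line_ne_zero hAB _)).1 (by rw [prj_one, hy])
    rw [e, br_smul_left, br_line]
    exact mul_ne_zero hs hAB
  have hyw : br A (y, 1) / br (y, 1) B = w₀ :=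
    prj_line_injective hAB (by simp only; rw [← prj_chart hAB hyb, prj_one, hy])
  have c1 : ContinuousAt (fun z : ℂ => br (z, 1) B) y := by unfold br; fun_prop
  have c2 : ContinuousAt (fun z : ℂ => br A (z, 1) / br (z, 1) B) y := by
    refine ContinuousAt.div ?_ c1 hyb
    unfold br; fun_prop
  obtain ⟨ρ, hρ, h⟩ := Metric.eventually_nhds_iff_ball.1 ((c1.eventually_ne hyb).and
    (c2.eventually (isOpen_ball.mem_nhds (show _ ∈ ball 0 (r / 2) by simpa only [hyw] using hw₀))))
  refine ⟨ℱ, h1, h2, y, ρ, hρ, fun j => by rw [hy]; exact hgen j, fun z hz => ?_, fun ε hε => ?_⟩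
  · have := hfree _ (ball_subset_ball (by linarith) (h z hz).2)
    rwa [← iterate_sphereMap_prj hc _ (line_ne_zero hAB _), ← prj_chart hAB (h z hz).1,
      prj_one] at this
  · filter_upwards [hsmall ε hε] with n hn z hz
    have := hn _ (ball_subset_closedBall (h z hz).2)
    rwa [← orbitRatio_smul c n (div_ne_zero (h z hz).1 hAB), ← smul_chart hAB (h z hz).1] at this

/-- A representative of `f^(n+2)(prj Z)`, where `e` is the corresponding orbit ratio. -/
def returnVec (c : Par d) (e : ℂ) (Z : ℂ × ℂ) : ℂ × ℂ :=
  (hlift c)^[2] Z - (e * (br (hlift c Z) ((hlift c)^[2] Z) / br (hlift c Z) Z)) • Z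

lemma returnVec_zero (c : Par d) (Z : ℂ × ℂ) : returnVec c 0 Z = (hlift c)^[2] Z := by
  rw [returnVec, zero_mul, zero_smul, sub_zero]

lemma prj_eq_returnVec {c : Par d} (hc : ND c) {Z : ℂ × ℂ} (hZ : Z ≠ 0)
    (hp : prj ((hlift c)^[2] Z) ∉ Function.periodicPts (sphereMap c)) {n : ℕ}
    (hW : returnVec c (orbitRatio c n Z) Z ≠ 0) :
    prj ((hlift c)^[n + 2] Z) = prj (returnVec c (orbitRatio c n Z) Z) := by
  rw [prj_eq_prj_iff (hc.iter_ne_zero _ hZ) hW, returnVec, sub_eq_add_neg, ← neg_smul,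
    br_add_right, br_smul_right, orbitRatio, crossRatio]
  have h := fun i j (hi : i ≤ 2) (hij : i < j) => br_iter_ne_zero hc hZ hp hi hij
  have h2 : br (hlift c Z) Z ≠ 0 := h 0 1 (by lia) (by lia)
  have h3 : br ((hlift c)^[n + 2] Z) Z ≠ 0 := h 0 (n + 2) (by lia) (by lia)
  have h4 := h 1 2 (by lia) (by lia)
  rw [br_swap, neg_ne_zero] at h4
  simp only [Function.iterate_one] at h4
  field_simp
  ring

lemma continuousAt_returnVec {k : Par d × (ℂ × ℂ)} (hbr : br (hlift k.1 k.2) k.2 ≠ 0) :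
    ContinuousAt (fun p : ℂ × (Par d × (ℂ × ℂ)) => returnVec p.2.1 p.1 p.2.2) (0, k) := by
  have c0 : Continuous fun p : ℂ × (Par d × (ℂ × ℂ)) => p.2.2 := by fun_prop
  have c1 : Continuous fun p : ℂ × (Par d × (ℂ × ℂ)) => hlift p.2.1 p.2.2 := by
    have := (contDiff_hlift (d := d)).continuous.comp
      (continuous_snd : Continuous fun p : ℂ × (Par d × (ℂ × ℂ)) => p.2)
    simpa only [Function.comp_def] using this
  have c2 : Continuous fun p : ℂ × (Par d × (ℂ × ℂ)) => (hlift p.2.1)^[2] p.2.2 := by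
    have := (continuous_iter (d := d) 2).comp
      (continuous_snd : Continuous fun p : ℂ × (Par d × (ℂ × ℂ)) => p.2)
    simpa only [Function.comp_def] using this
  have c3 : Continuous fun p : ℂ × (Par d × (ℂ × ℂ)) =>
    br (hlift p.2.1 p.2.2) ((hlift p.2.1)^[2] p.2.2) := continuous_br.comp (c1.prodMk c2)
  have c4 : Continuous fun p : ℂ × (Par d × (ℂ × ℂ)) =>
    br (hlift p.2.1 p.2.2) p.2.2 := continuous_br.comp (c1.prodMk c0)
  have c5 : ContinuousAt (fun p : ℂ × (Par d × (ℂ × ℂ)) =>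
      br (hlift p.2.1 p.2.2) ((hlift p.2.1)^[2] p.2.2) / br (hlift p.2.1 p.2.2) p.2.2) (0, k) :=
    c3.continuousAt.div c4.continuousAt hbr
  unfold returnVec
  generalize (hlift : Par d → ℂ × ℂ → ℂ × ℂ) = T at *
  exact c2.continuousAt.sub ((continuousAt_fst.mul c5).smul c0.continuousAt)

lemma continuousAt_quot {Z : ℂ × ℂ} (h : Z.2 ≠ 0) : ContinuousAt quot Z :=
  continuousAt_fst.div continuousAt_snd h

/-- A small cross-ratio forces a return close to the initial point. -/
lemma exists_quot_close {K : Set (Par d × (ℂ × ℂ))} (hK : IsCompact K)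
    (h : ∀ k ∈ K, ND k.1 ∧ k.2 ≠ 0 ∧
      prj ((hlift k.1)^[2] k.2) ∉ Function.periodicPts (sphereMap k.1) ∧
      ((hlift k.1)^[2] k.2).2 ≠ 0) {ε : ℝ} (hε : 0 < ε) :
    ∃ δ > 0, ∀ k ∈ K, ∀ n, ‖orbitRatio k.1 n k.2‖ < δ →
      ((hlift k.1)^[n + 2] k.2).2 ≠ 0 ∧
      ‖quot ((hlift k.1)^[n + 2] k.2) - quot ((hlift k.1)^[2] k.2)‖ < ε := by
  have key := hK.eventually_forall_of_forall_eventually (x₀ := (0 : ℂ))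
    (P := fun e k => (returnVec k.1 e k.2).2 ≠ 0 ∧
      ‖quot (returnVec k.1 e k.2) - quot (returnVec k.1 0 k.2)‖ < ε) ?_
  · obtain ⟨δ, hδ, hb⟩ := Metric.eventually_nhds_iff_ball.1 key
    refine ⟨δ, hδ, fun k hk n hlt => ?_⟩
    have h1 := hb _ (by simpa using hlt) k hk
    obtain ⟨hnd, hZ, hp, -⟩ := h k hk
    have e := prj_eq_returnVec hnd hZ hp (n := n) (fun h0 => h1.1 (by rw [h0]; rfl))
    rw [prj_eq_quot h1.1] at e
    obtain ⟨e1, e2⟩ := quot_eq_of_prj e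
    refine ⟨e1, ?_⟩
    rw [e2, ← returnVec_zero]
    exact h1.2
  · rintro k hk
    obtain ⟨hnd, hZ, hp, h2⟩ := h k hk
    rw [← returnVec_zero] at h2
    have c5 := continuousAt_returnVec (k := k)
      (br_iter_ne_zero hnd hZ hp (i := 0) (j := 1) (by lia) (by lia))
    have c5' : ContinuousAt (fun p : ℂ × (Par d × (ℂ × ℂ)) => returnVec p.2.1 0 p.2.2) (0, k) :=
      ContinuousAt.comp (x := ((0 : ℂ), k))
        (f := fun p : ℂ × (Par d × (ℂ × ℂ)) => ((0 : ℂ), p.2)) c5 (by fun_prop)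
    have c8 := ContinuousAt.comp (x := ((0 : ℂ), k))
      (f := fun p : ℂ × (Par d × (ℂ × ℂ)) => returnVec p.2.1 p.1 p.2.2) (continuousAt_quot h2) c5
    have c9 := ContinuousAt.comp (x := ((0 : ℂ), k))
      (f := fun p : ℂ × (Par d × (ℂ × ℂ)) => returnVec p.2.1 0 p.2.2) (continuousAt_quot h2) c5'
    have c6 := ContinuousAt.comp (x := ((0 : ℂ), k)) (g := Prod.snd)
      (f := fun p : ℂ × (Par d × (ℂ × ℂ)) => returnVec p.2.1 p.1 p.2.2) continuousAt_snd c5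
    have c10 := (c8.sub c9).norm.eventually_lt (continuousAt_const (y := ε)) (by simpa using hε)
    exact (c6.eventually_ne h2).and c10

/-- The derivative of the rational map `p / q` in the affine coordinate. -/
def df (c : Par d) (z : ℂ) : ℂ := (wr c).eval z / ((polyOf c.2).eval z) ^ 2

lemma quot_hlift (c : Par d) {Z : ℂ × ℂ} (h : Z.2 ≠ 0) :
    quot (hlift c Z) = (polyOf c.1).eval (quot Z) / (polyOf c.2).eval (quot Z) := by
  have e : Z = Z.2 • (quot Z, (1 : ℂ)) := by
    apply Prod.ext <;> simp [quot, mul_div_cancel₀ _ h]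
  conv_lhs => rw [e, hlift_smul]
  simp only [quot, hlift, Prod.smul_mk, smul_eq_mul, hom_one]
  rw [mul_div_mul_left _ _ (pow_ne_zero _ h)]

lemma polyOf_add_smul (a b : Fin (d + 1) → ℂ) (t z : ℂ) :
    (polyOf (a + t • b)).eval z = (polyOf a).eval z + t * (polyOf b).eval z := by
  simp only [polyOf_eval, Pi.add_apply, Pi.smul_apply, smul_eq_mul, add_mul, Finset.sum_add_distrib,
    Finset.mul_sum, mul_assoc]

lemma hasDerivAt_quot_hlift {c v : Par d} {Z : ℂ → ℂ × ℂ} {s D : ℂ} (hZ : ContinuousAt Z s)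
    (h2 : (Z s).2 ≠ 0) (hD : HasDerivAt (fun t => quot (Z t)) D s)
    (hq : (polyOf (c + s • v).2).eval (quot (Z s)) ≠ 0) :
    HasDerivAt (fun t : ℂ => quot (hlift (c + t • v) (Z t)))
      (((polyOf v.1).eval (quot (Z s)) * (polyOf (c + s • v).2).eval (quot (Z s)) -
        (polyOf (c + s • v).1).eval (quot (Z s)) * (polyOf v.2).eval (quot (Z s))) /
          ((polyOf (c + s • v).2).eval (quot (Z s))) ^ 2 + df (c + s • v) (quot (Z s)) * D) s := by
  have hev : ∀ a b : Fin (d + 1) → ℂ, HasDerivAt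
      (fun t : ℂ => (polyOf (a + t • b)).eval (quot (Z t)))
      ((polyOf b).eval (quot (Z s)) +
        (derivative (polyOf (a + s • b))).eval (quot (Z s)) * D) s := by
    intro a b
    have h1 := ((polyOf a).hasDerivAt (quot (Z s))).comp s hD
    have h3 := ((polyOf b).hasDerivAt (quot (Z s))).comp s hD
    have h4 := h1.add ((hasDerivAt_id s).mul h3)
    have e : derivative (polyOf (a + s • b)) =
        derivative (polyOf a) + C s * derivative (polyOf b) := by
      have : polyOf (a + s • b) = polyOf a + C s * polyOf b :=
        Polynomial.funext fun z => by simp [polyOf_add_smul]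
      rw [this]; simp
    refine (h4.congr_of_eventuallyEq (Eventually.of_forall fun t => ?_)).congr_deriv ?_
    · simp [polyOf_add_smul]
    · simp [e]; ring
  have h := (hev c.1 v.1).fun_div (hev c.2 v.2) hq
  refine (h.congr_of_eventuallyEq ?_).congr_deriv ?_
  · filter_upwards [(continuousAt_snd.comp hZ).eventually_ne h2] with t ht
    exact quot_hlift _ ht
  · simp only [df, wr, Prod.fst_add, Prod.snd_add, Prod.smul_fst, Prod.smul_snd, eval_sub, eval_mul]
      at hq ⊢
    field_simp
    ring

/-- A finite orbit. -/
def IsOrbit (c : Par d) (x : ℕ → ℂ) : Prop := ∀ j, sphereMap c (x j) = (x (j + 1) : Sphere)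

lemma IsOrbit.iterate {c : Par d} {x : ℕ → ℂ} (h : IsOrbit c x) (n k : ℕ) :
    (sphereMap c)^[n] (x k) = (x (k + n) : Sphere) := by
  induction n with
  | zero => rfl
  | succ n ih => rw [Function.iterate_succ_apply', ih, h, add_assoc]

lemma IsOrbit.quot_eq {c : Par d} (hc : ND c) {x : ℕ → ℂ} (h : IsOrbit c x) {Z : ℂ × ℂ} (hZ : Z ≠ 0)
    {k : ℕ} (hk : prj Z = x k) (n : ℕ) :
    ((hlift c)^[n] Z).2 ≠ 0 ∧ quot ((hlift c)^[n] Z) = x (k + n) := by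
  refine quot_eq_of_prj ?_
  rw [← iterate_sphereMap_prj hc n hZ, hk, h.iterate]

lemma IsOrbit.eval_ne_zero {c : Par d} {x : ℕ → ℂ} (h : IsOrbit c x) (j : ℕ) :
    (polyOf c.2).eval (x j) ≠ 0 ∧ x (j + 1) = (polyOf c.1).eval (x j) / (polyOf c.2).eval (x j) := by
  have := h j
  rw [sphereMap, ratEval, if_neg (OnePoint.coe_ne_infty _), toC_coe] at this
  split_ifs at this with h0
  · exact absurd this.symm (OnePoint.coe_ne_infty _)
  exact ⟨h0, (OnePoint.coe_injective this).symm⟩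

lemma differentiableAt_quot_comp {Z : ℂ → ℂ × ℂ} {s : ℂ} (hZ : DifferentiableAt ℂ Z s)
    (h2 : (Z s).2 ≠ 0) : DifferentiableAt ℂ (fun t => quot (Z t)) s := by
  unfold quot
  exact hZ.fst.fun_div hZ.snd h2

lemma differentiable_iter_one (c : Par d) (n : ℕ) :
    Differentiable ℂ fun u : ℂ => (hlift c)^[n] (u, (1 : ℂ)) := by
  have := ((contDiff_iter_right n c).differentiable (by simp)).comp
    (by fun_prop : Differentiable ℂ fun u : ℂ => (u, (1 : ℂ)))
  simpa only [Function.comp_def] using this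

lemma IsOrbit.hasDerivAt {c : Par d} (hc : ND c) {x : ℕ → ℂ} (h : IsOrbit c x) (k n : ℕ) :
    HasDerivAt (fun u : ℂ => quot ((hlift c)^[n] (u, 1))) (∏ i ∈ Finset.range n, df c (x (k + i)))
      (x k) := by
  have h0 := fun n => h.quot_eq hc (Z := (x k, 1)) (by simp) (k := k) (by simp) n
  induction n with
  | zero =>
    simp only [Function.iterate_zero, id, quot, div_one, Finset.range_zero, Finset.prod_empty]
    exact hasDerivAt_id (x k)
  | succ n ih =>
    have := hasDerivAt_quot_hlift (c := c) (v := 0) (Z := fun u => (hlift c)^[n] (u, 1))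
      (differentiable_iter_one c n _).continuousAt (h0 n).1 ih
      (by rw [(h0 n).2]; simpa using (h.eval_ne_zero (k + n)).1)
    simp only [smul_zero, add_zero] at this
    simp only [Function.iterate_succ_apply']
    refine this.congr_deriv ?_
    rw [(h0 n).2, Finset.prod_range_succ]
    simp [polyOf]; ring

/-- The solution of an affine recursion. -/
lemma affine_recursion {D ξ a : ℕ → ℂ} (ha : ∀ n, a n ≠ 0) (h : ∀ n, D (n + 1) = ξ n + a n * D n)
    (n : ℕ) : D n / (∏ i ∈ Finset.range n, a i) - D 0 =
      ∑ j ∈ Finset.range n, ξ j / ∏ i ∈ Finset.range (j + 1), a i := by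
  induction n with
  | zero => simp
  | succ n ih =>
    rw [Finset.sum_range_succ, ← ih, h, Finset.prod_range_succ]
    have := ha n
    have : ∏ i ∈ Finset.range n, a i ≠ 0 := Finset.prod_ne_zero_iff.2 fun i _ => ha i
    field_simp
    ring

lemma exists_isOrbit {c : Par d} {y : ℂ} (h : ∀ j, (sphereMap c)^[j] y ∉ badSet c) :
    ∃ x : ℕ → ℂ, x 0 = y ∧ IsOrbit c x ∧ (∀ j, (wr c).eval (x j) ≠ 0) ∧
      ∀ j, (x (j + 1) : Sphere) ≠ sphereMap c ∞ := by
  have h1 : ∀ j, (sphereMap c)^[j] y ≠ ∞ := fun j hj => h j (Or.inr (by simp [hj]))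
  choose x hx using fun j => OnePoint.ne_infty_iff_exists.1 (h1 j)
  have ho : IsOrbit c x := fun j => by rw [hx, hx, Function.iterate_succ_apply']
  refine ⟨x, OnePoint.coe_injective (hx 0), ho, fun j hj => h j (Or.inl ⟨x j, hj, hx j⟩),
    fun j hj => h j (Or.inr ?_)⟩
  rw [mem_preimage, mem_singleton_iff, ← hj, ← hx, ho]

lemma df_ne_zero {c : Par d} {z : ℂ} (h : (wr c).eval z ≠ 0) (h' : (polyOf c.2).eval z ≠ 0) :
    df c z ≠ 0 := div_ne_zero h (pow_ne_zero _ h')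

/-- Small orbit ratios near `y` yield iterates close to the identity near `f^2(y)`. -/
lemma exists_ball_iterate_close {c : Par d} (hc : ND c) {ℱ : Filter ℕ} {x : ℕ → ℂ}
    (ho : IsOrbit c x) (hw : ∀ j, (wr c).eval (x j) ≠ 0) {ρ : ℝ} (hρ : 0 < ρ)
    (hfree : ∀ z ∈ ball (x 0) ρ,
      (sphereMap c)^[2] z ∉ closure (Function.periodicPts (sphereMap c)))
    (hsmall : ∀ ε > 0, ∀ᶠ n in ℱ, ∀ z ∈ ball (x 0) ρ, ‖orbitRatio c n (z, 1)‖ < ε) :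
    ∃ R > 0, ∀ ε > 0, ∀ᶠ n in ℱ, ∀ u ∈ ball (x 2) R,
      ((hlift c)^[n] (u, 1)).2 ≠ 0 ∧ ‖quot ((hlift c)^[n] (u, 1)) - u‖ < ε := by
  have hx2 := ho.quot_eq hc (Z := (x 0, 1)) (by simp) (k := 0) (by simp) 2
  rw [zero_add] at hx2
  have hcont := (differentiable_iter_one c 2).continuous
  obtain ⟨ρ', hρ', hball⟩ := Metric.nhds_basis_closedBall.eventually_iff.1
    (((continuous_snd.comp hcont).continuousAt.eventually_ne hx2.1).and (ball_mem_nhds (x 0) hρ))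
  have hstrict : HasStrictDerivAt (fun z : ℂ => quot ((hlift c)^[2] (z, 1)))
      (∏ i ∈ Finset.range 2, df c (x (0 + i))) (x 0) := by
    refine ContDiffAt.hasStrictDerivAt' (n := 1) ?_ (ho.hasDerivAt hc 0 2) one_ne_zero
    have h1 : ContDiff ℂ 1 fun z : ℂ => (hlift c)^[2] (z, (1 : ℂ)) := by
      have := ((contDiff_iter_right 2 c).of_le le_top).comp
        (by fun_prop : ContDiff ℂ 1 fun u : ℂ => (u, (1 : ℂ)))
      simpa only [Function.comp_def] using this
    exact h1.fst.contDiffAt.div h1.snd.contDiffAt hx2.1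
  have hmap := hstrict.map_nhds_eq (Finset.prod_ne_zero_iff.2 fun i _ =>
    df_ne_zero (hw _) (ho.eval_ne_zero _).1)
  rw [hx2.2] at hmap
  have him : (fun z : ℂ => quot ((hlift c)^[2] (z, 1))) '' closedBall (x 0) ρ' ∈ 𝓝 (x 2) := by
    rw [← hmap]; exact image_mem_map (closedBall_mem_nhds _ hρ')
  obtain ⟨R, hR, hRsub⟩ := Metric.mem_nhds_iff.1 him
  refine ⟨R, hR, fun ε hε => ?_⟩
  have hK : IsCompact ((fun z : ℂ => (c, (z, (1 : ℂ)))) '' closedBall (x 0) ρ') :=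
    (isCompact_closedBall _ _).image (by fun_prop)
  obtain ⟨δ, hδ, hclose⟩ := exists_quot_close hK (by
    rintro _ ⟨z, hz, rfl⟩
    refine ⟨hc, by simp, fun h => hfree z (hball hz).2 (subset_closure ?_), (hball hz).1⟩
    rwa [← iterate_sphereMap_prj hc _ (by simp), prj_one] at h) hε
  filter_upwards [hsmall δ hδ] with n hn u hu
  obtain ⟨z, hz, rfl⟩ := hRsub hu
  obtain ⟨h1, h2⟩ := hclose _ ⟨z, hz, rfl⟩ n (hn z (hball hz).2)
  have e : prj ((hlift c)^[n] (quot ((hlift c)^[2] (z, 1)), 1)) =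
      (quot ((hlift c)^[n + 2] (z, 1)) : Sphere) := by
    rw [← prj_eq_quot h1, ← iterate_sphereMap_prj hc _ (by simp), prj_one,
      ← prj_eq_quot (hball hz).1, iterate_sphereMap_prj hc _ (hc.iter_ne_zero _ (by simp)),
      Function.iterate_add_apply]
  obtain ⟨e1, e2⟩ := quot_eq_of_prj e
  exact ⟨e1, by simp only; rw [e2]; exact h2⟩

lemma tendsto_prod_df {c : Par d} (hc : ND c) {ℱ : Filter ℕ} {x : ℕ → ℂ} (ho : IsOrbit c x) {R : ℝ}
    (hR : 0 < R) (h : ∀ ε > 0, ∀ᶠ n in ℱ, ∀ u ∈ ball (x 0) R,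
      ((hlift c)^[n] (u, 1)).2 ≠ 0 ∧ ‖quot ((hlift c)^[n] (u, 1)) - u‖ < ε) :
    Tendsto (fun n => ∏ i ∈ Finset.range n, df c (x i)) ℱ (𝓝 1) := by
  rw [Metric.tendsto_nhds]
  intro ε hε
  filter_upwards [h (ε * (R / 2) / 2) (by positivity)] with n hn
  have hsub : closedBall (x 0) (R / 2) ⊆ ball (x 0) R := closedBall_subset_ball (by linarith)
  have hd : DifferentiableOn ℂ (fun u : ℂ => quot ((hlift c)^[n] (u, 1)) - u) (ball (x 0) R) :=
    fun u hu => ((differentiableAt_quot_comp (differentiable_iter_one c n u)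
      (hn u hu).1).sub differentiableAt_id).differentiableWithinAt
  have := Complex.norm_deriv_le_of_forall_mem_sphere_norm_le (c := x 0) (half_pos hR)
    ((hd.mono hsub).diffContOnCl_ball le_rfl) fun u hu =>
      (hn u (hsub (sphere_subset_closedBall hu))).2.le
  have hder := (ho.hasDerivAt hc 0 n).fun_sub (hasDerivAt_id' (x 0))
  simp only [zero_add] at hder
  rw [hder.deriv] at this
  rw [dist_eq_norm]
  refine this.trans_lt ?_
  rw [div_div, div_lt_iff₀ (by positivity)]
  nlinarith [mul_pos hε hR]

/-- The first variation of the orbit of `y` under a perturbation of the coefficients. -/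
lemma tendsto_variation {c v : Par d} {A C : ℂ → ℂ × ℂ}
    (hF : Frame (fun t : ℂ => c + t • v) A C) (hc : ND c) {ℱ : Filter ℕ} (hle : ℱ ≤ atTop)
    {x : ℕ → ℂ} (ho : IsOrbit c x)
    (hfree : (x 2 : Sphere) ∉ closure (Function.periodicPts (sphereMap c)))
    (hsmall : ∀ ε > 0, ∀ᶠ n in ℱ, ‖orbitRatio c n (x 0, 1)‖ < ε) :
    Tendsto (fun n => deriv (fun t : ℂ => quot ((hlift (c + t • v))^[n + 2] (x 0, 1))) 0 -
      deriv (fun t : ℂ => quot ((hlift (c + t • v))^[2] (x 0, 1))) 0) ℱ (𝓝 0) := by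
  have hγ : Differentiable ℂ fun t : ℂ => c + t • v := by fun_prop
  have hi : ∀ k, Differentiable ℂ fun t : ℂ => (hlift (c + t • v))^[k] (x 0, (1 : ℂ)) := fun k => by
    have := ((contDiff_iter k).differentiable (by simp)).comp
      (hγ.prodMk (differentiable_const ((x 0, 1) : ℂ × ℂ)))
    simpa only [Function.comp_def] using this
  have e0 : c + (0 : ℂ) • v = c := by simp
  have hx2 := ho.quot_eq hc (Z := (x 0, 1)) (by simp) (k := 0) (by simp) 2
  have hp2 : prj ((hlift c)^[2] (x 0, 1)) = x 2 := by rw [prj_eq_quot hx2.1, hx2.2]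
  have h1 : ∀ᶠ t : ℂ in 𝓝 0, ND (c + t • v) :=
    hγ.continuous.continuousAt.eventually (isOpen_nd.mem_nhds (by beta_reduce; rw [e0]; exact hc))
  have h2 : ∀ᶠ t : ℂ in 𝓝 0, ((hlift (c + t • v))^[2] (x 0, (1 : ℂ))).2 ≠ 0 :=
    (continuous_snd.comp (hi 2).continuous).continuousAt.eventually_ne
      (by simp only [Function.comp, e0]; exact hx2.1)
  have h3 : ∀ᶠ t : ℂ in 𝓝 0, prj ((hlift (c + t • v))^[2] (x 0, (1 : ℂ))) ∉
      Function.periodicPts (sphereMap (c + t • v)) := by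
    have hx : (x 2 : Sphere) ∉
      closure (Function.periodicPts (sphereMap (c + (0 : ℂ) • v))) := by rwa [e0]
    have k1 : ContinuousAt (fun t : ℂ => prj ((hlift (c + t • v))^[2] (x 0, (1 : ℂ)))) 0 :=
      ContinuousAt.comp (f := fun t : ℂ => (hlift (c + t • v))^[2] (x 0, (1 : ℂ)))
        (continuousAt_prj (by rw [e0]; exact hc.iter_ne_zero _ (by simp))) (hi 2).continuous.continuousAt
    have k2 := (continuousAt_id (x := (0 : ℂ))).prodMk k1
    rw [ContinuousAt] at k2
    simp only [e0, hp2, id] at k2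
    exact k2.eventually (hF.eventually_notMem_periodicPts hx)
  obtain ⟨r, hr, hb⟩ := Metric.eventually_nhds_iff_ball.1 (h1.and (h2.and h3))
  rw [Metric.tendsto_nhds]
  intro ε hε
  have hK : IsCompact ((fun t : ℂ => (c + t • v, (x 0, (1 : ℂ)))) '' closedBall 0 (r / 2)) :=
    (isCompact_closedBall _ _).image (by fun_prop)
  have hsub : closedBall (0 : ℂ) (r / 2) ⊆ ball 0 r := closedBall_subset_ball (by linarith)
  obtain ⟨δ, hδ, hclose⟩ := exists_quot_close hK (ε := ε * (r / 2) / 2) (by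
    rintro _ ⟨t, ht, rfl⟩
    obtain ⟨k1, k2, k3⟩ := hb t (hsub ht)
    exact ⟨k1, by simp, k3, k2⟩) (by positivity)
  obtain ⟨δ', hδ', hsch⟩ := schottky_small (R := r) (r / 2) δ (by linarith) hδ
  filter_upwards [hsmall δ' hδ', hle (eventually_ge_atTop 1)] with n hn hn1
  have hcl : ∀ t ∈ closedBall (0 : ℂ) (r / 2), _ := fun t ht => hclose _ ⟨t, ht, rfl⟩ n <|
    hsch 0 (fun t => orbitRatio (c + t • v) n (x 0, 1))
    (differentiableOn_orbitRatio (Z := fun _ => (x 0, 1)) hγ (by fun_prop)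
      (fun t ht => ⟨(hb t ht).1, by simp, (hb t ht).2.2⟩) n)
    (fun t ht => orbitRatio_ne (hb t ht).1 (by simp) (hb t ht).2.2 hn1) 0 (by simp; linarith) t ht
    (by simp only [e0]; exact hn)
  have hm : (0 : ℂ) ∈ closedBall (0 : ℂ) (r / 2) := by simp; linarith
  have hq : ∀ t ∈ closedBall (0 : ℂ) (r / 2),
      DifferentiableAt ℂ (fun t : ℂ => quot ((hlift (c + t • v))^[n + 2] (x 0, 1))) t ∧
      DifferentiableAt ℂ (fun t : ℂ => quot ((hlift (c + t • v))^[2] (x 0, 1))) t := fun t ht =>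
    ⟨differentiableAt_quot_comp (hi _ t) (hcl t ht).1,
      differentiableAt_quot_comp (hi _ t) (hb t (hsub ht)).2.1⟩
  have hdiff : DifferentiableOn ℂ (fun t : ℂ => quot ((hlift (c + t • v))^[n + 2] (x 0, 1)) -
      quot ((hlift (c + t • v))^[2] (x 0, 1))) (closedBall 0 (r / 2)) := fun t ht =>
    ((hq t ht).1.sub (hq t ht).2).differentiableWithinAt
  have := Complex.norm_deriv_le_of_forall_mem_sphere_norm_le (c := (0 : ℂ)) (half_pos hr)
    (hdiff.diffContOnCl_ball le_rfl) fun t ht => (hcl t (sphere_subset_closedBall ht)).2.le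
  rw [deriv_fun_sub (hq 0 hm).1 (hq 0 hm).2] at this
  rw [dist_zero_right]
  refine this.trans_lt ?_
  rw [div_div, div_lt_iff₀ (by positivity)]
  nlinarith [mul_pos hε hr]

/-- Every polynomial of degree at most `2 d` is an infinitesimal variation of the map. -/
lemma exists_variation (hd : 2 ≤ d) {c : Par d} (hc : ND c) {N : ℂ[X]} (hN : N.natDegree ≤ 2 * d) :
    ∃ v : Par d, polyOf v.1 * polyOf c.2 - polyOf c.1 * polyOf v.2 = N := by
  have hsurj : ∀ P : ℂ[X], P.natDegree ≤ d → ∃ a : Fin (d + 1) → ℂ, polyOf a = P := by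
    intro P hP
    refine ⟨fun i => P.coeff i, ?_⟩
    rw [polyOf]
    conv_rhs => rw [P.as_sum_range_C_mul_X_pow' (Nat.lt_succ_of_le hP)]
    exact Fin.sum_univ_eq_sum_range (fun i => C (P.coeff i) * X ^ i) (d + 1)
  obtain ⟨hcop, hmax⟩ := (nd_iff hd c).1 hc
  have key : ∀ P Q : ℂ[X], IsCoprime P Q → P.natDegree ≤ d → Q.natDegree = d →
      ∃ a b : ℂ[X], a.natDegree ≤ d ∧ b.natDegree ≤ d ∧ a * Q + b * P = N := by
    intro P Q hPQ hP hQ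
    have hQ0 : Q ≠ 0 := by rintro rfl; simp at hQ; lia
    obtain ⟨u, w, huw⟩ := hPQ
    have hb : (N * u % Q).natDegree < d := by
      rw [← hQ]; exact natDegree_mod_lt _ (by lia)
    have e : (N * w + N * u / Q * P) * Q + N * u % Q * P = N := by
      have := EuclideanDomain.div_add_mod (N * u) Q
      linear_combination N * huw + P * this
    refine ⟨N * w + N * u / Q * P, N * u % Q, ?_, hb.le, e⟩
    by_contra! hlt
    have h1 : ((N * w + N * u / Q * P) * Q).natDegree ≤ 2 * d := by
      rw [eq_sub_of_add_eq e]
      refine (natDegree_sub_le _ _).trans (max_le hN (natDegree_mul_le.trans (by lia)))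
    rw [natDegree_mul (by rintro h; simp [h] at hlt) hQ0] at h1
    lia
  rcases max_choice (polyOf c.1).natDegree (polyOf c.2).natDegree with h | h <;> rw [hmax] at h
  · obtain ⟨a, b, ha, hb, e⟩ := key (polyOf c.2) (polyOf c.1) hcop.symm (polyOf_natDegree_le _) h.symm
    obtain ⟨a', ha'⟩ := hsurj (-a) (by simpa)
    obtain ⟨b', hb'⟩ := hsurj b hb
    exact ⟨(b', a'), by rw [ha', hb', ← e]; ring⟩
  · obtain ⟨a, b, ha, hb, e⟩ := key (polyOf c.1) (polyOf c.2) hcop (polyOf_natDegree_le _) h.symm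
    obtain ⟨a', ha'⟩ := hsurj a (by simpa)
    obtain ⟨b', hb'⟩ := hsurj (-b) (by simpa)
    exact ⟨(a', b'), by rw [ha', hb', ← e]; ring⟩

/-- The inverse of the derivative of the `j`-th iterate along an orbit. -/
def invMul (c : Par d) (x : ℕ → ℂ) (j : ℕ) : ℂ := (∏ i ∈ Finset.range j, df c (x i))⁻¹

/-- The sum of the values of a vector field along an orbit, pulled back to the initial point. -/
def pullSum (c : Par d) (x : ℕ → ℂ) (n : ℕ) (φ : ℂ → ℂ) : ℂ :=
  ∑ j ∈ Finset.range n, invMul c x j * φ (x j)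

/-- An orbit near which the iterates converge to the identity along a filter, stably under
perturbations of the map. -/
structure Recurrent (c : Par d) (ℱ : Filter ℕ) (x : ℕ → ℂ) (R : ℝ) : Prop where
  neBot : ℱ.NeBot
  le_atTop : ℱ ≤ atTop
  nd : ND c
  orbit : IsOrbit c x
  wr_ne : ∀ j, (wr c).eval (x j) ≠ 0
  ne_infty : ∀ j, (x (j + 1) : Sphere) ≠ sphereMap c ∞
  notMem : (x 0 : Sphere) ∉ Function.periodicPts (sphereMap c)
  pos : 0 < R
  close : ∀ ε > 0, ∀ᶠ n in ℱ, ∀ u ∈ ball (x 0) R,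
    ((hlift c)^[n] (u, 1)).2 ≠ 0 ∧ ‖quot ((hlift c)^[n] (u, 1)) - u‖ < ε
  variation : ∀ N : ℂ[X], N.natDegree ≤ 2 * d →
    Tendsto (fun n => pullSum c x n fun y => N.eval y / (wr c).eval y) ℱ (𝓝 0)

lemma IsOrbit.shift {c : Par d} {x : ℕ → ℂ} (h : IsOrbit c x) (k : ℕ) :
    IsOrbit c fun j => x (k + j) := fun j => h (k + j)

lemma tendsto_pullSum_of_variation {c v : Par d} (hc : ND c) {ℱ : Filter ℕ} {x : ℕ → ℂ}
    (ho : IsOrbit c x) (hw : ∀ j, (wr c).eval (x j) ≠ 0)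
    (hm : Tendsto (fun n => ∏ i ∈ Finset.range n, df c (x (2 + i))) ℱ (𝓝 1))
    (hv : Tendsto (fun n => deriv (fun t : ℂ => quot ((hlift (c + t • v))^[n + 2] (x 0, 1))) 0 -
      deriv (fun t : ℂ => quot ((hlift (c + t • v))^[2] (x 0, 1))) 0) ℱ (𝓝 0)) :
    Tendsto (fun n => pullSum c (fun j => x (2 + j)) n fun y =>
      (polyOf v.1 * polyOf c.2 - polyOf c.1 * polyOf v.2).eval y / (wr c).eval y) ℱ (𝓝 0) := by
  have e0 : c + (0 : ℂ) • v = c := by simp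
  have hi : ∀ k, Differentiable ℂ fun t : ℂ => (hlift (c + t • v))^[k] (x 0, (1 : ℂ)) := fun k => by
    have := ((contDiff_iter k).differentiable (by simp)).comp
      ((by fun_prop : Differentiable ℂ fun t : ℂ => c + t • v).prodMk
        (differentiable_const ((x 0, 1) : ℂ × ℂ)))
    simpa only [Function.comp_def] using this
  have hx := fun n => ho.quot_eq hc (Z := (x 0, 1)) (by simp) (k := 0) (by simp) (n + 2)
  set D : ℕ → ℂ := fun n => deriv (fun t : ℂ => quot ((hlift (c + t • v))^[n + 2] (x 0, 1))) 0
    with hD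
  set ξ : ℕ → ℂ := fun n => (polyOf v.1 * polyOf c.2 - polyOf c.1 * polyOf v.2).eval (x (2 + n)) /
    ((polyOf c.2).eval (x (2 + n))) ^ 2 with hξ
  have hne : ∀ n, df c (x (2 + n)) ≠ 0 := fun n => df_ne_zero (hw _) (ho.eval_ne_zero _).1
  have hrec : ∀ n, D (n + 1) = ξ n + df c (x (2 + n)) * D n := by
    intro n
    have h1 : DifferentiableAt ℂ (fun t : ℂ => quot ((hlift (c + t • v))^[n + 2] (x 0, 1))) 0 :=
      differentiableAt_quot_comp (hi _ 0) (by rw [e0]; exact (hx n).1)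
    have h2 : quot ((hlift (c + (0 : ℂ) • v))^[n + 2] (x 0, 1)) = x (2 + n) := by
      rw [e0, (hx n).2]; congr 1; ring
    have := hasDerivAt_quot_hlift (c := c) (v := v)
      (Z := fun t => (hlift (c + t • v))^[n + 2] (x 0, 1)) (hi _ 0).continuousAt
      (by rw [e0]; exact (hx n).1) h1.hasDerivAt
      (by rw [h2, e0]; exact (ho.eval_ne_zero _).1)
    rw [h2, e0] at this
    simp only [hD, show n + 1 + 2 = (n + 2) + 1 by ring]
    simp only [Function.iterate_succ_apply' _ (n + 2)]
    rw [this.deriv]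
    simp [hξ]
  have hsum := affine_recursion hne hrec
  have key : ∀ n, (pullSum c (fun j => x (2 + j)) n fun y =>
      (polyOf v.1 * polyOf c.2 - polyOf c.1 * polyOf v.2).eval y / (wr c).eval y) =
      D n / (∏ i ∈ Finset.range n, df c (x (2 + i))) - D 0 := by
    intro n
    rw [hsum, pullSum]
    refine Finset.sum_congr rfl fun j _ => ?_
    rw [Finset.prod_range_succ, invMul, hξ]
    have h1 := hw (2 + j)
    have h2 := (ho.eval_ne_zero (2 + j)).1
    have h3 : ∏ i ∈ Finset.range j, df c (x (2 + i)) ≠ 0 :=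
      Finset.prod_ne_zero_iff.2 fun i _ => hne i
    simp only [df] at h3 ⊢
    field_simp
  have hDt : Tendsto D ℱ (𝓝 (D 0)) := by
    have h := hv.add_const (D 0)
    rw [zero_add] at h
    exact h.congr fun n => sub_add_cancel (D n) (D 0)
  have := (hDt.div hm one_ne_zero).sub_const (D 0)
  rw [div_one, sub_self] at this
  exact this.congr fun n => (key n).symm

lemma pullSum_smul (c : Par d) (x : ℕ → ℂ) (n : ℕ) (a : ℂ) (φ : ℂ → ℂ) :
    pullSum c x n (fun y => a * φ y) = a * pullSum c x n φ := by
  simp only [pullSum, Finset.mul_sum]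
  exact Finset.sum_congr rfl fun j _ => by ring

theorem exists_recurrent (hd : 2 ≤ d) {V : Set (Par d)} (hV : IsOpen V)
    (h : ∀ c ∈ V, ND c ∧ ∀ n, 1 ≤ n → NP n c) {c : Par d} (hcV : c ∈ V) (hwr : wr c ≠ 0)
    {x₀ : Sphere} (hx : x₀ ∈ nonWandering (sphereMap c))
    (hper : x₀ ∉ closure (Function.periodicPts (sphereMap c))) :
    ∃ ℱ x R, Recurrent c ℱ x R := by
  have hc := (h c hcV).1
  obtain ⟨ℱ, h1, h2, y, ρ, hρ, hgen, hfree, hsmall⟩ :=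
    exists_generic_recurrence (by lia) hc hwr hx hper
  obtain ⟨x, rfl, ho, hw, hinf⟩ := exists_isOrbit hgen
  obtain ⟨R, hR, hclose⟩ := exists_ball_iterate_close hc ho hw hρ hfree hsmall
  have hx2 : (x 2 : Sphere) ∉ closure (Function.periodicPts (sphereMap c)) := by
    have := hfree (x 0) (mem_ball_self hρ)
    rwa [ho.iterate] at this
  have hm := tendsto_prod_df hc (ho.shift 2) hR hclose
  obtain ⟨ε, hε, hframe⟩ := exists_frame hd hV h hcV
  refine ⟨ℱ, fun j => x (2 + j), R, h1, h2, hc, ho.shift 2, fun j => hw _, fun j => hinf (2 + j),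
    fun h => hx2 (subset_closure h), hR, hclose, fun N hN => ?_⟩
  obtain ⟨v, rfl⟩ := exists_variation hd hc hN
  obtain ⟨a, ha, hav⟩ : ∃ a : ℂ, a ≠ 0 ∧ ‖a • v‖ < ε := by
    have : ∀ᶠ a : ℂ in 𝓝[≠] 0, ‖a • v‖ < ε := nhdsWithin_le_nhds
      ((by fun_prop : Continuous fun a : ℂ => ‖a • v‖).continuousAt.eventually
        (Iio_mem_nhds (by simpa using hε)))
    obtain ⟨a, h, ha⟩ := (this.and self_mem_nhdsWithin).exists
    exact ⟨a, ha, h⟩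
  obtain ⟨A, C', hF⟩ := hframe _ hav
  have key := tendsto_pullSum_of_variation hc ho hw hm (tendsto_variation hF hc h2 ho hx2
    fun ε hε => (hsmall ε hε).mono fun n hn => hn _ (mem_ball_self hρ))
  have hpol : ∀ b : Fin (d + 1) → ℂ, polyOf (a • b) = C a * polyOf b := fun b =>
    Polynomial.funext fun z => by simpa [polyOf_eval] using polyOf_add_smul 0 b a z
  have := key.const_mul a⁻¹
  rw [mul_zero] at this
  refine this.congr fun n => ?_
  rw [← pullSum_smul]
  congr 1
  funext y
  simp only [Prod.smul_fst, Prod.smul_snd, hpol, eval_sub, eval_mul, eval_C]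
  field_simp

/-- The rational map `p / q` in the affine coordinate. -/
def fa (c : Par d) (z : ℂ) : ℂ := (polyOf c.1).eval z / (polyOf c.2).eval z

lemma sphereMap_coe {c : Par d} {z : ℂ} (h : (polyOf c.2).eval z ≠ 0) :
    sphereMap c z = (fa c z : Sphere) := by
  rw [sphereMap, ratEval, if_neg (OnePoint.coe_ne_infty _), toC_coe, if_neg h, fa]

lemma sphereMap_coe_eq_infty {c : Par d} {z : ℂ} (h : (polyOf c.2).eval z = 0) :
    sphereMap c z = ∞ := by
  rw [sphereMap, ratEval, if_neg (OnePoint.coe_ne_infty _), toC_coe, if_pos h]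

lemma hasDerivAt_fa {c : Par d} {z : ℂ} (h : (polyOf c.2).eval z ≠ 0) :
    HasDerivAt (fa c) (df c z) z := by
  refine (((polyOf c.1).hasDerivAt z).fun_div ((polyOf c.2).hasDerivAt z) h).congr_deriv ?_
  simp [df, wr]

lemma hasStrictDerivAt_fa {c : Par d} {z : ℂ} (h : (polyOf c.2).eval z ≠ 0) :
    HasStrictDerivAt (fa c) (df c z) z := by
  refine (((polyOf c.1).hasStrictDerivAt z).fun_div ((polyOf c.2).hasStrictDerivAt z) h).congr_deriv ?_
  simp [df, wr]

namespace Recurrent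

variable {c : Par d} {ℱ : Filter ℕ} {x : ℕ → ℂ} {R : ℝ}

/-- The union of the forward images of a disc of recurrence. -/
def spread (c : Par d) (x : ℕ → ℂ) (R : ℝ) : Set Sphere :=
  ⋃ j : ℕ, (fun z : ℂ => (sphereMap c)^[j] z) '' closedBall (x 0) (R / 2)

lemma spread_forward {z : Sphere} (h : z ∈ spread c x R) : sphereMap c z ∈ spread c x R := by
  obtain ⟨j, u, hu, rfl⟩ := mem_iUnion.1 h
  exact mem_iUnion.2 ⟨j + 1, u, hu, Function.iterate_succ_apply' _ _ _⟩

lemma spread_forward_iterate {z : Sphere} (h : z ∈ spread c x R) (n : ℕ) :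
    (sphereMap c)^[n] z ∈ spread c x R := by
  induction n with
  | zero => exact h
  | succ n ih => rw [Function.iterate_succ_apply']; exact spread_forward ih

lemma coe_mem_spread {u : ℂ} (hu : u ∈ closedBall (x 0) (R / 2)) : (u : Sphere) ∈ spread c x R :=
  mem_iUnion.2 ⟨0, u, hu, rfl⟩

lemma orbit_mem_spread (h : Recurrent c ℱ x R) (j : ℕ) : (x j : Sphere) ∈ spread c x R := by
  have := spread_forward_iterate (coe_mem_spread (c := c) (mem_closedBall_self (x := x 0)
    (half_pos h.pos).le)) j
  rwa [h.orbit.iterate, zero_add] at this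

lemma subset_ball (h : Recurrent c ℱ x R) : closedBall (x 0) (R / 2) ⊆ ball (x 0) R :=
  closedBall_subset_ball (by linarith [h.pos])

lemma tendsto_iterate (h : Recurrent c ℱ x R) {z : Sphere} (hz : z ∈ spread c x R) :
    Tendsto (fun n => (sphereMap c)^[n] z) ℱ (𝓝 z) := by
  obtain ⟨j, u, hu, rfl⟩ := mem_iUnion.1 hz
  have h1 : Tendsto (fun n => quot ((hlift c)^[n] (u, 1))) ℱ (𝓝 u) := by
    rw [Metric.tendsto_nhds]
    intro ε hε
    filter_upwards [h.close ε hε] with n hn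
    rw [dist_eq_norm]
    exact (hn u (h.subset_ball hu)).2
  have h2 := ((h.nd.continuous_iterate j).tendsto (u : Sphere)).comp
    ((OnePoint.continuous_coe.tendsto u).comp h1)
  refine h2.congr' ?_
  filter_upwards [h.close 1 one_pos] with n hn
  simp only [Function.comp]
  rw [← Function.iterate_add_apply, add_comm, Function.iterate_add_apply,
    ← prj_eq_quot (hn u (h.subset_ball hu)).1, ← prj_one,
    ← iterate_sphereMap_prj h.nd _ (by simp)]

lemma injOn_iterate (h : Recurrent c ℱ x R) (j : ℕ) :
    InjOn (sphereMap c)^[j] (spread c x R) := by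
  intro z hz w hw hzw
  have := h.neBot
  refine tendsto_nhds_unique (h.tendsto_iterate hz) ((h.tendsto_iterate hw).congr' ?_)
  filter_upwards [h.le_atTop (eventually_ge_atTop j)] with n hn
  rw [show n = (n - j) + j by lia, Function.iterate_add_apply, ← hzw, Function.iterate_add_apply]

lemma measurableSet_preimage_spread (h : Recurrent c ℱ x R) (k : ℕ) :
    MeasurableSet {z : ℂ | (sphereMap c)^[k] z ∈ spread c x R} := by
  simp only [spread, mem_iUnion]
  rw [Set.ofPred_exists]
  refine MeasurableSet.iUnion fun j => IsClosed.measurableSet ?_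
  refine IsClosed.preimage ((h.nd.continuous_iterate k).comp OnePoint.continuous_coe)
    (IsCompact.isClosed ?_)
  exact (isCompact_closedBall _ _).image
    ((h.nd.continuous_iterate j).comp OnePoint.continuous_coe)

lemma orbit_zero_ne (h : Recurrent c ℱ x R) {n : ℕ} (hn : 1 ≤ n) : x n ≠ x 0 := by
  intro e
  refine h.notMem ⟨n, hn, ?_⟩
  rw [Function.IsPeriodicPt, Function.IsFixedPt, h.orbit.iterate, zero_add, e]

/-- Some nonempty open set lies outside of the spread but is mapped into it. -/
lemma exists_open_preimage (hd : 2 ≤ d) (h : Recurrent c ℱ x R) :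
    ∃ W : Set ℂ, IsOpen W ∧ W.Nonempty ∧ ∀ z ∈ W, (z : Sphere) ∉ spread c x R ∧
      sphereMap c z ∈ spread c x R := by
  have hq := h.orbit.eval_ne_zero 0
  have hfx : fa c (x 0) = x 1 := hq.2.symm
  set P := fibre c (x 1, 1) with hP
  have hPe : ∀ z, P.eval z = 0 ↔ sphereMap c z = (x 1 : Sphere) := fun z => by
    rw [hP, ← sphereMap_coe_eq_iff h.nd (by simp), prj_one]
  have hdeg : P.coeff d ≠ 0 := fun h0 => by
    have := (sphereMap_infty_eq_iff h.nd (by simp)).2 h0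
    rw [prj_one] at this
    exact h.ne_infty 0 this.symm
  have hroot : P.eval (x 0) = 0 := (hPe _).2 (h.orbit 0)
  have hsimple : (derivative P).eval (x 0) ≠ 0 := by
    have e : (derivative P).eval (x 0) * (polyOf c.2).eval (x 0) = (wr c).eval (x 0) := by
      have h1 := hq.2
      rw [eq_div_iff hq.1] at h1
      simp only [hP, fibre, wr, map_one, one_mul, derivative_sub, derivative_mul, derivative_C,
        zero_mul, zero_add, eval_sub, eval_mul, eval_C]
      linear_combination (-(derivative (polyOf c.2)).eval (x 0)) * h1
    exact left_ne_zero_of_mul (e ▸ h.wr_ne 0)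
  obtain ⟨G, hG⟩ := dvd_iff_isRoot.2 hroot
  have hG0 : G.eval (x 0) ≠ 0 := by
    intro h0; apply hsimple; rw [hG]; simp [h0]
  obtain ⟨p, hp⟩ : ∃ p, G.eval p = 0 := by
    refine IsAlgClosed.exists_root G fun h0 => ?_
    have h1 := le_natDegree_of_ne_zero hdeg
    have h2 : P.natDegree ≤ 1 + 0 := by
      rw [hG]
      exact natDegree_mul_le_of_le (natDegree_X_sub_C_le _) (natDegree_le_iff_degree_le.2 h0.le)
    lia
  have hpx : p ≠ x 0 := by rintro rfl; exact hG0 hp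
  have hfp : sphereMap c p = (x 1 : Sphere) := (hPe p).1 (by rw [hG]; simp [hp])
  have hqp : (polyOf c.2).eval p ≠ 0 := fun h0 => by
    rw [sphereMap_coe_eq_infty h0] at hfp
    exact OnePoint.coe_ne_infty _ hfp.symm
  have hfap : fa c p = x 1 := OnePoint.coe_injective (by rw [← sphereMap_coe hqp, hfp])
  obtain ⟨U₁, U₂, hU₁, hU₂, hx1, hp2, hdisj⟩ := t2_separation hpx.symm
  have hmap := (hasStrictDerivAt_fa hq.1).map_nhds_eq (df_ne_zero (h.wr_ne 0) hq.1)
  have hqx : ∀ᶠ z in 𝓝 (x 0), (polyOf c.2).eval z ≠ 0 :=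
    (polyOf c.2).continuous.continuousAt.eventually_ne hq.1
  have hT : U₁ ∩ closedBall (x 0) (R / 2) ∩ {z | (polyOf c.2).eval z ≠ 0} ∈ 𝓝 (x 0) :=
    inter_mem (inter_mem (hU₁.mem_nhds hx1) (closedBall_mem_nhds _ (half_pos h.pos))) hqx
  have hN : U₂ ∩ {z | (polyOf c.2).eval z ≠ 0} ∩ fa c ⁻¹' (fa c '' (U₁ ∩ closedBall (x 0) (R / 2) ∩
      {z | (polyOf c.2).eval z ≠ 0})) ∈ 𝓝 p := by
    refine inter_mem (inter_mem (hU₂.mem_nhds hp2)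
      ((polyOf c.2).continuous.continuousAt.eventually_ne hqp)) ?_
    refine (hasDerivAt_fa hqp).continuousAt.preimage_mem_nhds ?_
    rw [hfap, ← hfx, ← hmap]
    exact image_mem_map hT
  obtain ⟨W, hWN, hW, hpW⟩ := _root_.mem_nhds_iff.1 hN
  refine ⟨W, hW, ⟨p, hpW⟩, fun z hz => ?_⟩
  obtain ⟨⟨hz2, hzq⟩, u, ⟨⟨hu1, huR⟩, huq⟩, hzu⟩ := hWN hz
  have e : sphereMap c u = sphereMap c z := by rw [sphereMap_coe hzq, sphereMap_coe huq, hzu]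
  have huO := coe_mem_spread (c := c) huR
  refine ⟨fun hzO => ?_, e ▸ spread_forward huO⟩
  have := OnePoint.coe_injective (h.injOn_iterate 1 huO hzO e)
  exact hdisj.le_bot ⟨hu1, this ▸ hz2⟩

end Recurrent

/-- All roots of the polynomial are simple. -/
def SimpleRoots (D : ℂ[X]) : Prop := ∀ a, D.eval a = 0 → (derivative D).eval a ≠ 0

namespace SimpleRoots

lemma ne_zero {D : ℂ[X]} (h : SimpleRoots D) : D ≠ 0 := by
  rintro rfl
  exact h 0 (by simp) (by simp)

lemma X_sub_C (y : ℂ) : SimpleRoots (X - C y) := fun a _ => by simp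

lemma mul {A B : ℂ[X]} (hA : SimpleRoots A) (hB : SimpleRoots B)
    (hAB : ∀ a, A.eval a = 0 → B.eval a ≠ 0) : SimpleRoots (A * B) := by
  intro a ha
  rw [derivative_mul, eval_add, eval_mul, eval_mul]
  by_cases h : A.eval a = 0
  · rw [h, zero_mul, add_zero]
    exact mul_ne_zero (hA a h) (hAB a h)
  · have h' : B.eval a = 0 := by simpa [h] using ha
    rw [h', mul_zero, zero_add]
    exact mul_ne_zero h (hB a h')

lemma nodup_roots {D : ℂ[X]} (h : SimpleRoots D) : D.roots.Nodup := by
  rw [Multiset.nodup_iff_count_le_one]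
  intro a
  rw [count_roots]
  by_contra! hlt
  have := (one_lt_rootMultiplicity_iff_isRoot h.ne_zero).1 hlt
  exact h a this.1 this.2

lemma card_roots {D : ℂ[X]} (h : SimpleRoots D) : D.roots.toFinset.card = D.natDegree := by
  rw [Multiset.toFinset_card_of_nodup h.nodup_roots, IsAlgClosed.card_roots_eq_natDegree]

lemma eq_nodal {D : ℂ[X]} (h : SimpleRoots D) :
    D = C D.leadingCoeff * Lagrange.nodal D.roots.toFinset id := by
  conv_lhs => rw [(IsAlgClosed.splits D).eq_prod_roots]
  rw [Lagrange.nodal_eq, Finset.prod, Multiset.toFinset_val, h.nodup_roots.dedup]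
  rfl

lemma eval_derivative {D : ℂ[X]} (h : SimpleRoots D) {a : ℂ} (ha : a ∈ D.roots.toFinset) :
    (derivative D).eval a = D.leadingCoeff * ∏ b ∈ D.roots.toFinset.erase a, (a - b) := by
  conv_lhs => rw [h.eq_nodal]
  rw [derivative_C_mul, eval_mul, eval_C]
  congr 1
  have := Lagrange.eval_nodal_derivative_eval_node_eq (v := id) ha
  rw [id, Lagrange.eval_nodal] at this
  exact this

/-- The sum of the residues of a rational function with simple poles that is `O(z⁻²)`. -/
lemma sum_residues {D N : ℂ[X]} (h : SimpleRoots D) (hN : N.natDegree + 2 ≤ D.natDegree) :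
    ∑ a ∈ D.roots.toFinset, N.eval a / (derivative D).eval a = 0 := by
  have hcard := h.card_roots
  have hdeg : N.degree < D.roots.toFinset.card := by
    rw [hcard]
    exact degree_le_natDegree.trans_lt (by exact_mod_cast (by lia))
  have key := Lagrange.coeff_eq_sum (v := id) (Function.injective_id.injOn) hdeg
  rw [coeff_eq_zero_of_natDegree_lt (by rw [hcard]; lia)] at key
  calc _ = ∑ a ∈ D.roots.toFinset, D.leadingCoeff⁻¹ *
        (N.eval (id a) / ∏ b ∈ D.roots.toFinset.erase a, (id a - id b)) := by
        refine Finset.sum_congr rfl fun a ha => ?_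
        rw [h.eval_derivative ha]
        simp only [id, div_eq_mul_inv, mul_inv]
        ring
    _ = 0 := by rw [← Finset.mul_sum, ← key, mul_zero]

lemma sum_residues_mul {A B : ℂ[X]} (hA : SimpleRoots A) (hB : SimpleRoots B)
    (hAB : ∀ a, A.eval a = 0 → B.eval a ≠ 0) (N : ℂ → ℂ) :
    ∑ a ∈ (A * B).roots.toFinset, N a / (derivative (A * B)).eval a =
      ∑ a ∈ A.roots.toFinset, N a / ((derivative A).eval a * B.eval a) +
      ∑ a ∈ B.roots.toFinset, N a / ((derivative B).eval a * A.eval a) := by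
  rw [roots_mul (mul_ne_zero hA.ne_zero hB.ne_zero), Multiset.toFinset_add, Finset.sum_union]
  · congr 1 <;> refine Finset.sum_congr rfl fun a ha => ?_
    · have : A.eval a = 0 := (mem_roots'.1 (Multiset.mem_toFinset.1 ha)).2
      simp [this]
    · have : B.eval a = 0 := (mem_roots'.1 (Multiset.mem_toFinset.1 ha)).2
      simp [this, mul_comm]
  · rw [Finset.disjoint_left]
    intro a ha hb
    exact hAB a (mem_roots'.1 (Multiset.mem_toFinset.1 ha)).2
      (mem_roots'.1 (Multiset.mem_toFinset.1 hb)).2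

end SimpleRoots

/-- The monic cubic polynomial with prescribed roots. -/
def cubic (b : Fin 3 → ℂ) : ℂ[X] := ∏ i, (X - C (b i))

/-- A kernel whose poles are `y` and the roots of a cubic, with residue `1` at `y`. -/
def cauchyKer (b : Fin 3 → ℂ) (y ζ : ℂ) : ℂ := (cubic b).eval y / ((ζ - y) * (cubic b).eval ζ)

/-- The push-forward of a quadratic differential. -/
def pushF (c : Par d) (V : ℂ → ℂ) (ζ : ℂ) : ℂ :=
  ∑ w ∈ (fibre c (ζ, 1)).roots.toFinset, V w / df c w ^ 2

lemma eval_cubic (b : Fin 3 → ℂ) (z : ℂ) : (cubic b).eval z = ∏ i, (z - b i) := by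
  simp [cubic, eval_prod]

lemma natDegree_cubic (b : Fin 3 → ℂ) : (cubic b).natDegree = 3 := by
  rw [cubic, natDegree_prod_of_monic _ _ fun i _ => monic_X_sub_C _]
  simp

lemma eval_fibre_one (c : Par d) (ζ z : ℂ) :
    (fibre c (ζ, 1)).eval z = (polyOf c.1).eval z - ζ * (polyOf c.2).eval z := by
  simp [fibre]

lemma ND.eval_ne_zero {c : Par d} (hc : ND c) {ζ z : ℂ} (h : (fibre c (ζ, 1)).eval z = 0) :
    (polyOf c.2).eval z ≠ 0 := by
  intro h0
  rw [eval_fibre_one, h0, mul_zero, sub_zero] at h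
  refine hc (z, 1) (by simp) ?_
  simp [hlift, hom_one, h, h0]

lemma fa_eq_iff {c : Par d} {ζ z : ℂ} (h : (polyOf c.2).eval z ≠ 0) :
    fa c z = ζ ↔ (fibre c (ζ, 1)).eval z = 0 := by
  rw [eval_fibre_one, fa, div_eq_iff h, sub_eq_zero]

lemma eval_derivative_fibre {c : Par d} {z : ℂ} (h : (polyOf c.2).eval z ≠ 0) :
    (derivative (fibre c (fa c z, 1))).eval z = (wr c).eval z / (polyOf c.2).eval z := by
  simp [fibre, wr, fa]
  field_simp

lemma Gen.wr_ne_zero (hd : 2 ≤ d) {c : Par d} (hg : Gen c) : wr c ≠ 0 := by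
  intro h
  have := hg.1
  rw [h, natDegree_zero] at this
  lia

set_option maxHeartbeats 1000000 in
lemma sum_residues_push (hd : 2 ≤ d) {c : Par d} (hc : ND c) (hg : Gen c) {b : Fin 3 → ℂ}
    (hG : SimpleRoots (wr c * cubic b)) {y ζ : ℂ} (hy : (wr c * cubic b).eval y ≠ 0)
    (hinf : sphereMap c ∞ ≠ ζ) (hζy : (fibre c (ζ, 1)).eval y ≠ 0)
    (hζ : ∀ a, (wr c * cubic b).eval a = 0 → (fibre c (ζ, 1)).eval a ≠ 0)  :
    ∑ w ∈ (fibre c (ζ, 1)).roots.toFinset, (∏ i, (fibre c (b i, 1)).eval w) * (cubic b).eval y /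
        ((wr c).eval w / (polyOf c.2).eval w * ((w - y) * (wr c * cubic b).eval w)) +
      ((∏ i, (fibre c (b i, 1)).eval y) / ((fibre c (ζ, 1)).eval y * (wr c).eval y) +
      ∑ a ∈ (wr c * cubic b).roots.toFinset, (∏ i, (fibre c (b i, 1)).eval a) /
        ((derivative (wr c * cubic b)).eval a * (fibre c (ζ, 1)).eval a) *
          ((cubic b).eval y / (a - y))) = 0 := by
  have hζ' : ∀ w, (fibre c (ζ, 1)).eval w = 0 → (wr c * cubic b).eval w ≠ 0 := fun w hw h0 => hζ w h0 hw
  have hder : ∀ w, (fibre c (ζ, 1)).eval w = 0 → (derivative (fibre c (ζ, 1))).eval w =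
      (wr c).eval w / (polyOf c.2).eval w := by
    intro w hw
    have hq := hc.eval_ne_zero hw
    rw [← eval_derivative_fibre hq, (fa_eq_iff hq).2 hw]
  have hP : SimpleRoots (fibre c (ζ, 1)) := by
    intro w hw
    rw [hder w hw]
    refine div_ne_zero (fun h => hζ' w hw (by rw [eval_mul, h, zero_mul])) (hc.eval_ne_zero hw)
  have hXG : SimpleRoots ((X - C y) * (wr c * cubic b)) := by
    refine (SimpleRoots.X_sub_C y).mul hG fun a ha => ?_
    rw [eval_sub, eval_X, eval_C, sub_eq_zero] at ha
    rwa [ha]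
  have hdisj : ∀ w, (fibre c (ζ, 1)).eval w = 0 → ((X - C y) * (wr c * cubic b)).eval w ≠ 0 := by
    intro w hw
    rw [eval_mul]
    refine mul_ne_zero ?_ (hζ' w hw)
    rw [eval_sub, eval_X, eval_C, sub_ne_zero]
    rintro rfl
    exact hζy hw
  have hPdeg : (fibre c (ζ, 1)).natDegree = d := by
    refine le_antisymm (natDegree_fibre_le _ _) (le_natDegree_of_ne_zero fun h0 => hinf ?_)
    rw [(sphereMap_infty_eq_iff hc (by simp)).2 h0, prj_one]
  have hdeg : ((∏ i, fibre c (b i, 1)) * C ((cubic b).eval y)).natDegree + 2 ≤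
      (fibre c (ζ, 1) * ((X - C y) * (wr c * cubic b))).natDegree := by
    rw [natDegree_mul hP.ne_zero hXG.ne_zero, natDegree_mul (X_sub_C_ne_zero y) hG.ne_zero,
      natDegree_mul (hg.wr_ne_zero hd) (right_ne_zero_of_mul hG.ne_zero), natDegree_cubic, hPdeg,
      hg.1, natDegree_X_sub_C]
    have h1 := natDegree_mul_C_le (∏ i, fibre c (b i, 1)) ((cubic b).eval y)
    have h2 := natDegree_prod_le Finset.univ fun i => fibre c (b i, 1)
    have h3 : ∑ i, (fibre c (b i, 1)).natDegree ≤ ∑ i : Fin 3, d :=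
      Finset.sum_le_sum fun i _ => natDegree_fibre_le _ _
    simp only [Finset.sum_const, Finset.card_univ, Fintype.card_fin, smul_eq_mul] at h3
    lia
  have key := (hP.mul hXG hdisj).sum_residues hdeg
  rw [hP.sum_residues_mul hXG hdisj fun a => ((∏ i, fibre c (b i, 1)) *
    C ((cubic b).eval y)).eval a] at key
  have h2 := (SimpleRoots.X_sub_C y).sum_residues_mul hG (fun a ha => by
    rw [eval_sub, eval_X, eval_C, sub_eq_zero] at ha
    rwa [ha]) fun a => ((∏ i, fibre c (b i, 1)) * C ((cubic b).eval y)).eval a /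
      (fibre c (ζ, 1)).eval a
  rw [show ∀ s : Finset ℂ, ∑ a ∈ s, ((∏ i, fibre c (b i, 1)) * C ((cubic b).eval y)).eval a /
      ((derivative ((X - C y) * (wr c * cubic b))).eval a * (fibre c (ζ, 1)).eval a) =
    ∑ a ∈ s, ((∏ i, fibre c (b i, 1)) * C ((cubic b).eval y)).eval a / (fibre c (ζ, 1)).eval a /
      (derivative ((X - C y) * (wr c * cubic b))).eval a from
    fun s => Finset.sum_congr rfl fun a _ => by rw [div_div, mul_comm (eval a (derivative _))],
    h2, roots_X_sub_C, Multiset.toFinset_singleton, Finset.sum_singleton] at key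
  rw [← key]
  congr 1
  · refine Finset.sum_congr rfl fun w hw => ?_
    have hw0 : (fibre c (ζ, 1)).eval w = 0 := (mem_roots'.1 (Multiset.mem_toFinset.1 hw)).2
    simp [hder w hw0, eval_prod]
  congr 1
  · rw [eval_mul] at hy
    have := right_ne_zero_of_mul hy
    have := left_ne_zero_of_mul hy
    simp [eval_prod]
    field_simp
  · refine Finset.sum_congr rfl fun a ha => ?_
    have ha0 := (mem_roots'.1 (Multiset.mem_toFinset.1 ha)).2
    have h1 := hζ a ha0
    have h2 := hG a ha0
    have h3 : a - y ≠ 0 := by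
      rw [sub_ne_zero]
      rintro rfl
      exact hy ha0
    simp only [eval_mul, eval_prod, eval_C, eval_sub, eval_X]
    field_simp

lemma pushF_cauchyKer (hd : 2 ≤ d) {c : Par d} (hc : ND c) (hg : Gen c) {b : Fin 3 → ℂ}
    (hG : SimpleRoots (wr c * cubic b)) {y ζ : ℂ} (hq : (polyOf c.2).eval y ≠ 0)
    (hy : (wr c * cubic b).eval y ≠ 0)
    (hinf : sphereMap c ∞ ≠ ζ) (hζy : (fibre c (ζ, 1)).eval y ≠ 0)
    (hζ : ∀ a, (wr c * cubic b).eval a = 0 → (fibre c (ζ, 1)).eval a ≠ 0)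
    (hB : (cubic b).eval ζ ≠ 0) :
    pushF c (cauchyKer b y) ζ = (df c y)⁻¹ * cauchyKer b (fa c y) ζ -
      ∑ a ∈ (wr c * cubic b).roots.toFinset, (∏ i, (fibre c (b i, 1)).eval a) /
        ((derivative (wr c * cubic b)).eval a * ((cubic b).eval ζ * (fibre c (ζ, 1)).eval a)) *
          ((cubic b).eval y / (a - y)) := by
  have hprod : ∀ w, (polyOf c.2).eval w ≠ 0 → ∏ i, (fibre c (b i, 1)).eval w =
      (polyOf c.2).eval w ^ 3 * (cubic b).eval (fa c w) := by
    intro w hw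
    simp only [eval_cubic, eval_fibre_one, Fin.prod_univ_three, fa]
    field_simp
  have key := sum_residues_push hd hc hg hG hy hinf hζy hζ
  have h1 : ∑ w ∈ (fibre c (ζ, 1)).roots.toFinset, (∏ i, (fibre c (b i, 1)).eval w) *
      (cubic b).eval y / ((wr c).eval w / (polyOf c.2).eval w *
        ((w - y) * (wr c * cubic b).eval w)) = (cubic b).eval ζ * pushF c (cauchyKer b y) ζ := by
    rw [pushF, Finset.mul_sum]
    refine Finset.sum_congr rfl fun w hw => ?_
    have hw0 : (fibre c (ζ, 1)).eval w = 0 := (mem_roots'.1 (Multiset.mem_toFinset.1 hw)).2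
    have hqw := hc.eval_ne_zero hw0
    have hG0 : (wr c * cubic b).eval w ≠ 0 := fun h => hζ w h hw0
    rw [eval_mul] at hG0
    have hw1 := left_ne_zero_of_mul hG0
    have hw2 := right_ne_zero_of_mul hG0
    have hw3 : w - y ≠ 0 := by
      rw [sub_ne_zero]
      rintro rfl
      exact hζy hw0
    rw [hprod w hqw, (fa_eq_iff hqw).2 hw0, cauchyKer, df, eval_mul]
    field_simp
  have h2 : (∏ i, (fibre c (b i, 1)).eval y) / ((fibre c (ζ, 1)).eval y * (wr c).eval y) =
      - ((cubic b).eval ζ * ((df c y)⁻¹ * cauchyKer b (fa c y) ζ)) := by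
    have hy1 : (wr c).eval y ≠ 0 := by
      rw [eval_mul] at hy
      exact left_ne_zero_of_mul hy
    have hfy : (fibre c (ζ, 1)).eval y = (polyOf c.2).eval y * (fa c y - ζ) := by
      rw [eval_fibre_one, fa]
      field_simp
    have h3 : fa c y - ζ ≠ 0 := by
      rw [hfy] at hζy
      exact right_ne_zero_of_mul hζy
    have h4 : ζ - fa c y ≠ 0 := by
      rw [← neg_sub]
      exact neg_ne_zero.2 h3
    rw [hprod y hq, cauchyKer, df, hfy, ← neg_sub ζ (fa c y)]
    field_simp
  rw [h1, h2] at key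
  refine mul_left_cancel₀ hB ?_
  have h3 : (cubic b).eval ζ * ∑ a ∈ (wr c * cubic b).roots.toFinset,
      (∏ i, (fibre c (b i, 1)).eval a) /
        ((derivative (wr c * cubic b)).eval a * ((cubic b).eval ζ * (fibre c (ζ, 1)).eval a)) *
          ((cubic b).eval y / (a - y)) = ∑ a ∈ (wr c * cubic b).roots.toFinset,
      (∏ i, (fibre c (b i, 1)).eval a) /
        ((derivative (wr c * cubic b)).eval a * (fibre c (ζ, 1)).eval a) *
          ((cubic b).eval y / (a - y)) := by
    rw [Finset.mul_sum]
    refine Finset.sum_congr rfl fun a ha => ?_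
    have ha0 := (mem_roots'.1 (Multiset.mem_toFinset.1 ha)).2
    have h1 := hζ a ha0
    have h2 := hG a ha0
    field_simp
  rw [mul_sub, h3]
  linear_combination key

namespace Recurrent

variable {c : Par d} {ℱ : Filter ℕ} {x : ℕ → ℂ} {R : ℝ}

lemma invMul_succ (j : ℕ) : invMul c x (j + 1) = invMul c x j * (df c (x j))⁻¹ := by
  rw [invMul, invMul, Finset.prod_range_succ, mul_inv]

lemma fa_orbit (h : Recurrent c ℱ x R) (j : ℕ) :
    (polyOf c.2).eval (x j) ≠ 0 ∧ fa c (x j) = x (j + 1) :=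
  ⟨(h.orbit.eval_ne_zero j).1, (h.orbit.eval_ne_zero j).2.symm⟩

lemma pushF_pullSum (hd : 2 ≤ d) (h : Recurrent c ℱ x R) (hg : Gen c) {b : Fin 3 → ℂ}
    (hG : SimpleRoots (wr c * cubic b)) (hb : ∀ j, (cubic b).eval (x j) ≠ 0) {ζ : ℂ}
    (hinf : sphereMap c ∞ ≠ ζ) (hζx : ∀ j, ζ ≠ x j)
    (hζ : ∀ a, (wr c * cubic b).eval a = 0 → (fibre c (ζ, 1)).eval a ≠ 0)
    (hB : (cubic b).eval ζ ≠ 0) (n : ℕ) :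
    pushF c (fun z => pullSum c x n fun y => cauchyKer b y z) ζ =
      pullSum c x n (fun y => cauchyKer b y ζ) +
      (invMul c x n * cauchyKer b (x n) ζ - cauchyKer b (x 0) ζ) -
      ∑ a ∈ (wr c * cubic b).roots.toFinset, (∏ i, (fibre c (b i, 1)).eval a) /
        ((derivative (wr c * cubic b)).eval a * ((cubic b).eval ζ * (fibre c (ζ, 1)).eval a)) *
          pullSum c x n fun y => (cubic b).eval y / (a - y) := by
  have h1 : pushF c (fun z => pullSum c x n fun y => cauchyKer b y z) ζ =
      ∑ j ∈ Finset.range n, invMul c x j * pushF c (cauchyKer b (x j)) ζ := by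
    simp only [pushF, pullSum, Finset.sum_div, Finset.mul_sum]
    rw [Finset.sum_comm]
    exact Finset.sum_congr rfl fun j _ => Finset.sum_congr rfl fun w _ => mul_div_assoc _ _ _
  have h2 : ∀ j, invMul c x j * pushF c (cauchyKer b (x j)) ζ =
      (invMul c x (j + 1) * cauchyKer b (x (j + 1)) ζ - invMul c x j * cauchyKer b (x j) ζ) +
      invMul c x j * cauchyKer b (x j) ζ - 
      ∑ a ∈ (wr c * cubic b).roots.toFinset, (∏ i, (fibre c (b i, 1)).eval a) /
        ((derivative (wr c * cubic b)).eval a * ((cubic b).eval ζ * (fibre c (ζ, 1)).eval a)) *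
          (invMul c x j * ((cubic b).eval (x j) / (a - x j))) := by
    intro j
    obtain ⟨hq, hf⟩ := h.fa_orbit j
    rw [pushF_cauchyKer hd h.nd hg hG hq ?_ hinf ?_ hζ hB, hf, invMul_succ, mul_sub,
      Finset.mul_sum]
    · have : ∀ u v w : ℂ, u * (v * w) = v * (u * w) := fun u v w => by ring
      simp only [this (invMul c x j) (_ / _)]
      ring
    · rw [eval_mul]
      exact mul_ne_zero (h.wr_ne j) (hb j)
    · rw [Ne, ← fa_eq_iff hq, hf]
      exact (hζx _).symm
  rw [h1, Finset.sum_congr rfl fun j _ => h2 j, Finset.sum_sub_distrib, Finset.sum_add_distrib,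
    Finset.sum_range_sub fun j => invMul c x j * cauchyKer b (x j) ζ, Finset.sum_comm]
  simp only [← Finset.mul_sum]
  simp only [pullSum, invMul, Finset.range_zero, Finset.prod_empty, inv_one, one_mul]
  ring

end Recurrent

end

section

open Metric MeasureTheory

variable {d : ℕ}

/-- The points where the affine expression of the map is a local diffeomorphism. -/
def regSet (c : Par d) : Set ℂ := {z | (polyOf c.2).eval z ≠ 0 ∧ (wr c).eval z ≠ 0}

lemma isOpen_regSet (c : Par d) : IsOpen (regSet c) :=
  (isOpen_ne_fun (polyOf c.2).continuous continuous_const).inter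
    (isOpen_ne_fun (wr c).continuous continuous_const)

lemma exists_injOn_partition (c : Par d) : ∃ A : ℕ → Set ℂ, (∀ i, MeasurableSet (A i)) ∧
    Pairwise (Function.onFun Disjoint A) ∧ ⋃ i, A i = regSet c ∧ ∀ i, InjOn (fa c) (A i) := by
  have hloc : ∀ z ∈ regSet c, ∃ U, IsOpen U ∧ z ∈ U ∧ InjOn (fa c) U := by
    intro z hz
    have hs := (hasStrictDerivAt_fa hz.1).hasStrictFDerivAt_equiv (df_ne_zero hz.2 hz.1)
    obtain ⟨U, hU, hUo, hzU⟩ := _root_.mem_nhds_iff.1 hs.eventually_left_inverse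
    refine ⟨U, hUo, hzU, fun u hu v hv huv => ?_⟩
    rw [← show _ = u from hU hu, ← show _ = v from hU hv, huv]
  choose! U hUo hzU hinj using hloc
  obtain ⟨t, hts, htc, hst⟩ := TopologicalSpace.countable_cover_nhdsWithin
    fun z hz => mem_nhdsWithin_of_mem_nhds ((hUo z hz).mem_nhds (hzU z hz))
  rcases t.eq_empty_or_nonempty with rfl | hne
  · refine ⟨fun _ => ∅, fun _ => MeasurableSet.empty, fun _ _ _ => disjoint_bot_left, ?_,
      fun _ => injOn_empty _⟩
    simpa [subset_empty_iff, eq_comm] using hst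
  obtain ⟨e, rfl⟩ := htc.exists_eq_range hne
  have he : ∀ i, e i ∈ regSet c := fun i => hts (mem_range_self i)
  refine ⟨fun i => regSet c ∩ disjointed (fun i => U (e i)) i, fun i =>
    (isOpen_regSet c).measurableSet.inter (MeasurableSet.disjointed
      (fun i => (hUo _ (he i)).measurableSet) i), fun i j hij => ?_, ?_, fun i => ?_⟩
  · exact (disjoint_disjointed _ hij).mono inter_subset_right inter_subset_right
  · rw [← inter_iUnion, iUnion_disjointed, inter_eq_left]
    simpa using hst
  · exact (hinj _ (he i)).mono (inter_subset_right.trans (disjointed_subset _ i))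

lemma measurable_fa (c : Par d) : Measurable (fa c) :=
  (polyOf c.1).continuous.measurable.div (polyOf c.2).continuous.measurable

lemma measurable_df (c : Par d) : Measurable (df c) :=
  (wr c).continuous.measurable.div ((polyOf c.2).continuous.pow 2).measurable

lemma det_restrictScalars_toSpanSingleton (a : ℂ) :
    ((ContinuousLinearMap.toSpanSingleton ℂ a).restrictScalars ℝ).det = ‖a‖ ^ 2 := by
  have h1 : ((ContinuousLinearMap.toSpanSingleton ℂ a : ℂ →L[ℂ] ℂ) : ℂ →ₗ[ℂ] ℂ) =
      a • LinearMap.id := by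
    ext
    simp
  rw [ContinuousLinearMap.det, ContinuousLinearMap.coe_restrictScalars, LinearMap.det_restrictScalars,
    h1, LinearMap.det_smul, Algebra.norm_complex_apply]
  simp [Complex.normSq_eq_norm_sq]

/-- Pushing forward quadratic differentials does not increase area. -/
lemma lintegral_pushF_le {c : Par d} (hc : ND c) {V : ℂ → ℂ} (hV : Measurable V) {E : Set ℂ}
    (hE : MeasurableSet E) :
    ∫⁻ ζ in E, ‖pushF c V ζ‖ₑ ≤ ∫⁻ z in regSet c ∩ fa c ⁻¹' E, ‖V z‖ₑ := by
  obtain ⟨A, hAm, hAd, hAU, hAi⟩ := exists_injOn_partition c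
  set Q : ℂ → ENNReal := fun w => ‖V w / df c w ^ 2‖ₑ
  have hQm : Measurable Q := (hV.div ((measurable_df c).pow_const 2)).enorm
  have hder : ∀ i, ∀ z ∈ A i ∩ fa c ⁻¹' E, HasFDerivWithinAt (fa c)
      ((ContinuousLinearMap.toSpanSingleton ℂ (df c z)).restrictScalars ℝ)
      (A i ∩ fa c ⁻¹' E) z := by
    intro i z hz
    have hz' : z ∈ regSet c := hAU ▸ mem_iUnion_of_mem i hz.1
    exact ((hasDerivAt_fa hz'.1).hasFDerivAt.restrictScalars ℝ).hasFDerivWithinAt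
  have hBm : ∀ i, MeasurableSet (A i ∩ fa c ⁻¹' E) := fun i => (hAm i).inter (measurable_fa c hE)
  have hBi : ∀ i, InjOn (fa c) (A i ∩ fa c ⁻¹' E) := fun i => (hAi i).mono inter_subset_left
  have hemb := fun i => measurableEmbedding_of_fderivWithin (hBm i) (hder i) (hBi i)
  set g : ℕ → ℂ → ENNReal := fun i => Function.extend
    ((A i ∩ fa c ⁻¹' E).domRestrict (fa c)) (fun w => Q w) 0
  have hgm : ∀ i, Measurable (g i) := fun i =>
    (hemb i).measurable_extend (hQm.comp measurable_subtype_coe) measurable_const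
  have hgval : ∀ i, ∀ z ∈ A i ∩ fa c ⁻¹' E, g i (fa c z) = Q z := fun i z hz =>
    (hemb i).injective.extend_apply (fun w => Q w) 0 ⟨z, hz⟩
  have hgint : ∀ i, ∫⁻ ζ in E, g i ζ = ∫⁻ z in A i ∩ fa c ⁻¹' E, ‖V z‖ₑ := by
    intro i
    have h1 : ∫⁻ ζ in fa c '' (A i ∩ fa c ⁻¹' E), g i ζ = ∫⁻ ζ in E, g i ζ := by
      have hsub : Function.support (g i) ⊆ fa c '' (A i ∩ fa c ⁻¹' E) := by
        intro ζ hζ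
        by_contra hn
        refine hζ (Function.extend_apply' _ _ _ ?_)
        rintro ⟨w, rfl⟩
        exact hn ⟨w, w.2, rfl⟩
      rw [setLIntegral_eq_of_support_subset hsub, setLIntegral_eq_of_support_subset
        (hsub.trans (by rintro _ ⟨z, hz, rfl⟩; exact hz.2))]
    rw [← h1, lintegral_image_eq_lintegral_abs_det_fderiv_mul volume (hBm i) (hder i) (hBi i)]
    refine setLIntegral_congr_fun (hBm i) fun z hz => ?_
    have hz' : z ∈ regSet c := hAU ▸ mem_iUnion_of_mem i hz.1
    have hdf := df_ne_zero hz'.2 hz'.1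
    rw [hgval i z hz, det_restrictScalars_toSpanSingleton, abs_of_nonneg (sq_nonneg _)]
    simp only [Q, ← ofReal_norm, norm_div, norm_pow]
    rw [← ENNReal.ofReal_mul (sq_nonneg _), mul_div_cancel₀ _ (pow_ne_zero _ (norm_ne_zero_iff.2 hdf))]
  have hpt : ∀ ζ ∈ E, ‖pushF c V ζ‖ₑ ≤ ∑' i, g i ζ := by
    intro ζ hζ
    set T := (fibre c (ζ, 1)).roots.toFinset.filter (· ∈ regSet c)
    have hT : ∀ w ∈ T, w ∈ regSet c ∧ fa c w = ζ := by
      intro w hw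
      obtain ⟨hw1, hw2⟩ := Finset.mem_filter.1 hw
      exact ⟨hw2, (fa_eq_iff hw2.1).2 (mem_roots'.1 (Multiset.mem_toFinset.1 hw1)).2⟩
    have hsum : pushF c V ζ = ∑ w ∈ T, V w / df c w ^ 2 := by
      refine (Finset.sum_filter_of_ne fun w hw hne => ?_).symm
      have hw0 : (fibre c (ζ, 1)).eval w = 0 := (mem_roots'.1 (Multiset.mem_toFinset.1 hw)).2
      refine ⟨hc.eval_ne_zero hw0, fun h0 => hne ?_⟩
      simp [df, h0]
    have hex : ∀ w ∈ T, ∃ i, w ∈ A i := fun w hw => by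
      have := (hT w hw).1
      rw [← hAU] at this
      exact mem_iUnion.1 this
    choose! ι hι using hex
    have hinj : InjOn ι T := fun u hu v hv huv => hAi (ι u) (hι u hu) (huv ▸ hι v hv)
      ((hT u hu).2.trans (hT v hv).2.symm)
    calc ‖pushF c V ζ‖ₑ ≤ ∑ w ∈ T, Q w := by
          rw [hsum]
          exact enorm_sum_le _ _
      _ = ∑ w ∈ T, g (ι w) ζ := Finset.sum_congr rfl fun w hw => by
          have h2 := (hT w hw).2
          rw [← hgval (ι w) w ⟨hι w hw, by rw [mem_preimage, h2]; exact hζ⟩, h2]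
      _ = ∑ i ∈ T.image ι, g i ζ := (Finset.sum_image (f := fun i => g i ζ) hinj).symm
      _ ≤ ∑' i, g i ζ := ENNReal.sum_le_tsum _
  calc ∫⁻ ζ in E, ‖pushF c V ζ‖ₑ ≤ ∫⁻ ζ in E, ∑' i, g i ζ := setLIntegral_mono' hE hpt
    _ = ∑' i, ∫⁻ ζ in E, g i ζ := lintegral_tsum fun i => (hgm i).aemeasurable
    _ = ∑' i, ∫⁻ z in A i ∩ fa c ⁻¹' E, ‖V z‖ₑ := by simp only [hgint]
    _ = ∫⁻ z in ⋃ i, (A i ∩ fa c ⁻¹' E), ‖V z‖ₑ := (lintegral_iUnion hBm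
        (fun i j hij => (hAd hij).mono inter_subset_left inter_subset_left) _).symm
    _ = _ := by rw [← iUnion_inter, hAU]

end

section

open Metric MeasureTheory

lemma lintegral_eq_polar {F : ℂ → ENNReal} (hF : Measurable F) (a : ℂ) :
    ∫⁻ z, F z = ∫⁻ ρ in Ioi (0 : ℝ), ENNReal.ofReal ρ *
      ∫⁻ θ in Ioo (-Real.pi) Real.pi, F (circleMap a ρ θ) := by
  have hc : ∀ p : ℝ × ℝ, a + Complex.polarCoord.symm p = circleMap a p.1 p.2 := by
    intro p
    rw [Complex.polarCoord_symm_apply, circleMap, Complex.exp_mul_I, Complex.ofReal_cos,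
      Complex.ofReal_sin]
  have hm : Measurable fun p : ℝ × ℝ => F (circleMap a p.1 p.2) := by
    refine hF.comp (Continuous.measurable ?_)
    simp only [circleMap]
    fun_prop
  rw [← lintegral_add_left_eq_self F a, ← Complex.lintegral_comp_polarCoord_symm, polarCoord_target,
    Measure.volume_eq_prod]
  simp only [hc, smul_eq_mul]
  rw [setLIntegral_prod _ (by fun_prop)]
  refine lintegral_congr fun ρ => ?_
  exact lintegral_const_mul' _ _ ENNReal.ofReal_ne_top

lemma enorm_center_le {V : ℂ → ℂ} {a : ℂ} {r ρ : ℝ} (hV : DifferentiableOn ℂ V (ball a r))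
    (h0 : 0 < ρ) (hρ : ρ < r) : ENNReal.ofReal (2 * Real.pi) * ‖V a‖ₑ ≤
      ∫⁻ θ in Ioo (-Real.pi) Real.pi, ‖V (circleMap a ρ θ)‖ₑ := by
  have h1 : Real.circleAverage V a ρ = V a := by
    refine DiffContOnCl.circleAverage ((hV.mono ?_).diffContOnCl)
    rw [closure_ball _ (abs_pos.2 h0.ne').ne', abs_of_pos h0]
    exact closedBall_subset_ball hρ
  have h2 : ∫ θ in (-Real.pi)..Real.pi, V (circleMap a ρ θ) =
      ((2 * Real.pi : ℝ) : ℂ) * V a := by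
    have hp : Function.Periodic (fun θ => V (circleMap a ρ θ)) (2 * Real.pi) := fun θ => by
      beta_reduce
      rw [periodic_circleMap a ρ θ]
    have h3 := hp.intervalIntegral_add_eq (-Real.pi) 0
    rw [show -Real.pi + 2 * Real.pi = Real.pi by ring, zero_add] at h3
    rw [h3, ← h1, Real.circleAverage, ← Complex.real_smul, smul_smul,
      mul_inv_cancel₀ (by positivity), one_smul]
  have h4 : ENNReal.ofReal (2 * Real.pi) * ‖V a‖ₑ =
      ‖∫ θ in (-Real.pi)..Real.pi, V (circleMap a ρ θ)‖ₑ := by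
    rw [h2, enorm_mul, ← ofReal_norm ((2 * Real.pi : ℝ) : ℂ), Complex.norm_real, Real.norm_of_nonneg
      (by positivity)]
  rw [h4, intervalIntegral.integral_of_le (by linarith [Real.pi_pos]),
    setLIntegral_congr Ioo_ae_eq_Ioc]
  exact enorm_integral_le_lintegral_enorm _

/-- The value of a holomorphic function at the centre of a disc is bounded by its `L¹` norm. -/
lemma enorm_mul_le_lintegral_ball {V : ℂ → ℂ} (hVm : Measurable V) {a : ℂ} {r : ℝ}
    (hV : DifferentiableOn ℂ V (ball a r)) :
    ENNReal.ofReal (r / 2) * (ENNReal.ofReal (r / 2) * (ENNReal.ofReal (2 * Real.pi) * ‖V a‖ₑ)) ≤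
      ∫⁻ z in ball a r, ‖V z‖ₑ := by
  rcases le_or_gt r 0 with hr | hr
  · rw [ENNReal.ofReal_of_nonpos (by linarith), zero_mul]
    exact zero_le
  rw [← lintegral_indicator measurableSet_ball, lintegral_eq_polar
    (hVm.enorm.indicator measurableSet_ball) a]
  calc _ = ∫⁻ ρ in Ioo (r / 2) r, ENNReal.ofReal (r / 2) *
        (ENNReal.ofReal (2 * Real.pi) * ‖V a‖ₑ) := by
        rw [setLIntegral_const, Real.volume_Ioo, mul_comm]
        congr 2
        ring
    _ ≤ ∫⁻ ρ in Ioo (r / 2) r, ENNReal.ofReal ρ * ∫⁻ θ in Ioo (-Real.pi) Real.pi,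
        (ball a r).indicator (fun z => ‖V z‖ₑ) (circleMap a ρ θ) := by
        refine setLIntegral_mono' measurableSet_Ioo fun ρ hρ => ?_
        have h0 : 0 < ρ := by linarith [hρ.1]
        refine mul_le_mul' (ENNReal.ofReal_le_ofReal hρ.1.le)
          ((enorm_center_le hV h0 hρ.2).trans_eq (lintegral_congr fun θ => ?_))
        rw [indicator_of_mem]
        rw [mem_ball, dist_eq_norm, circleMap_sub_center, norm_circleMap_zero, abs_of_pos h0]
        exact hρ.2
    _ ≤ _ := lintegral_mono_set fun ρ hρ => mem_Ioi.2 (by linarith [hρ.1])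

lemma lintegral_ball_inv_sub_lt_top (v : ℂ) : ∫⁻ z in ball v 1, ‖(z - v)⁻¹‖ₑ < ⊤ := by
  rw [← lintegral_indicator measurableSet_ball, lintegral_eq_polar
    (Measurable.indicator (by fun_prop) measurableSet_ball) v]
  calc _ ≤ ∫⁻ ρ in Ioi (0 : ℝ), (Ioo (0 : ℝ) 1).indicator
        (fun _ => ∫⁻ θ in Ioo (-Real.pi) Real.pi, 1) ρ := by
        refine setLIntegral_mono' measurableSet_Ioi fun ρ (hρ : 0 < ρ) => ?_
        rw [← lintegral_const_mul' _ _ ENNReal.ofReal_ne_top]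
        by_cases h1 : ρ < 1
        · rw [indicator_of_mem (show ρ ∈ Ioo (0 : ℝ) 1 from ⟨hρ, h1⟩)]
          refine lintegral_mono fun θ => ?_
          refine (mul_le_mul_right (indicator_le_self _ _ _) _).trans_eq ?_
          beta_reduce
          rw [circleMap_sub_center, ← ofReal_norm, norm_inv, norm_circleMap_zero, abs_of_pos hρ,
            ← ENNReal.ofReal_mul hρ.le, mul_inv_cancel₀ hρ.ne', ENNReal.ofReal_one]
        · refine (lintegral_eq_zero_of_ae_eq_zero (ae_of_all _ fun θ => ?_)).le.trans zero_le
          rw [indicator_of_notMem, mul_zero]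
          · rfl
          · rw [mem_ball, dist_eq_norm, circleMap_sub_center, norm_circleMap_zero, abs_of_pos hρ]
            exact h1
    _ ≤ ∫⁻ ρ in Ioo (0 : ℝ) 1, ∫⁻ θ in Ioo (-Real.pi) Real.pi, 1 := by
        rw [setLIntegral_indicator measurableSet_Ioo]
        exact lintegral_mono_set inter_subset_left
    _ < ⊤ := by
        simp only [setLIntegral_const, Real.volume_Ioo]
        exact ENNReal.mul_lt_top (by simp) (by simp)

lemma exists_inv_cubic_le {b : Fin 3 → ℂ} {x₀ : ℂ} {r : ℝ} (hb : ∀ i, b i ∈ ball x₀ r) :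
    ∃ K : ℝ, 0 ≤ K ∧ ∀ ζ ∉ closedBall x₀ r, ‖((cubic b).eval ζ)⁻¹‖ ≤ K * (1 + ‖ζ‖) ^ (-3 : ℝ) := by
  have h1 : ∀ i, ∃ K : ℝ, 0 ≤ K ∧ ∀ ζ ∉ closedBall x₀ r, ‖(ζ - b i)⁻¹‖ ≤ K * (1 + ‖ζ‖)⁻¹ := by
    intro i
    set m := r - dist (b i) x₀
    have hm : 0 < m := sub_pos.2 (mem_ball.1 (hb i))
    refine ⟨(1 + ‖b i‖) / m + 1, by positivity, fun ζ hζ => ?_⟩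
    have hd : m ≤ ‖ζ - b i‖ := by
      rw [mem_closedBall, not_le] at hζ
      have := dist_triangle ζ (b i) x₀
      rw [dist_eq_norm ζ (b i)] at this
      simp only [m]
      linarith
    have h2 : 1 + ‖ζ‖ ≤ ((1 + ‖b i‖) / m + 1) * ‖ζ - b i‖ := by
      have h3 : ‖ζ‖ ≤ ‖ζ - b i‖ + ‖b i‖ := by simpa using norm_add_le (ζ - b i) (b i)
      have h4 : 1 + ‖b i‖ ≤ (1 + ‖b i‖) / m * ‖ζ - b i‖ := by
        rw [div_mul_eq_mul_div, le_div_iff₀ hm]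
        gcongr
      linarith
    have hp : 0 < ‖ζ - b i‖ := hm.trans_le hd
    rw [norm_inv, inv_eq_one_div, div_le_iff₀ hp, mul_right_comm, ← div_eq_mul_inv,
      one_le_div (by positivity)]
    exact h2
  choose K hK h using h1
  refine ⟨∏ i, K i, Finset.prod_nonneg fun i _ => hK i, fun ζ hζ => ?_⟩
  rw [eval_cubic, ← Finset.prod_inv_distrib, norm_prod, Real.rpow_neg (by positivity),
    show (3 : ℝ) = ((3 : ℕ) : ℝ) by norm_num, Real.rpow_natCast]
  calc _ ≤ ∏ i, K i * (1 + ‖ζ‖)⁻¹ := Finset.prod_le_prod (fun i _ => norm_nonneg _)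
        fun i _ => h i ζ hζ
    _ = _ := by
      rw [Finset.prod_mul_distrib, Finset.prod_const, Finset.card_univ, Fintype.card_fin, inv_pow]

lemma exists_inv_linear_le (α β : ℂ) : ∃ (v : ℂ) (K : ℝ), 0 ≤ K ∧
    ∀ ζ, ‖(α - ζ * β)⁻¹‖ₑ ≤ ENNReal.ofReal K *
      (1 + (ball v 1).indicator (fun z => ‖(z - v)⁻¹‖ₑ) ζ) := by
  by_cases hβ : β = 0
  · refine ⟨0, ‖α⁻¹‖, norm_nonneg _, fun ζ => ?_⟩
    rw [hβ, mul_zero, sub_zero, ofReal_norm]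
    exact le_mul_of_one_le_right' le_self_add
  · refine ⟨α / β, ‖β⁻¹‖, norm_nonneg _, fun ζ => ?_⟩
    have e : (α - ζ * β)⁻¹ = - (β⁻¹ * (ζ - α / β)⁻¹) := by
      rw [← mul_inv, ← inv_neg]
      congr 1
      field_simp
      ring
    rw [e, enorm_neg, enorm_mul, ofReal_norm]
    gcongr
    by_cases hm : ζ ∈ ball (α / β) 1
    · rw [indicator_of_mem hm]
      exact le_add_self
    · rw [indicator_of_notMem hm, add_zero, ← ofReal_norm, norm_inv, ← ENNReal.ofReal_one]
      refine ENNReal.ofReal_le_ofReal (inv_le_one_of_one_le₀ ?_)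
      rwa [mem_ball, not_lt, dist_eq_norm] at hm

lemma lintegral_inv_cubic_lt_top {b : Fin 3 → ℂ} {x₀ : ℂ} {r : ℝ} (hb : ∀ i, b i ∈ ball x₀ r)
    (α β : ℂ) :
    ∫⁻ ζ in (closedBall x₀ r)ᶜ, ‖((cubic b).eval ζ * (α - ζ * β))⁻¹‖ₑ < ⊤ := by
  obtain ⟨K, hK, h1⟩ := exists_inv_cubic_le hb
  obtain ⟨v, L, hL, h2⟩ := exists_inv_linear_le α β
  calc _ ≤ ∫⁻ ζ in (closedBall x₀ r)ᶜ, ENNReal.ofReal (K * L) *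
        (ENNReal.ofReal ((1 + ‖ζ‖) ^ (-3 : ℝ)) +
          (ball v 1).indicator (fun z => ‖(z - v)⁻¹‖ₑ) ζ) := by
        refine setLIntegral_mono' measurableSet_closedBall.compl fun ζ hζ => ?_
        have h3 : (1 + ‖ζ‖) ^ (-3 : ℝ) ≤ 1 :=
          Real.rpow_le_one_of_one_le_of_nonpos (by linarith [norm_nonneg ζ]) (by norm_num)
        have h4 : ‖((cubic b).eval ζ)⁻¹‖ₑ ≤ ENNReal.ofReal K *
            ENNReal.ofReal ((1 + ‖ζ‖) ^ (-3 : ℝ)) := by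
          rw [← ENNReal.ofReal_mul hK, ← ofReal_norm]
          exact ENNReal.ofReal_le_ofReal (h1 ζ hζ)
        rw [mul_inv, enorm_mul, ENNReal.ofReal_mul hK]
        refine (mul_le_mul' h4 (h2 ζ)).trans ?_
        rw [mul_mul_mul_comm, mul_add, mul_one]
        gcongr
        refine mul_le_of_le_one_left' ?_
        rw [← ENNReal.ofReal_one]
        exact ENNReal.ofReal_le_ofReal h3
    _ ≤ ∫⁻ ζ, ENNReal.ofReal (K * L) * (ENNReal.ofReal ((1 + ‖ζ‖) ^ (-3 : ℝ)) +
          (ball v 1).indicator (fun z => ‖(z - v)⁻¹‖ₑ) ζ) := setLIntegral_le_lintegral _ _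
    _ = ENNReal.ofReal (K * L) * ((∫⁻ ζ : ℂ, ENNReal.ofReal ((1 + ‖ζ‖) ^ (-3 : ℝ))) +
          ∫⁻ z in ball v 1, ‖(z - v)⁻¹‖ₑ) := by
        rw [lintegral_const_mul' _ _ ENNReal.ofReal_ne_top, lintegral_add_left (by fun_prop),
          lintegral_indicator measurableSet_ball]
    _ < ⊤ := ENNReal.mul_lt_top ENNReal.ofReal_lt_top (ENNReal.add_lt_top.2
        ⟨finite_integral_one_add_norm (by rw [Complex.finrank_real_complex]; norm_num),
          lintegral_ball_inv_sub_lt_top v⟩)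

end

section

open Metric MeasureTheory

variable {d : ℕ}

/-- Three auxiliary points in the disc of recurrence, in general position. -/
structure Nodes (c : Par d) (x : ℕ → ℂ) (R : ℝ) (b : Fin 3 → ℂ) : Prop where
  mem : ∀ i, b i ∈ ball (x 0) (R / 2)
  simple : SimpleRoots (wr c * cubic b)
  ne : ∀ j, (cubic b).eval (x j) ≠ 0

lemma simpleRoots_cubic {b : Fin 3 → ℂ} (hb : Function.Injective b) : SimpleRoots (cubic b) := by
  rw [cubic, Fin.prod_univ_three]
  refine ((SimpleRoots.X_sub_C _).mul (SimpleRoots.X_sub_C _) fun a ha => ?_).mul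
    (SimpleRoots.X_sub_C _) fun a ha => ?_
  · simp only [eval_sub, eval_X, eval_C, sub_eq_zero] at ha
    simp only [eval_sub, eval_X, eval_C]
    rw [ha, Ne, sub_eq_zero, hb.eq_iff]
    decide
  · simp only [eval_mul, eval_sub, eval_X, eval_C, mul_eq_zero, sub_eq_zero] at ha
    simp only [eval_sub, eval_X, eval_C]
    rcases ha with ha | ha <;> rw [ha, Ne, sub_eq_zero, hb.eq_iff] <;> decide

namespace Recurrent

variable {c : Par d} {ℱ : Filter ℕ} {x : ℕ → ℂ} {R : ℝ} {b : Fin 3 → ℂ}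

lemma exists_nodes (hd : 2 ≤ d) (h : Recurrent c ℱ x R) (hg : Gen c) : ∃ b, Nodes c x R b := by
  have hcount : (range x ∪ {z | (wr c).eval z = 0}).Countable :=
    (countable_range x).union (((wr c).roots.toFinset.finite_toSet.subset fun z hz => by
      simpa [hg.wr_ne_zero hd] using hz).countable)
  have hinf : (ball (x 0) (R / 2) \ (range x ∪ {z | (wr c).eval z = 0})).Infinite := by
    intro hf
    have h1 := (hf.countable.union hcount).dense_compl ℂ
    obtain ⟨z, hz, hz'⟩ := h1.inter_open_nonempty _ isOpen_ball
      ⟨x 0, mem_ball_self (half_pos h.pos)⟩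
    exact hz' (by by_cases hz2 : z ∈ range x ∪ {z | (wr c).eval z = 0}; exacts [.inr hz2, .inl ⟨hz, hz2⟩])
  set e := hinf.natEmbedding
  have hb : Function.Injective fun i : Fin 3 => (e i : ℂ) := fun i j hij =>
    Fin.ext (e.injective (Subtype.ext hij))
  refine ⟨fun i => e i, fun i => (e i).2.1, ?_, fun j => ?_⟩
  · refine SimpleRoots.mul hg.2 (simpleRoots_cubic hb) fun a ha => ?_
    rw [eval_cubic, Finset.prod_ne_zero_iff]
    intro i _ h0
    rw [sub_eq_zero] at h0
    exact (e i).2.2 (.inr (h0 ▸ ha))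
  · rw [eval_cubic, Finset.prod_ne_zero_iff]
    intro i _ h0
    rw [sub_eq_zero] at h0
    exact (e i).2.2 (.inl ⟨j, h0⟩)

lemma tendsto_orbit (h : Recurrent c ℱ x R) : Tendsto x ℱ (𝓝 (x 0)) := by
  have := h.tendsto_iterate (h.orbit_mem_spread 0)
  simp only [h.orbit.iterate, zero_add] at this
  exact OnePoint.isOpenEmbedding_coe.isInducing.tendsto_nhds_iff.2 this

lemma tendsto_invMul (h : Recurrent c ℱ x R) : Tendsto (invMul c x) ℱ (𝓝 1) := by
  have := (tendsto_prod_df h.nd h.orbit h.pos h.close).inv₀ one_ne_zero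
  rwa [inv_one] at this

lemma tendsto_pullSum_cubic_div (h : Recurrent c ℱ x R) (hb : Nodes c x R b) (hg : Gen c)
    (hd : 2 ≤ d) {a : ℂ} (ha : (wr c * cubic b).eval a = 0) :
    Tendsto (fun n => pullSum c x n fun y => (cubic b).eval y / (a - y)) ℱ (𝓝 0) := by
  obtain ⟨N, hN⟩ := dvd_iff_isRoot.2 ha
  have hN0 : N ≠ 0 := by
    rintro rfl
    exact hb.simple.ne_zero (by rw [hN, mul_zero])
  have hdeg : N.natDegree ≤ 2 * d := by
    have h1 := congrArg natDegree hN
    rw [natDegree_mul (X_sub_C_ne_zero a) hN0, natDegree_X_sub_C, natDegree_mul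
      (hg.wr_ne_zero hd) (right_ne_zero_of_mul hb.simple.ne_zero), natDegree_cubic, hg.1] at h1
    lia
  have := (h.variation N hdeg).neg
  rw [neg_zero] at this
  refine this.congr fun n => ?_
  simp only [pullSum, ← Finset.sum_neg_distrib]
  refine Finset.sum_congr rfl fun j _ => ?_
  have h1 := congrArg (eval (x j)) hN
  simp only [eval_mul, eval_sub, eval_X, eval_C] at h1
  have h2 := h.wr_ne j
  have h3 : a - x j ≠ 0 := by
    intro h0
    rw [sub_eq_zero] at h0
    rw [h0, eval_mul] at ha
    exact mul_ne_zero h2 (hb.ne j) ha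
  rw [← mul_neg]
  congr 1
  field_simp
  linear_combination -h1

lemma cubic_ne_zero (hb : Nodes c x R b) {ζ : ℂ} (hζ : ζ ∉ closedBall (x 0) (R / 2)) :
    (cubic b).eval ζ ≠ 0 := by
  rw [eval_cubic, Finset.prod_ne_zero_iff]
  intro i _ h0
  rw [sub_eq_zero] at h0
  exact hζ (h0 ▸ ball_subset_closedBall (hb.mem i))

lemma ae_good (h : Recurrent c ℱ x R) (hb : Nodes c x R b) : ∀ᵐ ζ : ℂ, sphereMap c ∞ ≠ ζ ∧ (∀ j, ζ ≠ x j) ∧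
    ∀ a, (wr c * cubic b).eval a = 0 → (fibre c (ζ, 1)).eval a ≠ 0 := by
  have h1 : {ζ : ℂ | sphereMap c ∞ = ζ}.Countable :=
    Set.Subsingleton.countable fun u hu v hv => OnePoint.coe_injective (hu.symm.trans hv)
  have h2 : (⋃ a ∈ (wr c * cubic b).roots.toFinset,
      {ζ : ℂ | (fibre c (ζ, 1)).eval a = 0}).Countable := by
    refine (Finset.countable_toSet _).biUnion fun a _ => Set.Subsingleton.countable
      fun u hu v hv => ?_
    rw [← (fa_eq_iff (h.nd.eval_ne_zero hu)).2 hu, (fa_eq_iff (h.nd.eval_ne_zero hu)).2 hv]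
  refine ((h1.union (countable_range x)).union h2).ae_notMem volume |>.mono fun ζ hζ => ?_
  simp only [mem_union, not_or] at hζ
  refine ⟨hζ.1.1, fun j hj => hζ.1.2 ⟨j, hj.symm⟩, fun a ha h0 => hζ.2 ?_⟩
  exact mem_biUnion (by simpa [hb.simple.ne_zero] using! ha) h0

end Recurrent

lemma measurable_cauchyKer (b : Fin 3 → ℂ) (y : ℂ) : Measurable (cauchyKer b y) :=
  measurable_const.div ((measurable_id.sub_const y).mul (cubic b).continuous.measurable)

lemma measurable_pullSum {c : Par d} {x : ℕ → ℂ} {b : Fin 3 → ℂ} (n : ℕ) :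
    Measurable fun ζ => pullSum c x n fun y => cauchyKer b y ζ :=
  Finset.measurable_fun_sum _ fun j _ => (measurable_cauchyKer b (x j)).const_mul _

namespace Recurrent

variable {c : Par d} {ℱ : Filter ℕ} {x : ℕ → ℂ} {R : ℝ} {b : Fin 3 → ℂ}

lemma lintegral_cauchyKer_lt_top (hb : Nodes c x R b) (y : ℂ) :
    ∫⁻ ζ in (closedBall (x 0) (R / 2))ᶜ, ‖cauchyKer b y ζ‖ₑ < ⊤ := by
  have h1 := lintegral_inv_cubic_lt_top hb.mem (-y) (-1)
  have h2 : ∀ ζ, ‖cauchyKer b y ζ‖ₑ =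
      ‖(cubic b).eval y‖ₑ * ‖((cubic b).eval ζ * (-y - ζ * -1))⁻¹‖ₑ := fun ζ => by
    rw [← enorm_mul, cauchyKer, div_eq_mul_inv]
    congr 3
    ring
  simp only [h2]
  rw [lintegral_const_mul' _ _ (by simp)]
  exact ENNReal.mul_lt_top (by simp) h1

lemma lintegral_pullSum_lt_top (hb : Nodes c x R b) (n : ℕ) :
    ∫⁻ ζ in (closedBall (x 0) (R / 2))ᶜ, ‖pullSum c x n fun y => cauchyKer b y ζ‖ₑ < ⊤ := by
  calc _ ≤ ∫⁻ ζ in (closedBall (x 0) (R / 2))ᶜ, ∑ j ∈ Finset.range n,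
        ‖invMul c x j‖ₑ * ‖cauchyKer b (x j) ζ‖ₑ := by
        refine lintegral_mono fun ζ => (enorm_sum_le _ _).trans_eq ?_
        simp only [enorm_mul]
    _ = ∑ j ∈ Finset.range n, ‖invMul c x j‖ₑ * ∫⁻ ζ in (closedBall (x 0) (R / 2))ᶜ,
        ‖cauchyKer b (x j) ζ‖ₑ := by
        rw [lintegral_finsetSum _ fun j _ => (measurable_cauchyKer b (x j)).enorm.const_mul _]
        exact Finset.sum_congr rfl fun j _ => lintegral_const_mul' _ _ (by simp)
    _ < ⊤ := ENNReal.sum_lt_top.2 fun j _ => ENNReal.mul_lt_top (by simp)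
        (lintegral_cauchyKer_lt_top hb _)

lemma exists_cauchyKer_sub_le (h : Recurrent c ℱ x R) (hb : Nodes c x R b) : ∃ e : ℕ → ℂ,
    Tendsto e ℱ (𝓝 0) ∧ ∀ᶠ n in ℱ, ∀ ζ ∉ closedBall (x 0) (R / 2),
      ‖invMul c x n * cauchyKer b (x n) ζ - cauchyKer b (x 0) ζ‖ₑ ≤
        ‖e n‖ₑ * ‖((cubic b).eval ζ * (1 - ζ * 0))⁻¹‖ₑ := by
  have hR := h.pos
  set e : ℕ → ℝ := fun n =>
    ‖invMul c x n * (cubic b).eval (x n) - (cubic b).eval (x 0)‖ * (R / 4)⁻¹ +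
      ‖(cubic b).eval (x 0)‖ * ‖x n - x 0‖ * ((R / 4)⁻¹ * (R / 4)⁻¹) with he
  have hx := h.tendsto_orbit
  have hBx : Tendsto (fun n => (cubic b).eval (x n)) ℱ (𝓝 ((cubic b).eval (x 0))) :=
    ((cubic b).continuous.tendsto _).comp hx
  have ht : Tendsto e ℱ (𝓝 0) := by
    have h1 := ((h.tendsto_invMul.mul hBx).sub_const ((cubic b).eval (x 0))).norm.mul_const (R / 4)⁻¹
    have h2 := ((hx.sub_const (x 0)).norm.const_mul ‖(cubic b).eval (x 0)‖).mul_const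
      ((R / 4)⁻¹ * (R / 4)⁻¹)
    have h3 := h1.add h2
    simp only [one_mul, sub_self, norm_zero, mul_zero, zero_mul, add_zero] at h3
    exact h3
  refine ⟨fun n => (e n : ℂ), by simpa using! (Complex.continuous_ofReal.tendsto 0).comp ht, ?_⟩
  filter_upwards [hx (ball_mem_nhds (x 0) (show 0 < R / 4 by positivity))] with n hn ζ hζ
  have hn' : dist (x n) (x 0) < R / 4 := hn
  have hζ0 : R / 2 < dist ζ (x 0) := not_le.1 hζ
  have h1 : R / 4 ≤ ‖ζ - x n‖ := by
    rw [← dist_eq_norm]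
    linarith [dist_triangle ζ (x n) (x 0)]
  have h0 : R / 4 ≤ ‖ζ - x 0‖ := by
    rw [← dist_eq_norm]
    linarith
  have hn1 : ζ - x n ≠ 0 := norm_pos_iff.1 (by linarith)
  have hn0 : ζ - x 0 ≠ 0 := norm_pos_iff.1 (by linarith)
  have hB := cubic_ne_zero hb hζ
  have hid : invMul c x n * cauchyKer b (x n) ζ - cauchyKer b (x 0) ζ =
      ((invMul c x n * (cubic b).eval (x n) - (cubic b).eval (x 0)) * (ζ - x n)⁻¹ +
        (cubic b).eval (x 0) * (x n - x 0) * ((ζ - x n)⁻¹ * (ζ - x 0)⁻¹)) *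
      ((cubic b).eval ζ * (1 - ζ * 0))⁻¹ := by
    rw [cauchyKer, cauchyKer, mul_zero, sub_zero, mul_one]
    field_simp
    ring
  rw [hid, enorm_mul]
  gcongr
  rw [← ofReal_norm, ← ofReal_norm, Complex.norm_real, Real.norm_of_nonneg (by positivity)]
  refine ENNReal.ofReal_le_ofReal ((norm_add_le _ _).trans ?_)
  simp only [norm_mul, norm_inv, he]
  gcongr

/-- The push-forward of the kernel sums almost fixes them away from the disc of recurrence. -/
lemma tendsto_lintegral_pushF_sub (hd : 2 ≤ d) (h : Recurrent c ℱ x R) (hg : Gen c)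
    (hb : Nodes c x R b) :
    Tendsto (fun n => ∫⁻ ζ in (closedBall (x 0) (R / 2))ᶜ,
      ‖pushF c (fun z => pullSum c x n fun y => cauchyKer b y z) ζ -
        pullSum c x n (fun y => cauchyKer b y ζ)‖ₑ) ℱ (𝓝 0) := by
  obtain ⟨e, he, hle⟩ := h.exists_cauchyKer_sub_le hb
  set S := (wr c * cubic b).roots.toFinset
  set M := (closedBall (x 0) (R / 2))ᶜ
  set L : ℂ → ℂ → ENNReal := fun α β => ∫⁻ ζ in M, ‖((cubic b).eval ζ * (α - ζ * β))⁻¹‖ₑ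
  have hL : ∀ α β, L α β ≠ ⊤ := fun α β => (lintegral_inv_cubic_lt_top hb.mem α β).ne
  set q : ℂ → ℕ → ℂ := fun a n => (∏ i, (fibre c (b i, 1)).eval a) /
    (derivative (wr c * cubic b)).eval a * pullSum c x n fun y => (cubic b).eval y / (a - y)
  have hq : ∀ a ∈ S, Tendsto (q a) ℱ (𝓝 0) := fun a ha => by
    have := (h.tendsto_pullSum_cubic_div hb hg hd
      (mem_roots'.1 (Multiset.mem_toFinset.1 ha)).2).const_mul
        ((∏ i, (fibre c (b i, 1)).eval a) / (derivative (wr c * cubic b)).eval a)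
    rwa [mul_zero] at this
  have hen : ∀ {u : ℕ → ℂ} (K : ENNReal), K ≠ ⊤ → Tendsto u ℱ (𝓝 0) →
      Tendsto (fun n => ‖u n‖ₑ * K) ℱ (𝓝 0) := fun K hK hu => by
    have := ENNReal.Tendsto.mul_const (continuous_enorm.tendsto _ |>.comp hu) (.inr hK)
    simpa using this
  have hlim : Tendsto (fun n => ‖e n‖ₑ * L 1 0 + ∑ a ∈ S, ‖q a n‖ₑ *
      L ((polyOf c.1).eval a) ((polyOf c.2).eval a)) ℱ (𝓝 0) := by
    have := (hen _ (hL 1 0) he).add (tendsto_finsetSum S fun a ha => 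
      hen (L ((polyOf c.1).eval a) ((polyOf c.2).eval a)) (hL _ _) (hq a ha))
    simpa using this
  refine tendsto_of_tendsto_of_tendsto_of_le_of_le' tendsto_const_nhds hlim
    (Eventually.of_forall fun n => zero_le) ?_
  filter_upwards [hle] with n hn
  have hms : ∀ α β : ℂ, Measurable fun ζ => ‖((cubic b).eval ζ * (α - ζ * β))⁻¹‖ₑ := fun α β =>
    ((cubic b).continuous.measurable.mul (by fun_prop)).inv.enorm
  calc _ ≤ ∫⁻ ζ in M, (‖e n‖ₑ * ‖((cubic b).eval ζ * (1 - ζ * 0))⁻¹‖ₑ + ∑ a ∈ S, ‖q a n‖ₑ *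
        ‖((cubic b).eval ζ * ((polyOf c.1).eval a - ζ * (polyOf c.2).eval a))⁻¹‖ₑ) := by
        refine setLIntegral_mono_ae' measurableSet_closedBall.compl ?_
        filter_upwards [h.ae_good hb] with ζ hζ hM
        rw [h.pushF_pullSum hd hg hb.simple hb.ne hζ.1 hζ.2.1 hζ.2.2 (cubic_ne_zero hb hM),
          add_sub_assoc, add_sub_cancel_left]
        refine (enorm_sub_le).trans (add_le_add (hn ζ hM) ((enorm_sum_le _ _).trans_eq ?_))
        refine Finset.sum_congr rfl fun a _ => ?_
        rw [← enorm_mul, eval_fibre_one]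
        congr 1
        simp only [q, div_eq_mul_inv, mul_inv]
        ring
    _ = _ := by
        rw [lintegral_add_left ((hms 1 0).const_mul _), lintegral_const_mul _ (hms 1 0),
          lintegral_finsetSum _ fun a _ => (hms _ _).const_mul _]
        congr 1
        exact Finset.sum_congr rfl fun a _ => lintegral_const_mul _ (hms _ _)

end Recurrent

namespace Recurrent

variable {c : Par d} {ℱ : Filter ℕ} {x : ℕ → ℂ} {R : ℝ} {b : Fin 3 → ℂ}

/-- The points whose `k`-th iterate has not yet entered the spread. -/
def late (c : Par d) (x : ℕ → ℂ) (R : ℝ) (k : ℕ) : Set ℂ :=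
  {z | (sphereMap c)^[k] z ∉ spread c x R}

lemma measurableSet_late (h : Recurrent c ℱ x R) (k : ℕ) : MeasurableSet (late c x R k) :=
  (h.measurableSet_preimage_spread k).compl

lemma late_succ_subset (k : ℕ) : late c x R (k + 1) ⊆ late c x R k := fun z hz hk => by
  refine hz ?_
  rw [Function.iterate_succ_apply']
  exact spread_forward hk

lemma coe_notMem_spread {k : ℕ} {z : ℂ} (hz : z ∈ late c x R k) : (z : Sphere) ∉ spread c x R :=
  fun h => hz (spread_forward_iterate h k)

lemma late_subset (k : ℕ) : late c x R k ⊆ (closedBall (x 0) (R / 2))ᶜ :=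
  fun _ hz hm => coe_notMem_spread hz (coe_mem_spread hm)

lemma aemeasurable_pushF (hd : 2 ≤ d) (h : Recurrent c ℱ x R) (hg : Gen c) (hb : Nodes c x R b)
    (n : ℕ) : AEMeasurable (pushF c fun z => pullSum c x n fun y => cauchyKer b y z)
      (volume.restrict (closedBall (x 0) (R / 2))ᶜ) := by
  refine AEMeasurable.congr (f := fun ζ => pullSum c x n (fun y => cauchyKer b y ζ) +
    (invMul c x n * cauchyKer b (x n) ζ - cauchyKer b (x 0) ζ) -
    ∑ a ∈ (wr c * cubic b).roots.toFinset, (∏ i, (fibre c (b i, 1)).eval a) /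
      ((derivative (wr c * cubic b)).eval a * ((cubic b).eval ζ * (fibre c (ζ, 1)).eval a)) *
        pullSum c x n fun y => (cubic b).eval y / (a - y)) (Measurable.aemeasurable ?_) ?_
  · refine ((measurable_pullSum n).add (((measurable_cauchyKer b _).const_mul _).sub
      (measurable_cauchyKer b _))).sub (Finset.measurable_fun_sum _ fun a _ => ?_)
    simp only [eval_fibre_one]
    exact (measurable_const.div (((cubic b).continuous.measurable.mul
      (by fun_prop)).const_mul _)).mul_const _
  · refine (ae_restrict_iff' measurableSet_closedBall.compl).2 ?_
    filter_upwards [h.ae_good hb] with ζ hζ hM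
    exact (h.pushF_pullSum hd hg hb.simple hb.ne hζ.1 hζ.2.1 hζ.2.2 (cubic_ne_zero hb hM) n).symm

lemma tendsto_lintegral_late (hd : 2 ≤ d) (h : Recurrent c ℱ x R) (hg : Gen c)
    (hb : Nodes c x R b) (k : ℕ) :
    Tendsto (fun n => ∫⁻ ζ in late c x R k \ late c x R (k + 1),
      ‖pullSum c x n fun y => cauchyKer b y ζ‖ₑ) ℱ (𝓝 0) := by
  refine tendsto_of_tendsto_of_tendsto_of_le_of_le tendsto_const_nhds
    (h.tendsto_lintegral_pushF_sub hd hg hb) (fun n => zero_le) fun n => ?_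
  set V : ℂ → ℂ := fun z => pullSum c x n fun y => cauchyKer b y z
  have hV : Measurable V := measurable_pullSum n
  set err := ∫⁻ ζ in (closedBall (x 0) (R / 2))ᶜ, ‖pushF c V ζ - V ζ‖ₑ
  have h1 : ∫⁻ ζ in late c x R k, ‖V ζ‖ₑ ≤ (∫⁻ ζ in late c x R (k + 1), ‖V ζ‖ₑ) + err := by
    calc _ ≤ ∫⁻ ζ in late c x R k, (‖pushF c V ζ‖ₑ + ‖pushF c V ζ - V ζ‖ₑ) := by
          refine lintegral_mono fun ζ => ?_
          have := enorm_sub_le (a := pushF c V ζ) (b := pushF c V ζ - V ζ)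
          rwa [sub_sub_cancel] at this
      _ = (∫⁻ ζ in late c x R k, ‖pushF c V ζ‖ₑ) + ∫⁻ ζ in late c x R k, ‖pushF c V ζ - V ζ‖ₑ :=
          lintegral_add_left' ((h.aemeasurable_pushF hd hg hb n).mono_measure
            (Measure.restrict_mono (late_subset k) le_rfl)).enorm _
      _ ≤ _ := by
          refine add_le_add ((lintegral_pushF_le h.nd hV (h.measurableSet_late k)).trans
            (lintegral_mono_set fun z hz => ?_)) (lintegral_mono_set (late_subset k))
          have := hz.2
          simp only [late, mem_preimage, mem_ofPred_eq] at this ⊢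
          rwa [Function.iterate_succ_apply, sphereMap_coe hz.1.1]
  have hfin : ∫⁻ ζ in late c x R (k + 1), ‖V ζ‖ₑ ≠ ⊤ :=
    ((lintegral_mono_set (late_subset _)).trans_lt (lintegral_pullSum_lt_top hb n)).ne
  have h2 := lintegral_inter_add_sdiff (μ := volume) (fun ζ => ‖V ζ‖ₑ) (late c x R k) (h.measurableSet_late (k + 1))
  rw [inter_eq_self_of_subset_right (late_succ_subset k)] at h2
  rw [← h2] at h1
  exact (ENNReal.add_le_add_iff_left hfin).1 h1

end Recurrent

namespace Recurrent

variable {c : Par d} {ℱ : Filter ℕ} {x : ℕ → ℂ} {R : ℝ} {b : Fin 3 → ℂ}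

lemma pullSum_add (n : ℕ) (φ ψ : ℂ → ℂ) :
    pullSum c x n (fun y => φ y + ψ y) = pullSum c x n φ + pullSum c x n ψ := by
  simp only [pullSum, mul_add, Finset.sum_add_distrib]

lemma tendsto_pullSum_eval (hd : 2 ≤ d) (h : Recurrent c ℱ x R) {N : ℂ[X]} (hN : N.natDegree ≤ 2) :
    Tendsto (fun n => pullSum c x n fun y => N.eval y) ℱ (𝓝 0) := by
  refine (h.variation (N * wr c) ?_).congr fun n => Finset.sum_congr rfl fun j _ => ?_
  · have := natDegree_wr_le hd c
    exact natDegree_mul_le.trans (by lia)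
  · beta_reduce
    rw [eval_mul, mul_div_cancel_right₀ _ (h.wr_ne j)]

lemma tendsto_cauchyKer (hd : 2 ≤ d) (h : Recurrent c ℱ x R) (hg : Gen c)
    (hb : Nodes c x R b) {k : ℕ} {U : Set ℂ} (hU : IsOpen U)
    (hUs : U ⊆ late c x R k \ late c x R (k + 1)) {a : ℂ} (ha : a ∈ U) :
    Tendsto (fun n => pullSum c x n fun y => cauchyKer b y a) ℱ (𝓝 0) := by
  obtain ⟨r, hr, hrU⟩ := Metric.isOpen_iff.1 hU a ha
  have hne : ∀ ζ ∈ U, ∀ j, ζ - x j ≠ 0 := fun ζ hζ j h0 =>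
    coe_notMem_spread (hUs hζ).1 (sub_eq_zero.1 h0 ▸ h.orbit_mem_spread j)
  have hB : ∀ ζ ∈ U, (cubic b).eval ζ ≠ 0 := fun ζ hζ => cubic_ne_zero hb (late_subset k (hUs hζ).1)
  have hdiff : ∀ n, DifferentiableOn ℂ (fun ζ => pullSum c x n fun y => cauchyKer b y ζ)
      (ball a r) := fun n => DifferentiableOn.fun_sum fun j _ => by
    refine DifferentiableOn.const_mul (fun ζ hζ => DifferentiableAt.differentiableWithinAt ?_) _
    exact (differentiableAt_const _).div ((differentiableAt_id.sub_const _).mul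
      (cubic b).differentiable.differentiableAt) (mul_ne_zero (hne ζ (hrU hζ) j) (hB ζ (hrU hζ)))
  have hle := fun n => (enorm_mul_le_lintegral_ball (measurable_pullSum (b := b) n)
    (hdiff n)).trans (lintegral_mono_set (hrU.trans hUs))
  set K := ENNReal.ofReal (r / 2) * (ENNReal.ofReal (r / 2) * ENNReal.ofReal (2 * Real.pi)) with hK
  have hK0 : K ≠ 0 := by
    have : 0 < r / 2 := by positivity
    have : 0 < 2 * Real.pi := by positivity
    simp only [hK, Ne, mul_eq_zero, ENNReal.ofReal_eq_zero, not_or, not_le]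
    tauto
  have hKt : K ≠ ⊤ := by simp [hK, ENNReal.mul_eq_top]
  have ht := ENNReal.Tendsto.const_mul (h.tendsto_lintegral_late hd hg hb k)
    (.inr (ENNReal.inv_ne_top.2 hK0))
  rw [mul_zero] at ht
  rw [tendsto_zero_iff_enorm_tendsto_zero]
  refine tendsto_of_tendsto_of_tendsto_of_le_of_le tendsto_const_nhds ht (fun n => zero_le)
    fun n => ?_
  rw [mul_comm, ← div_eq_mul_inv, ENNReal.le_div_iff_mul_le (.inl hK0) (.inl hKt)]
  refine le_trans (le_of_eq ?_) (hle n)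
  rw [hK]
  ring

/-- Cauchy kernels with pole in the interior of a layer of the basin sum to zero in the limit. -/
lemma tendsto_pullSum_inv (hd : 2 ≤ d) (h : Recurrent c ℱ x R) (hg : Gen c)
    {k : ℕ} {U : Set ℂ} (hU : IsOpen U)
    (hUs : U ⊆ late c x R k \ late c x R (k + 1)) {a : ℂ} (ha : a ∈ U) :
    Tendsto (fun n => pullSum c x n fun y => (y - a)⁻¹) ℱ (𝓝 0) := by
  obtain ⟨b, hb⟩ := h.exists_nodes hd hg
  have hB : (cubic b).eval a ≠ 0 := cubic_ne_zero hb (late_subset k (hUs ha).1)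
  set Q := cubic b /ₘ (X - C a) with hQ
  have hQdeg : Q.natDegree ≤ 2 := by
    rw [hQ, natDegree_divByMonic _ (monic_X_sub_C a), natDegree_X_sub_C, natDegree_cubic]
  have hQe : ∀ y, (cubic b).eval y = (cubic b).eval a + (y - a) * Q.eval y := fun y => by
    conv_lhs => rw [← modByMonic_add_div (cubic b) (X - C a)]
    rw [modByMonic_X_sub_C_eq_C_eval]
    simp [hQ]
  have := ((h.tendsto_cauchyKer hd hg hb hU hUs ha).const_mul (-1)).add
    ((h.tendsto_pullSum_eval hd hQdeg).const_mul (-((cubic b).eval a)⁻¹))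
  rw [mul_zero, mul_zero, add_zero] at this
  refine this.congr fun n => ?_
  rw [← pullSum_smul, ← pullSum_smul, ← pullSum_add]
  refine Finset.sum_congr rfl fun j _ => ?_
  congr 1
  have h1 : x j - a ≠ 0 := fun h0 =>
    coe_notMem_spread (hUs ha).1 (sub_eq_zero.1 h0 ▸ h.orbit_mem_spread j)
  have h2 : a - x j ≠ 0 := by rwa [← neg_ne_zero, neg_sub]
  beta_reduce
  rw [cauchyKer, hQe (x j)]
  field_simp
  ring

end Recurrent

end

section

open Metric

variable {d : ℕ}

namespace SimpleRoots

lemma exists_partialFractions {D N : ℂ[X]} {k : ℕ} (h : SimpleRoots D) (hD : 1 ≤ D.natDegree)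
    (hN : N.natDegree ≤ D.natDegree + k) : ∃ (q : ℂ[X]) (r : ℂ → ℂ), q.natDegree ≤ k ∧
      ∀ y, D.eval y ≠ 0 →
        N.eval y / D.eval y = q.eval y + ∑ a ∈ D.roots.toFinset, r a * (y - a)⁻¹ := by
  have hD0 := h.ne_zero
  have hl : D.leadingCoeff ≠ 0 := leadingCoeff_ne_zero.2 hD0
  have hm := monic_mul_leadingCoeff_inv hD0
  set E := D * C D.leadingCoeff⁻¹ with hE
  have hdeg : E.natDegree = D.natDegree := natDegree_mul_leadingCoeff_inv D hD0
  set S := N %ₘ E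
  have hS : S.natDegree < D.natDegree := by
    rw [← hdeg]
    exact natDegree_modByMonic_lt N hm fun h1 => by rw [h1, natDegree_one] at hdeg; lia
  refine ⟨N /ₘ E * C D.leadingCoeff⁻¹, fun a => S.eval a / (derivative D).eval a, ?_,
    fun y hy => ?_⟩
  · refine (natDegree_mul_C_le _ _).trans ?_
    rw [natDegree_divByMonic _ hm, hdeg]
    lia
  have hy' : ∀ a, D.eval a = 0 → (X - C y).eval a ≠ 0 := fun a ha h0 => by
    rw [eval_sub, eval_X, eval_C, sub_eq_zero] at h0
    exact hy (h0 ▸ ha)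
  have h1 := (h.mul (X_sub_C y) hy').sum_residues (N := S) (by
    rw [natDegree_mul hD0 (X_sub_C_ne_zero y), natDegree_X_sub_C]
    lia)
  rw [h.sum_residues_mul (X_sub_C y) hy'] at h1
  simp only [roots_X_sub_C, Multiset.toFinset_singleton, Finset.sum_singleton, derivative_sub,
    derivative_X, derivative_C, sub_zero, eval_one, one_mul, eval_sub, eval_X, eval_C] at h1
  have h2 : N.eval y = S.eval y + D.eval y * D.leadingCoeff⁻¹ * (N /ₘ E).eval y := by
    conv_lhs => rw [← modByMonic_add_div N E]
    simp [S, hE]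
  have h3 : ∑ a ∈ D.roots.toFinset, S.eval a / (derivative D).eval a * (y - a)⁻¹ =
      -∑ a ∈ D.roots.toFinset, S.eval a / ((derivative D).eval a * (a - y)) := by
    rw [← Finset.sum_neg_distrib]
    refine Finset.sum_congr rfl fun a _ => ?_
    rw [← neg_sub a y, inv_neg, ← div_div, div_eq_mul_inv _ (a - y)]
    ring
  rw [h3, ← eq_neg_of_add_eq_zero_right h1, h2, eval_mul, eval_C]
  field_simp
  ring

end SimpleRoots

/-- Homogeneous coordinates of the `n`-th iterate, as polynomials in the affine coordinate. -/
def iterPoly (n : ℕ) (c : Par d) : ℂ[X] × ℂ[X] :=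
  (hlift ((fun i => C (c.1 i)), (fun i => C (c.2 i))))^[n]
    (C (0, 1).1 + C (1, 0).1 * X, C (0, 1).2 + C (1, 0).2 * X)

lemma eval_iterPoly (n : ℕ) (c : Par d) (w : ℂ) :
    (hlift c)^[n] (w, 1) = ((iterPoly n c).1.eval w, (iterPoly n c).2.eval w) := by
  have := map_iter (evalRingHom w) ((fun i => C (c.1 i)), (fun i => C (c.2 i))) n
    (C (0, 1).1 + C (1, 0).1 * X, C (0, 1).2 + C (1, 0).2 * X)
  simp only [coe_evalRingHom, Prod.map] at this
  rw [iterPoly, this]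
  simp

/-- The polynomial whose roots are the solutions of `f^n = p`. -/
def iterFibre (n : ℕ) (c : Par d) (p : ℂ) : ℂ[X] := (iterPoly n c).1 - C p * (iterPoly n c).2

lemma hasLead_iterFibre (n : ℕ) (c : Par d) (p : ℂ) : HasLead (d ^ n) (iterFibre n c p)
    (((hlift c)^[n] (1, 0)).1 - p * ((hlift c)^[n] (1, 0)).2) := by
  have := hasLead_iter n c (0, 1) (1, 0)
  exact this.1.sub (this.2.C_mul p)

lemma eq_prj_iff {Z : ℂ × ℂ} (hZ : Z ≠ 0) (p : ℂ) : prj Z = p ↔ Z.1 - p * Z.2 = 0 := by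
  rw [← prj_one p, prj_eq_prj_iff hZ (by simp), br]
  ring_nf

lemma eval_iterFibre_eq_zero {c : Par d} (hc : ND c) (n : ℕ) (p w : ℂ) :
    (iterFibre n c p).eval w = 0 ↔ (sphereMap c)^[n] w = p := by
  rw [← prj_one w, iterate_sphereMap_prj hc n (by simp),
    eq_prj_iff (hc.iter_ne_zero n (by simp)), eval_iterPoly]
  simp [iterFibre]

lemma IsOrbit.iterPoly_ne {c : Par d} (hc : ND c) {x : ℕ → ℂ} (h : IsOrbit c x) (k n : ℕ) :
    (iterPoly n c).2.eval (x k) ≠ 0 ∧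
      (iterPoly n c).1.eval (x k) = x (k + n) * (iterPoly n c).2.eval (x k) := by
  have := h.quot_eq hc (Z := (x k, 1)) (by simp) (k := k) (by simp) n
  rw [eval_iterPoly, quot] at this
  exact ⟨this.1, (div_eq_iff this.1).1 this.2⟩

lemma IsOrbit.derivative_iterPoly {c : Par d} (hc : ND c) {x : ℕ → ℂ} (h : IsOrbit c x) (k n : ℕ) :
    (derivative (iterPoly n c).1).eval (x k) - x (k + n) * (derivative (iterPoly n c).2).eval (x k) =
      (iterPoly n c).2.eval (x k) * ∏ i ∈ Finset.range n, df c (x (k + i)) := by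
  have hne := h.iterPoly_ne hc k n
  have h1 := h.hasDerivAt hc k n
  simp only [eval_iterPoly, quot] at h1
  have h2 := ((iterPoly n c).1.hasDerivAt (x k)).fun_div ((iterPoly n c).2.hasDerivAt (x k)) hne.1
  have h3 := h2.unique h1
  have := hne.1
  rw [← h3, hne.2]
  field_simp

/-- A fibre of an iterate is simple when all the orbits starting in it are generic. -/
lemma simpleRoots_iterFibre {c : Par d} (hc : ND c) {n : ℕ} {p : ℂ}
    (hp : ∀ w : ℂ, (sphereMap c)^[n] w = p → ∀ j, (sphereMap c)^[j] w ∉ badSet c) :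
    SimpleRoots (iterFibre n c p) := by
  intro w hw
  have hw' := (eval_iterFibre_eq_zero hc n p w).1 hw
  obtain ⟨x, rfl, ho, hwr, -⟩ := exists_isOrbit (hp w hw')
  rw [ho.iterate, OnePoint.coe_eq_coe] at hw'
  have h1 := ho.derivative_iterPoly hc 0 n
  rw [hw'] at h1
  simp only [iterFibre, derivative_sub, derivative_C_mul, eval_sub, eval_mul, eval_C]
  rw [h1]
  exact mul_ne_zero (ho.iterPoly_ne hc 0 n).1 (Finset.prod_ne_zero_iff.2 fun i _ =>
    df_ne_zero (hwr _) (ho.eval_ne_zero _).1)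

namespace Recurrent

variable {c : Par d} {ℱ : Filter ℕ} {x : ℕ → ℂ} {R : ℝ}

lemma tendsto_pullSum_finsetSum {ι : Type*} (s : Finset ι) {φ : ι → ℂ → ℂ}
    (h : ∀ i ∈ s, Tendsto (fun n => pullSum c x n (φ i)) ℱ (𝓝 0)) :
    Tendsto (fun n => pullSum c x n fun y => ∑ i ∈ s, φ i y) ℱ (𝓝 0) := by
  have := tendsto_finsetSum s h
  rw [Finset.sum_const_zero] at this
  refine this.congr fun n => ?_
  simp only [pullSum, Finset.mul_sum]
  exact Finset.sum_comm

/-- The values of the vector field that interpolates between the identity and `f^n`. -/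
def displacement (n : ℕ) (c : Par d) (p y : ℂ) : ℂ :=
  ((X - C p) * ((iterPoly n c).1 - X * (iterPoly n c).2)).eval y / (iterFibre n c p).eval y

lemma exists_generic_point (hd : 2 ≤ d) (h : Recurrent c ℱ x R) (hg : Gen c) {W : Set ℂ}
    (hW : IsOpen W) (hne : W.Nonempty) (n : ℕ) :
    ∃ p ∈ W, (∀ w : ℂ, (sphereMap c)^[n] w = p → ∀ j, (sphereMap c)^[j] w ∉ badSet c) ∧
      (sphereMap c)^[n] ∞ ≠ p := by
  have hcount : (⋃ j, (sphereMap c)^[n] '' ((sphereMap c)^[j] ⁻¹' badSet c)).Countable :=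
    countable_iUnion fun j => (countable_preimage_iterate (by lia) h.nd
      (countable_badSet (by lia) h.nd (hg.wr_ne_zero hd)) j).image _
  have hc' := hcount.preimage_of_injOn (f := fun z : ℂ => (z : Sphere))
    OnePoint.coe_injective.injOn
  obtain ⟨p, hpW, hp⟩ := (hc'.dense_compl ℂ).inter_open_nonempty W hW hne
  refine ⟨p, hpW, fun w hw j hj => hp (mem_iUnion.2 ⟨j, w, hj, hw⟩), fun h0 =>
    hp (mem_iUnion.2 ⟨0, ∞, .inr ?_, h0⟩)⟩
  simp

lemma tendsto_pullSum_displacement (hd : 2 ≤ d) (h : Recurrent c ℱ x R) (hg : Gen c) (n : ℕ) :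
    ∃ p : ℂ, (p : Sphere) ∉ spread c x R ∧
      Tendsto (fun m => pullSum c x m (displacement n c p)) ℱ (𝓝 0) := by
  obtain ⟨W, hWo, hWne, hW⟩ := h.exists_open_preimage hd
  obtain ⟨p, hpW, hgen, hinf⟩ := h.exists_generic_point hd hg hWo hWne n
  have hps := (hW p hpW).1
  refine ⟨p, hps, ?_⟩
  have hS := simpleRoots_iterFibre h.nd hgen
  have hlead := hasLead_iterFibre n c p
  have hdeg : (iterFibre n c p).natDegree = d ^ n := by
    refine natDegree_eq_of_le_of_coeff_ne_zero hlead.1 ?_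
    rw [hlead.2]
    intro h0
    refine hinf ?_
    rw [← prj_zero_right 1, iterate_sphereMap_prj h.nd n (by simp)]
    exact (eq_prj_iff (h.nd.iter_ne_zero n (by simp)) p).2 h0
  have hit := hasLead_iter n c (0, 1) (1, 0)
  obtain ⟨q, r, hq, hqr⟩ := hS.exists_partialFractions (k := 2)
    (N := (X - C p) * ((iterPoly n c).1 - X * (iterPoly n c).2))
    (by rw [hdeg]; exact Nat.one_le_pow _ _ (by lia)) (by
      rw [hdeg]
      refine natDegree_mul_le.trans ?_
      rw [natDegree_X_sub_C]
      have h1 : ((iterPoly n c).1 - X * (iterPoly n c).2).natDegree ≤ d ^ n + 1 := by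
        refine (natDegree_sub_le _ _).trans (max_le (hit.1.1.trans (by lia))
          (natDegree_mul_le.trans ?_))
        rw [natDegree_X]
        have := hit.2.1
        simp only [iterPoly]
        lia
      lia)
  have hU : IsOpen {z : ℂ | (sphereMap c)^[n] z ∈ (fun z : ℂ => (z : Sphere)) '' W} :=
    (OnePoint.isOpenEmbedding_coe.isOpenMap W hWo).preimage
      ((h.nd.continuous_iterate n).comp OnePoint.continuous_coe)
  have hUs : {z : ℂ | (sphereMap c)^[n] z ∈ (fun z : ℂ => (z : Sphere)) '' W} ⊆
      late c x R n \ late c x R (n + 1) := by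
    rintro z ⟨w, hw, hwz⟩
    beta_reduce at hwz
    refine ⟨fun hz => (hW w hw).1 (by rw [hwz]; exact hz), fun hz => hz ?_⟩
    rw [Function.iterate_succ_apply', ← hwz]
    exact (hW w hw).2
  have hpole : ∀ a ∈ (iterFibre n c p).roots.toFinset,
      Tendsto (fun m => pullSum c x m fun y => r a * (y - a)⁻¹) ℱ (𝓝 0) := fun a ha => by
    have h0 := (mem_roots'.1 (Multiset.mem_toFinset.1 ha)).2
    have := (h.tendsto_pullSum_inv hd hg hU hUs (a := a)
      ⟨p, hpW, ((eval_iterFibre_eq_zero h.nd n p a).1 h0).symm⟩).const_mul (r a)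
    rw [mul_zero] at this
    exact this.congr fun m => (pullSum_smul c x m _ _).symm
  have := (h.tendsto_pullSum_eval hd hq).add (tendsto_pullSum_finsetSum _ hpole)
  rw [add_zero] at this
  refine this.congr fun m => ?_
  rw [← pullSum_add]
  refine Finset.sum_congr rfl fun j _ => ?_
  beta_reduce
  rw [displacement, hqr]
  intro h0
  refine hps ?_
  rw [← (eval_iterFibre_eq_zero h.nd n p _).1 h0]
  exact spread_forward_iterate (h.orbit_mem_spread j) n

lemma invMul_mul_displacement (h : Recurrent c ℱ x R) {κ : ℝ}
    (hκ : ∀ (a : ℂ) (r : ℝ) (g : ℂ → ℂ), 0 < r → DifferentiableOn ℂ g (ball a r) →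
      InjOn g (ball a r) → deriv g a ≠ 0 → ∀ z, ‖z - a‖ ≤ κ * r →
      ‖g z - g a - deriv g a * (z - a)‖ ≤ 1 / 2 * (‖deriv g a‖ * ‖z - a‖))
    {n : ℕ} (hn : ‖x n - x 0‖ ≤ κ * (R / 2)) {p : ℂ} (hp : (p : Sphere) ∉ spread c x R) (j : ℕ) :
    ‖invMul c x j * displacement n c p (x j) - (x n - x 0)‖ ≤ 1 / 2 * ‖x n - x 0‖ := by
  set g : ℂ → ℂ := fun u => (iterPoly j c).2.eval u / (iterFibre j c p).eval u with hgdef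
  have hne : ∀ u ∈ ball (x 0) (R / 2), (iterFibre j c p).eval u ≠ 0 := fun u hu h0 => by
    refine hp ?_
    rw [← (eval_iterFibre_eq_zero h.nd j p u).1 h0]
    exact spread_forward_iterate (coe_mem_spread (ball_subset_closedBall hu)) j
  have hd : ∀ u ∈ ball (x 0) (R / 2), HasDerivAt g _ u := fun u hu =>
    ((iterPoly j c).2.hasDerivAt u).fun_div ((iterFibre j c p).hasDerivAt u) (hne u hu)
  have hinj : InjOn g (ball (x 0) (R / 2)) := fun u hu v hv huv => by
    have h1 : br ((hlift c)^[j] (u, 1)) ((hlift c)^[j] (v, 1)) = 0 := by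
      rw [eval_iterPoly, eval_iterPoly, br]
      have := (div_eq_div_iff (hne u hu) (hne v hv)).1 huv
      simp only [iterFibre, eval_sub, eval_mul, eval_C] at this
      linear_combination -this
    rw [← prj_eq_prj_iff (h.nd.iter_ne_zero j (by simp)) (h.nd.iter_ne_zero j (by simp)),
      ← iterate_sphereMap_prj h.nd j (by simp), ← iterate_sphereMap_prj h.nd j (by simp),
      prj_one, prj_one] at h1
    exact OnePoint.coe_injective (h.injOn_iterate j (coe_mem_spread (ball_subset_closedBall hu))
      (coe_mem_spread (ball_subset_closedBall hv)) h1)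
  have hR : 0 < R / 2 := half_pos h.pos
  have h0 := hd _ (mem_ball_self hR)
  have hxp : ∀ k, x k - p ≠ 0 := fun k hk => hp (sub_eq_zero.1 hk ▸ h.orbit_mem_spread k)
  have hg : ∀ k, g (x k) = (x (k + j) - p)⁻¹ := fun k => by
    have h1 := h.orbit.iterPoly_ne h.nd k j
    have h2 := hxp (k + j)
    have h3 := h1.1
    simp only [hgdef, iterFibre, eval_sub, eval_mul, eval_C, h1.2]
    rw [← sub_mul]
    field_simp
  set m := ∏ i ∈ Finset.range j, df c (x i) with hm
  have hm0 : m ≠ 0 := Finset.prod_ne_zero_iff.2 fun i _ =>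
    df_ne_zero (h.wr_ne _) (h.orbit.eval_ne_zero _).1
  have hder : deriv g (x 0) = -m / (x j - p) ^ 2 := by
    have h1 := h.orbit.iterPoly_ne h.nd 0 j
    have h2 := h.orbit.derivative_iterPoly h.nd 0 j
    simp only [zero_add] at h1 h2
    rw [← hm] at h2
    have h3 := hxp j
    have h4 := h1.1
    rw [h0.deriv]
    simp only [iterFibre, eval_sub, eval_mul, eval_C, derivative_sub, derivative_C_mul, h1.2]
    rw [← sub_mul, div_eq_div_iff (by positivity) (by positivity)]
    linear_combination (-((iterPoly j c).2.eval (x 0)) * (x j - p) ^ 2) * h2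
  have hdisp : displacement n c p (x j) = (x j - p) * (x (n + j) - x j) / (x (n + j) - p) := by
    have h1 := h.orbit.iterPoly_ne h.nd j n
    rw [add_comm j n] at h1
    have h3 := hxp (n + j)
    have h4 := h1.1
    simp only [displacement, iterFibre, eval_sub, eval_mul, eval_C, eval_X, h1.2]
    rw [← sub_mul, ← sub_mul]
    field_simp
  have hder0 : deriv g (x 0) ≠ 0 := by
    have := hxp j
    rw [hder]
    exact div_ne_zero (neg_ne_zero.2 hm0) (pow_ne_zero _ this)
  have key := hκ _ _ g hR (fun u hu => (hd u hu).differentiableAt.differentiableWithinAt) hinj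
    hder0 _ hn
  have hid : g (x n) - g (x 0) - deriv g (x 0) * (x n - x 0) =
      deriv g (x 0) * (invMul c x j * displacement n c p (x j) - (x n - x 0)) := by
    have h1 := hxp j
    have h2 := hxp (n + j)
    rw [hg, hg, hder, hdisp, invMul, ← hm, zero_add]
    field_simp
    ring
  rw [hid, norm_mul, mul_left_comm] at key
  exact le_of_mul_le_mul_left key (norm_pos_iff.2 hder0)

theorem false (hd : 2 ≤ d) (h : Recurrent c ℱ x R) (hg : Gen c) : False := by
  obtain ⟨κ, hκ0, -, hκ⟩ := koebe_distortion
  have := h.neBot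
  have hR := h.pos
  obtain ⟨n, hn, hn1⟩ := ((h.tendsto_orbit.eventually (closedBall_mem_nhds _
    (show 0 < κ * (R / 2) by positivity))).and (h.le_atTop (eventually_ge_atTop 1))).exists
  obtain ⟨p, hp, ht⟩ := h.tendsto_pullSum_displacement hd hg n
  have hle := fun j => h.invMul_mul_displacement hκ (mem_closedBall_iff_norm.1 hn) hp j
  have hδ : 0 < ‖x n - x 0‖ := norm_pos_iff.2 (sub_ne_zero.2 (h.orbit_zero_ne hn1))
  obtain ⟨m, hm, hm1⟩ := ((ht.eventually (ball_mem_nhds 0 (half_pos hδ))).and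
    (h.le_atTop (eventually_ge_atTop 1))).exists
  have h1 : ‖pullSum c x m (displacement n c p)‖ < ‖x n - x 0‖ / 2 := mem_ball_zero_iff.1 hm
  have h2 : ‖pullSum c x m (displacement n c p) - m * (x n - x 0)‖ ≤
      m * (1 / 2 * ‖x n - x 0‖) := by
    have e : pullSum c x m (displacement n c p) - m * (x n - x 0) =
        ∑ j ∈ Finset.range m, (invMul c x j * displacement n c p (x j) - (x n - x 0)) := by
      rw [Finset.sum_sub_distrib, pullSum, Finset.sum_const, Finset.card_range, nsmul_eq_mul]
    rw [e]
    refine (norm_sum_le_of_le _ fun j _ => hle j).trans_eq ?_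
    simp
  have h3 := norm_sub_norm_le ((m : ℂ) * (x n - x 0)) (pullSum c x m (displacement n c p))
  rw [norm_sub_rev, norm_mul, Complex.norm_natCast] at h3
  have h4 : (1 : ℝ) ≤ m := by exact_mod_cast hm1
  nlinarith

end Recurrent

end

section

variable {d : ℕ}

/-- Topological conjugacy between the restrictions of `f` to `A` and of `g` to `B`. -/
def ConjOn (f g : Sphere → Sphere) (A B : Set Sphere) : Prop :=
  ∃ h hinv : Sphere → Sphere, ContinuousOn h A ∧ h '' A = B ∧ ContinuousOn hinv B ∧
    (∀ x ∈ A, hinv (h x) = x) ∧ (∀ y ∈ B, h (hinv y) = y) ∧ ∀ x ∈ A, h (f x) = g (h x)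

namespace ConjOn

variable {f g k : Sphere → Sphere} {A B D : Set Sphere}

lemma symm (H : ConjOn f g A B) (hf : MapsTo f A A) : ConjOn g f B A := by
  obtain ⟨h, hinv, hc, rfl, hic, hl, hr, hfg⟩ := H
  refine ⟨hinv, h, hic, ?_, hc, hr, hl, ?_⟩
  · rw [image_image]
    exact (image_congr hl).trans (image_id' A)
  · rintro _ ⟨x, hx, rfl⟩
    rw [← hfg x hx, hl x hx, hl _ (hf hx)]

lemma trans (H : ConjOn f g A B) (K : ConjOn g k B D) : ConjOn f k A D := by
  obtain ⟨h, hinv, hc, rfl, hic, hl, hr, hfg⟩ := H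
  obtain ⟨l, linv, lc, rfl, lic, ll, lr, lfg⟩ := K
  have hm : MapsTo h A (h '' A) := mapsTo_image h A
  refine ⟨l ∘ h, hinv ∘ linv, lc.comp hc hm, image_comp l h A, hic.comp lic ?_, fun x hx => ?_,
    ?_, fun x hx => ?_⟩
  · rintro _ ⟨y, hy, rfl⟩
    rwa [ll y hy]
  · simp only [Function.comp_apply]
    rw [ll _ (hm hx), hl x hx]
  · rintro _ ⟨y, hy, rfl⟩
    simp only [Function.comp_apply]
    rw [ll y hy, hr y hy]
  · simp only [Function.comp_apply]
    rw [hfg x hx, lfg _ (hm hx)]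

end ConjOn

lemma mapsTo_nonWandering {f : Sphere → Sphere} (hf : Continuous f) :
    MapsTo f (nonWandering f) (nonWandering f) := by
  intro x hx U hU
  obtain ⟨n, hn, y, ⟨z, hz, hzy⟩, hy⟩ := hx _ (hf.continuousAt hU)
  refine ⟨n, hn, f y, ⟨f z, hz, ?_⟩, hy⟩
  rw [← hzy, ← Function.iterate_succ_apply, Function.iterate_succ_apply']

lemma isClosed_nonWandering (f : Sphere → Sphere) : IsClosed (nonWandering f) := by
  refine isClosed_of_closure_subset fun x hx U hU => ?_
  obtain ⟨O, hOU, hO, hxO⟩ := _root_.mem_nhds_iff.1 hU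
  obtain ⟨y, hyO, hy⟩ := _root_.mem_closure_iff.1 hx O hO hxO
  obtain ⟨n, hn, z, hz, hz'⟩ := hy O (hO.mem_nhds hyO)
  exact ⟨n, hn, z, image_mono hOU hz, hOU hz'⟩

lemma closure_periodicPts_subset (f : Sphere → Sphere) :
    closure (Function.periodicPts f) ⊆ nonWandering f := by
  refine closure_minimal ?_ (isClosed_nonWandering f)
  rintro x ⟨n, hn, hx⟩ U hU
  exact ⟨n, hn, x, ⟨x, mem_of_mem_nhds hU, hx⟩, mem_of_mem_nhds hU⟩

/-- Where all periodic points move holomorphically, they are dense in the non-wandering set. -/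
lemma nonWandering_eq (hd : 2 ≤ d) {V : Set (Par d)} (hV : IsOpen V)
    (h : ∀ c ∈ V, ND c ∧ Gen c ∧ ∀ n, 1 ≤ n → NP n c) {c : Par d} (hc : c ∈ V) :
    nonWandering (sphereMap c) = closure (Function.periodicPts (sphereMap c)) := by
  refine Subset.antisymm (fun x hx => ?_) (closure_periodicPts_subset _)
  by_contra hper
  obtain ⟨ℱ, y, R, hr⟩ := exists_recurrent hd hV (fun c hc => ⟨(h c hc).1, (h c hc).2.2⟩) hc
    ((h c hc).2.1.wr_ne_zero hd) hx hper
  exact hr.false hd (h c hc).2.1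

lemma omegaStable_of_mem (hd : 2 ≤ d) {V : Set (Par d)} (hV : IsOpen V)
    (h : ∀ c ∈ V, ND c ∧ Gen c ∧ ∀ n, 1 ≤ n → NP n c) {F : RatSpace d} (hF : F.1 ∈ V) :
    OmegaStable F := by
  obtain ⟨ε, hε, hframe⟩ := exists_frame hd hV (fun c hc => ⟨(h c hc).1, (h c hc).2.2⟩) hF
  refine ⟨Subtype.val ⁻¹' (V ∩ Metric.ball F.1 ε), continuous_subtype_val.continuousAt
    (inter_mem (hV.mem_nhds hF) (Metric.ball_mem_nhds _ hε)), fun G hG => ?_⟩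
  obtain ⟨A, B, hAB⟩ := hframe (G.1 - F.1) (by simpa [dist_eq_norm] using hG.2)
  have := hAB.exists_conj
  simp only [zero_smul, add_zero, one_smul, add_sub_cancel] at this
  rw [← nonWandering_eq hd hV h hF, ← nonWandering_eq hd hV h hG.1] at this
  exact this

end

/-- **Mañé–Sad–Sullivan, Lyubich.**  For every `d ≥ 2`, the set of Ω-stable rational
maps of degree `d` of the Riemann sphere is open and dense in the space of rational
maps of degree `d`. -/
theorem omega_stable_rational_maps_open_dense (d : ℕ) (hd : 2 ≤ d) :
    IsOpen {F : RatSpace d | OmegaStable F} ∧ Dense {F : RatSpace d | OmegaStable F} := by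
  constructor
  · rw [isOpen_iff_mem_nhds]
    rintro F ⟨U, hU, hconj⟩
    filter_upwards [eventually_mem_nhds_iff.2 hU] with F' hF'
    have hcont : Continuous F.toFun := ((nd_iff hd F.1).2 F.2).continuous
    exact ⟨U, hF', fun G hG => (ConjOn.symm (hconj F' (mem_of_mem_nhds hF'))
      (mapsTo_nonWandering hcont)).trans (hconj G hG)⟩
  · intro F
    rw [_root_.mem_closure_iff]
    intro O hO hFO
    obtain ⟨W, hW, rfl⟩ := isOpen_induced_iff.1 hO
    obtain ⟨V, hVW, hV, ⟨c, hc⟩, h⟩ := exists_open_np hd hW hFO ((nd_iff hd F.1).2 F.2)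
    exact ⟨⟨c, (nd_iff hd c).1 (h c hc).1⟩, hVW hc, omegaStable_of_mem hd hV h hc⟩
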